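/- For every positive integer d, the normalized moment (1/((p² - p)·p^d)) · Σ a_p(A,B)^{2d}, where the sum is over all pairs (A,B) ∈ (ℤ/pℤ)² with 4A³ + 27B² ≠ 0, tends to the Catalan number (2d)!/(d!·(d+1)!) as p tends to infinity through primes. -/

import Mathlib

section

namespace Birch

open UpperHalfPlane ModularForm ModularGroup MatrixGroups Complex Manifold

/-- `c` is the power series expansion of `f` in the parameter `exp (2πiτ/N)`. -/
def QRep (N : ℕ) (f : ℍ → ℂ) (c : PowerSeries ℂ) : Prop :=
  ∀ τ : ℍ, HasSum (fun n => PowerSeries.coeff n c * Function.Periodic.qParam (N : ℝ) τ ^ n) (f τ)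

namespace QRep

variable {N : ℕ} {f g : ℍ → ℂ} {c d : PowerSeries ℂ}

theorem add (hf : QRep N f c) (hg : QRep N g d) : QRep N (fun τ => f τ + g τ) (c + d) := by
  intro τ
  simpa [add_mul] using (hf τ).add (hg τ)

theorem sub (hf : QRep N f c) (hg : QRep N g d) : QRep N (fun τ => f τ - g τ) (c - d) := by
  intro τ
  simpa [sub_mul] using (hf τ).sub (hg τ)

theorem smul (a : ℂ) (hf : QRep N f c) : QRep N (fun τ => a * f τ) (PowerSeries.C a * c) := by
  intro τ
  simpa [mul_assoc] using (hf τ).mul_left a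

theorem const (a : ℂ) : QRep N (fun _ => a) (PowerSeries.C a) := by
  intro τ
  have := hasSum_ite_eq (0 : ℕ) a
  refine this.congr_fun ?_
  intro n
  rcases eq_or_ne n 0 with rfl | hn
  · simp
  · simp [PowerSeries.coeff_C, hn]

theorem mul (hf : QRep N f c) (hg : QRep N g d) : QRep N (fun τ => f τ * g τ) (c * d) := by
  intro τ
  have h1 := (hf τ).summable.norm
  have h2 := (hg τ).summable.norm
  have h3 := summable_norm_sum_mul_antidiagonal_of_summable_norm h1 h2
  have h4 := tsum_mul_tsum_eq_tsum_sum_antidiagonal_of_summable_norm h1 h2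
  rw [(hf τ).tsum_eq, (hg τ).tsum_eq] at h4
  change HasSum _ (f τ * g τ)
  rw [h4]
  refine h3.of_norm.hasSum.congr_fun ?_
  intro n
  rw [PowerSeries.coeff_mul, Finset.sum_mul]
  refine Finset.sum_congr rfl fun x hx => ?_
  rw [← Finset.HasAntidiagonal.mem_antidiagonal.mp hx, pow_add]
  ring

theorem pow (hf : QRep N f c) (n : ℕ) : QRep N (fun τ => f τ ^ n) (c ^ n) := by
  induction n with
  | zero => simpa using const (N := N) 1
  | succ n ih => simpa [pow_succ] using ih.mul hf

theorem prod {ι : Type*} (s : Finset ι) {u : ι → ℍ → ℂ} {v : ι → PowerSeries ℂ}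
    (h : ∀ i ∈ s, QRep N (u i) (v i)) : QRep N (fun τ => ∏ i ∈ s, u i τ) (∏ i ∈ s, v i) := by
  classical
  induction s using Finset.induction_on with
  | empty => simpa using const (N := N) 1
  | insert a s ha ih =>
    simp only [Finset.prod_insert ha]
    exact (h a (by simp)).mul (ih fun i hi => h i (by simp [hi]))

theorem unique (hN : 0 < N) (hc : QRep N f c) (hd : QRep N f d) : c = d := by
  have hN' : (0 : ℝ) < N := by exact_mod_cast hN
  have key : ∀ {c : PowerSeries ℂ}, QRep N (fun _ => (0 : ℂ)) c → c = 0 := by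
    intro c hc
    have hper : (N : ℝ) ∈ (𝒮ℒ).strictPeriods := by
      simpa using nsmul_mem one_mem_strictPeriods_SL N
    ext n
    have h := ModularFormClass.qExpansion_coeff_unique (Γ := 𝒮ℒ) (k := 0)
      (f := (0 : ModularForm 𝒮ℒ 0)) hN' hper (c := fun n => PowerSeries.coeff n c)
      (fun τ => by simpa using hc τ) n
    rw [h, FunLike.coe_zero, UpperHalfPlane.qExpansion_zero]
  have := key (c := c - d) (by simpa using hc.sub hd)
  exact sub_eq_zero.mp this

end QRep

/-- Modular forms of level one and weight `k`, as plain functions. -/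
structure MF (k : ℕ) (f : ℍ → ℂ) : Prop where
  holo : MDiff f
  T_inv : ∀ τ : ℍ, f ((1 : ℝ) +ᵥ τ) = f τ
  S_inv : ∀ τ : ℍ, f (S • τ) = (τ : ℂ) ^ k * f τ
  rep : ∃ c, QRep 1 f c

theorem slash_S_apply (k : ℕ) (f : ℍ → ℂ) (τ : ℍ) :
    (f ∣[(k : ℤ)] S) τ = f (S • τ) / (τ : ℂ) ^ k := by
  rw [ModularForm.SL_slash_apply, denom_S, zpow_neg, zpow_natCast, div_eq_mul_inv]

theorem slash_T_apply (k : ℕ) (f : ℍ → ℂ) (τ : ℍ) :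
    (f ∣[(k : ℤ)] T) τ = f ((1 : ℝ) +ᵥ τ) := by
  rw [ModularForm.SL_slash_apply, UpperHalfPlane.modular_T_smul]
  have : denom (T : SL(2, ℤ)) τ = 1 := by
    rw [ModularGroup.denom_apply]; simp [ModularGroup.T]
  rw [this, one_zpow, mul_one]

theorem MF.exists_modularForm {k : ℕ} {f : ℍ → ℂ} (hf : MF k f) :
    ∃ F : ModularForm 𝒮ℒ (k : ℤ), ⇑F = f := by
  have hS : f ∣[(k:ℤ)] S = f := by
    ext τ
    rw [slash_S_apply, hf.S_inv, mul_div_cancel_left₀ _ (pow_ne_zero _ τ.ne_zero)]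
  have hT : f ∣[(k:ℤ)] T = f := by
    ext τ
    rw [slash_T_apply, hf.T_inv]
  have hall := SlashInvariantForm.slash_action_generators_SL2Z hS hT
  obtain ⟨c, hc⟩ := hf.rep
  have hb : IsBoundedAtImInfty f :=
    isBoundedAtImInfty_of_hasSum_qExpansion (h := 1) (c := fun n => PowerSeries.coeff n c) one_pos
      (by simpa [QRep] using hc)
  refine ⟨{ toFun := f
            slash_action_eq' := fun _ ⟨γ, hγ⟩ ↦ hγ ▸ hall γ
            holo' := hf.holo
            bdd_at_cusps' := fun {c} hc => ?_ }, rfl⟩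
  rw [Subgroup.IsArithmetic.isCusp_iff_isCusp_SL2Z] at hc
  rw [OnePoint.isBoundedAt_iff_forall_SL2Z hc]
  intro γ _
  rw [hall γ]
  exact hb

theorem qRep_qExpansion {k : ℤ} (F : ModularForm 𝒮ℒ k) : QRep 1 F (qExpansion 1 F) := by
  intro τ
  simpa using ModularForm.hasSum_qExpansion F one_pos one_mem_strictPeriods_SL τ

theorem MF.of_modularForm {k : ℕ} (F : ModularForm 𝒮ℒ (k : ℤ)) : MF k F := by
  have h : ∀ γ : SL(2, ℤ), (F : ℍ → ℂ) ∣[(k : ℤ)] γ = F := fun γ => F.slash_action_eq' _ ⟨γ, rfl⟩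
  refine ⟨F.holo', fun τ => ?_, fun τ => ?_, _, qRep_qExpansion F⟩
  · rw [← slash_T_apply k F, h]
  · have := congrFun (h S) τ
    rw [slash_S_apply, div_eq_iff (pow_ne_zero _ τ.ne_zero)] at this
    rw [this, mul_comm]

namespace MF

variable {k l : ℕ} {f g : ℍ → ℂ}

theorem mul (hf : MF k f) (hg : MF l g) : MF (k + l) (fun τ => f τ * g τ) where
  holo := hf.holo.mul hg.holo
  T_inv τ := by simp only [hf.T_inv, hg.T_inv]
  S_inv τ := by simp only [hf.S_inv, hg.S_inv]; ring
  rep := let ⟨_, hc⟩ := hf.rep; let ⟨_, hd⟩ := hg.rep; ⟨_, hc.mul hd⟩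

theorem add (hf : MF k f) (hg : MF k g) : MF k (fun τ => f τ + g τ) where
  holo := hf.holo.add hg.holo
  T_inv τ := by simp only [hf.T_inv, hg.T_inv]
  S_inv τ := by simp only [hf.S_inv, hg.S_inv]; ring
  rep := let ⟨_, hc⟩ := hf.rep; let ⟨_, hd⟩ := hg.rep; ⟨_, hc.add hd⟩

theorem sub (hf : MF k f) (hg : MF k g) : MF k (fun τ => f τ - g τ) where
  holo := hf.holo.sub hg.holo
  T_inv τ := by simp only [hf.T_inv, hg.T_inv]
  S_inv τ := by simp only [hf.S_inv, hg.S_inv]; ring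
  rep := let ⟨_, hc⟩ := hf.rep; let ⟨_, hd⟩ := hg.rep; ⟨_, hc.sub hd⟩

theorem const (a : ℂ) : MF 0 (fun _ => a) where
  holo := mdifferentiable_const
  T_inv τ := rfl
  S_inv τ := by simp
  rep := ⟨_, QRep.const a⟩

theorem smul (a : ℂ) (hf : MF k f) : MF k (fun τ => a * f τ) := by
  simpa using (const a).mul hf

theorem pow (hf : MF k f) (n : ℕ) : MF (k * n) (fun τ => f τ ^ n) := by
  induction n with
  | zero => simpa using const 1
  | succ n ih => simpa [pow_succ, mul_add] using ih.mul hf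

theorem zero (k : ℕ) : MF k (fun _ => 0) where
  holo := mdifferentiable_const
  T_inv τ := rfl
  S_inv τ := by simp
  rep := ⟨_, QRep.const 0⟩

end MF

/-- The Eisenstein series of weight four. -/
noncomputable abbrev e4 : ℍ → ℂ := fun τ => E₄ τ
/-- The Eisenstein series of weight six. -/
noncomputable abbrev e6 : ℍ → ℂ := fun τ => E₆ τ
/-- The discriminant. -/
noncomputable abbrev dl : ℍ → ℂ := fun τ => ModularForm.discriminant τ

theorem mf_e4 : MF 4 e4 := MF.of_modularForm E₄
theorem mf_e6 : MF 6 e6 := MF.of_modularForm E₆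

theorem dl_eq (τ : ℍ) : 1728 * dl τ = e4 τ ^ 3 - e6 τ ^ 2 := by
  have := ModularForm.discriminant_eq_E₄_cube_sub_E₆_sq τ
  simp only [dl, this]
  ring

theorem dl_ne_zero (τ : ℍ) : dl τ ≠ 0 := ModularForm.discriminant_ne_zero τ

theorem mf_dl : MF 12 dl := by
  have h1 : MF 12 _ := mf_e4.pow 3
  have h2 : MF 12 _ := mf_e6.pow 2
  have := (h1.sub h2).smul (1 / 1728)
  convert this using 1
  ext τ
  rw [← dl_eq]
  ring

/-- A form vanishing at the cusp is divisible by the discriminant. -/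
theorem MF.div_dl {k : ℕ} {f : ℍ → ℂ} {c : PowerSeries ℂ} (hf : MF k f) (hc : QRep 1 f c)
    (h0 : PowerSeries.coeff 0 c = 0) :
    (∀ τ, f τ = 0) ∨ ∃ l g, k = l + 12 ∧ MF l g ∧ ∀ τ, f τ = dl τ * g τ := by
  obtain ⟨F, rfl⟩ := hf.exists_modularForm
  have hc' : qExpansion 1 F = c := (qRep_qExpansion F).unique one_pos hc
  have h0' : (qExpansion 1 F).coeff 0 = 0 := by rw [hc', h0]
  have key := ModularForm.discriminant_mul_discriminantEquiv_apply
    (ModularForm.toCuspForm F h0')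
  generalize CuspForm.discriminantEquiv (ModularForm.toCuspForm F h0') = G at key
  rcases lt_or_ge k 12 with hk | hk
  · left
    intro τ
    have hG : G = 0 := rank_zero_iff_forall_zero.mp
      (ModularForm.levelOne_neg_weight_rank_zero (by lia)) G
    have := key τ
    rw [hG] at this
    simpa using this.symm
  · right
    obtain ⟨l, rfl⟩ := Nat.exists_eq_add_of_le' hk
    have hl : ((l + 12 : ℕ) : ℤ) - 12 = l := by simp
    refine ⟨l, ModularForm.mcast hl G, rfl, MF.of_modularForm _, fun τ => (key τ).symm⟩

theorem MF.eq_zero_of_odd {k : ℕ} {f : ℍ → ℂ} (hf : MF k f) (hk : Odd k) (τ : ℍ) : f τ = 0 := by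
  obtain ⟨F, rfl⟩ := hf.exists_modularForm
  rw [ModularForm.levelOne_odd_weight_eq_zero (by exact_mod_cast hk) F]
  rfl

theorem MF.eq_zero_of_two {f : ℍ → ℂ} (hf : MF 2 f) (τ : ℍ) : f τ = 0 := by
  obtain ⟨F, rfl⟩ := hf.exists_modularForm
  rw [rank_zero_iff_forall_zero.mp ModularForm.levelOne_weight_two_rank_zero F]
  rfl

theorem MF.eq_const {f : ℍ → ℂ} (hf : MF 0 f) : ∃ a, ∀ τ, f τ = a := by
  obtain ⟨F, rfl⟩ := hf.exists_modularForm
  obtain ⟨a, ha⟩ := ModularFormClass.levelOne_weight_zero_const F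
  exact ⟨a, fun τ => congrFun ha τ⟩

end Birch

end

section

namespace Birch

open UpperHalfPlane ModularForm ModularGroup MatrixGroups Complex Manifold

/-- The `q`-expansion of `e4`, with integer coefficients. -/
noncomputable def c4 : PowerSeries ℤ :=
  PowerSeries.mk fun m => if m = 0 then 1 else 240 * (ArithmeticFunction.sigma 3 m : ℤ)

/-- The `q`-expansion of `e6`, with integer coefficients. -/
noncomputable def c6 : PowerSeries ℤ :=
  PowerSeries.mk fun m => if m = 0 then 1 else -504 * (ArithmeticFunction.sigma 5 m : ℤ)

theorem qRep_e4 : QRep 1 e4 (c4.map (Int.castRingHom ℂ)) := by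
  have h := qRep_qExpansion E₄
  convert h using 1
  ext m
  rw [EisensteinSeries.E_qExpansion_coeff _ ⟨2, rfl⟩]
  simp only [c4, PowerSeries.coeff_map, PowerSeries.coeff_mk]
  split_ifs
  · simp
  · norm_num [show bernoulli 4 = -1 / 30 by decide +kernel]

theorem qRep_e6 : QRep 1 e6 (c6.map (Int.castRingHom ℂ)) := by
  have h := qRep_qExpansion E₆
  convert h using 1
  ext m
  rw [EisensteinSeries.E_qExpansion_coeff _ ⟨3, rfl⟩]
  simp only [c6, PowerSeries.coeff_map, PowerSeries.coeff_mk]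
  split_ifs
  · simp
  · norm_num [show bernoulli 6 = 1 / 42 by decide +kernel]

/-- The `q`-expansion of the discriminant. -/
noncomputable def cdl : PowerSeries ℂ :=
  PowerSeries.C (1 / 1728) *
    ((c4.map (Int.castRingHom ℂ)) ^ 3 - (c6.map (Int.castRingHom ℂ)) ^ 2)

theorem qRep_dl : QRep 1 dl cdl := by
  have := ((qRep_e4.pow 3).sub (qRep_e6.pow 2)).smul (1 / 1728)
  have h : dl = fun τ => (1 / 1728 : ℂ) * (e4 τ ^ 3 - e6 τ ^ 2) := by
    ext τ
    rw [← dl_eq]; ring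
  rw [h]
  exact this

@[simp] theorem constantCoeff_c4 :
    PowerSeries.constantCoeff (c4.map (Int.castRingHom ℂ)) = 1 := by
  rw [← PowerSeries.coeff_zero_eq_constantCoeff_apply, PowerSeries.coeff_map]
  simp [c4, -PowerSeries.coeff_zero_eq_constantCoeff]

@[simp] theorem constantCoeff_c6 :
    PowerSeries.constantCoeff (c6.map (Int.castRingHom ℂ)) = 1 := by
  rw [← PowerSeries.coeff_zero_eq_constantCoeff_apply, PowerSeries.coeff_map]
  simp [c6, -PowerSeries.coeff_zero_eq_constantCoeff]

theorem coeff_zero_cdl : PowerSeries.coeff 0 cdl = 0 := by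
  simp [cdl]

theorem coeff_one_cdl : PowerSeries.coeff 1 cdl = 1 := by
  have h4 : PowerSeries.coeff 1 ((c4.map (Int.castRingHom ℂ)) ^ 3) = 720 := by
    simp [c4, pow_succ, PowerSeries.coeff_mul, Finset.Nat.antidiagonal_succ]
    norm_num
  have h6 : PowerSeries.coeff 1 ((c6.map (Int.castRingHom ℂ)) ^ 2) = -1008 := by
    simp [c6, pow_succ, PowerSeries.coeff_mul, Finset.Nat.antidiagonal_succ]
    norm_num
  rw [cdl, PowerSeries.coeff_C_mul, map_sub, h4, h6]
  norm_num

variable {V : Subring ℂ}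

/-- Power series all of whose coefficients lie in a subring. -/
def CoeffIn (I : Submodule V ℂ) (c : PowerSeries ℂ) : Prop := ∀ n, PowerSeries.coeff n c ∈ I

/-- The subring itself as a submodule. -/
def selfMod (V : Subring ℂ) : Submodule V ℂ where
  carrier := V
  add_mem' := V.add_mem
  zero_mem' := V.zero_mem
  smul_mem' x _ hy := V.mul_mem x.2 hy

theorem mem_selfMod {x : ℂ} : x ∈ selfMod V ↔ x ∈ V := Iff.rfl

theorem mul_mem_of {I : Submodule V ℂ} {x y : ℂ} (hx : x ∈ V) (hy : y ∈ I) : x * y ∈ I :=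
  I.smul_mem ⟨x, hx⟩ hy

namespace CoeffIn

variable {I : Submodule V ℂ} {c d : PowerSeries ℂ}

theorem add (hc : CoeffIn I c) (hd : CoeffIn I d) : CoeffIn I (c + d) := fun n => by
  rw [map_add]; exact I.add_mem (hc n) (hd n)

theorem sub (hc : CoeffIn I c) (hd : CoeffIn I d) : CoeffIn I (c - d) := fun n => by
  rw [map_sub]; exact I.sub_mem (hc n) (hd n)

theorem mul (hc : CoeffIn (selfMod V) c) (hd : CoeffIn I d) : CoeffIn I (c * d) := fun n => by
  rw [PowerSeries.coeff_mul]
  exact I.sum_mem fun x _ => mul_mem_of (hc _) (hd _)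

theorem C {a : ℂ} (ha : a ∈ I) : CoeffIn I (PowerSeries.C a) := fun n => by
  rw [PowerSeries.coeff_C]
  split_ifs
  · exact ha
  · exact I.zero_mem

theorem pow (hc : CoeffIn (selfMod V) c) (n : ℕ) : CoeffIn (selfMod V) (c ^ n) := by
  induction n with
  | zero => simpa using C (I := selfMod V) V.one_mem
  | succ n ih => rw [pow_succ]; exact ih.mul hc

theorem map_int (c : PowerSeries ℤ) : CoeffIn (selfMod V) (c.map (Int.castRingHom ℂ)) := fun n => by
  simp [mem_selfMod]

theorem cdl (hV : (1 / 1728 : ℂ) ∈ V) : CoeffIn (selfMod V) cdl :=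
  (C (mem_selfMod.mpr hV)).mul ((map_int c4).pow 3 |>.sub ((map_int c6).pow 2))

end CoeffIn

/-- Forms generated by monomials in `e4`, `e6`, `dl` with coefficients in `I`. -/
inductive Gen (I : Submodule V ℂ) (k : ℕ) : (ℍ → ℂ) → Prop
  | zero : Gen I k fun _ => 0
  | add {x : ℂ} {a b n : ℕ} {f : ℍ → ℂ} (hx : x ∈ I) (h : 4 * a + 6 * b + 12 * n = k)
      (hf : Gen I k f) : Gen I k fun τ => x * (e4 τ ^ a * e6 τ ^ b * dl τ ^ n) + f τ

namespace Gen

variable {I : Submodule V ℂ} {k : ℕ} {f : ℍ → ℂ}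

theorem mul_dl (hf : Gen I k f) : Gen I (k + 12) (fun τ => dl τ * f τ) := by
  induction hf with
  | zero => simpa using Gen.zero
  | @add x a b n f hx h hf ih =>
    have := Gen.add (a := a) (b := b) (n := n + 1) hx (by omega) ih
    convert this using 2
    ring

theorem rep (hV : (1 / 1728 : ℂ) ∈ V) (hf : Gen I k f) : ∃ c, QRep 1 f c ∧ CoeffIn I c := by
  induction hf with
  | zero => exact ⟨_, QRep.const 0, CoeffIn.C I.zero_mem⟩
  | @add x a b n f hx h hf ih =>
    obtain ⟨c, hc, hc'⟩ := ih
    refine ⟨_, ((((qRep_e4.pow a).mul (qRep_e6.pow b)).mul (qRep_dl.pow n)).smul x).add hc, ?_⟩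
    refine CoeffIn.add ?_ hc'
    rw [mul_comm]
    exact CoeffIn.mul ((((CoeffIn.map_int c4).pow a).mul ((CoeffIn.map_int c6).pow b)).mul
      ((CoeffIn.cdl hV).pow n)) (CoeffIn.C hx)

theorem eval (hV : (1 / 1728 : ℂ) ∈ V) (hf : Gen I k f) {τ : ℍ} {s : ℂ}
    (h4 : s ^ 4 * e4 τ ∈ V) (h6 : s ^ 6 * e6 τ ∈ V) : s ^ k * f τ ∈ I := by
  induction hf with
  | zero => simp
  | @add x a b n f hx h hf ih =>
    have e : s ^ k * (x * (e4 τ ^ a * e6 τ ^ b * dl τ ^ n) + f τ) =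
        ((s ^ 4 * e4 τ) ^ a * (s ^ 6 * e6 τ) ^ b *
          (1 / 1728 * ((s ^ 4 * e4 τ) ^ 3 - (s ^ 6 * e6 τ) ^ 2)) ^ n) * x + s ^ k * f τ := by
      have : 1 / 1728 * ((s ^ 4 * e4 τ) ^ 3 - (s ^ 6 * e6 τ) ^ 2) = s ^ 12 * dl τ := by
        linear_combination (- s ^ 12 / 1728) * dl_eq τ
      rw [this, ← h]
      ring
    rw [e]
    refine I.add_mem (mul_mem_of ?_ hx) ih
    exact V.mul_mem (V.mul_mem (V.pow_mem h4 _) (V.pow_mem h6 _))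
      (V.pow_mem (V.mul_mem hV (V.sub_mem (V.pow_mem h4 _) (V.pow_mem h6 _))) _)

theorem eval_eq (hf : Gen I k f) {τ τ' : ℍ} {s : ℂ}
    (h4 : s ^ 4 * e4 τ' = e4 τ) (h6 : s ^ 6 * e6 τ' = e6 τ) : s ^ k * f τ' = f τ := by
  have hd : s ^ 12 * dl τ' = dl τ := by
    have h1 := dl_eq τ
    have h2 := dl_eq τ'
    rw [← h4, ← h6] at h1
    linear_combination (1 / 1728) * (s ^ 12 * h2 - h1)
  induction hf with
  | zero => simp
  | @add x a b n f hx h hf ih =>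
    change s ^ k * (x * (e4 τ' ^ a * e6 τ' ^ b * dl τ' ^ n) + f τ') =
      x * (e4 τ ^ a * e6 τ ^ b * dl τ ^ n) + f τ
    rw [← ih, ← h4, ← h6, ← hd, ← h]
    ring

end Gen

theorem coeffs_div_cdl (hV : (1 / 1728 : ℂ) ∈ V) {I : Submodule V ℂ} {d : PowerSeries ℂ} {N : ℕ}
    (h : ∀ n ≤ N, PowerSeries.coeff n (cdl * d) ∈ I) :
    ∀ n, n + 1 ≤ N → PowerSeries.coeff n d ∈ I := by
  intro n
  induction n using Nat.strong_induction_on with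
  | _ n ih =>
    intro hn
    have h1 := h (n + 1) hn
    rw [PowerSeries.coeff_mul, Finset.Nat.sum_antidiagonal_eq_sum_range_succ_mk,
      Finset.sum_range_succ', coeff_zero_cdl, Finset.sum_range_succ'] at h1
    simp only [zero_add, zero_mul, add_zero, coeff_one_cdl, one_mul] at h1
    have h2 : ∑ i ∈ Finset.range n, PowerSeries.coeff (i + 1 + 1) cdl *
        PowerSeries.coeff (n + 1 - (i + 1 + 1)) d ∈ I :=
      I.sum_mem fun i hi => by
        have := Finset.mem_range.mp hi
        exact mul_mem_of (CoeffIn.cdl hV _) (ih _ (by omega) (by omega))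
    simpa using (I.add_mem_iff_right h2).mp h1

theorem MF.gen (hV : (1 / 1728 : ℂ) ∈ V) (I : Submodule V ℂ) {k : ℕ} {f : ℍ → ℂ} (hf : MF k f)
    {c : PowerSeries ℂ} (hc : QRep 1 f c) (h : ∀ n ≤ k / 12, PowerSeries.coeff n c ∈ I) :
    Gen I k f := by
  induction k using Nat.strong_induction_on generalizing f c with
  | _ k ih =>
  have hz : (∀ τ, f τ = 0) → Gen I k f := fun h => by
    rw [funext h]; exact Gen.zero
  rcases Nat.even_or_odd k with hk | hk
  swap
  · exact hz fun τ => hf.eq_zero_of_odd hk τ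
  rcases eq_or_ne k 2 with rfl | hk2
  · exact hz fun τ => hf.eq_zero_of_two τ
  obtain ⟨a, b, hab⟩ : ∃ a b, 4 * a + 6 * b = k := by
    obtain ⟨j, rfl⟩ := hk
    rcases Nat.even_or_odd j with ⟨i, rfl⟩ | ⟨i, rfl⟩
    · exact ⟨i, 0, by omega⟩
    · exact ⟨i - 1, 1, by omega⟩
  have hm : MF k (fun τ => e4 τ ^ a * e6 τ ^ b) := by
    rw [← hab]; exact (mf_e4.pow a).mul (mf_e6.pow b)
  have hmr : QRep 1 (fun τ => e4 τ ^ a * e6 τ ^ b) _ := (qRep_e4.pow a).mul (qRep_e6.pow b)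
  have hmI : CoeffIn (selfMod V) _ := ((CoeffIn.map_int c4).pow a).mul ((CoeffIn.map_int c6).pow b)
  set x := PowerSeries.coeff 0 c with hx
  have hxI : x ∈ I := h 0 (Nat.zero_le _)
  have hg := hf.sub (hm.smul x)
  have hgr := hc.sub (hmr.smul x)
  have key : ∀ g : ℍ → ℂ, Gen I k g → (∀ τ, f τ - x * (e4 τ ^ a * e6 τ ^ b) = g τ) →
      Gen I k f := fun g hg h => by
    have := Gen.add (a := a) (b := b) (n := 0) hxI (by omega) hg
    convert this using 2 with τ
    rw [← h τ]
    ring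
  have h0 : PowerSeries.coeff 0 (c - PowerSeries.C x * ((c4.map (Int.castRingHom ℂ)) ^ a *
      (c6.map (Int.castRingHom ℂ)) ^ b)) = 0 := by
    simp [hx]
  rcases hg.div_dl hgr h0 with hg0 | ⟨l, g, rfl, hg1, hg2⟩
  · exact key _ Gen.zero hg0
  · obtain ⟨d, hd⟩ := hg1.rep
    have hr : c - PowerSeries.C x * ((c4.map (Int.castRingHom ℂ)) ^ a *
      (c6.map (Int.castRingHom ℂ)) ^ b) = cdl * d := by
      refine hgr.unique one_pos ?_
      rw [funext hg2]
      exact qRep_dl.mul hd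
    refine key _ (ih l (by omega) hg1 hd fun n hn => ?_).mul_dl hg2
    refine coeffs_div_cdl hV (N := (l + 12) / 12) (fun n hn => ?_) n (by omega)
    rw [← hr, map_sub]
    refine I.sub_mem (h n hn) ?_
    rw [mul_comm]
    exact hmI.mul (CoeffIn.C hxI) n

/-- Two points with proportional `e4` and `e6` have all forms proportional. -/
theorem MF.eval_eq {k : ℕ} {f : ℍ → ℂ} (hf : MF k f) {τ τ' : ℍ} {s : ℂ}
    (h4 : s ^ 4 * e4 τ' = e4 τ) (h6 : s ^ 6 * e6 τ' = e6 τ) : s ^ k * f τ' = f τ := by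
  obtain ⟨c, hc⟩ := hf.rep
  exact (hf.gen (V := ⊤) (by trivial) ⊤ hc (fun _ _ => trivial)).eval_eq h4 h6

/-- Forms of weight `12 m` are polynomials in `e4 ^ 3` and `dl`. -/
theorem MF.exists_poly (hV : (1 / 1728 : ℂ) ∈ V) (I : Submodule V ℂ) {m : ℕ} {f : ℍ → ℂ}
    (hf : MF (12 * m) f) {c : PowerSeries ℂ} (hc : QRep 1 f c)
    (h : ∀ n ≤ m, PowerSeries.coeff n c ∈ I) (ν : ℕ) (hν : ∀ n < ν, PowerSeries.coeff n c = 0) :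
    ∃ x : ℕ → ℂ, (∀ i, x i ∈ I) ∧ (∀ i, m < i + ν → x i = 0) ∧
      ∀ τ, f τ = ∑ i ∈ Finset.range (m + 1), x i * ((e4 τ ^ 3) ^ i * dl τ ^ (m - i)) := by
  induction m generalizing f c ν with
  | zero =>
    obtain ⟨a, ha⟩ := hf.eq_const
    have hca : c = PowerSeries.C a := hc.unique one_pos (by rw [funext ha]; exact QRep.const a)
    refine ⟨fun i => if i = 0 then a else 0, fun i => ?_, fun i hi => ?_, fun τ => ?_⟩
    · dsimp only
      split_ifs
      · simpa [hca] using h 0 le_rfl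
      · exact I.zero_mem
    · dsimp only
      split_ifs with h0
      · subst h0
        simpa [hca] using hν 0 (by omega)
      · rfl
    · simp [ha τ]
  | succ m ih =>
    set a := PowerSeries.coeff 0 c with ha
    have haI : a ∈ I := h 0 (Nat.zero_le _)
    have hm : MF (12 * (m + 1)) (fun τ => (e4 τ ^ 3) ^ (m + 1)) := (mf_e4.pow 3).pow (m + 1)
    have hmr := (qRep_e4.pow 3).pow (m + 1)
    have hmI : CoeffIn (selfMod V) _ := ((CoeffIn.map_int c4).pow 3).pow (m + 1)
    have hg := hf.sub (hm.smul a)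
    have hgr := hc.sub (hmr.smul a)
    have h0 : PowerSeries.coeff 0 (c - PowerSeries.C a *
        ((c4.map (Int.castRingHom ℂ)) ^ 3) ^ (m + 1)) = 0 := by
      simp [ha]
    have key : ∃ g, MF (12 * m) g ∧ ∀ τ, f τ - a * (e4 τ ^ 3) ^ (m + 1) = dl τ * g τ := by
      rcases hg.div_dl hgr h0 with hg0 | ⟨l, g, hl, hg1, hg2⟩
      · exact ⟨_, MF.zero _, fun τ => by simpa using hg0 τ⟩
      · obtain rfl : l = 12 * m := by omega
        exact ⟨g, hg1, hg2⟩
    obtain ⟨g, hg1, hg2⟩ := key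
    obtain ⟨d, hd⟩ := hg1.rep
    have hr : c - PowerSeries.C a * ((c4.map (Int.castRingHom ℂ)) ^ 3) ^ (m + 1) = cdl * d := by
      refine hgr.unique one_pos ?_
      rw [funext hg2]
      exact qRep_dl.mul hd
    obtain ⟨x, hx1, hx2, hx3⟩ := ih hg1 hd
      (fun n hn => coeffs_div_cdl hV (N := m + 1) (fun n hn => by
        rw [← hr, map_sub]
        refine I.sub_mem (h n hn) ?_
        rw [mul_comm]
        exact hmI.mul (CoeffIn.C haI) n) n (by omega)) (ν - 1) (fun n hn => by
        have h0 : a = 0 := hν 0 (by omega)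
        have := coeffs_div_cdl (V := V) hV (I := ⊥) (d := d) (N := ν - 1) (fun n hn' => by
          rw [← hr, h0]
          simpa using hν n (by omega)) n (by omega)
        simpa using this)
    refine ⟨fun i => if i = m + 1 then a else x i, fun i => ?_, fun i hi => ?_, fun τ => ?_⟩
    · dsimp only
      split_ifs
      · exact haI
      · exact hx1 i
    · dsimp only
      split_ifs with h0
      · exact hν 0 (by omega)
      · exact hx2 i (by omega)
    · rw [Finset.sum_range_succ, sub_eq_iff_eq_add.mp (hg2 τ), hx3 τ, Finset.mul_sum]
      congr 1
      · refine Finset.sum_congr rfl fun i hi => ?_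
        have hi' := Finset.mem_range.mp hi
        dsimp only
        rw [if_neg (by omega), show m + 1 - i = (m - i) + 1 by omega, pow_succ (dl τ)]
        ring
      · simp

end Birch

end

section

open UpperHalfPlane ModularForm ModularGroup MatrixGroups Complex Manifold

namespace Birch
theorem countable_lattice (L : PeriodPair) : (L.lattice : Set ℂ).Countable :=
  have : Countable L.lattice := L.latticeEquivProd.toEquiv.countable_iff.mpr inferInstance
  Set.to_countable _

/-- The power sums of a lattice determine its nonzero points. -/
theorem mem_lattice_of_G_eq {L L' : PeriodPair} (h : ∀ n, 3 ≤ n → L.G n = L'.G n) {l : ℂ}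
    (hl : l ∈ L.lattice) : l ∈ L'.lattice := by
  by_contra hl'
  have hl0 : l ≠ 0 := fun h0 => hl' (h0 ▸ zero_mem _)
  set A : Set ℂ := L.lattice \ {0}
  set B : Set ℂ := L'.lattice \ {0}
  have hfa := L.analyticOnNhd_weierstrassPExcept 0
  have hga := L'.analyticOnNhd_weierstrassPExcept 0
  have hcA : A.Countable := (countable_lattice L).mono Set.sdiff_subset
  have hcB : B.Countable := (countable_lattice L').mono Set.sdiff_subset
  have hconn : IsPreconnected (A ∪ B)ᶜ :=
    ((hcA.union hcB).isConnected_compl_of_one_lt_rank (by simp)).isPreconnected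
  have hloc : L.weierstrassPExcept 0 =ᶠ[nhds 0] L'.weierstrassPExcept 0 := by
    have h1 := L.hasFPowerSeriesAt_weierstrassPExcept 0
    have h2 := L'.hasFPowerSeriesAt_weierstrassPExcept 0
    have hser : ∀ i : ℕ, (if i = 0 then L.weierstrassPExcept 0 0
        else ((i : ℂ) + 1) * L.sumInvPow 0 (i + 2)) = if i = 0 then L'.weierstrassPExcept 0 0
        else ((i : ℂ) + 1) * L'.sumInvPow 0 (i + 2) := by
      intro i
      split_ifs with hi
      · simp
      · simp only [PeriodPair.sumInvPow_zero]
        rw [h _ (by lia)]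
    simp only [hser] at h1
    filter_upwards [h1.eventually_hasSum_sub, h2.eventually_hasSum_sub] with z hz1 hz2
    exact hz1.unique hz2
  have heq : Set.EqOn (L.weierstrassPExcept 0) (L'.weierstrassPExcept 0) (A ∪ B)ᶜ :=
    AnalyticOnNhd.eqOn_of_preconnected_of_eventuallyEq
      (hfa.mono (Set.compl_subset_compl.mpr Set.subset_union_left))
      (hga.mono (Set.compl_subset_compl.mpr Set.subset_union_right)) hconn
      (z₀ := 0) (by simp [A, B]) hloc
  have hnear : ∀ᶠ z in nhdsWithin l {l}ᶜ, z ∈ (A ∪ B)ᶜ ∧ z ≠ 0 := by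
    have h1 := nhdsWithin_le_nhds (s := {l}ᶜ) (L.compl_lattice_sdiff_singleton_mem_nhds l)
    have h2 := nhdsWithin_le_nhds (s := {l}ᶜ) (L'.compl_lattice_sdiff_singleton_mem_nhds l)
    filter_upwards [h1, h2, self_mem_nhdsWithin,
      nhdsWithin_le_nhds (isOpen_compl_singleton.mem_nhds (show l ∈ ({0}ᶜ : Set ℂ) from hl0))] with z h1 h2 h3 h4
    have h3' : z ≠ l := h3
    refine ⟨?_, h4⟩
    simp only [A, B, Set.mem_compl_iff, Set.mem_union, Set.mem_sdiff, Set.mem_singleton_iff] at *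
    tauto
  have hord := L.order_weierstrassP l hl
  have hana : AnalyticAt ℂ (fun z => L'.weierstrassPExcept 0 z + 1 / z ^ 2) l := by
    have : AnalyticAt ℂ (L'.weierstrassPExcept 0) l := hga l (fun h => hl' h.1)
    have h2 : AnalyticAt ℂ (fun z : ℂ => 1 / z ^ 2) l := by
      fun_prop (disch := simpa)
    exact this.add h2
  have hcongr : L.weierstrassP =ᶠ[nhdsWithin l {l}ᶜ] (fun z => L'.weierstrassPExcept 0 z + 1 / z ^ 2) := by
    filter_upwards [hnear] with z hz
    have := L.weierstrassPExcept_add 0 z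
    simp at this
    rw [← heq hz.1, ← this]
    simp
  rw [meromorphicOrderAt_congr hcongr] at hord
  have := hana.meromorphicOrderAt_nonneg
  rw [hord] at this
  revert this
  decide

/-- The period pair `(s τ, s)`. -/
noncomputable def periods (s : ℂ) (hs : s ≠ 0) (τ : ℍ) : PeriodPair where
  ω₁ := s * τ
  ω₂ := s
  indep := by
    rw [LinearIndependent.pair_iff]
    intro a b hab
    have h1 : (a : ℂ) * τ + b = 0 := by
      have : s * ((a : ℂ) * τ + b) = 0 := by
        rw [← hab]; simp only [Complex.real_smul]; ring
      exact (mul_eq_zero.mp this).resolve_left hs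
    have h2 : a = 0 := by
      have := congrArg Complex.im h1
      simp at this
      exact this.resolve_right τ.im_pos.ne'
    refine ⟨h2, ?_⟩
    simpa [h2] using h1

theorem periods_G (s : ℂ) (hs : s ≠ 0) (τ : ℍ) {n : ℕ} (hn : 3 ≤ n) :
    (periods s hs τ).G n = (s ^ n)⁻¹ * (2 * riemannZeta n) * E hn τ := by
  have h1 := tsum_eisSummand_eq_riemannZeta_mul_eisensteinSeries hn τ
  have h2 : E hn τ = (1 / 2 : ℂ) * eisensteinSeries (N := 1) 0 n τ := by
    rw [show E hn τ = (1 / 2 : ℂ) • EisensteinSeries.eisensteinSeriesSIF (N := 1) 0 n τ from rfl,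
      EisensteinSeries.eisensteinSeriesSIF_apply 0 n τ, smul_eq_mul]
  have h3 : (periods s hs τ).G n = (s ^ n)⁻¹ * ∑' v : Fin 2 → ℤ, EisensteinSeries.eisSummand n v τ := by
    rw [← tsum_mul_left, PeriodPair.G,
      ← ((finTwoArrowEquiv ℤ).trans (periods s hs τ).latticeEquivProd.symm.toEquiv).tsum_eq]
    congr 1
    ext v
    have := (periods s hs τ).latticeEquiv_symm_apply (v 0, v 1)
    have hv : ((finTwoArrowEquiv ℤ).trans (periods s hs τ).latticeEquivProd.symm.toEquiv) v =
      (periods s hs τ).latticeEquivProd.symm (v 0, v 1) := rfl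
    simp only [EisensteinSeries.eisSummand]
    rw [hv, this, zpow_neg, zpow_natCast, ← mul_inv, ← mul_pow]
    simp only [periods]
    ring
  rw [h3, h1, h2]
  ring

/-- Two points with proportional `e4` and `e6` are equivalent. -/
theorem exists_smul_eq {τ τ' : ℍ} {s : ℂ} (hs : s ≠ 0)
    (h4 : s ^ 4 * e4 τ' = e4 τ) (h6 : s ^ 6 * e6 τ' = e6 τ) : ∃ g : SL(2, ℤ), τ' = g • τ := by
  have hG : ∀ n, 3 ≤ n →
      (periods 1 one_ne_zero τ).G n = (periods s⁻¹ (inv_ne_zero hs) τ').G n := by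
    intro n hn
    rcases Nat.even_or_odd n with _ | ho
    · rw [periods_G _ _ _ hn, periods_G _ _ _ hn, ← (MF.of_modularForm (E hn)).eval_eq h4 h6]
      simp
      ring
    · rw [PeriodPair.G_eq_zero_of_odd _ _ ho, PeriodPair.G_eq_zero_of_odd _ _ ho]
  set L := periods 1 one_ne_zero τ
  set L' := periods s⁻¹ (inv_ne_zero hs) τ'
  have hL : ∀ {x}, x ∈ L.lattice ↔ ∃ m n : ℤ, m * (τ : ℂ) + n = x := fun {x} => by
    rw [PeriodPair.mem_lattice]; simp [L, periods]
  have hL' : ∀ {x}, x ∈ L'.lattice ↔ ∃ m n : ℤ, m * (s⁻¹ * (τ' : ℂ)) + n * s⁻¹ = x := fun {x} => by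
    rw [PeriodPair.mem_lattice]; simp [L', periods]
  obtain ⟨a, b, hab⟩ := hL.mp (mem_lattice_of_G_eq (fun n hn => (hG n hn).symm)
    (hL'.mpr ⟨1, 0, rfl⟩))
  obtain ⟨c, d, hcd⟩ := hL.mp (mem_lattice_of_G_eq (fun n hn => (hG n hn).symm)
    (hL'.mpr ⟨0, 1, rfl⟩))
  obtain ⟨a', b', hab'⟩ := hL'.mp (mem_lattice_of_G_eq hG (hL.mpr ⟨1, 0, rfl⟩))
  obtain ⟨c', d', hcd'⟩ := hL'.mp (mem_lattice_of_G_eq hG (hL.mpr ⟨0, 1, rfl⟩))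
  have hsi : s⁻¹ ≠ 0 := inv_ne_zero hs
  have hind : ∀ x y : ℤ, (x : ℂ) * τ + y = 0 → x = 0 ∧ y = 0 := by
    intro x y h
    have h2 : x = 0 := by
      have := congrArg Complex.im h
      simp at this
      exact this.resolve_right τ.im_pos.ne'
    refine ⟨h2, ?_⟩
    simpa [h2] using h
  simp only [Int.cast_one, Int.cast_zero, one_mul, zero_mul, add_zero, zero_add] at hab hcd hab' hcd'
  rw [← hab, ← hcd] at hab' hcd'
  obtain ⟨e1, e2⟩ := hind (a' * a + b' * c - 1) (a' * b + b' * d) (by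
    push_cast; linear_combination hab')
  obtain ⟨e3, e4⟩ := hind (c' * a + d' * c) (c' * b + d' * d - 1) (by
    push_cast; linear_combination hcd')
  have hdet : (a' * d' - b' * c') * (a * d - b * c) = 1 := by
    have : (a' * d' - b' * c') * (a * d - b * c) =
      (a' * a + b' * c) * (c' * b + d' * d) - (a' * b + b' * d) * (c' * a + d' * c) := by ring
    rw [this, e2, e3, show a' * a + b' * c = 1 by linarith, show c' * b + d' * d = 1 by linarith]
    norm_num
  have hcd0 : (c : ℂ) * τ + d ≠ 0 := by rw [hcd]; exact hsi
  have hτ' : (τ' : ℂ) * (c * τ + d) = a * τ + b := by rw [hcd, hab]; ring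
  have hpos : 0 < a * d - b * c := by
    have h1 : ((a * d - b * c : ℤ) : ℝ) * (τ : ℂ).im = (τ' : ℂ).im * Complex.normSq (c * τ + d) := by
      have h2 : (τ' : ℂ) * (Complex.normSq (c * τ + d) : ℂ) =
          (a * τ + b) * (starRingEnd ℂ) (c * τ + d) := by
        rw [← hτ', ← Complex.mul_conj]; ring
      have h3 := congrArg Complex.im h2
      rw [Complex.im_mul_ofReal] at h3
      rw [h3]
      simp
      ring
    have h4 : 0 < ((a * d - b * c : ℤ) : ℝ) * (τ : ℂ).im := by
      rw [h1]; exact mul_pos τ'.im_pos (Complex.normSq_pos.mpr hcd0)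
    have := pos_of_mul_pos_left h4 τ.im_pos.le
    exact_mod_cast this
  have hdet1 : a * d - b * c = 1 := by
    rcases Int.eq_one_or_neg_one_of_mul_eq_one ((mul_comm _ _).trans hdet) with h | h <;> lia
  obtain ⟨g, hg⟩ : ∃ g : SL(2, ℤ), (g : Matrix (Fin 2) (Fin 2) ℤ) = !![a, b; c, d] :=
    ⟨⟨!![a, b; c, d], by rw [Matrix.det_fin_two_of]; exact hdet1⟩, rfl⟩
  refine ⟨g, ?_⟩
  ext
  rw [UpperHalfPlane.coe_specialLinearGroup_apply, hg]
  simp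
  rw [eq_div_iff hcd0, hτ']

/-- The values of `j` separate orbits. -/
theorem exists_smul_eq_of_j {τ τ' : ℍ} (h : e4 τ ^ 3 * dl τ' = e4 τ' ^ 3 * dl τ) :
    ∃ g : SL(2, ℤ), τ' = g • τ := by
  have hd := dl_ne_zero τ
  have hd' := dl_ne_zero τ'
  have e := dl_eq τ
  have e' := dl_eq τ'
  have h6 : e6 τ ^ 2 * dl τ' = e6 τ' ^ 2 * dl τ := by
    linear_combination h + dl τ' * e - dl τ * e'
  have key : ∃ s : ℂ, s ≠ 0 ∧ s ^ 4 * e4 τ' = e4 τ ∧ s ^ 6 * e6 τ' = e6 τ := by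
    generalize e4 τ = u, e4 τ' = u', e6 τ = v, e6 τ' = v', dl τ = D, dl τ' = D' at *
    by_cases hu' : u' = 0
    · have hu : u = 0 := by
        rw [hu', zero_pow three_ne_zero, zero_mul] at h
        exact pow_eq_zero_iff three_ne_zero |>.mp ((mul_eq_zero.mp h).resolve_right hd')
      have hv' : v' ≠ 0 := fun h0 => hd' (by rw [hu', h0] at e'; simpa using e')
      have hv : v ≠ 0 := fun h0 => hd (by rw [hu, h0] at e; simpa using e)
      obtain ⟨s, hs⟩ := IsAlgClosed.exists_pow_nat_eq (v / v') (show 0 < 6 by norm_num)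
      refine ⟨s, fun h0 => ?_, by rw [hu, hu', mul_zero], by rw [hs]; field_simp⟩
      rw [h0] at hs
      exact div_ne_zero hv hv' (by rw [← hs]; norm_num)
    · obtain ⟨s, hs⟩ := IsAlgClosed.exists_pow_nat_eq (u / u') (show 0 < 4 by norm_num)
      have hs4 : s ^ 4 * u' = u := by rw [hs]; field_simp
      have hu : u ≠ 0 := by
        rintro rfl
        rw [zero_pow three_ne_zero, zero_mul] at h
        exact mul_ne_zero (pow_ne_zero 3 hu') hd h.symm
      have hs0 : s ≠ 0 := by rintro rfl; apply hu; rw [← hs4]; ring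
      have h12 : s ^ 12 * D' = D := by
        have : u' ^ 3 * (s ^ 12 * D') = u' ^ 3 * D := by rw [← h, ← hs4]; ring
        exact mul_left_cancel₀ (pow_ne_zero 3 hu') this
      have hsq : v ^ 2 = (s ^ 6 * v') ^ 2 := by
        have : v ^ 2 * D' = (s ^ 6 * v') ^ 2 * D' := by rw [h6, ← h12]; ring
        exact mul_right_cancel₀ hd' this
      rcases sq_eq_sq_iff_eq_or_eq_neg.mp hsq with hv | hv
      · exact ⟨s, hs0, hs4, hv.symm⟩
      · refine ⟨Complex.I * s, mul_ne_zero Complex.I_ne_zero hs0, ?_, ?_⟩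
        · rw [mul_pow, Complex.I_pow_four, one_mul, hs4]
        · rw [mul_pow, show (6 : ℕ) = 4 + 2 from rfl, pow_add, Complex.I_pow_four, Complex.I_sq, hv]
          ring
  obtain ⟨s, hs, h4, h6⟩ := key
  exact exists_smul_eq hs h4 h6

theorem QRep.tendsto {f : ℍ → ℂ} {c : PowerSeries ℂ} (hf : QRep 1 f c) :
    Filter.Tendsto f atImInfty (nhds (PowerSeries.coeff 0 c)) := by
  set q : ℍ → ℂ := fun τ => Function.Periodic.qParam (1 : ℝ) τ
  have hq0 : ∀ τ, q τ ≠ 0 := fun τ => Function.Periodic.qParam_ne_zero _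
  have hf' : ∀ τ : ℍ, HasSum (fun m ↦ PowerSeries.coeff m c * q τ ^ m) (f τ) := by
    simpa [QRep, q] using hf
  have hg : ∀ τ, HasSum (fun m ↦ PowerSeries.coeff (m + 1) c • q τ ^ m)
      ((f τ - PowerSeries.coeff 0 c) / q τ) := fun τ => by
    have h1 := (hasSum_nat_add_iff' 1).mpr (hf' τ)
    have h2 := h1.div_const (q τ)
    simp only [Finset.sum_range_one, pow_zero, mul_one] at h2
    have h3 : (fun m ↦ PowerSeries.coeff (m + 1) c • q τ ^ m) =
        fun m => PowerSeries.coeff (m + 1) c * q τ ^ (m + 1) / q τ := by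
      ext m
      rw [smul_eq_mul, eq_div_iff (hq0 τ), pow_succ, mul_assoc]
    rw [h3]
    exact h2
  have hb : IsBoundedAtImInfty fun τ => (f τ - PowerSeries.coeff 0 c) / q τ :=
    isBoundedAtImInfty_of_hasSum_qExpansion (h := 1)
      (c := fun n => PowerSeries.coeff (n + 1) c) one_pos hg
  have hqt : Filter.Tendsto q atImInfty (nhds 0) := qParam_tendsto_atImInfty one_pos
  have h3 := hb.mul_isLittleO ((Asymptotics.isLittleO_one_iff ℝ).mpr hqt)
  have h4 : Filter.Tendsto (fun τ => (f τ - PowerSeries.coeff 0 c) / q τ * q τ) atImInfty (nhds 0) := by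
    refine (Asymptotics.isLittleO_one_iff ℝ).mp (h3.trans_isBigO ?_)
    simp only [Pi.one_apply, mul_one]
    exact Asymptotics.isBigO_refl _ _
  have h5 := h4.add_const (PowerSeries.coeff 0 c)
  rw [zero_add] at h5
  refine h5.congr fun τ => ?_
  rw [div_mul_cancel₀ _ (hq0 τ), sub_add_cancel]

theorem MF.of_bounded {k : ℕ} {f : ℍ → ℂ} (holo : MDiff f)
    (T_inv : ∀ τ : ℍ, f ((1 : ℝ) +ᵥ τ) = f τ) (S_inv : ∀ τ : ℍ, f (S • τ) = (τ : ℂ) ^ k * f τ)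
    (hb : IsBoundedAtImInfty f) : MF k f := by
  have hS : f ∣[(k:ℤ)] S = f := by
    ext τ
    rw [slash_S_apply, S_inv, mul_div_cancel_left₀ _ (pow_ne_zero _ τ.ne_zero)]
  have hT : f ∣[(k:ℤ)] T = f := by
    ext τ
    rw [slash_T_apply, T_inv]
  have hall := SlashInvariantForm.slash_action_generators_SL2Z hS hT
  exact MF.of_modularForm
    { toFun := f
      slash_action_eq' := fun _ ⟨γ, hγ⟩ ↦ hγ ▸ hall γ
      holo' := holo
      bdd_at_cusps' := fun {c} hc => by
        rw [Subgroup.IsArithmetic.isCusp_iff_isCusp_SL2Z] at hc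
        rw [OnePoint.isBoundedAt_iff_forall_SL2Z hc]
        intro γ _
        rw [hall γ]
        exact hb }

/-- Every complex number is a value of `j`. -/
theorem exists_j_eq (r : ℂ) : ∃ τ : ℍ, e4 τ ^ 3 = r * dl τ := by
  by_contra! hne
  have cc_cdl : PowerSeries.constantCoeff cdl = 0 := by
    rw [← PowerSeries.coeff_zero_eq_constantCoeff_apply, coeff_zero_cdl]
  have hF : MF 12 (fun τ => e4 τ ^ 3 - r * dl τ) := (mf_e4.pow 3).sub (mf_dl.smul r)
  have hF0 : ∀ τ, e4 τ ^ 3 - r * dl τ ≠ 0 := fun τ => sub_ne_zero.mpr (hne τ)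
  have ht1 : Filter.Tendsto (fun τ => e4 τ ^ 3 - r * dl τ) atImInfty (nhds 1) := by
    have := ((qRep_e4.pow 3).sub (qRep_dl.smul r)).tendsto
    simpa [cc_cdl] using this
  have ht2 : Filter.Tendsto dl atImInfty (nhds 0) := by
    simpa [cc_cdl] using qRep_dl.tendsto
  have ht : Filter.Tendsto (fun τ => dl τ / (e4 τ ^ 3 - r * dl τ)) atImInfty (nhds 0) := by
    have := ht2.div ht1 one_ne_zero
    rwa [zero_div] at this
  have hg : MF 0 (fun τ => dl τ / (e4 τ ^ 3 - r * dl τ)) := by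
    refine MF.of_bounded ?_ (fun τ => ?_) (fun τ => ?_) (ht.isBigO_one ℝ)
    · rw [UpperHalfPlane.mdifferentiable_iff]
      exact (UpperHalfPlane.mdifferentiable_iff.mp mf_dl.holo).div (UpperHalfPlane.mdifferentiable_iff.mp hF.holo)
        (fun z _ => hF0 _)
    · have h1 := hF.T_inv τ
      have h2 := mf_dl.T_inv τ
      rw [h1, h2]
    · have h1 := hF.S_inv τ
      have h2 := mf_dl.S_inv τ
      rw [h1, h2, pow_zero, one_mul, mul_div_mul_left _ _ (pow_ne_zero _ τ.ne_zero)]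
  obtain ⟨a, ha⟩ := hg.eq_const
  rw [funext ha] at ht
  have ha0 : a = 0 := tendsto_nhds_unique tendsto_const_nhds ht
  have := ha UpperHalfPlane.I
  rw [ha0, div_eq_zero_iff] at this
  exact this.elim (dl_ne_zero _) (hF0 _)
end Birch

end

section

open UpperHalfPlane ModularForm ModularGroup MatrixGroups Complex Manifold

namespace Birch

/-- `red` is the residue map of a valuation ring of `ℂ`, with residue characteristic `p`. -/
structure Place (p : ℕ) {V : Subring ℂ} {κ : Type} [Field κ] (red : V →+* κ) : Prop where
  charP : CharP κ p
  val : ∀ x : ℂ, x ∈ V ∨ ∃ h : x⁻¹ ∈ V, red ⟨x⁻¹, h⟩ = 0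

theorem exists_place (p : ℕ) (hp : p.Prime) :
    ∃ (V : Subring ℂ) (κ : Type) (_ : Field κ) (red : V →+* κ), Place p red := by
  let A : Subring ℂ := (Int.castRingHom ℂ).range
  let e : ℤ →+* A := (Int.castRingHom ℂ).rangeRestrict
  have he : Function.Bijective e :=
    ⟨fun a b h => by
      have := congrArg (fun x : A => (x : ℂ)) h
      exact Int.cast_injective (α := ℂ) this, (Int.castRingHom ℂ).rangeRestrict_surjective⟩
  let I : Ideal A := Ideal.span {e p}
  have hI : I ≠ ⊤ := by
    intro h
    rw [Ideal.span_singleton_eq_top] at h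
    have h2 : IsUnit (p : ℤ) := (isUnit_map_iff (RingEquiv.ofBijective e he) (p : ℤ)).mp h
    exact (Nat.prime_iff_prime_int.mp hp).not_isUnit h2
  obtain ⟨B, -, hB⟩ := Ideal.image_subset_nonunits_valuationSubring I hI
  have hpB : (p : ℂ) ∈ B.nonunits := hB ⟨e p, Ideal.subset_span rfl, by simp [e]⟩
  refine ⟨B.toSubring, IsLocalRing.ResidueField B, inferInstance, IsLocalRing.residue B, ⟨?_, ?_⟩⟩
  · have h0 : ((p : ℕ) : IsLocalRing.ResidueField B) = 0 := by
      rw [← map_natCast (IsLocalRing.residue B), IsLocalRing.residue_eq_zero_iff]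
      obtain ⟨h, h'⟩ := ValuationSubring.mem_nonunits_iff_exists_mem_maximalIdeal.mp hpB
      exact h'
    exact (CharP.charP_iff_prime_eq_zero hp).mpr h0
  · intro x
    rcases B.mem_or_inv_mem x with h | h
    · exact Or.inl h
    · by_cases hx : x ∈ B
      · exact Or.inl hx
      · refine Or.inr ⟨h, ?_⟩
        change IsLocalRing.residue B ⟨x⁻¹, h⟩ = 0
        rw [IsLocalRing.residue_eq_zero_iff]
        have : x⁻¹ ∈ B.nonunits := B.inv_mem_nonunits_iff.mpr (Or.inr hx)
        exact (ValuationSubring.mem_nonunits_iff_exists_mem_maximalIdeal.mp this).2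

section
variable {V : Subring ℂ} {κ : Type} [Field κ] (red : V →+* κ)

/-- `x` is integral with residue `a`. -/
def Rd (x : ℂ) (a : κ) : Prop := ∃ h : x ∈ V, red ⟨x, h⟩ = a

/-- `c` is a power series with integral coefficients and residue `g`. -/
def Red (c : PowerSeries ℂ) (g : PowerSeries κ) : Prop :=
  ∃ c' : PowerSeries V, c'.map V.subtype = c ∧ c'.map red = g

/-- The kernel of the residue map. -/
def kerMod : Submodule V ℂ where
  carrier := {x | Rd red x 0}
  add_mem' := by
    rintro x y ⟨hx, hx'⟩ ⟨hy, hy'⟩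
    exact ⟨V.add_mem hx hy, by
      rw [show (⟨x + y, V.add_mem hx hy⟩ : V) = ⟨x, hx⟩ + ⟨y, hy⟩ from rfl, map_add, hx', hy',
        add_zero]⟩
  zero_mem' := ⟨V.zero_mem, map_zero red⟩
  smul_mem' := by
    rintro c x ⟨hx, hx'⟩
    exact ⟨V.mul_mem c.2 hx, by
      rw [show (⟨c • x, V.mul_mem c.2 hx⟩ : V) = c * ⟨x, hx⟩ from rfl, map_mul, hx', mul_zero]⟩

variable {red}

theorem mem_kerMod {x : ℂ} : x ∈ kerMod red ↔ Rd red x 0 := Iff.rfl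

namespace Rd
variable {x y : ℂ} {a b : κ}

theorem coe (x : V) : Rd red (x : ℂ) (red x) := ⟨x.2, rfl⟩

theorem mem (h : Rd red x a) : x ∈ V := h.1

theorem exists_of_mem (h : x ∈ V) : ∃ a, Rd red x a := ⟨_, h, rfl⟩

theorem unique (h : Rd red x a) (h' : Rd red x b) : a = b := h.2.symm.trans h'.2

theorem add (h : Rd red x a) (h' : Rd red y b) : Rd red (x + y) (a + b) := by
  obtain ⟨h1, rfl⟩ := h
  obtain ⟨h2, rfl⟩ := h'
  exact ⟨V.add_mem h1 h2, by rw [← map_add]; rfl⟩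

theorem sub (h : Rd red x a) (h' : Rd red y b) : Rd red (x - y) (a - b) := by
  obtain ⟨h1, rfl⟩ := h
  obtain ⟨h2, rfl⟩ := h'
  exact ⟨V.sub_mem h1 h2, by rw [← map_sub]; rfl⟩

theorem mul (h : Rd red x a) (h' : Rd red y b) : Rd red (x * y) (a * b) := by
  obtain ⟨h1, rfl⟩ := h
  obtain ⟨h2, rfl⟩ := h'
  exact ⟨V.mul_mem h1 h2, by rw [← map_mul]; rfl⟩

theorem neg (h : Rd red x a) : Rd red (-x) (-a) := by
  obtain ⟨h1, rfl⟩ := h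
  exact ⟨V.neg_mem h1, by rw [← map_neg]; rfl⟩

theorem pow (h : Rd red x a) (n : ℕ) : Rd red (x ^ n) (a ^ n) := by
  obtain ⟨h1, rfl⟩ := h
  exact ⟨V.pow_mem h1 n, by rw [← map_pow]; rfl⟩

theorem intCast (n : ℤ) : Rd red (n : ℂ) (n : κ) := ⟨intCast_mem V n, map_intCast red n⟩

theorem natCast (n : ℕ) : Rd red (n : ℂ) (n : κ) := ⟨natCast_mem V n, map_natCast red n⟩

theorem one : Rd red 1 1 := ⟨V.one_mem, map_one red⟩

theorem zero : Rd red 0 0 := ⟨V.zero_mem, map_zero red⟩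

theorem sum {ι : Type*} (s : Finset ι) {u : ι → ℂ} {v : ι → κ} (h : ∀ i ∈ s, Rd red (u i) (v i)) :
    Rd red (∑ i ∈ s, u i) (∑ i ∈ s, v i) := by
  classical
  induction s using Finset.induction_on with
  | empty => exact zero
  | insert i s hi ih =>
    rw [Finset.sum_insert hi, Finset.sum_insert hi]
    exact (h i (by simp)).add (ih fun j hj => h j (by simp [hj]))

theorem inv {p : ℕ} (hP : Place p red) (h : Rd red x a) (ha : a ≠ 0) : Rd red x⁻¹ a⁻¹ := by
  have hx : x ≠ 0 := by
    rintro rfl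
    exact ha (h.unique zero)
  have hV : x⁻¹ ∈ V := by
    rcases hP.val x⁻¹ with h1 | ⟨h1, h2⟩
    · exact h1
    · have : Rd red x 0 := by
        have : Rd red x⁻¹⁻¹ 0 := ⟨h1, h2⟩
        rwa [inv_inv] at this
      exact absurd (h.unique this) ha
  obtain ⟨b, hb⟩ := exists_of_mem (red := red) hV
  have h1 := h.mul hb
  rw [mul_inv_cancel₀ hx] at h1
  have := one.unique h1
  rwa [eq_inv_of_mul_eq_one_right this.symm] at hb

theorem div {p : ℕ} (hP : Place p red) (h : Rd red x a) (h' : Rd red y b) (hb : b ≠ 0) :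
    Rd red (x / y) (a / b) := by
  rw [div_eq_mul_inv, div_eq_mul_inv]
  exact h.mul (h'.inv hP hb)

end Rd

namespace Red
variable {c d : PowerSeries ℂ} {g h : PowerSeries κ}

theorem coeff (hc : Red red c g) (n : ℕ) :
    Rd red (PowerSeries.coeff n c) (PowerSeries.coeff n g) := by
  obtain ⟨c', rfl, rfl⟩ := hc
  simp only [PowerSeries.coeff_map]
  exact Rd.coe _

theorem of_coeff (h : ∀ n, Rd red (PowerSeries.coeff n c) (PowerSeries.coeff n g)) :
    Red red c g := by
  refine ⟨PowerSeries.mk fun n => ⟨PowerSeries.coeff n c, (h n).1⟩, ?_, ?_⟩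
  · ext n; simp
  · ext n; simpa using (h n).2

theorem add (hc : Red red c g) (hd : Red red d h) : Red red (c + d) (g + h) := by
  obtain ⟨c', rfl, rfl⟩ := hc
  obtain ⟨d', rfl, rfl⟩ := hd
  exact ⟨c' + d', map_add _ _ _, map_add _ _ _⟩

theorem sub (hc : Red red c g) (hd : Red red d h) : Red red (c - d) (g - h) := by
  obtain ⟨c', rfl, rfl⟩ := hc
  obtain ⟨d', rfl, rfl⟩ := hd
  exact ⟨c' - d', map_sub _ _ _, map_sub _ _ _⟩

theorem mul (hc : Red red c g) (hd : Red red d h) : Red red (c * d) (g * h) := by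
  obtain ⟨c', rfl, rfl⟩ := hc
  obtain ⟨d', rfl, rfl⟩ := hd
  exact ⟨c' * d', map_mul _ _ _, map_mul _ _ _⟩

theorem pow (hc : Red red c g) (n : ℕ) : Red red (c ^ n) (g ^ n) := by
  obtain ⟨c', rfl, rfl⟩ := hc
  exact ⟨c' ^ n, map_pow _ _ _, map_pow _ _ _⟩

theorem C {x : ℂ} {a : κ} (h : Rd red x a) : Red red (PowerSeries.C x) (PowerSeries.C a) := by
  obtain ⟨h1, rfl⟩ := h
  exact ⟨PowerSeries.C ⟨x, h1⟩, PowerSeries.map_C _ _, PowerSeries.map_C _ _⟩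

theorem expand {n : ℕ} (hn : n ≠ 0) (hc : Red red c g) : Red red (c.expand n hn) (g.expand n hn) := by
  obtain ⟨c', rfl, rfl⟩ := hc
  exact ⟨c'.expand n hn, PowerSeries.map_expand .., PowerSeries.map_expand ..⟩

theorem rescale {x : ℂ} {a : κ} (hx : Rd red x a) (hc : Red red c g) :
    Red red (PowerSeries.rescale x c) (PowerSeries.rescale a g) := by
  refine of_coeff fun n => ?_
  rw [PowerSeries.coeff_rescale, PowerSeries.coeff_rescale]
  exact (hx.pow n).mul (hc.coeff n)

theorem map_int (c : PowerSeries ℤ) :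
    Red red (c.map (Int.castRingHom ℂ)) (c.map (Int.castRingHom κ)) := by
  refine of_coeff fun n => ?_
  rw [PowerSeries.coeff_map, PowerSeries.coeff_map]
  exact Rd.intCast _

theorem prod {ι : Type*} (s : Finset ι) {u : ι → PowerSeries ℂ} {v : ι → PowerSeries κ}
    (h : ∀ i ∈ s, Red red (u i) (v i)) : Red red (∏ i ∈ s, u i) (∏ i ∈ s, v i) := by
  classical
  induction s using Finset.induction_on with
  | empty => exact ⟨1, map_one _, map_one _⟩
  | insert i s hi ih =>
    rw [Finset.prod_insert hi, Finset.prod_insert hi]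
    exact (h i (by simp)).mul (ih fun j hj => h j (by simp [hj]))

theorem unique {g' : PowerSeries κ} (hc : Red red c g) (hc' : Red red c g') : g = g' := by
  ext n
  exact (hc.coeff n).unique (hc'.coeff n)

theorem coeffIn_ker (hc : Red red c 0) : CoeffIn (kerMod red) c := fun n => by
  simpa using! hc.coeff n

end Red

/-- Power series over `κ` whose `p`-th power is their expansion. -/
def Fr (p : ℕ) (hp : p ≠ 0) (g : PowerSeries κ) : Prop := g ^ p = g.expand p hp

theorem expand_pow_eq (p : ℕ) [Fact p.Prime] [CharP κ p] (hp : p ≠ 0) (g : PowerSeries κ)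
    (h : ∀ n, (PowerSeries.coeff n g) ^ p = PowerSeries.coeff n g) : Fr p hp g := by
  have : ExpChar κ p := ExpChar.prime Fact.out
  have h1 : (PowerSeries.expand p hp g).map (frobenius κ p) = g ^ p :=
    MvPowerSeries.map_frobenius_expand p hp
  rw [Fr, ← h1]
  ext n
  rw [PowerSeries.coeff_map, PowerSeries.coeff_expand]
  split_ifs
  · exact h _
  · exact map_zero _

theorem Fr.map_int (p : ℕ) [Fact p.Prime] [CharP κ p] (hp : p ≠ 0) (c : PowerSeries ℤ) :
    Fr p hp (c.map (Int.castRingHom κ)) := by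
  have : ExpChar κ p := ExpChar.prime Fact.out
  refine expand_pow_eq p hp _ fun n => ?_
  rw [PowerSeries.coeff_map]
  exact map_intCast (frobenius κ p) _

/-- An element which satisfies a monic equation over the valuation ring belongs to it. -/
theorem Place.mem_of_monic {p : ℕ} (hP : Place p red) {f : Polynomial V} (hf : f.Monic) {x : ℂ}
    (hx : (f.map V.subtype).eval x = 0) : x ∈ V := by
  by_cases hx0 : x = 0
  · rw [hx0]
    exact V.zero_mem
  rcases hP.val x with h | ⟨h, h0⟩
  · exact h
  exfalso
  set y : V := ⟨x⁻¹, h⟩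
  have h1 : f.reverse.eval₂ V.subtype x⁻¹ = 0 := by
    have : Invertible x := invertibleOfNonzero hx0
    have := Polynomial.eval₂_reverse_eq_zero_iff V.subtype x f
    rw [invOf_eq_inv] at this
    rw [this, Polynomial.eval₂_eq_eval_map, hx]
  have h2 : f.reverse.eval y = 0 := by
    apply Subtype.coe_injective
    have : V.subtype (f.reverse.eval y) = f.reverse.eval₂ V.subtype (V.subtype y) :=
      (Polynomial.eval₂_at_apply V.subtype y).symm
    exact this.trans h1
  have h3 := congrArg red h2
  rw [← Polynomial.eval₂_at_apply, h0, Polynomial.eval₂_at_zero,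
    Polynomial.coeff_zero_reverse, hf.leadingCoeff, map_one, map_zero] at h3
  exact one_ne_zero h3

end
end Birch

end

section

open UpperHalfPlane ModularForm ModularGroup MatrixGroups Complex Manifold

namespace Birch

theorem MF.act {k : ℕ} {f : ℍ → ℂ} (hf : MF k f) {a b c d : ℤ} (h : a * d - b * c = 1) {τ τ' : ℍ}
    (hτ : (τ' : ℂ) * (c * τ + d) = a * τ + b) : f τ' = ((c : ℂ) * τ + d) ^ k * f τ := by
  obtain ⟨F, rfl⟩ := hf.exists_modularForm
  let g : SL(2, ℤ) := ⟨!![a, b; c, d], by rw [Matrix.det_fin_two_of, h]⟩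
  have hd : denom (g : GL (Fin 2) ℝ) τ = (c : ℂ) * τ + d := by
    rw [ModularGroup.denom_apply]; simp [g]
  have hg : τ' = g • τ := by
    apply UpperHalfPlane.ext
    have h0 : (c : ℂ) * τ + d ≠ 0 := by
      rw [← hd]; exact denom_ne_zero _ _
    rw [UpperHalfPlane.coe_specialLinearGroup_apply]
    simp only [g, Matrix.of_apply, Matrix.cons_val', Matrix.cons_val_zero,
      Matrix.cons_val_one, Matrix.cons_val_fin_one, algebraMap_int_eq, eq_intCast]
    push_cast
    rw [eq_div_iff h0, hτ]
  have := SlashInvariantForm.slash_action_eqn'' F (γ := (g : GL (Fin 2) ℝ)) (MonoidHom.mem_range.mpr ⟨g, rfl⟩) τ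
  rw [hd] at this
  rw [hg]
  exact_mod_cast this

theorem MF.add_int {k : ℕ} {f : ℍ → ℂ} (hf : MF k f) (n : ℤ) {τ τ' : ℍ} (h : (τ' : ℂ) = τ + n) :
    f τ' = f τ := by
  have := hf.act (a := 1) (b := n) (c := 0) (d := 1) (by ring) (τ := τ) (τ' := τ') (by simp [h])
  simpa using this

theorem mdiff_comp {f : ℍ → ℂ} (hf : MDiff f) {pt : ℍ → ℍ} {φ : ℂ → ℂ} (hφ : Differentiable ℂ φ)
    (h : ∀ τ : ℍ, (pt τ : ℂ) = φ τ) : MDiff (fun τ => f (pt τ)) := by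
  rw [UpperHalfPlane.mdifferentiable_iff] at hf ⊢
  have hm : Set.MapsTo φ {z | 0 < z.im} {z | 0 < z.im} := fun z hz => by
    have := h ⟨z, hz⟩
    simp only at this
    change 0 < (φ z).im
    rw [← this]
    exact (pt ⟨z, hz⟩).im_pos
  refine (hf.comp hφ.differentiableOn hm).congr fun z hz => ?_
  have h1 : ofComplex (φ z) = pt ⟨z, hz⟩ := by
    rw [← h ⟨z, hz⟩, ofComplex_apply]
  change f (pt (ofComplex z)) = f (ofComplex (φ z))
  rw [h1, ofComplex_apply_of_im_pos hz]

section
variable (p : ℕ) [hp : Fact p.Prime]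

theorem p_pos : (0 : ℝ) < p := by exact_mod_cast hp.out.pos

/-- The point `p τ`. -/
noncomputable def ptInf (τ : ℍ) : ℍ :=
  ⟨p * τ, by
    have := mul_pos (p_pos p) τ.im_pos
    simpa using this⟩

/-- The point `(τ + n) / p`. -/
noncomputable def ptFin (n : ℤ) (τ : ℍ) : ℍ :=
  ⟨(τ + n) / p, by
    have := div_pos τ.im_pos (p_pos p)
    simpa using this⟩

@[simp] theorem coe_ptInf (τ : ℍ) : (ptInf p τ : ℂ) = p * τ := rfl

@[simp] theorem coe_ptFin (n : ℤ) (τ : ℍ) : (ptFin p n τ : ℂ) = (τ + n) / p := rfl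

theorem p_ne : (p : ℂ) ≠ 0 := by exact_mod_cast hp.out.ne_zero

variable {p}

theorem MF.ptFin_congr {k : ℕ} {f : ℍ → ℂ} (hf : MF k f) {m n : ℤ} (h : (m : ZMod p) = n) (τ : ℍ) :
    f (ptFin p m τ) = f (ptFin p n τ) := by
  obtain ⟨c, hc⟩ := (ZMod.intCast_eq_intCast_iff_dvd_sub _ _ _).mp h
  refine (hf.add_int c ?_).symm
  have : (n : ℂ) = m + p * c := by
    rw [← sub_eq_iff_eq_add']; exact_mod_cast hc
  rw [coe_ptFin, coe_ptFin, this]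
  field_simp [p_ne p]
  ring

/-- The point attached to a Hecke coset. -/
noncomputable def pt (γ : Option (ZMod p)) (τ : ℍ) : ℍ :=
  match γ with
  | none => ptInf p τ
  | some b => ptFin p (b.val : ℤ) τ

/-- The translate of a form of weight `w` by a Hecke coset. -/
noncomputable def tr (w : ℕ) (f : ℍ → ℂ) (γ : Option (ZMod p)) (τ : ℍ) : ℂ :=
  match γ with
  | none => (p : ℂ) ^ w * f (ptInf p τ)
  | some b => f (ptFin p (b.val : ℤ) τ)

/-- The action of `S` on the Hecke cosets. -/
noncomputable def sg : Option (ZMod p) → Option (ZMod p)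
  | none => some 0
  | some b => if b = 0 then none else some (-b⁻¹)

theorem sg_sg (γ : Option (ZMod p)) : sg (sg γ) = γ := by
  rcases γ with _ | b
  · simp [sg]
  · by_cases hb : b = 0
    · simp [sg, hb]
    · have : (-b⁻¹ : ZMod p) ≠ 0 := by simpa using hb
      simp [sg, hb]

variable (p) in
/-- A family of functions indexed by the Hecke cosets and permuted by the modular group. -/
structure Fam (w : ℕ) (u : Option (ZMod p) → ℍ → ℂ) : Prop where
  holo : ∀ γ, MDiff (u γ)
  T_inv : ∀ γ τ, u γ ((1 : ℝ) +ᵥ τ) = u (γ.map (· + 1)) τ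
  S_inv : ∀ γ τ, u γ (S • τ) = (τ : ℂ) ^ w * u (sg γ) τ
  rep : ∀ γ, ∃ c, QRep p (u γ) c

namespace QRep

theorem expand_left {N m : ℕ} (hm : m ≠ 0) {f : ℍ → ℂ} {c : PowerSeries ℂ} (hf : QRep N f c) :
    QRep (N * m) f (c.expand m hm) := by
  intro τ
  have hi : Function.Injective (fun n : ℕ => m * n) := fun a b h => by
    simpa [hm] using h
  rw [← hi.hasSum_iff]
  · refine (hf τ).congr_fun fun n => ?_
    simp only [Function.comp_apply, PowerSeries.coeff_expand_mul]
    congr 1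
    rw [pow_mul]
    congr 1
    rw [Function.Periodic.qParam, Function.Periodic.qParam, ← Complex.exp_nat_mul]
    congr 1
    have : (m : ℂ) ≠ 0 := by exact_mod_cast hm
    push_cast
    rcases eq_or_ne (N : ℂ) 0 with h | h
    · simp [h]
    · field_simp
  · intro n hn
    rw [PowerSeries.coeff_expand, if_neg, zero_mul]
    rintro ⟨k, rfl⟩
    exact hn ⟨k, rfl⟩

theorem comp_ptInf {f : ℍ → ℂ} {c : PowerSeries ℂ} {N : ℕ} (hf : QRep N f c) :
    QRep N (fun τ => f (ptInf p τ)) (c.expand p hp.out.ne_zero) := by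
  intro τ
  have hm := hp.out.ne_zero
  have hi : Function.Injective (fun n : ℕ => p * n) := fun a b h => by
    simpa [hm] using h
  rw [← hi.hasSum_iff]
  · refine (hf (ptInf p τ)).congr_fun fun n => ?_
    simp only [Function.comp_apply, PowerSeries.coeff_expand_mul]
    congr 1
    rw [pow_mul]
    congr 1
    rw [Function.Periodic.qParam, Function.Periodic.qParam, ← Complex.exp_nat_mul]
    congr 1
    rw [coe_ptInf]
    ring
  · intro n hn
    rw [PowerSeries.coeff_expand, if_neg, zero_mul]
    rintro ⟨k, rfl⟩
    exact hn ⟨k, rfl⟩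

theorem comp_ptFin {f : ℍ → ℂ} {c : PowerSeries ℂ} (hf : QRep 1 f c) (m : ℤ) :
    QRep p (fun τ => f (ptFin p m τ))
      (c.rescale (Complex.exp (2 * Real.pi * Complex.I * m / p))) := by
  intro τ
  refine (hf (ptFin p m τ)).congr_fun fun n => ?_
  rw [PowerSeries.coeff_rescale, mul_comm (_ ^ n), mul_assoc, ← mul_pow, Function.Periodic.qParam,
    Function.Periodic.qParam, ← Complex.exp_add]
  congr 4
  rw [coe_ptFin]
  push_cast
  ring

end QRep

theorem MF.fam_tr {w : ℕ} {f : ℍ → ℂ} (hf : MF w f) : Fam p w (tr w f) where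
  holo γ := by
    rcases γ with _ | b
    · have := mdiff_comp hf.holo (pt := ptInf p) (φ := fun z => p * z) (by fun_prop) (fun τ => rfl)
      rw [UpperHalfPlane.mdifferentiable_iff] at this ⊢
      exact this.const_mul _
    · exact mdiff_comp hf.holo (pt := ptFin p (b.val : ℤ)) (φ := fun z => (z + (b.val : ℤ)) / p)
        (by fun_prop) (fun τ => rfl)
  T_inv γ τ := by
    rcases γ with _ | b
    · change (p : ℂ) ^ w * f _ = (p : ℂ) ^ w * f _
      congr 1
      refine hf.add_int p ?_
      simp; ring
    · change f _ = f _
      trans f (ptFin p ((b.val : ℤ) + 1) τ)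
      · congr 1
        apply UpperHalfPlane.ext
        simp; ring
      · apply hf.ptFin_congr
        simp
  S_inv γ τ := by
    have hp0 := p_ne p
    have hτ := τ.ne_zero
    have hS : ((S • τ : ℍ) : ℂ) = -1 / τ := by
      rw [UpperHalfPlane.modular_S_smul]
      change (-(τ : ℂ))⁻¹ = _
      rw [inv_neg, neg_div, one_div]
    generalize (S • τ : ℍ) = σ at hS ⊢
    rcases γ with _ | b
    · simp only [tr, sg]
      rw [hf.act (a := 0) (b := -1) (c := 1) (d := 0) (by ring) (τ := ptFin p ((0 : ZMod p).val : ℤ) τ)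
        (by simp [hS]; field_simp)]
      simp only [coe_ptFin]
      rw [← mul_assoc, ← mul_pow]
      congr 2
      simp
      field_simp
    · by_cases hb : b = 0
      · simp only [tr, sg, hb, if_true]
        rw [hf.act (a := 0) (b := -1) (c := 1) (d := 0) (by ring) (τ := ptInf p τ)
          (by simp [hS]; field_simp)]
        rw [← mul_assoc, ← mul_pow]
        congr 2
        simp
        ring
      · simp only [tr, sg, hb, if_false]
        obtain ⟨e, he⟩ : ∃ e : ℤ, 1 + (b.val : ℤ) * ((-b⁻¹ : ZMod p).val : ℤ) = p * e := by
          have : (p : ℤ) ∣ 1 + (b.val : ℤ) * ((-b⁻¹ : ZMod p).val : ℤ) := by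
            rw [← ZMod.intCast_zmod_eq_zero_iff_dvd]
            push_cast
            simp [hb]
          exact this
        set b' : ℤ := ((-b⁻¹ : ZMod p).val : ℤ)
        rw [hf.act (a := b.val) (b := -e) (c := p) (d := -b') (by linarith)
          (τ := ptFin p b' τ)]
        · congr 2
          simp
          field_simp
          ring
        · have he' : (1 : ℂ) + b.val * b' = p * e := by exact_mod_cast he
          simp only [coe_ptFin, hS]
          push_cast
          field_simp
          linear_combination -(τ : ℂ) * he'
  rep γ := by
    obtain ⟨c, hc⟩ := hf.rep
    rcases γ with _ | b
    · have := (hc.expand_left hp.out.ne_zero).comp_ptInf (p := p)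
      rw [one_mul] at this
      exact ⟨_, this.smul _⟩
    · exact ⟨_, hc.comp_ptFin _⟩

namespace Fam
variable {w l : ℕ} {u v : Option (ZMod p) → ℍ → ℂ}

theorem const {f : ℍ → ℂ} (hf : MF w f) : Fam p w (fun _ => f) where
  holo _ := hf.holo
  T_inv _ τ := hf.T_inv τ
  S_inv _ τ := hf.S_inv τ
  rep _ := by
    obtain ⟨c, hc⟩ := hf.rep
    have := hc.expand_left hp.out.ne_zero
    rw [one_mul] at this
    exact ⟨_, this⟩

theorem mul (hu : Fam p w u) (hv : Fam p l v) : Fam p (w + l) (fun γ τ => u γ τ * v γ τ) where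
  holo γ := (UpperHalfPlane.mdifferentiable_iff.mpr <|
    (UpperHalfPlane.mdifferentiable_iff.mp (hu.holo γ)).mul
    (UpperHalfPlane.mdifferentiable_iff.mp (hv.holo γ)))
  T_inv γ τ := by rw [hu.T_inv, hv.T_inv]
  S_inv γ τ := by rw [hu.S_inv, hv.S_inv]; ring
  rep γ := by
    obtain ⟨c, hc⟩ := hu.rep γ
    obtain ⟨d, hd⟩ := hv.rep γ
    exact ⟨_, hc.mul hd⟩

theorem sub (hu : Fam p w u) (hv : Fam p w v) : Fam p w (fun γ τ => u γ τ - v γ τ) where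
  holo γ := (UpperHalfPlane.mdifferentiable_iff.mpr <|
    (UpperHalfPlane.mdifferentiable_iff.mp (hu.holo γ)).sub
    (UpperHalfPlane.mdifferentiable_iff.mp (hv.holo γ)))
  T_inv γ τ := by rw [hu.T_inv, hv.T_inv]
  S_inv γ τ := by rw [hu.S_inv, hv.S_inv]; ring
  rep γ := by
    obtain ⟨c, hc⟩ := hu.rep γ
    obtain ⟨d, hd⟩ := hv.rep γ
    exact ⟨_, hc.sub hd⟩

theorem prod (hu : Fam p w u) : MF (w * (p + 1)) (fun τ => ∏ γ, u γ τ) := by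
  refine MF.of_bounded ?_ (fun τ => ?_) (fun τ => ?_) ?_
  · rw [UpperHalfPlane.mdifferentiable_iff]
    have : ((fun τ => ∏ γ, u γ τ) ∘ ofComplex) = fun z => ∏ γ, (u γ ∘ ofComplex) z := rfl
    rw [this]
    exact DifferentiableOn.fun_finsetProd fun γ _ => UpperHalfPlane.mdifferentiable_iff.mp (hu.holo γ)
  · simp only [hu.T_inv]
    exact Fintype.prod_equiv (Equiv.optionCongr (Equiv.addRight (1 : ZMod p))) _ _ (fun γ => rfl)
  · simp only [hu.S_inv]
    rw [Finset.prod_mul_distrib, Finset.prod_const, Finset.card_univ, Fintype.card_option, ZMod.card,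
      ← pow_mul]
    congr 1
    exact Fintype.prod_equiv ⟨sg, sg, sg_sg, sg_sg⟩ _ _ (fun γ => rfl)
  · choose c hc using hu.rep
    have h := QRep.prod Finset.univ (fun γ _ => hc γ)
    exact isBoundedAtImInfty_of_hasSum_qExpansion (h := p) (p_pos p) (c := fun n => PowerSeries.coeff n _)
      (by simpa [QRep] using! h)

end Fam
end
end Birch

end

section

open UpperHalfPlane ModularForm ModularGroup MatrixGroups Complex Manifold

set_option linter.unusedSectionVars false

namespace Birch

section
variable {p : ℕ} [hp : Fact p.Prime] {V : Subring ℂ} {κ : Type} [Field κ] {red : V →+* κ}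

theorem Place.natCast_eq_zero (hP : Place p red) (n : ℕ) : (n : κ) = 0 ↔ p ∣ n :=
  have := hP.charP
  CharP.cast_eq_zero_iff κ p n

theorem not_dvd_1728 (hp5 : 5 ≤ p) : ¬ p ∣ 1728 := by
  intro h
  rw [show 1728 = 2 ^ 6 * 3 ^ 3 by norm_num] at h
  rcases (Nat.Prime.dvd_mul hp.out).mp h with h | h
  · have := Nat.le_of_dvd (by norm_num) (hp.out.dvd_of_dvd_pow h)
    omega
  · have := Nat.le_of_dvd (by norm_num) (hp.out.dvd_of_dvd_pow h)
    omega

theorem Place.ne_1728 (hP : Place p red) (hp5 : 5 ≤ p) : (1728 : κ) ≠ 0 := by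
  have := mt (hP.natCast_eq_zero 1728).mp (not_dvd_1728 hp5)
  exact_mod_cast this

theorem Place.rd_1728 (hP : Place p red) (hp5 : 5 ≤ p) : Rd red (1 / 1728) (1 / 1728) :=
  Rd.one.div hP (by exact_mod_cast Rd.natCast (red := red) 1728) (hP.ne_1728 hp5)

theorem Place.mem_1728 (hP : Place p red) (hp5 : 5 ≤ p) : (1 / 1728 : ℂ) ∈ V := (hP.rd_1728 hp5).mem

theorem Place.rd_zeta (hP : Place p red) (m : ℤ) :
    Rd red (Complex.exp (2 * Real.pi * Complex.I * m / p)) 1 := by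
  have := hP.charP
  have h1 : Complex.exp (2 * Real.pi * Complex.I * m / p) ^ p = 1 := by
    rw [← Complex.exp_nat_mul, Complex.exp_eq_one_iff]
    exact ⟨m, by field_simp [p_ne p]⟩
  have hmem : Complex.exp (2 * Real.pi * Complex.I * m / p) ∈ V := by
    refine hP.mem_of_monic (f := Polynomial.X ^ p - Polynomial.C 1)
      (Polynomial.monic_X_pow_sub_C 1 hp.out.ne_zero) ?_
    simp [h1]
  obtain ⟨a, ha⟩ := Rd.exists_of_mem (red := red) hmem
  have h2 := ha.pow p
  rw [h1] at h2
  have h3 : a ^ p = 1 := h2.unique Rd.one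
  have h4 : (a - 1) ^ p = 0 := by rw [sub_pow_char, h3, one_pow, sub_self]
  have h5 := pow_eq_zero_iff hp.out.ne_zero |>.mp h4
  rwa [sub_eq_zero.mp h5] at ha

namespace Fr
variable {g h : PowerSeries κ} {hp0 : p ≠ 0}

theorem mul (hg : Fr p hp0 g) (hh : Fr p hp0 h) : Fr p hp0 (g * h) := by
  rw [Fr, mul_pow, map_mul, hg, hh]

theorem sub [CharP κ p] (hg : Fr p hp0 g) (hh : Fr p hp0 h) : Fr p hp0 (g - h) := by
  have : CharP (PowerSeries κ) p := charP_of_injective_ringHom (PowerSeries.C_injective (R := κ)) p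
  rw [Fr, sub_pow_char, map_sub, hg, hh]

theorem pow (hg : Fr p hp0 g) (n : ℕ) : Fr p hp0 (g ^ n) := by
  rw [Fr, ← pow_mul, mul_comm, pow_mul, hg, map_pow]

theorem C {a : κ} (ha : a ^ p = a) : Fr p hp0 (PowerSeries.C a) := by
  rw [Fr, ← map_pow, ha, PowerSeries.expand_C]

end Fr

variable (p κ) in
/-- The reduction of the expansion of `dl`. -/
noncomputable def gdl : PowerSeries κ :=
  PowerSeries.C (1 / 1728) *
    ((c4.map (Int.castRingHom κ)) ^ 3 - (c6.map (Int.castRingHom κ)) ^ 2)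

theorem Place.red_cdl (hP : Place p red) (hp5 : 5 ≤ p) : Red red cdl (gdl κ) :=
  (Red.C (hP.rd_1728 hp5)).mul (((Red.map_int c4).pow 3).sub ((Red.map_int c6).pow 2))

theorem Place.fr_gdl (hP : Place p red) (hp0 : p ≠ 0) : Fr p hp0 (gdl κ) := by
  have := hP.charP
  refine (Fr.C ?_).mul (((Fr.map_int p hp0 c4).pow 3).sub ((Fr.map_int p hp0 c6).pow 2))
  have : ((1728 : ℕ) : κ) ^ p = (1728 : ℕ) := by
    rw [← frobenius_def, map_natCast]
  rw [div_pow, one_pow]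
  push_cast at this
  rw [this]

variable (p) in
/-- The norm of `f g_γ - f' g'_γ` over the Hecke cosets. -/
noncomputable def nm (k l : ℕ) (f g f' g' : ℍ → ℂ) (τ : ℍ) : ℂ :=
  (f τ * g (ptInf p τ) - (p : ℂ) ^ (l - k) * (f' τ * g' (ptInf p τ))) *
    ∏ b : ZMod p, (f τ * g (ptFin p (b.val : ℤ) τ) - f' τ * g' (ptFin p (b.val : ℤ) τ))

variable (p) in
/-- The expansion of `nm`. -/
noncomputable def nmExp (k l : ℕ) (cf cg cf' cg' : PowerSeries ℂ) : PowerSeries ℂ :=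
  (cf.expand p hp.out.ne_zero * (cg.expand p hp.out.ne_zero).expand p hp.out.ne_zero -
    PowerSeries.C ((p : ℂ) ^ (l - k)) *
      (cf'.expand p hp.out.ne_zero * (cg'.expand p hp.out.ne_zero).expand p hp.out.ne_zero)) *
    ∏ b : ZMod p, (cf.expand p hp.out.ne_zero *
        cg.rescale (Complex.exp (2 * Real.pi * Complex.I * (b.val : ℤ) / p)) -
      cf'.expand p hp.out.ne_zero *
        cg'.rescale (Complex.exp (2 * Real.pi * Complex.I * (b.val : ℤ) / p)))

theorem MF.nm {w w' k l : ℕ} {f g f' g' : ℍ → ℂ} (hf : MF w f) (hg : MF k g) (hf' : MF w' f')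
    (hg' : MF l g') (hw : w + k = w' + l) (hkl : k ≤ l) :
    MF ((w + k) * (p + 1)) (nm p k l f g f' g') := by
  have h1 := (Fam.const (p := p) hf).mul hg.fam_tr
  have h2 := (Fam.const (p := p) hf').mul hg'.fam_tr
  rw [← hw] at h2
  have h3 := (h1.sub h2).prod.smul (((p : ℂ) ^ k)⁻¹)
  convert h3 using 2 with τ
  rw [Fintype.prod_option]
  simp only [tr, Birch.nm]
  obtain ⟨e, rfl⟩ := Nat.exists_eq_add_of_le hkl
  have := pow_ne_zero k (p_ne p)
  rw [Nat.add_sub_cancel_left, pow_add, ← mul_assoc ((p : ℂ) ^ k)⁻¹]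
  congr 1
  field_simp

theorem QRep.nm {cf cg cf' cg' : PowerSeries ℂ} (k l : ℕ) {f g f' g' : ℍ → ℂ} (hf : QRep 1 f cf)
    (hg : QRep 1 g cg) (hf' : QRep 1 f' cf') (hg' : QRep 1 g' cg') :
    QRep p (nm p k l f g f' g') (nmExp p k l cf cg cf' cg') := by
  have e {f : ℍ → ℂ} {c : PowerSeries ℂ} (hf : QRep 1 f c) :
      QRep p f (c.expand p hp.out.ne_zero) := by
    have := hf.expand_left hp.out.ne_zero
    rwa [one_mul] at this
  refine (((e hf).mul (e hg).comp_ptInf).sub (((e hf').mul (e hg').comp_ptInf).smul _)).mul ?_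
  exact QRep.prod _ fun b _ => ((e hf).mul (hg.comp_ptFin _)).sub ((e hf').mul (hg'.comp_ptFin _))

theorem Place.red_nm (hP : Place p red) {k l : ℕ} {c cf cg cf' cg' : PowerSeries ℂ}
    {F G F' G' : PowerSeries κ} (hc : c.expand p hp.out.ne_zero = nmExp p k l cf cg cf' cg')
    (hf : Red red cf F) (hg : Red red cg G) (hf' : Red red cf' F') (hg' : Red red cg' G')
    (hG : Fr p hp.out.ne_zero G) (hG' : Fr p hp.out.ne_zero G') :
    Red red c ((F * G ^ p - PowerSeries.C ((p : κ) ^ (l - k)) * (F' * G' ^ p)) *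
      (F ^ p * G - F' ^ p * G')) := by
  have := hP.charP
  have : CharP (PowerSeries κ) p := charP_of_injective_ringHom (PowerSeries.C_injective (R := κ)) p
  have hp0 := hp.out.ne_zero
  set H := (F * G ^ p - PowerSeries.C ((p : κ) ^ (l - k)) * (F' * G' ^ p)) *
      (F ^ p * G - F' ^ p * G')
  have h1 : Red red (c.expand p hp0) (H.expand p hp0) := by
    rw [hc]
    have : H.expand p hp0 = (F.expand p hp0 * (G.expand p hp0).expand p hp0 -
        PowerSeries.C ((p : κ) ^ (l - k)) * (F'.expand p hp0 * (G'.expand p hp0).expand p hp0)) *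
        ∏ b : ZMod p, (F.expand p hp0 * G.rescale 1 - F'.expand p hp0 * G'.rescale 1) := by
      rw [Finset.prod_const, Finset.card_univ, ZMod.card, PowerSeries.rescale_one]
      simp only [H, map_mul, map_sub, map_pow, PowerSeries.expand_C, RingHom.id_apply]
      rw [sub_pow_char, mul_pow, mul_pow, ← hG, ← hG', map_pow, map_pow, ← hG, ← hG']
    rw [this]
    refine Red.mul ?_ (Red.prod _ fun b _ => ?_)
    · exact ((hf.expand hp0).mul ((hg.expand hp0).expand hp0)).sub
        ((Red.C (Rd.pow (Rd.natCast p) _)).mul ((hf'.expand hp0).mul ((hg'.expand hp0).expand hp0)))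
    · exact ((hf.expand hp0).mul (Red.rescale (hP.rd_zeta _) hg)).sub
        ((hf'.expand hp0).mul (Red.rescale (hP.rd_zeta _) hg'))
  refine Red.of_coeff fun n => ?_
  have := h1.coeff (p * n)
  rwa [PowerSeries.coeff_expand_mul, PowerSeries.coeff_expand_mul] at this

theorem exists_nm_exp {w w' k l : ℕ} {f g f' g' : ℍ → ℂ} (hf : MF w f) (hg : MF k g)
    (hf' : MF w' f') (hg' : MF l g') (hw : w + k = w' + l) (hkl : k ≤ l)
    {cf cg cf' cg' : PowerSeries ℂ} (cf_f : QRep 1 f cf) (cg_g : QRep 1 g cg) (cf_f' : QRep 1 f' cf')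
    (cg_g' : QRep 1 g' cg') :
    ∃ c, QRep 1 (nm p k l f g f' g') c ∧ c.expand p hp.out.ne_zero = nmExp p k l cf cg cf' cg' := by
  obtain ⟨c, hc⟩ := (MF.nm (p := p) hf hg hf' hg' hw hkl).rep
  refine ⟨c, hc, ?_⟩
  have h1 := hc.expand_left hp.out.ne_zero
  rw [one_mul] at h1
  exact h1.unique hp.out.pos (QRep.nm k l cf_f cg_g cf_f' cg_g')

theorem X_dvd_expand {c : PowerSeries ℂ} (hc : PowerSeries.X ∣ c) :
    (PowerSeries.X : PowerSeries ℂ) ^ p ∣ c.expand p hp.out.ne_zero := by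
  obtain ⟨d, rfl⟩ := hc
  rw [map_mul, PowerSeries.expand_X]
  exact Dvd.intro _ rfl

theorem X_dvd_rescale {c : PowerSeries ℂ} (hc : PowerSeries.X ∣ c) (a : ℂ) :
    (PowerSeries.X : PowerSeries ℂ) ∣ c.rescale a := by
  rw [PowerSeries.X_dvd_iff] at hc ⊢
  rw [← PowerSeries.coeff_zero_eq_constantCoeff_apply] at hc ⊢
  rw [PowerSeries.coeff_rescale, hc, mul_zero]

/-- The modular polynomial of prime level in one of its variables, and its reduction. -/
theorem Place.modular_poly (hP : Place p red) (hp5 : 5 ≤ p) :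
    ∃ x : ℕ → ℂ, (∀ i, Rd red (x i) 0) ∧ ∀ τ,
      nm p 12 12 (fun τ => e4 τ ^ 3) dl dl (fun τ => e4 τ ^ 3) τ =
        ∑ i ∈ Finset.range (2 * p + 1), x i * ((e4 τ ^ 3) ^ i * dl τ ^ (2 * p + 2 - i)) -
        (e4 τ ^ 3 * dl τ ^ p - (e4 τ ^ 3) ^ p * dl τ) ^ 2 := by
  have := hP.charP
  have hp0 := hp.out.ne_zero
  have hA : MF 12 (fun τ => e4 τ ^ 3) := mf_e4.pow 3
  obtain ⟨c, hc, hc'⟩ := exists_nm_exp (p := p) hA mf_dl mf_dl hA rfl le_rfl (qRep_e4.pow 3) qRep_dl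
    qRep_dl (qRep_e4.pow 3)
  set a := (c4.map (Int.castRingHom ℂ)) ^ 3
  have ha : Red red a ((c4.map (Int.castRingHom κ)) ^ 3) := (Red.map_int c4).pow 3
  have hra := hP.red_nm hc' ha (hP.red_cdl hp5) (hP.red_cdl hp5) ha (hP.fr_gdl hp0)
    ((Fr.map_int p hp0 c4).pow 3)
  have hXd : PowerSeries.X ∣ cdl := PowerSeries.X_dvd_iff.mpr (by
    rw [← PowerSeries.coeff_zero_eq_constantCoeff_apply, coeff_zero_cdl])
  have hX : PowerSeries.X ^ 2 ∣ c := by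
    rw [PowerSeries.X_pow_dvd_iff]
    intro n hn
    have h1 : PowerSeries.X ^ (p + p) ∣ c.expand p hp0 := by
      rw [hc', nmExp, pow_add]
      refine mul_dvd_mul ?_ ?_
      · refine dvd_sub ?_ ?_
        · refine Dvd.dvd.mul_left ?_ _
          exact X_dvd_expand (PowerSeries.X_dvd_iff.mpr (by
            rw [PowerSeries.constantCoeff_expand, PowerSeries.X_dvd_iff.mp hXd]))
        · exact Dvd.dvd.mul_left (Dvd.dvd.mul_right (X_dvd_expand hXd) _) _
      · have : (PowerSeries.X : PowerSeries ℂ) ^ p = ∏ b : ZMod p, PowerSeries.X := by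
          rw [Finset.prod_const, Finset.card_univ, ZMod.card]
        rw [this]
        refine Finset.prod_dvd_prod_of_dvd _ _ fun b _ => dvd_sub ?_ ?_
        · exact Dvd.dvd.mul_left (X_dvd_rescale hXd _) _
        · exact Dvd.dvd.mul_right ((dvd_pow_self _ hp0).trans (X_dvd_expand hXd)) _
    have h2 := PowerSeries.X_pow_dvd_iff.mp h1 (p * n) (by nlinarith [hp.out.pos])
    rwa [PowerSeries.coeff_expand_mul] at h2
  have hT : MF (12 * (2 * p + 2)) (fun τ => (e4 τ ^ 3 * dl τ ^ p - (e4 τ ^ 3) ^ p * dl τ) ^ 2) := by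
    have h1 := hA.mul (mf_dl.pow p)
    have h2 := (hA.pow p).mul mf_dl
    rw [add_comm] at h2
    have := (h1.sub h2).pow 2
    convert this using 1
    ring
  have hTq := ((((qRep_e4.pow 3).mul (qRep_dl.pow p)).sub
    (((qRep_e4.pow 3).pow p).mul qRep_dl)).pow 2)
  have hG := MF.nm (p := p) hA mf_dl mf_dl hA rfl le_rfl
  have hG' : MF (12 * (2 * p + 2)) (nm p 12 12 (fun τ => e4 τ ^ 3) dl dl (fun τ => e4 τ ^ 3)) := by
    convert hG using 1
    ring
  have hD := hG'.add hT
  have hDq := hc.add hTq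
  have hred := hra.add (((ha.mul ((hP.red_cdl hp5).pow p)).sub ((ha.pow p).mul (hP.red_cdl hp5))).pow 2)
  have hz : ∀ n, PowerSeries.coeff n (c + (a * cdl ^ p - a ^ p * cdl) ^ 2) ∈ kerMod red := by
    refine Red.coeffIn_ker ?_
    convert hred using 1
    simp only [Nat.sub_self, pow_zero, map_one, one_mul]
    ring
  have hX2 : PowerSeries.X ^ 2 ∣ c + (a * cdl ^ p - a ^ p * cdl) ^ 2 := by
    refine dvd_add hX (pow_dvd_pow_of_dvd (dvd_sub ?_ ?_) 2)
    · exact Dvd.dvd.mul_left (hXd.trans (dvd_pow_self _ hp0)) _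
    · exact Dvd.dvd.mul_left hXd _
  obtain ⟨x, hx, hx0, hxf⟩ := hD.exists_poly (hP.mem_1728 hp5) (kerMod red) hDq (fun n _ => hz n) 2
    (fun n hn => PowerSeries.X_pow_dvd_iff.mp hX2 n hn)
  refine ⟨x, hx, fun τ => ?_⟩
  rw [eq_sub_iff_add_eq, hxf τ, Finset.sum_range_succ, Finset.sum_range_succ, hx0 (2 * p + 2) (by omega),
    hx0 (2 * p + 1) (by omega)]
  simp

/-- Norm relation for `x e6 e4_γ - e6_γ e4`, in terms of a lift `h` of the Hasse invariant. -/
theorem Place.norm_rel (hP : Place p red) (hp5 : 5 ≤ p) {h : ℍ → ℂ} (hh : MF (p - 1) h)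
    {ch : PowerSeries ℂ} (hch : QRep 1 h ch) {gh : PowerSeries κ} (hgh : Red red ch gh)
    (hgh1 : gh ^ 2 = 1) {x : ℂ} (hx : x ∈ V) {τ : ℍ} {s : ℂ} (h4 : s ^ 4 * e4 τ ∈ V)
    (h6 : s ^ 6 * e6 τ ∈ V) :
    s ^ (10 * (p + 1)) * nm p 4 6 (fun τ => x * e6 τ) e4 e4 e6 τ -
      (x ^ (p + 1) * (s ^ 4 * e4 τ * (s ^ 6 * e6 τ)) ^ (p + 1) -
        x * (s ^ (p - 1) * h τ) ^ 2 * (s ^ 6 * e6 τ) ^ 2 * (s ^ 4 * e4 τ) ^ (2 * p)) ∈ kerMod red := by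
  have := hP.charP
  have hp0 := hp.out.ne_zero
  obtain ⟨xr, hxr⟩ := Rd.exists_of_mem (red := red) hx
  obtain ⟨c, hc, hc'⟩ := exists_nm_exp (p := p) (mf_e6.smul x) mf_e4 mf_e4 mf_e6 rfl (by norm_num)
    (qRep_e6.smul x) qRep_e4 qRep_e4 qRep_e6
  have r4 := Red.map_int (red := red) c4
  have r6 := Red.map_int (red := red) c6
  have hra := hP.red_nm hc' ((Red.C hxr).mul r6) r4 r4 r6 (Fr.map_int p hp0 c4) (Fr.map_int p hp0 c6)
  have hM := MF.nm (p := p) (mf_e6.smul x) mf_e4 mf_e4 mf_e6 rfl (by norm_num)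
  have hM1 := ((mf_e4.mul mf_e6).pow (p + 1)).smul (x ^ (p + 1))
  have hM2 := (((hh.pow 2).mul (mf_e6.pow 2)).mul (mf_e4.pow (2 * p))).smul x
  have e1 : (p - 1) * 2 + 6 * 2 + 4 * (2 * p) = 10 * (p + 1) := by omega
  rw [e1] at hM2
  have hD := hM.sub (hM1.sub hM2)
  have hDq := hc.sub ((((qRep_e4.mul qRep_e6).pow (p + 1)).smul (x ^ (p + 1))).sub
    ((((hch.pow 2).mul (qRep_e6.pow 2)).mul (qRep_e4.pow (2 * p))).smul x))
  have hred := hra.sub (((Red.C (hxr.pow (p + 1))).mul ((r4.mul r6).pow (p + 1))).sub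
    ((Red.C hxr).mul (((hgh.pow 2).mul (r6.pow 2)).mul (r4.pow (2 * p)))))
  have hk := Red.coeffIn_ker (by
    convert hred using 1
    rw [CharP.cast_eq_zero, hgh1]
    simp only [map_pow, map_zero]
    ring)
  have hgen := hD.gen (hP.mem_1728 hp5) (kerMod red) hDq (fun n _ => hk n)
  have := hgen.eval (hP.mem_1728 hp5) h4 h6
  convert this using 1
  have e2 : s ^ (10 * (p + 1)) = s ^ ((p - 1) * 2) * s ^ (6 * 2) * s ^ (4 * (2 * p)) := by
    rw [← pow_add, ← pow_add, e1]
  have e3 : s ^ (10 * (p + 1)) = s ^ (4 * (p + 1)) * s ^ (6 * (p + 1)) := by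
    rw [← pow_add]; congr 1; ring
  rw [mul_sub]
  congr 1
  rw [mul_sub]
  congr 1
  · rw [mul_pow, mul_pow, mul_pow, ← pow_mul, ← pow_mul, e3]; ring
  · rw [mul_pow, mul_pow, mul_pow, ← pow_mul, ← pow_mul, ← pow_mul, e2]; ring

end
end Birch

end

section

namespace Birch

open UpperHalfPlane ModularForm ModularGroup MatrixGroups Complex Manifold Derivative

/-- The derivation `q d/dq` on power series. -/
noncomputable def theta (R : Type*) [CommRing R] : Derivation R (PowerSeries R) (PowerSeries R) :=
  (PowerSeries.X : PowerSeries R) • PowerSeries.derivative R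

theorem coeff_theta {R : Type*} [CommRing R] (f : PowerSeries R) (n : ℕ) :
    PowerSeries.coeff n (theta R f) = n * PowerSeries.coeff n f := by
  rw [theta, Derivation.smul_apply, smul_eq_mul]
  cases n with
  | zero => simp
  | succ n =>
    rw [PowerSeries.coeff_succ_X_mul, PowerSeries.coeff_derivative]
    push_cast; ring

theorem Red.theta {V : Subring ℂ} {κ : Type} [Field κ] {red : V →+* κ} {c : PowerSeries ℂ}
    {g : PowerSeries κ} (h : Red red c g) : Red red (theta ℂ c) (theta κ g) := by
  refine Red.of_coeff fun n => ?_
  rw [coeff_theta, coeff_theta]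
  exact (Rd.natCast n).mul (h.coeff n)

theorem norm_qParam_lt {w : ℂ} {y : ℝ} (h : y < w.im) :
    ‖Function.Periodic.qParam (1:ℝ) w‖ ≤ ‖Function.Periodic.qParam (1:ℝ) (y * Complex.I)‖ := by
  rw [Function.Periodic.norm_qParam, Function.Periodic.norm_qParam]
  apply Real.exp_le_exp.mpr
  have : (y * Complex.I : ℂ).im = y := by simp
  rw [this]
  have := Real.pi_pos
  simp only [div_one]
  nlinarith

theorem QRep.theta {f : ℍ → ℂ} {c : PowerSeries ℂ} (hf : QRep 1 f c) :
    QRep 1 (normalizedDerivOfComplex f) (Birch.theta ℂ c) := by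
  intro τ
  have him := τ.im_pos
  set y : ℝ := τ.im / 2 with hy
  have hy0 : 0 < y := by positivity
  let U : Set ℂ := {w | y < w.im}
  have hU : IsOpen U := isOpen_lt continuous_const Complex.continuous_im
  have hτU : (τ : ℂ) ∈ U := by
    change y < (τ:ℂ).im
    rw [coe_im]; linarith
  let τ0 : ℍ := ⟨y * Complex.I, by simpa using hy0⟩
  have hsum := (hf τ0).summable.norm
  let F : ℕ → ℂ → ℂ := fun n w => PowerSeries.coeff n c * Function.Periodic.qParam (1:ℝ) w ^ n
  have hder : ∀ n (w : ℂ), HasDerivAt (F n)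
      (PowerSeries.coeff n c * (n * (2 * Real.pi * Complex.I)) * Function.Periodic.qParam (1:ℝ) w ^ n) w := by
    intro n w
    have h1 : HasDerivAt (fun w : ℂ => Function.Periodic.qParam (1:ℝ) w)
        (Function.Periodic.qParam (1:ℝ) w * (2 * Real.pi * Complex.I)) w := by
      have := ((hasDerivAt_id w).const_mul (2 * Real.pi * Complex.I : ℂ)).div_const ((1:ℝ):ℂ)
      have := this.cexp
      simpa [Function.Periodic.qParam] using this
    have h2 := (h1.pow n).const_mul (PowerSeries.coeff n c)
    have h3 : PowerSeries.coeff n c * (n * (2 * Real.pi * Complex.I)) *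
        Function.Periodic.qParam (1:ℝ) w ^ n = PowerSeries.coeff n c *
      (↑n * Function.Periodic.qParam 1 w ^ (n - 1) *
        (Function.Periodic.qParam 1 w * (2 * ↑Real.pi * Complex.I))) := by
      rcases n with _ | n
      · simp
      · simp [pow_succ]; ring
    rw [h3]
    exact h2
  have key := hasSum_deriv_of_summable_norm (F := F) (U := U) (z := (τ:ℂ)) hsum
    (fun n w _ => (hder n w).differentiableAt.differentiableWithinAt) hU (fun n w hw => by
      rw [norm_mul, norm_mul, norm_pow, norm_pow]
      have := norm_qParam_lt hw
      simp only [Nat.cast_one]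
      gcongr) hτU
  have heq : deriv (f ∘ ofComplex) τ = deriv (fun w => ∑' n, F n w) τ := by
    apply Filter.EventuallyEq.deriv_eq
    filter_upwards [hU.mem_nhds hτU] with w hw
    have hw0 : 0 < w.im := hy0.trans hw
    have := (hf ⟨w, hw0⟩).tsum_eq
    simp only [Function.comp_apply, ofComplex_apply_of_im_pos hw0]
    rw [← this]
    simp [F]
  rw [← heq] at key
  have key2 := key.mul_left ((2 * Real.pi * Complex.I)⁻¹ : ℂ)
  refine key2.congr_fun ?_
  intro n
  rw [(hder n τ).deriv, coeff_theta]
  have : (2 * Real.pi * Complex.I : ℂ) ≠ 0 := Complex.two_pi_I_ne_zero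
  simp only [Nat.cast_one]
  field_simp

/-- The normalized derivative. -/
noncomputable abbrev DD (f : ℍ → ℂ) : ℍ → ℂ := normalizedDerivOfComplex f

theorem DD_T {f : ℍ → ℂ} (hf : MDiff f) (h : ∀ τ : ℍ, f ((1 : ℝ) +ᵥ τ) = f τ) (τ : ℍ) :
    DD f ((1 : ℝ) +ᵥ τ) = DD f τ := by
  have hT : f ∣[(0:ℤ)] T = f := by
    ext τ
    have := slash_T_apply 0 f τ
    rw [h] at this
    exact_mod_cast this
  have := congrFun (normalizedDerivOfComplex_SL_slash (k := 0) (γ := T) hf) τ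
  rw [hT] at this
  have h2 := slash_T_apply 2 (DD f) τ
  simp at this
  exact h2.symm.trans this.symm

theorem DD_S {k : ℕ} {f g : ℍ → ℂ} (hf : MDiff f)
    (h : ∀ τ : ℍ, f (S • τ) = (τ : ℂ) ^ k * g τ) (τ : ℍ) :
    DD f (S • τ) = (τ : ℂ) ^ (k + 2) * DD g τ + k * (2 * Real.pi * Complex.I)⁻¹ * (τ : ℂ) ^ (k + 1) * g τ := by
  have hS : f ∣[(k:ℤ)] S = g := by
    ext τ
    rw [slash_S_apply, h, mul_div_cancel_left₀ _ (pow_ne_zero _ τ.ne_zero)]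
  have := congrFun (normalizedDerivOfComplex_SL_slash (k := k) (γ := S) hf) τ
  rw [hS] at this
  have h2 := slash_S_apply (k + 2) (DD f) τ
  push_cast at h2
  simp only [Pi.sub_apply] at this
  rw [h2, denom_S] at this
  have h0 := τ.ne_zero
  have h3 : ((S : SL(2,ℤ)) 1 0 : ℂ) = 1 := by simp [ModularGroup.S]
  simp only [DD] at *
  rw [this]
  rw [eq_comm] at this
  simp [ModularGroup.S] at *
  field_simp
  ring

end Birch

end

section

namespace Birch

open UpperHalfPlane ModularForm ModularGroup MatrixGroups Complex Manifold Derivative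

theorem MF.eq_zero {k : ℕ} {f : ℍ → ℂ} (hf : MF k f) {c : PowerSeries ℂ} (hc : QRep 1 f c)
    (h : ∀ n ≤ k / 12, PowerSeries.coeff n c = 0) : (∀ τ, f τ = 0) ∧ c = 0 := by
  have hg := hf.gen (V := ⊤) (by trivial) ⊥ hc (fun n hn => by simpa using h n hn)
  obtain ⟨c', hc', h0⟩ := hg.rep (V := ⊤) (by trivial)
  have h1 : c = c' := hc.unique one_pos hc'
  have h2 : c = 0 := by
    ext n
    rw [h1]
    simpa using h0 n
  refine ⟨fun τ => ?_, h2⟩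
  have := hc τ
  rw [h2] at this
  simp only [map_zero, zero_mul] at this
  exact this.unique hasSum_zero

theorem MF.holo_DD {k : ℕ} {f : ℍ → ℂ} (hf : MF k f) : MDiff (DD f) :=
  normalizedDerivOfComplex_mdifferentiable hf.holo

/-- The first Rankin–Cohen bracket. -/
theorem MF.bracket {k l : ℕ} {f g : ℍ → ℂ} (hf : MF k f) (hg : MF l g) :
    MF (k + l + 2) (fun τ => k * (f τ * DD g τ) - l * (g τ * DD f τ)) where
  holo := (mdifferentiable_const.mul (hf.holo.mul hg.holo_DD)).sub
    (mdifferentiable_const.mul (hg.holo.mul hf.holo_DD))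
  T_inv τ := by
    rw [DD_T hf.holo hf.T_inv, DD_T hg.holo hg.T_inv, hf.T_inv, hg.T_inv]
  S_inv τ := by
    rw [DD_S hf.holo hf.S_inv, DD_S hg.holo hg.S_inv, hf.S_inv, hg.S_inv]
    ring
  rep := by
    obtain ⟨c, hc⟩ := hf.rep
    obtain ⟨d, hd⟩ := hg.rep
    exact ⟨_, ((hc.mul hd.theta).smul k).sub ((hd.mul hc.theta).smul l)⟩

theorem DD_DD_S {f : ℍ → ℂ} {k : ℕ} (hf : MF k f) (τ : ℍ) :
    DD (DD f) (S • τ) = (τ : ℂ) ^ (k + 4) * DD (DD f) τ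
      + (2 * k + 2) * (2 * Real.pi * Complex.I)⁻¹ * (τ : ℂ) ^ (k + 3) * DD f τ
      + (k * (k + 1)) * ((2 * Real.pi * Complex.I)⁻¹) ^ 2 * (τ : ℂ) ^ (k + 2) * f τ := by
  have hid : MDiff (fun τ : ℍ => (τ : ℂ)) := UpperHalfPlane.mdifferentiable_coe
  have h1 := DD_S (k := k + 1) (f := DD f)
    (g := (fun τ : ℍ => (τ : ℂ)) * DD f + ((k * (2 * Real.pi * Complex.I)⁻¹ : ℂ) • f)) hf.holo_DD
    (fun τ => by
      rw [DD_S hf.holo hf.S_inv]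
      simp only [Pi.add_apply, Pi.mul_apply, Pi.smul_apply, smul_eq_mul]
      ring) τ
  have h2 : DD (fun τ : ℍ => (τ : ℂ)) τ = (2 * Real.pi * Complex.I)⁻¹ := by
    have : deriv ((fun τ : ℍ => (τ : ℂ)) ∘ ofComplex) (τ : ℂ) = 1 := by
      rw [← deriv_id (τ : ℂ)]
      apply Filter.EventuallyEq.deriv_eq
      filter_upwards [isOpen_upperHalfPlaneSet.mem_nhds τ.im_pos] with w hw
      simp [ofComplex_apply_of_im_pos hw]
    simp [DD, normalizedDerivOfComplex, this]
  have h3 : DD ((fun τ : ℍ => (τ : ℂ)) * DD f + ((k * (2 * Real.pi * Complex.I)⁻¹ : ℂ) • f)) τ =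
      (2 * Real.pi * Complex.I)⁻¹ * DD f τ + (τ : ℂ) * DD (DD f) τ
        + k * (2 * Real.pi * Complex.I)⁻¹ * DD f τ := by
    rw [DD, normalizedDerivOfComplex_add _ _ (hid.mul hf.holo_DD) (hf.holo.const_smul _),
      normalizedDerivOfComplex_mul _ _ hid hf.holo_DD, normalizedDerivOfComplex_smul _ _ hf.holo]
    simp only [Pi.add_apply, Pi.mul_apply, Pi.smul_apply, smul_eq_mul]
    rw [← h2]
  rw [h1, h3]
  simp only [Pi.add_apply, Pi.mul_apply, Pi.smul_apply, smul_eq_mul]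
  push_cast
  ring

/-- The bracket `k f f'' - (k+1) f'^2`. -/
theorem MF.bracket_two {k : ℕ} {f : ℍ → ℂ} (hf : MF k f) :
    MF (2 * k + 4) (fun τ => k * (f τ * DD (DD f) τ) - (k + 1) * (DD f τ) ^ 2) where
  holo := (mdifferentiable_const.mul (hf.holo.mul
    (normalizedDerivOfComplex_mdifferentiable hf.holo_DD))).sub
    (mdifferentiable_const.mul (hf.holo_DD.pow 2))
  T_inv τ := by
    rw [DD_T hf.holo_DD (DD_T hf.holo hf.T_inv), DD_T hf.holo hf.T_inv, hf.T_inv]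
  S_inv τ := by
    rw [DD_DD_S hf, DD_S hf.holo hf.S_inv, hf.S_inv]
    ring
  rep := by
    obtain ⟨c, hc⟩ := hf.rep
    exact ⟨_, ((hc.mul hc.theta.theta).smul k).sub ((hc.theta.pow 2).smul (k + 1))⟩

section coefficients

open PowerSeries

theorem coeff_one_mul' {R : Type*} [CommRing R] (c d : PowerSeries R) :
    coeff 1 (c * d) = coeff 0 c * coeff 1 d + coeff 1 c * coeff 0 d := by
  simp [PowerSeries.coeff_mul, Finset.Nat.antidiagonal_succ]

theorem coeff_two_mul' {R : Type*} [CommRing R] (c d : PowerSeries R) :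
    coeff 2 (c * d) = coeff 0 c * coeff 2 d + coeff 1 c * coeff 1 d + coeff 2 c * coeff 0 d := by
  simp [PowerSeries.coeff_mul, Finset.Nat.antidiagonal_succ]
  ring

/-- The `q`-expansion of `e4` with complex coefficients. -/
noncomputable abbrev C4 : PowerSeries ℂ := c4.map (Int.castRingHom ℂ)
/-- The `q`-expansion of `e6` with complex coefficients. -/
noncomputable abbrev C6 : PowerSeries ℂ := c6.map (Int.castRingHom ℂ)

theorem coeff_zero_mul' {R : Type*} [CommRing R] (c d : PowerSeries R) :
    coeff 0 (c * d) = coeff 0 c * coeff 0 d := by simp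

theorem coeff_zero_C4 : coeff 0 C4 = 1 := by
  rw [coeff_zero_eq_constantCoeff_apply]; exact constantCoeff_c4
theorem coeff_zero_C6 : coeff 0 C6 = 1 := by
  rw [coeff_zero_eq_constantCoeff_apply]; exact constantCoeff_c6
theorem coeff_zero_theta {R : Type*} [CommRing R] (c : PowerSeries R) : coeff 0 (theta R c) = 0 := by
  rw [coeff_theta]; simp

theorem ramanujan_e4 : (∀ τ, e4 τ * DD dl τ - 3 * (dl τ * DD e4 τ) = dl τ * e6 τ) ∧
    C4 * theta ℂ cdl - 3 * (cdl * theta ℂ C4) = cdl * C6 := by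
  have h := ((mf_e4.bracket mf_dl).smul (1/4)).sub (mf_dl.mul mf_e6)
  have hq := ((((qRep_e4.mul qRep_dl.theta).smul 4).sub
    ((qRep_dl.mul qRep_e4.theta).smul 12)).smul (1/4)).sub (qRep_dl.mul qRep_e6)
  obtain ⟨h1, h2⟩ := h.eq_zero hq (fun n hn => by
    have hn : n = 0 ∨ n = 1 := by omega
    rcases hn with rfl | rfl
    · simp only [map_sub, coeff_C_mul, coeff_zero_mul', coeff_zero_theta, coeff_zero_cdl]; ring
    · simp only [map_sub, coeff_C_mul, coeff_one_mul', coeff_zero_cdl,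
        coeff_theta, coeff_one_cdl]
      rw [coeff_zero_C4, coeff_zero_C6]
      push_cast; ring)
  refine ⟨fun τ => ?_, ?_⟩
  · have := h1 τ
    push_cast at this
    linear_combination this
  · have h3 : PowerSeries.C (1/4:ℂ) * PowerSeries.C 4 = 1 := by rw [← map_mul]; norm_num
    have h4 : PowerSeries.C (1/4:ℂ) * PowerSeries.C 12 = 3 := by
      rw [← map_mul]; norm_num; rfl
    linear_combination h2 - h3 * (C4 * theta ℂ cdl) + h4 * (cdl * theta ℂ C4)

theorem ramanujan_e6 : (∀ τ, e6 τ * DD dl τ - 2 * (dl τ * DD e6 τ) = dl τ * e4 τ ^ 2) ∧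
    C6 * theta ℂ cdl - 2 * (cdl * theta ℂ C6) = cdl * C4 ^ 2 := by
  have h := ((mf_e6.bracket mf_dl).smul (1/6)).sub (mf_dl.mul (mf_e4.pow 2))
  have hq := ((((qRep_e6.mul qRep_dl.theta).smul 6).sub
    ((qRep_dl.mul qRep_e6.theta).smul 12)).smul (1/6)).sub (qRep_dl.mul (qRep_e4.pow 2))
  obtain ⟨h1, h2⟩ := h.eq_zero hq (fun n hn => by
    have hn : n = 0 ∨ n = 1 := by omega
    rcases hn with rfl | rfl
    · simp only [map_sub, coeff_C_mul, coeff_zero_mul', coeff_zero_theta, coeff_zero_cdl]; ring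
    · simp only [map_sub, coeff_C_mul, coeff_one_mul', coeff_zero_cdl,
        coeff_theta, coeff_one_cdl, pow_two, coeff_zero_mul']
      rw [coeff_zero_C4, coeff_zero_C6]
      push_cast; ring)
  refine ⟨fun τ => ?_, ?_⟩
  · have := h1 τ
    push_cast at this
    linear_combination this
  · have h3 : PowerSeries.C (1/6:ℂ) * PowerSeries.C 6 = 1 := by rw [← map_mul]; norm_num
    have h4 : PowerSeries.C (1/6:ℂ) * PowerSeries.C 12 = 2 := by
      rw [← map_mul]; norm_num; rfl
    linear_combination h2 - h3 * (C6 * theta ℂ cdl) + h4 * (cdl * theta ℂ C6)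

theorem ramanujan_dl :
    12 * (cdl * theta ℂ (theta ℂ cdl)) - 13 * theta ℂ cdl ^ 2 = - (C4 * cdl ^ 2) := by
  have h := mf_dl.bracket_two.add (mf_e4.mul (mf_dl.pow 2))
  simp only [show ((12:ℕ):ℂ) + 1 = 13 by norm_num] at h
  have hq := (((qRep_dl.mul qRep_dl.theta.theta).smul (12:ℕ)).sub
    ((qRep_dl.theta.pow 2).smul 13)).add (qRep_e4.mul (qRep_dl.pow 2))
  obtain ⟨h1, h2⟩ := h.eq_zero hq (fun n hn => by
    have hn : n = 0 ∨ n = 1 ∨ n = 2 := by omega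
    rcases hn with rfl | rfl | rfl
    · simp only [map_sub, map_add, coeff_C_mul, coeff_zero_mul', coeff_zero_theta, coeff_zero_cdl,
        pow_two]; ring
    · simp only [map_sub, map_add, coeff_C_mul, coeff_one_mul', coeff_zero_cdl,
        coeff_theta, coeff_one_cdl, pow_two, coeff_zero_mul']
      ring
    · simp only [map_sub, map_add, coeff_C_mul, coeff_one_mul', coeff_zero_cdl,
        coeff_theta, coeff_one_cdl, pow_two, coeff_zero_mul', coeff_two_mul']
      rw [coeff_zero_C4]
      push_cast; ring)
  have h3 : (PowerSeries.C ((12:ℕ):ℂ)) = 12 := by norm_num; rfl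
  have h4 : (PowerSeries.C (13:ℂ)) = 13 := rfl
  rw [h3, h4] at h2
  linear_combination h2

end coefficients

end Birch

end

section

namespace Birch

open Polynomial

/-- The coefficient of `X ^ (2 m)` in `(X ^ 3 + α X + β) ^ m`. -/
noncomputable def hs {R : Type*} [CommRing R] (m : ℕ) (α β : R) : R :=
  ((X ^ 3 + C α * X + C β) ^ m).coeff (2 * m)

theorem map_hs {R S : Type*} [CommRing R] [CommRing S] (φ : R →+* S) (m : ℕ) (α β : R) :
    φ (hs m α β) = hs m (φ α) (φ β) := by
  rw [hs, hs, ← Polynomial.coeff_map]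
  simp

variable {R K : Type*} [CommRing R] [CommRing K] [Algebra R K]

/-- The derivation acting on coefficients of polynomials. -/
noncomputable def coeffDer (d : Derivation R K K) : Derivation R K[X] K[X] :=
  (PolynomialModule.equivPolynomialSelf (R := K)).toLinearMap.compDer d.mapCoeffs

theorem coeff_coeffDer (d : Derivation R K K) (f : K[X]) (n : ℕ) :
    (coeffDer d f).coeff n = d (f.coeff n) := by
  rfl

theorem coeffDer_X (d : Derivation R K K) : coeffDer d X = 0 := by
  ext n
  rw [coeff_coeffDer, coeff_X]
  split_ifs <;> simp

theorem coeffDer_C (d : Derivation R K K) (a : K) : coeffDer d (C a) = C (d a) := by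
  ext n
  rw [coeff_coeffDer, coeff_C, coeff_C]
  split_ifs <;> simp


/-- The Picard–Fuchs equation for the coefficient `hs`. -/
theorem picard_fuchs (d : Derivation R K K) {a b e : K} (h4 : 3 * d a = e * a - b)
    (h6 : 2 * d b = e * b - a ^ 2) (h2 : 12 * d e = e ^ 2 - a) {n : ℕ} (hn : 2 ≤ n)
    (hn1 : 2 * (n : K) + 1 = 0) : 12 * d (d (hs n (-3 * a) (2 * b))) = 0 := by
  obtain ⟨n, rfl⟩ := Nat.exists_eq_add_of_le' hn
  set f : K[X] := X ^ 3 + C (-3 * a) * X + C (2 * b) with hf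
  set t : K[X] := -C (e * a - b) * X + C (e * b - a ^ 2) with ht
  set g : K[X] := -C (e ^ 2 * a - 2 * e * b + a ^ 2) * X ^ 2
    + C (e ^ 2 * b - 2 * e * a ^ 2 + a * b) * X + C (2 * (a ^ 3 - b ^ 2)) with hg
  have hC4 : 3 * C (d a) = C e * C a - C b := by
    rw [← C_mul, ← C_sub, ← h4, C_mul]; rfl
  have hC6 : 2 * C (d b) = C e * C b - C a ^ 2 := by
    rw [← C_mul, ← C_pow, ← C_sub, ← h6, C_mul]; rfl
  have hC2 : 12 * C (d e) = C e ^ 2 - C a := by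
    rw [← C_pow, ← C_sub, ← h2, C_mul]; rfl
  have h3 : d 3 = 0 := by simpa using d.map_natCast 3
  have h22 : d 2 = 0 := by simpa using d.map_natCast 2
  have c2 : (C (2:K)) = 2 := rfl
  have c3 : (C (3:K)) = 3 := rfl
  have c5 : (C (5:K)) = 5 := rfl
  have c7 : (C (7:K)) = 7 := rfl
  have e1 : coeffDer d f = t := by
    rw [hf, ht]
    simp only [map_add, Derivation.leibniz, coeffDer_X, coeffDer_C, Derivation.leibniz_pow,
      smul_eq_mul, smul_zero, mul_zero, zero_add, map_neg, C_neg, C_mul, h3, h22, map_zero, C_sub,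
      C_pow, neg_zero, add_zero, nsmul_zero]
    rw [c2, c3]
    linear_combination (-X) * hC4 + hC6
  have e2 : 12 * coeffDer d t = -C (5 * (e ^ 2 * a - 2 * e * b + a ^ 2)) * X
      + C (7 * (e ^ 2 * b - 2 * e * a ^ 2 + a * b)) := by
    rw [ht]
    simp only [map_add, Derivation.leibniz, coeffDer_X, coeffDer_C, Derivation.leibniz_pow,
      smul_eq_mul, smul_zero, mul_zero, zero_add, map_neg, C_neg, C_mul, map_sub, C_sub, C_add,
      C_pow, add_zero, nsmul_eq_mul, map_mul, map_pow, map_ofNat]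
    simp only [pow_one, Nat.add_one_sub_one]
    linear_combination (-X * C a + C b) * hC2 - (4 * X * C e + 8 * C a) * hC4
      + (6 * X + 6 * C e) * hC6
  have hn2 : 2 * (n : K[X]) + 5 = 0 := by
    have := congrArg C hn1
    simp only [map_add, map_mul, map_ofNat, map_natCast, map_one, map_zero] at this
    push_cast at this
    linear_combination this
  have e3 : derivative f = 3 * X ^ 2 - 3 * C a := by
    rw [hf]; simp; simp only [c2, c3]; ring
  have e4 : derivative g = -2 * C (e ^ 2 * a - 2 * e * b + a ^ 2) * X
    + C (e ^ 2 * b - 2 * e * a ^ 2 + a * b) := by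
    rw [hg]; simp [derivative_pow]; simp only [c2]; ring
  have key : 12 * coeffDer d (coeffDer d (f ^ (n + 2))) = derivative (f ^ (n + 1) * g) := by
    have l1 : coeffDer d (f ^ (n + 2)) = (n + 2 : ℕ) * (f ^ (n + 1) * t) := by
      rw [Derivation.leibniz_pow, e1]; simp
    have l2 : coeffDer d ((n + 2 : ℕ) * (f ^ (n + 1) * t)) = 
        (n + 2 : ℕ) * (f ^ (n + 1) * coeffDer d t + t * ((n + 1 : ℕ) * (f ^ n * t))) := by
      rw [Derivation.leibniz, Derivation.leibniz, Derivation.leibniz_pow, e1, Derivation.map_natCast]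
      simp
    have l3 : derivative (f ^ (n + 1) * g) = 
        (n + 1 : ℕ) * f ^ n * derivative f * g + f ^ (n + 1) * derivative g := by
      rw [derivative_mul, derivative_pow]; simp
    rw [l1, l2, l3, e3, e4]
    push_cast
    rw [pow_succ f n]
    generalize f ^ n = P
    rw [ht] at e2 ⊢
    generalize coeffDer d (-C (e * a - b) * X + C (e * b - a ^ 2)) = T at e2 ⊢
    rw [hf, hg]
    simp only [C_mul, C_sub, C_add, C_pow, C_neg, c2, c3, c5, c7] at e2 ⊢
    generalize (n : K[X]) = N at hn2 ⊢
    generalize C a = A at e2 ⊢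
    generalize C b = B at e2 ⊢
    generalize C e = E at e2 ⊢
    linear_combination (N + 2) * P * (X ^ 3 + -3 * A * X + 2 * B) * e2 + P * (
      6 * (-(E * A - B) * X + (E * B - A ^ 2)) ^ 2 * (N + 2) +
      (3 * X ^ 2 - 3 * A) * (-(E ^ 2 * A - 2 * E * B + A ^ 2) * X ^ 2
        + (E ^ 2 * B - 2 * E * A ^ 2 + A * B) * X + (2 * (A ^ 3 - B ^ 2))) -
      (X ^ 3 + -3 * A * X + 2 * B) * (-2 * (E ^ 2 * A - 2 * E * B + A ^ 2) * X
        + (E ^ 2 * B - 2 * E * A ^ 2 + A * B))) * hn2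
  have hco := congrArg (fun P : K[X] => P.coeff (2 * (n + 2))) key
  change (12 * _ : K[X]).coeff _ = (derivative _).coeff _ at hco
  rw [hs, ← coeff_coeffDer, ← coeff_coeffDer]
  rw [coeff_derivative] at hco
  have h12 : (12 : K[X]) = C 12 := rfl
  rw [h12, coeff_C_mul] at hco
  rw [hco]
  push_cast at hn1 ⊢
  linear_combination (coeff (f ^ (n + 1) * g) (2 * (n + 2) + 1)) * hn1

end Birch

end

section

set_option linter.unusedSectionVars false

namespace Birch

open UpperHalfPlane ModularForm ModularGroup MatrixGroups Complex Manifold Derivative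

/-- The Hasse invariant as a modular form. -/
noncomputable def hf (m : ℕ) (τ : ℍ) : ℂ := hs m (-3 * e4 τ) (2 * e6 τ)

section
open Polynomial

theorem coeff_cubic_mul {R : Type*} [CommRing R] (α β : R) (g : R[X]) (n : ℕ) :
    (g * (X ^ 3 + C α * X + C β)).coeff n = (if 3 ≤ n then g.coeff (n - 3) else 0)
      + α * (if 1 ≤ n then g.coeff (n - 1) else 0) + β * g.coeff n := by
  have h1 : (g * X).coeff n = if 1 ≤ n then g.coeff (n - 1) else 0 := by
    simpa using coeff_mul_X_pow' g 1 n
  rw [mul_add, mul_add, coeff_add, coeff_add, coeff_mul_X_pow', coeff_mul_C,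
    show g * (C α * X) = C α * (g * X) by ring, coeff_C_mul, h1]
  ring

theorem coeff_cubic_pow_eq_zero {R : Type*} [CommRing R] (α β : R) (m n : ℕ) (h : 3 * m < n) :
    ((X ^ 3 + C α * X + C β) ^ m).coeff n = 0 := by
  apply coeff_eq_zero_of_natDegree_lt
  refine lt_of_le_of_lt natDegree_pow_le ?_
  have : (X ^ 3 + C α * X + C β).natDegree ≤ 3 := by compute_degree
  nlinarith

theorem MF.coeff_cubic_pow (m : ℕ) : ∀ n k : ℕ, 6 * m = 2 * n + k →
    MF k (fun τ => ((X ^ 3 + C (-3 * e4 τ) * X + C (2 * e6 τ)) ^ m).coeff n) := by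
  induction m with
  | zero =>
    intro n k h
    obtain rfl : n = 0 := by omega
    obtain rfl : k = 0 := by omega
    simpa using MF.const 1
  | succ m ih =>
    intro n k h
    have e : (fun τ => ((X ^ 3 + C (-3 * e4 τ) * X + C (2 * e6 τ)) ^ (m + 1)).coeff n) =
        fun τ => (if 3 ≤ n then ((X ^ 3 + C (-3 * e4 τ) * X + C (2 * e6 τ)) ^ m).coeff (n - 3) else 0)
      + (-3) * (e4 τ * (if 1 ≤ n then ((X ^ 3 + C (-3 * e4 τ) * X + C (2 * e6 τ)) ^ m).coeff (n - 1)
          else 0)) + 2 * (e6 τ * ((X ^ 3 + C (-3 * e4 τ) * X + C (2 * e6 τ)) ^ m).coeff n) := by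
      ext τ
      rw [pow_succ, coeff_cubic_mul]
      ring
    rw [e]
    refine MF.add (MF.add ?_ (MF.smul (-3) ?_)) (MF.smul 2 ?_)
    · split_ifs with h3
      · exact ih (n - 3) k (by omega)
      · exact MF.zero k
    · by_cases hk : 4 ≤ k ∧ 1 ≤ n
      · obtain ⟨k, rfl⟩ := Nat.exists_eq_add_of_le hk.1
        simp only [hk.2, if_true]
        exact mf_e4.mul (ih (n - 1) k (by omega))
      · have : ∀ τ, (if 1 ≤ n then ((X ^ 3 + C (-3 * e4 τ) * X + C (2 * e6 τ)) ^ m).coeff (n - 1)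
          else 0) = 0 := by
          intro τ
          split_ifs with h1
          · exact coeff_cubic_pow_eq_zero _ _ _ _ (by omega)
          · rfl
        simp only [this, mul_zero]
        exact MF.zero k
    · by_cases hk : 6 ≤ k
      · obtain ⟨k, rfl⟩ := Nat.exists_eq_add_of_le hk
        exact mf_e6.mul (ih n k (by omega))
      · have : ∀ τ, ((X ^ 3 + C (-3 * e4 τ) * X + C (2 * e6 τ)) ^ m).coeff n = 0 := by
          intro τ
          exact coeff_cubic_pow_eq_zero _ _ _ _ (by omega)
        simp only [this, mul_zero]
        exact MF.zero k

theorem mf_hf (m : ℕ) : MF (2 * m) (hf m) := MF.coeff_cubic_pow m (2 * m) (2 * m) (by ring)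

theorem QRep.coeff_cubic_pow (m : ℕ) : ∀ n : ℕ,
    QRep 1 (fun τ => ((X ^ 3 + C (-3 * e4 τ) * X + C (2 * e6 τ)) ^ m).coeff n)
      (((X ^ 3 + C (-3 * C4) * X + C (2 * C6)) ^ m).coeff n) := by
  induction m with
  | zero =>
    intro n
    simp only [pow_zero, coeff_one]
    split_ifs
    · simpa using QRep.const 1
    · simpa using QRep.const 0
  | succ m ih =>
    intro n
    simp only [pow_succ _ m, coeff_cubic_mul]
    have h4 : QRep 1 (fun τ => -3 * e4 τ) (-3 * C4) := by
      have := qRep_e4.smul (-3)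
      rwa [show (PowerSeries.C (-3:ℂ)) = -3 by rw [map_neg]; rfl] at this
    have h6 : QRep 1 (fun τ => 2 * e6 τ) (2 * C6) := by
      have := qRep_e6.smul 2
      rwa [show (PowerSeries.C (2:ℂ)) = 2 from rfl] at this
    refine ((QRep.add ?_ (h4.mul ?_))).add (h6.mul (ih n))
    · split_ifs
      · exact ih _
      · simpa using QRep.const 0
    · split_ifs
      · exact ih _
      · simpa using QRep.const 0

end

theorem qRep_hf (m : ℕ) : QRep 1 (hf m) (hs m (-3 * C4) (2 * C6)) :=
  QRep.coeff_cubic_pow m (2 * m)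

variable {p : ℕ} [hp : Fact p.Prime] {V : Subring ℂ} {κ : Type} [Field κ] {red : V →+* κ}

/-- The reduced expansion of `e4`. -/
noncomputable abbrev g4 (κ : Type) [Field κ] : PowerSeries κ := c4.map (Int.castRingHom κ)
/-- The reduced expansion of `e6`. -/
noncomputable abbrev g6 (κ : Type) [Field κ] : PowerSeries κ := c6.map (Int.castRingHom κ)

theorem red_hf (m : ℕ) : Red red (hs m (-3 * C4) (2 * C6)) (hs m (-3 * g4 κ) (2 * g6 κ)) := by
  have h (K : Type) [CommRing K] : hs m (-3 * c4.map (Int.castRingHom K)) (2 * c6.map (Int.castRingHom K)) =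
      (hs m (-3 * c4) (2 * c6)).map (Int.castRingHom K) := by
    have h2 : (PowerSeries.map (Int.castRingHom K)) 2 = 2 := map_ofNat _ 2
    have h3 : (PowerSeries.map (Int.castRingHom K)) (-3) = -3 := by
      rw [map_neg]; exact congrArg _ (map_ofNat _ 3)
    rw [map_hs, map_mul, map_mul, h2, h3]
  rw [h, h]
  exact Red.map_int _

theorem Place.exists_ramanujan (hP : Place p red) (hp5 : 5 ≤ p) : ∃ e : PowerSeries κ,
    3 * theta κ (g4 κ) = e * g4 κ - g6 κ ∧ 2 * theta κ (g6 κ) = e * g6 κ - g4 κ ^ 2 ∧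
    12 * theta κ e = e ^ 2 - g4 κ := by
  have h4 : Red red C4 (g4 κ) := Red.map_int c4
  have h6 : Red red C6 (g6 κ) := Red.map_int c6
  have hd := hP.red_cdl hp5
  set g := gdl κ with hg
  have hn (n : ℕ) : Red red (n : PowerSeries ℂ) (n : PowerSeries κ) := by
    have := Red.C (Rd.natCast (red := red) n)
    simpa using this
  have r4 : g4 κ * theta κ g - 3 * (g * theta κ (g4 κ)) = g * g6 κ := by
    have := ((h4.mul hd.theta).sub ((hn 3).mul (hd.mul h4.theta)))
    have h := ramanujan_e4.2
    push_cast at this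
    rw [h] at this
    exact this.unique (hd.mul h6)
  have r6 : g6 κ * theta κ g - 2 * (g * theta κ (g6 κ)) = g * g4 κ ^ 2 := by
    have := ((h6.mul hd.theta).sub ((hn 2).mul (hd.mul h6.theta)))
    have h := ramanujan_e6.2
    push_cast at this
    rw [h] at this
    exact this.unique (hd.mul (h4.pow 2))
  have rd : 13 * theta κ g ^ 2 - 12 * (g * theta κ (theta κ g)) = g4 κ * g ^ 2 := by
    have := ((hn 13).mul (hd.theta.pow 2)).sub ((hn 12).mul (hd.mul hd.theta.theta))
    have h := ramanujan_dl
    have h' : 13 * theta ℂ cdl ^ 2 - 12 * (cdl * theta ℂ (theta ℂ cdl)) = C4 * cdl ^ 2 := by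
      linear_combination -h
    push_cast at this
    rw [h'] at this
    exact this.unique (h4.mul (hd.pow 2))
  have hg0 : PowerSeries.coeff 0 g = 0 := by
    have := hd.coeff 0
    rw [coeff_zero_cdl] at this
    exact this.unique Rd.zero
  have hg1 : PowerSeries.coeff 1 g = 1 := by
    have := hd.coeff 1
    rw [coeff_one_cdl] at this
    exact this.unique Rd.one
  have hgne : g ≠ 0 := by
    intro h
    rw [h] at hg1
    simp at hg1
  obtain ⟨w, hw⟩ := PowerSeries.X_dvd_iff.mpr
    (by rw [← PowerSeries.coeff_zero_eq_constantCoeff_apply, hg0] : PowerSeries.constantCoeff g = 0)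
  have hw1 : PowerSeries.constantCoeff w ≠ 0 := by
    rw [hw, show 1 = 0 + 1 from rfl, PowerSeries.coeff_succ_X_mul] at hg1
    rw [← PowerSeries.coeff_zero_eq_constantCoeff_apply, hg1]
    exact one_ne_zero
  have hX : theta κ PowerSeries.X = PowerSeries.X := by
    simp [theta]
  have he : theta κ g = ((w + theta κ w) * w⁻¹) * g := by
    have : w⁻¹ * w = 1 := PowerSeries.inv_mul_cancel w hw1
    rw [hw, Derivation.leibniz, hX]
    simp only [smul_eq_mul]
    linear_combination (-(w + theta κ w) * PowerSeries.X) * this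
  set e := (w + theta κ w) * w⁻¹
  have he2 : theta κ (theta κ g) = (theta κ e + e ^ 2) * g := by
    have := congrArg (theta κ) he
    rw [this, Derivation.leibniz, he]
    simp only [smul_eq_mul]
    ring
  rw [he] at r4 r6
  rw [he2, he] at rd
  refine ⟨e, mul_left_cancel₀ hgne ?_, mul_left_cancel₀ hgne ?_,
    mul_left_cancel₀ (pow_ne_zero 2 hgne) ?_⟩
  · linear_combination -r4
  · linear_combination -r6
  · linear_combination -rd

theorem Place.prime_dvd_of_coeff_ne_zero (hP : Place p red) (hp5 : 5 ≤ p) {m : ℕ} (hm : 2 * m + 1 = p)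
    {n : ℕ} (hn : ¬ p ∣ n) : PowerSeries.coeff n (hs m (-3 * g4 κ) (2 * g6 κ)) = 0 := by
  obtain ⟨e, h1, h2, h3⟩ := hP.exists_ramanujan hp5
  have hpk : (p : PowerSeries κ) = 0 := by
    have : (p : κ) = 0 := (hP.natCast_eq_zero p).mpr dvd_rfl
    rw [← map_natCast (PowerSeries.C (R := κ)), this, map_zero]
  have h := picard_fuchs (theta κ) h1 h2 h3 (n := m) (by omega) (by
    rw [← hpk, ← hm]; push_cast; ring)
  have h' := congrArg (PowerSeries.coeff n) h
  have h12 : (12 : PowerSeries κ) = PowerSeries.C 12 := rfl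
  rw [h12, PowerSeries.coeff_C_mul, coeff_theta, coeff_theta, map_zero] at h'
  have hn' := mt (hP.natCast_eq_zero n).mp hn
  have h12' : (12 : κ) ≠ 0 := by
    intro h0
    apply hP.ne_1728 hp5
    linear_combination 144 * h0
  rcases mul_eq_zero.mp h' with h | h
  · exact absurd h h12'
  · exact (mul_eq_zero.mp ((mul_eq_zero.mp h).resolve_left hn')).resolve_left hn'

theorem Place.rd_bernoulli (hP : Place p red) {k : ℕ} (hk : 2 * k + 1 = p) :
    Rd red (2 * ((2 * k : ℕ) : ℂ) / ((bernoulli (2 * k) : ℚ) : ℂ)) 0 := by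
  obtain ⟨N, hN⟩ := Bernoulli.vonStaudt_clausen k
  have hmem : p ∈ (Finset.range (2 * k + 2)).filter (fun q => q.Prime ∧ (q - 1) ∣ 2 * k) := by
    simp only [Finset.mem_filter, Finset.mem_range]
    exact ⟨by omega, hp.out, by rw [← hk]; simp⟩
  rw [← Finset.add_sum_erase _ _ hmem] at hN
  set s := ((Finset.range (2 * k + 2)).filter (fun q => q.Prime ∧ (q - 1) ∣ 2 * k)).erase p
  have hs : ∃ a, Rd red ((∑ q ∈ s, (1:ℚ) / q : ℚ) : ℂ) a := by
    have : ∀ q ∈ s, Rd red ((1:ℂ) / q) (1 / q) := by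
      intro q hq
      simp only [s, Finset.mem_erase, Finset.mem_filter, Finset.mem_range] at hq
      refine Rd.one.div hP (Rd.natCast q) (mt (hP.natCast_eq_zero q).mp fun h => hq.1 ?_)
      exact ((Nat.prime_dvd_prime_iff_eq hp.out hq.2.2.1).mp h).symm
    exact ⟨_, by push_cast; exact Rd.sum s this⟩
  obtain ⟨a, ha⟩ := hs
  have hpC : (p : ℂ) ≠ 0 := by exact_mod_cast hp.out.ne_zero
  have hpk : (p : κ) = 0 := (hP.natCast_eq_zero p).mpr dvd_rfl
  set B : ℂ := ((bernoulli (2 * k) : ℚ) : ℂ) with hB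
  have hBe : p * B = p * (N - ((∑ q ∈ s, (1:ℚ) / q : ℚ) : ℂ)) - 1 := by
    have : (N : ℂ) = B + (1 / p + ((∑ q ∈ s, (1:ℚ) / q : ℚ) : ℂ)) := by
      have := congrArg (Rat.cast : ℚ → ℂ) hN
      simpa [hB] using this
    rw [this]
    field_simp
    ring
  have hpB : Rd red (p * B) (-1) := by
    rw [hBe]
    have := ((Rd.natCast (red := red) p).mul ((Rd.intCast N).sub ha)).sub Rd.one
    simpa [hpk] using this
  have h2 : Rd red (p * (2 * ((2 * k : ℕ) : ℂ))) 0 := by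
    have := (Rd.natCast (red := red) p).mul (Rd.natCast (2 * (2 * k)))
    rw [hpk, zero_mul] at this
    simpa using this
  have := h2.div hP hpB (by simp)
  rw [zero_div] at this
  rwa [mul_div_mul_left _ _ hpC] at this

/-- The Eisenstein series of weight `p - 1` is congruent to `1`. -/
theorem Place.exists_eisenstein (hP : Place p red) {k : ℕ} (hk : 2 * k + 1 = p) (hp5 : 5 ≤ p) :
    ∃ (f : ℍ → ℂ) (c : PowerSeries ℂ), MF (2 * k) f ∧ QRep 1 f c ∧ Red red c 1 := by
  have hk3 : 3 ≤ 2 * k := by omega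
  refine ⟨_, _, MF.of_modularForm (ModularForm.E hk3), qRep_qExpansion _, ?_⟩
  refine Red.of_coeff fun n => ?_
  rw [EisensteinSeries.E_qExpansion_coeff _ ⟨k, by ring⟩, PowerSeries.coeff_one]
  split_ifs
  · exact Rd.one
  · have := ((hP.rd_bernoulli hk).neg).mul (Rd.natCast (ArithmeticFunction.sigma (2 * k - 1) n))
    simpa using this

theorem Place.red_hf_eq (hP : Place p red) (hp5 : 5 ≤ p) {m : ℕ} (hm : 2 * m + 1 = p) :
    hs m (-3 * g4 κ) (2 * g6 κ) = PowerSeries.C (hs m (-3) 2) := by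
  have h0 : PowerSeries.coeff 0 (hs m (-3 * g4 κ) (2 * g6 κ)) = hs m (-3) 2 := by
    rw [PowerSeries.coeff_zero_eq_constantCoeff_apply, map_hs]
    congr 1
    · have h3 : PowerSeries.constantCoeff (-3 : PowerSeries κ) = -3 := by
        rw [map_neg]; exact congrArg _ (map_ofNat _ 3)
      rw [map_mul, h3]
      simp [c4, ← PowerSeries.coeff_zero_eq_constantCoeff_apply, -PowerSeries.coeff_zero_eq_constantCoeff]
    · have h3 : PowerSeries.constantCoeff (2 : PowerSeries κ) = 2 := map_ofNat _ 2
      rw [map_mul, h3]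
      simp [c6, ← PowerSeries.coeff_zero_eq_constantCoeff_apply, -PowerSeries.coeff_zero_eq_constantCoeff]
  obtain ⟨f, c, hf, hfc, hc⟩ := hP.exists_eisenstein hm hp5
  have hx : Rd red (hs m (-3 : ℤ) 2 : ℤ) (hs m (-3 : κ) 2) := by
    have := Rd.intCast (red := red) (hs m (-3 : ℤ) 2)
    have e : (((hs m (-3 : ℤ) 2 : ℤ)) : κ) = hs m (-3 : κ) 2 := by
      have := map_hs (Int.castRingHom κ) m (-3) 2
      simpa using this
    rwa [e] at this
  set x : ℂ := ((hs m (-3 : ℤ) 2 : ℤ) : ℂ)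
  have hF := (mf_hf m).sub (hf.smul x)
  have hFq := (qRep_hf m).sub (hfc.smul x)
  have hFr := (red_hf (red := red) m).sub ((Red.C hx).mul hc)
  have hgen := hF.gen (hP.mem_1728 hp5) (kerMod red) hFq (fun n hn => by
    rw [mem_kerMod]
    have := hFr.coeff n
    convert this using 1
    rcases Nat.eq_zero_or_pos n with rfl | hn0
    · rw [map_sub, h0]; simp
    · rw [map_sub, hP.prime_dvd_of_coeff_ne_zero hp5 hm (n := n)]
      · rw [mul_one, PowerSeries.coeff_C, if_neg hn0.ne']; simp
      · intro h
        have := Nat.le_of_dvd hn0 h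
        omega)
  obtain ⟨c', hc', hI⟩ := hgen.rep (hP.mem_1728 hp5)
  obtain rfl := hFq.unique one_pos hc'
  have : Red red (hs m (-3 * C4) (2 * C6) - PowerSeries.C x * c) 0 := by
    refine Red.of_coeff fun n => ?_
    rw [map_zero]
    exact mem_kerMod.mp (hI n)
  have := hFr.unique this
  rw [mul_one] at this
  exact sub_eq_zero.mp this


theorem sub_one_pow_eq_geom (κ : Type) [Field κ] [CharP κ p] :
    (Polynomial.X - 1 : Polynomial κ) ^ (p - 1) = ∑ i ∈ Finset.range p, Polynomial.X ^ i := by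
  have h0 : (Polynomial.X - 1 : Polynomial κ) ≠ 0 := Polynomial.X_sub_C_ne_zero 1
  apply mul_right_cancel₀ h0
  rw [geom_sum_mul, ← pow_succ, Nat.sub_add_cancel hp.out.one_le, sub_pow_char, one_pow]

theorem Place.hs_cusp_sq (hP : Place p red) (hp5 : 5 ≤ p) {m : ℕ} (hm : 2 * m + 1 = p) :
    (hs m (-3 : κ) 2) ^ 2 = 1 := by
  have := hP.charP
  have h1 : (Polynomial.X ^ 3 + Polynomial.C (-3) * Polynomial.X + Polynomial.C 2 : Polynomial κ) ^ m
      = (∑ i ∈ Finset.range p, Polynomial.X ^ i) * (Polynomial.X + Polynomial.C 2) ^ m := by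
    rw [← sub_one_pow_eq_geom, ← hm, Nat.add_sub_cancel, pow_mul, ← mul_pow]
    congr 1
    have c2 : (Polynomial.C (2:κ)) = 2 := rfl
    have c3 : (Polynomial.C (-3:κ)) = -3 := by rw [Polynomial.C_neg]; rfl
    rw [c2, c3]
    ring
  have h2 : hs m (-3 : κ) 2 = 3 ^ m := by
    rw [hs, h1, Polynomial.coeff_mul, Finset.Nat.sum_antidiagonal_eq_sum_range_succ_mk,
      ← Finset.sum_range_reflect]
    have h3 : ((Polynomial.X + Polynomial.C (2:κ)) ^ m).eval 1 = 3 ^ m := by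
      rw [Polynomial.eval_pow]; norm_num
    rw [← h3, Polynomial.eval_eq_sum_range' (n := 2 * m + 1)]
    · refine Finset.sum_congr rfl fun j hj => ?_
      rw [Finset.mem_range] at hj
      rw [Polynomial.finsetSum_coeff]
      simp only [Polynomial.coeff_X_pow]
      rw [Finset.sum_ite_eq, if_pos (by rw [Finset.mem_range]; omega), one_mul, one_pow, mul_one]
      congr 1
      omega
    · refine lt_of_le_of_lt Polynomial.natDegree_pow_le ?_
      rw [Polynomial.natDegree_X_add_C]
      omega
  have h3 : (3 : κ) ≠ 0 := by
    intro h0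
    apply hP.ne_1728 hp5
    linear_combination 576 * h0
  have h4 : ((3 : ℕ) : κ) ^ p = (3 : ℕ) := by
    rw [← frobenius_def, map_natCast]
  rw [h2, ← pow_mul]
  apply mul_right_cancel₀ h3
  rw [← pow_succ, mul_comm m 2, hm, one_mul]
  exact_mod_cast h4

end Birch

end

section

namespace Birch

open Polynomial Finset

variable {p : ℕ} [hp : Fact p.Prime]

theorem hs_mul_pow {F : Type*} [Field F] (m : ℕ) {u : F} (hu : u ≠ 0) (α β : F) :
    hs m (u ^ 2 * α) (u ^ 3 * β) = u ^ m * hs m α β := by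
  have h : ((X ^ 3 + C (u ^ 2 * α) * X + C (u ^ 3 * β) : F[X]) ^ m).comp (C u * X)
      = C (u ^ (3 * m)) * (X ^ 3 + C α * X + C β) ^ m := by
    rw [pow_mul, C_pow, ← mul_pow, pow_comp]
    congr 1
    simp
    ring
  have h2 := congrArg (fun f => f.coeff (2 * m)) h
  simp only [comp_C_mul_X_coeff, coeff_C_mul] at h2
  rw [hs, hs]
  apply mul_right_cancel₀ (pow_ne_zero (2 * m) hu)
  rw [h2]
  ring

theorem hs_mul_pow_pow {F : Type*} [Field F] (m : ℕ) {s : F} (hs0 : s ≠ 0) (α β : F) :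
    hs m (s ^ 4 * α) (s ^ 6 * β) = s ^ (2 * m) * hs m α β := by
  have := hs_mul_pow m (pow_ne_zero 2 hs0) α β
  rw [← pow_mul, ← pow_mul, ← pow_mul] at this
  exact this

/-- The integer `p - #{y ^ 2 = x ^ 3 + α x + β}`. -/
noncomputable def ap (α β : ZMod p) : ℤ :=
  (p : ℤ) - (Nat.card {xy : ZMod p × ZMod p // xy.2 ^ 2 = xy.1 ^ 3 + α * xy.1 + β} : ℤ)

theorem ringChar_ne_two (hp5 : 5 ≤ p) : ringChar (ZMod p) ≠ 2 := by
  rw [ZMod.ringChar_zmod_n]; omega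

local notation "χ" => quadraticChar (ZMod p)

theorem ap_eq (hp5 : 5 ≤ p) (α β : ZMod p) : ap α β = -∑ x : ZMod p, χ (x ^ 3 + α * x + β) := by
  have h1 : (Nat.card {xy : ZMod p × ZMod p // xy.2 ^ 2 = xy.1 ^ 3 + α * xy.1 + β} : ℤ)
      = ∑ x : ZMod p, (χ (x ^ 3 + α * x + β) + 1) := by
    rw [Nat.subtype_card (univ.filter fun xy : ZMod p × ZMod p => xy.2 ^ 2 = xy.1 ^ 3 + α * xy.1 + β)
      (by simp), card_filter, Fintype.sum_prod_type]
    push_cast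
    refine sum_congr rfl fun x _ => ?_
    rw [← quadraticChar_card_sqrts (ringChar_ne_two hp5)]
    rw [Finset.sum_boole]
    congr 2
    ext y
    simp
  rw [ap, h1, sum_add_distrib]
  simp

theorem ap_cast (hp5 : 5 ≤ p) {m : ℕ} (hm : 2 * m + 1 = p) (α β : ZMod p) :
    (ap α β : ZMod p) = hs m α β := by
  have hc : Fintype.card (ZMod p) = p := ZMod.card p
  have hm2 : p / 2 = m := by omega
  set P : (ZMod p)[X] := (X ^ 3 + C α * X + C β) ^ m with hP
  have h1 : ∀ x : ZMod p, ((χ (x ^ 3 + α * x + β) : ℤ) : ZMod p) = ∑ i ∈ range (3 * m + 1), P.coeff i * x ^ i := by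
    intro x
    rw [quadraticChar_eq_pow_of_char_ne_two' (ringChar_ne_two hp5), hc, hm2, ← eval_eq_sum_range' ]
    · simp [hP]
    · rw [Nat.lt_succ_iff, natDegree_le_iff_coeff_eq_zero]
      intro n hn
      exact coeff_cubic_pow_eq_zero α β m n hn
  have h2 : ∀ i ∈ range (3 * m + 1), i ≠ 2 * m → ∑ x : ZMod p, P.coeff i * x ^ i = 0 := by
    intro i hi hne
    rw [← mul_sum]
    rw [mem_range] at hi
    rcases lt_or_gt_of_ne hne with h | h
    · rw [FiniteField.sum_pow_lt_card_sub_one (ZMod p) i (by rw [hc]; omega), mul_zero]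
    · have : ∀ x : ZMod p, x ^ i = x ^ (i - 2 * m) := by
        intro x
        by_cases hx : x = 0
        · rw [hx, zero_pow (by omega), zero_pow (by omega)]
        · conv_lhs => rw [← Nat.sub_add_cancel h.le, pow_add]
          rw [show 2 * m = p - 1 by omega, ZMod.pow_card_sub_one_eq_one hx, mul_one]
      simp_rw [this]
      rw [FiniteField.sum_pow_lt_card_sub_one (ZMod p) _ (by rw [hc]; omega), mul_zero]
  rw [ap_eq hp5]
  push_cast
  simp_rw [h1]
  rw [sum_comm, sum_eq_single_of_mem (2 * m) (by simp; omega) h2, ← mul_sum]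
  have h3 : ∑ x : ZMod p, x ^ (2 * m) = -1 := by
    have : ∀ x : ZMod p, x ^ (2 * m) = 1 - if x = 0 then 1 else 0 := by
      intro x
      split_ifs with hx
      · rw [hx, zero_pow (by omega)]; simp
      · rw [show 2 * m = p - 1 by omega, ZMod.pow_card_sub_one_eq_one hx, sub_zero]
    simp_rw [this, sum_sub_distrib]
    simp
  rw [h3, hs]
  simp [hP]

theorem ap_twist (hp5 : 5 ≤ p) {u : ZMod p} (hu : u ≠ 0) (α β : ZMod p) :
    ap (u ^ 2 * α) (u ^ 3 * β) = χ u * ap α β := by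
  rw [ap_eq hp5, ap_eq hp5, mul_neg, mul_sum]
  congr 1
  rw [← Equiv.sum_comp (Equiv.mulLeft₀ u hu)]
  refine sum_congr rfl fun x _ => ?_
  have h1 : χ u ^ 2 = 1 := quadraticChar_sq_one hu
  have : (Equiv.mulLeft₀ u hu x) ^ 3 + u ^ 2 * α * (Equiv.mulLeft₀ u hu x) + u ^ 3 * β
      = u ^ 3 * (x ^ 3 + α * x + β) := by
    simp only [Equiv.mulLeft₀_apply]; ring
  rw [this, map_mul, map_pow, pow_succ, h1, one_mul]

theorem ap_twist_sq (hp5 : 5 ≤ p) {u : ZMod p} (hu : u ≠ 0) (α β : ZMod p) :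
    ap (u ^ 2 * α) (u ^ 3 * β) ^ 2 = ap α β ^ 2 := by
  rw [ap_twist hp5 hu, mul_pow, quadraticChar_sq_one hu, one_mul]

theorem sum_quadraticChar_mul (hp5 : 5 ≤ p) (c d : ZMod p) :
    ∑ b : ZMod p, χ (c + b) * χ (d + b) = (if c = d then (p : ℤ) else 0) - 1 := by
  rw [← Equiv.sum_comp (Equiv.subRight d)]
  simp only [Equiv.subRight_apply]
  have h0 : ∀ b : ZMod p, χ (c + (b - d)) * χ (d + (b - d))
      = χ (b * (b + (c - d))) := by
    intro b; rw [← map_mul]; congr 1; ring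
  simp_rw [h0]
  split_ifs with h
  · subst h
    have : ∀ b : ZMod p, χ (b * (b + (c - c))) = 1 - if b = 0 then 1 else 0 := by
      intro b
      split_ifs with hb
      · simp [hb]
      · rw [sub_self, add_zero, map_mul, ← pow_two, quadraticChar_sq_one hb, sub_zero]
    simp_rw [this, sum_sub_distrib]
    simp
  · have hcd : c - d ≠ 0 := sub_ne_zero.mpr h
    have h1 : ∀ b : ZMod p, χ (b * (b + (c - d))) = if b = 0 then 0 else χ (1 + (c - d) * b⁻¹) := by
      intro b
      split_ifs with hb
      · simp [hb]
      · have : b * (b + (c - d)) = b ^ 2 * (1 + (c - d) * b⁻¹) := by field_simp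
        rw [this, map_mul, map_pow, quadraticChar_sq_one hb, one_mul]
    have h2 : ∑ b : ZMod p, (if b = 0 then 0 else χ (1 + (c - d) * b⁻¹))
        = ∑ b : ZMod p, χ (1 + (c - d) * b⁻¹) - 1 := by
      have : ∀ b : ZMod p, (if b = 0 then 0 else χ (1 + (c - d) * b⁻¹))
          = χ (1 + (c - d) * b⁻¹) - if b = 0 then 1 else 0 := by
        intro b; split_ifs with hb <;> simp [hb]
      simp_rw [this, sum_sub_distrib]
      simp
    simp_rw [h1]
    rw [h2]
    have h3 : ∑ b : ZMod p, χ (1 + (c - d) * b⁻¹) = ∑ b : ZMod p, χ b := by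
      rw [← Equiv.sum_comp (((Equiv.inv (ZMod p)).trans (Equiv.mulLeft₀ (c - d) hcd)).trans (Equiv.addLeft 1)) (fun b => χ b)]
      rfl
    rw [h3, quadraticChar_sum_zero (ringChar_ne_two hp5)]

theorem sum_ap_sq_right (hp5 : 5 ≤ p) (α : ZMod p) : ∑ β : ZMod p, ap α β ^ 2 =
    p * (∑ x : ZMod p, ∑ y : ZMod p, if x ^ 3 + α * x = y ^ 3 + α * y then 1 else 0) - (p:ℤ) ^ 2 := by
  have h1 : ∀ β : ZMod p, ap α β ^ 2 = ∑ x : ZMod p, ∑ y : ZMod p,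
      χ (x ^ 3 + α * x + β) * χ (y ^ 3 + α * y + β) := by
    intro β
    rw [ap_eq hp5, neg_sq, pow_two, sum_mul_sum]
  simp_rw [h1]
  rw [sum_comm]
  have h2 : ∀ x : ZMod p, ∑ β : ZMod p, ∑ y : ZMod p, χ (x ^ 3 + α * x + β) * χ (y ^ 3 + α * y + β)
      = ∑ y : ZMod p, ((p : ℤ) * (if x ^ 3 + α * x = y ^ 3 + α * y then 1 else 0) - 1) := by
    intro x
    rw [sum_comm]
    refine sum_congr rfl fun y _ => ?_
    rw [sum_quadraticChar_mul hp5]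
    simp
  simp_rw [h2, sum_sub_distrib, ← mul_sum]
  simp
  ring

theorem sum_ap_sq (hp5 : 5 ≤ p) :
    ∑ α : ZMod p, ∑ β : ZMod p, ap α β ^ 2 = (p:ℤ) ^ 3 - (p:ℤ) ^ 2 := by
  simp_rw [sum_ap_sq_right hp5, sum_sub_distrib, ← mul_sum]
  rw [sum_comm]
  have h1 : ∀ x : ZMod p, ∑ α : ZMod p, ∑ y : ZMod p,
      (if x ^ 3 + α * x = y ^ 3 + α * y then (1:ℤ) else 0) = 2 * p - 1 := by
    intro x
    rw [sum_comm]
    have : ∀ y : ZMod p, ∑ α : ZMod p, (if x ^ 3 + α * x = y ^ 3 + α * y then (1:ℤ) else 0)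
        = 1 + if y = x then (p:ℤ) - 1 else 0 := by
      intro y
      split_ifs with h
      · subst h; simp
      · have hxy : x - y ≠ 0 := sub_ne_zero.mpr (Ne.symm h)
        have : ∀ α : ZMod p, x ^ 3 + α * x = y ^ 3 + α * y ↔ α = -(x ^ 2 + x * y + y ^ 2) := by
          intro α
          constructor
          · intro h
            apply mul_left_cancel₀ hxy
            linear_combination h
          · rintro rfl; ring
        simp_rw [this]
        simp
    simp_rw [this, sum_add_distrib]
    simp
    ring
  simp_rw [h1]
  simp
  ring

theorem card_pow_eq_le (n : ℕ) (hn : 0 < n) (a : ZMod p) :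
    #{u : ZMod p | u ^ n = a} ≤ n := by
  have := card_nthRoots (R := ZMod p) n a
  refine le_trans ?_ this
  rw [← Finset.card_val]
  refine Multiset.card_le_card ((Multiset.le_iff_subset (Finset.nodup _)).mpr ?_)
  intro u hu
  rw [mem_nthRoots hn]
  simpa using hu

theorem sum_pow_mul_le {n : ℕ} (hn : 0 < n) {b : ZMod p} (hb : b ≠ 0) (f : ZMod p → ℤ) (hf : ∀ x, 0 ≤ f x) :
    ∑ u : ZMod p, f (u ^ n * b) ≤ n * ∑ x : ZMod p, f x := by
  rw [← sum_fiberwise (s := univ) (g := fun u : ZMod p => u ^ n * b), mul_sum]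
  refine sum_le_sum fun x _ => ?_
  rw [sum_congr rfl (g := fun _ => f x) (by simp +contextual), sum_const, nsmul_eq_mul]
  gcongr
  · exact hf x
  · refine le_trans (card_le_card ?_) (card_pow_eq_le n hn (x * b⁻¹))
    intro u hu
    simp at hu ⊢
    rw [← hu]; field_simp

theorem sq_le_of_twist {n : ℕ} (hn : 0 < n) {b : ZMod p} (hb : b ≠ 0) (f : ZMod p → ℤ)
    (hf : ∀ x, 0 ≤ f x) (h : ∀ u, u ≠ 0 → f (u ^ n * b) = f b) :
    ((p : ℤ) - 1) * f b ≤ n * ∑ x : ZMod p, f x := by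
  refine le_trans ?_ (sum_pow_mul_le hn hb f hf)
  rw [← sum_erase_add univ _ (mem_univ (0 : ZMod p))]
  have : ∑ u ∈ univ.erase (0 : ZMod p), f (u ^ n * b) = ((p:ℤ) - 1) * f b := by
    rw [sum_congr rfl (g := fun _ => f b) (fun u hu => h u (by simpa using hu)), sum_const, card_erase_of_mem (mem_univ _)]
    simp [ZMod.card]
    left
    rw [Nat.cast_sub hp.out.one_le, Nat.cast_one]
  rw [this]
  have := hf (0 ^ n * b)
  omega

theorem le_of_sub_one_mul_le {p : ℕ} (hp5 : 5 ≤ p) {a : ℤ} (h : ((p : ℤ) - 1) * a ≤ 6 * (p : ℤ) ^ 2) :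
    a ≤ 12 * (p : ℤ) := by
  have h5 : (5:ℤ) ≤ p := by exact_mod_cast hp5
  by_contra! hlt
  have h1 : ((p : ℤ) - 1) * (12 * p) < ((p : ℤ) - 1) * a := by
    apply mul_lt_mul_of_pos_left hlt; linarith
  nlinarith

theorem ap_zero_left_sq_le (hp5 : 5 ≤ p) {β : ZMod p} (hβ : β ≠ 0) : ap 0 β ^ 2 ≤ 12 * (p:ℤ) := by
  have h1 : ((p : ℤ) - 1) * ap 0 β ^ 2 ≤ (3 : ℕ) * ∑ x : ZMod p, ap 0 x ^ 2 := by
    refine sq_le_of_twist (by norm_num) hβ (fun β => ap 0 β ^ 2) (fun _ => sq_nonneg _) ?_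
    intro u hu
    have := ap_twist_sq hp5 hu 0 β
    simpa using this
  have h2 : (∑ x : ZMod p, ∑ y : ZMod p, if x ^ 3 + 0 * x = y ^ 3 + 0 * y then (1:ℤ) else 0) ≤ p * 3 := by
    calc _ ≤ ∑ x : ZMod p, (3:ℤ) := by
          refine sum_le_sum fun x _ => ?_
          rw [sum_boole]
          have := card_pow_eq_le 3 (by norm_num) (x ^ 3)
          simp_rw [zero_mul, add_zero, eq_comm (a := x ^ 3)]
          exact_mod_cast this
      _ = _ := by simp
  rw [sum_ap_sq_right hp5] at h1
  have h3 : ((p : ℤ) - 1) * ap 0 β ^ 2 ≤ 6 * (p : ℤ) ^ 2 := by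
    have := mul_le_mul_of_nonneg_left h2 (show (0:ℤ) ≤ p by positivity)
    push_cast at h1 ⊢
    nlinarith
  exact le_of_sub_one_mul_le hp5 h3

theorem ap_zero_right_sq_le (hp5 : 5 ≤ p) {α : ZMod p} (hα : α ≠ 0) : ap α 0 ^ 2 ≤ 12 * (p:ℤ) := by
  have h1 : ((p : ℤ) - 1) * ap α 0 ^ 2 ≤ (2 : ℕ) * ∑ x : ZMod p, ap x 0 ^ 2 := by
    refine sq_le_of_twist (by norm_num) hα (fun α => ap α 0 ^ 2) (fun _ => sq_nonneg _) ?_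
    intro u hu
    have := ap_twist_sq hp5 hu α 0
    simpa using this
  have h2 : ∑ x : ZMod p, ap x 0 ^ 2 ≤ 2 * (p:ℤ) ^ 2 := by
    have e1 : ∀ α : ZMod p, ap α 0 ^ 2 = ∑ x : ZMod p, ∑ y : ZMod p,
        χ (x * y) * (χ (x ^ 2 + α) * χ (y ^ 2 + α)) := by
      intro α
      rw [ap_eq hp5, neg_sq, pow_two, sum_mul_sum]
      refine sum_congr rfl fun x _ => sum_congr rfl fun y _ => ?_
      rw [← map_mul, ← map_mul, ← map_mul]
      congr 1; ring
    simp_rw [e1]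
    rw [sum_comm]
    have e2 : ∀ x : ZMod p, ∑ β : ZMod p, ∑ y : ZMod p, χ (x * y) * (χ (x ^ 2 + β) * χ (y ^ 2 + β))
      = ∑ y : ZMod p, χ (x * y) * (if x ^ 2 = y ^ 2 then (p:ℤ) else 0) := by
      intro x
      rw [sum_comm]
      have e3 : ∀ y : ZMod p, ∑ β : ZMod p, χ (x * y) * (χ (x ^ 2 + β) * χ (y ^ 2 + β))
          = χ (x * y) * (if x ^ 2 = y ^ 2 then (p:ℤ) else 0) - χ x * χ y := by
        intro y
        rw [← mul_sum, sum_quadraticChar_mul hp5, mul_sub, mul_one, map_mul]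
      simp_rw [e3, sum_sub_distrib, ← mul_sum]
      rw [quadraticChar_sum_zero (ringChar_ne_two hp5), mul_zero, sub_zero]
    simp_rw [e2]
    calc _ ≤ ∑ x : ZMod p, (2:ℤ) * p := by
          refine sum_le_sum fun x _ => ?_
          calc _ ≤ ∑ y : ZMod p, (p:ℤ) * (if x ^ 2 = y ^ 2 then 1 else 0) := by
                refine sum_le_sum fun y _ => ?_
                split_ifs
                · have : χ (x * y) ≤ 1 := by
                    by_cases hx : x * y = 0
                    · simp [hx]
                    · rcases quadraticChar_dichotomy hx with h | h <;> rw [h] <;> simp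
                  nlinarith
                · simp
            _ ≤ _ := by
                rw [← mul_sum, sum_boole, mul_comm]
                have := card_pow_eq_le 2 (by norm_num) (x ^ 2)
                simp_rw [eq_comm (a := x ^ 2)]
                gcongr
                exact_mod_cast this
      _ = _ := by simp; ring
  refine le_of_sub_one_mul_le hp5 (h1.trans ?_)
  push_cast
  nlinarith [sq_nonneg (p:ℤ)]

/-- Sums of twist-invariant functions over pairs reduce to the diagonal. -/
theorem sum_pairs (f : ZMod p → ZMod p → ℝ)
    (h : ∀ u, u ≠ 0 → ∀ α β, f (u ^ 2 * α) (u ^ 3 * β) = f α β) :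
    ∑ α ∈ univ.erase (0 : ZMod p), ∑ β ∈ univ.erase (0 : ZMod p), f α β
      = ((p:ℝ) - 1) * ∑ c ∈ univ.erase (0 : ZMod p), f c c := by
  have h1 : ((p:ℝ) - 1) * ∑ c ∈ univ.erase (0 : ZMod p), f c c
      = ∑ c ∈ univ.erase (0 : ZMod p), ∑ u ∈ univ.erase (0 : ZMod p), f (u ^ 2 * c) (u ^ 3 * c) := by
    rw [mul_sum]
    refine sum_congr rfl fun c _ => ?_
    rw [sum_congr rfl (g := fun _ => f c c) (fun u hu => h u (by simpa using hu) c c), sum_const,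
      card_erase_of_mem (mem_univ _)]
    simp [ZMod.card, Nat.cast_sub hp.out.one_le]
  rw [h1, ← sum_product', ← sum_product']
  refine sum_bij' (fun x _ => (x.1 ^ 3 * (x.2 ^ 2)⁻¹, x.2 * x.1⁻¹))
    (fun x _ => (x.2 ^ 2 * x.1, x.2 ^ 3 * x.1)) ?_ ?_ ?_ ?_ ?_
  · rintro ⟨a, b⟩ hx; simp at hx ⊢; tauto
  · rintro ⟨a, b⟩ hx; simp at hx ⊢; tauto
  · rintro ⟨a, b⟩ hx; simp at hx ⊢; obtain ⟨h1, h2⟩ := hx; constructor <;> field_simp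
  · rintro ⟨a, b⟩ hx; simp at hx ⊢; obtain ⟨h1, h2⟩ := hx; constructor <;> field_simp
  · rintro ⟨a, b⟩ hx; simp at hx ⊢; obtain ⟨h1, h2⟩ := hx; congr 1 <;> field_simp

end Birch

end

section

open UpperHalfPlane ModularForm ModularGroup MatrixGroups Complex Manifold

set_option linter.unusedSectionVars false

namespace Birch

section
variable {p : ℕ} [hp : Fact p.Prime] {V : Subring ℂ} {κ : Type} [Field κ] {red : V →+* κ}

theorem exists_coset {x c a y : ℤ} (hdet : x * y + a * c = p) :
    (∃ A B C D : ℤ, A * D - B * C = 1 ∧ x = A * p ∧ -c = B ∧ a = C * p ∧ y = D) ∨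
    (∃ b : ZMod p, ∃ A B C D : ℤ, A * D - B * C = 1 ∧ x = A ∧ -c = A * b.val + B * p ∧ a = C ∧
      y = C * b.val + D * p) := by
  have hp0 : (p : ℤ) ≠ 0 := by exact_mod_cast hp.out.ne_zero
  have hd : (x : ZMod p) * y + a * c = 0 := by
    have := congrArg (Int.cast : ℤ → ZMod p) hdet
    push_cast at this
    simpa using this
  have fin : ∀ b : ZMod p, (p : ℤ) ∣ -c - x * b.val → (p : ℤ) ∣ y - a * b.val →
      (∃ A B C D : ℤ, A * D - B * C = 1 ∧ x = A ∧ -c = A * b.val + B * p ∧ a = C ∧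
      y = C * b.val + D * p) := by
    rintro b ⟨B, hB⟩ ⟨D, hD⟩
    refine ⟨x, B, a, D, ?_, rfl, by linarith, rfl, by linarith⟩
    apply mul_left_cancel₀ hp0
    linear_combination hdet - x * hD + a * hB
  have key : ∀ n : ℤ, (n : ZMod p) = 0 ↔ (p : ℤ) ∣ n := fun n => ZMod.intCast_zmod_eq_zero_iff_dvd n p
  by_cases ha : (a : ZMod p) = 0
  · by_cases hx : (x : ZMod p) = 0
    · left
      obtain ⟨A, rfl⟩ := (key x).mp hx
      obtain ⟨C, rfl⟩ := (key a).mp ha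
      refine ⟨A, -c, C, y, ?_, by ring, rfl, by ring, rfl⟩
      apply mul_left_cancel₀ hp0
      linear_combination hdet
    · right
      refine ⟨-c / x, fin _ ?_ ?_⟩
      · rw [← key]; push_cast; rw [ZMod.natCast_val, ZMod.cast_id]; field_simp; ring
      · rw [← key]; push_cast
        rw [ha, zero_mul, add_zero] at hd
        rw [ha, (mul_eq_zero.mp hd).resolve_left hx]; ring
  · right
    refine ⟨y / a, fin _ ?_ ?_⟩
    · rw [← key]; push_cast; rw [ZMod.natCast_val, ZMod.cast_id]; field_simp
      linear_combination -hd
    · rw [← key]; push_cast; rw [ZMod.natCast_val, ZMod.cast_id]; field_simp; ring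

theorem nm_eq_zero {x c a y : ℤ} (hdet : x * y + a * c = p) {τ : ℍ}
    (hfix : (a : ℂ) * (τ : ℂ) ^ 2 + (y - x) * τ + c = 0) :
    nm p 4 6 (fun τ' => ((x : ℂ) - a * τ) ^ 2 * e6 τ') e4 e4 e6 τ = 0 := by
  have hp0 : (p : ℂ) ≠ 0 := by exact_mod_cast hp.out.ne_zero
  have hdC : (x : ℂ) * y + a * c = p := by exact_mod_cast congrArg (Int.cast : ℤ → ℂ) hdet
  have hN : ((a : ℂ) * τ + y) * (x - a * τ) = p := by
    linear_combination hdC - a * hfix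
  have hN4 : ((a : ℂ) * τ + y) ^ 2 * (x - a * τ) ^ 2 = p ^ 2 := by rw [← mul_pow, hN]
  rw [nm, mul_eq_zero]
  rcases exists_coset hdet with ⟨A, B, C, D, h1, hx, hc, ha, hy⟩ | ⟨b, A, B, C, D, h1, hx, hc, ha, hy⟩
  · left
    have hτ : (τ : ℂ) * (C * (ptInf p τ : ℂ) + D) = A * (ptInf p τ : ℂ) + B := by
      rw [coe_ptInf]
      have h2 : (a : ℂ) = C * p := by exact_mod_cast congrArg (Int.cast : ℤ → ℂ) ha
      have h3 : (x : ℂ) = A * p := by exact_mod_cast congrArg (Int.cast : ℤ → ℂ) hx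
      have h4 : -(c : ℂ) = B := by exact_mod_cast congrArg (Int.cast : ℤ → ℂ) hc
      have h5 : (y : ℂ) = D := by exact_mod_cast congrArg (Int.cast : ℤ → ℂ) hy
      rw [← h4, ← h5]
      rw [h2, h3] at hfix
      linear_combination hfix
    have hj : C * (ptInf p τ : ℂ) + D = a * τ + y := by
      rw [coe_ptInf, ha, hy]; push_cast; ring
    have e1 := mf_e4.act h1 hτ
    have e2 := mf_e6.act h1 hτ
    rw [hj] at e1 e2
    rw [e1, e2]
    linear_combination ((a : ℂ) * τ + y) ^ 4 * e6 (ptInf p τ) * e4 (ptInf p τ) * hN4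
  · right
    refine Finset.prod_eq_zero (Finset.mem_univ b) ?_
    have h2 : (a : ℂ) = C := by exact_mod_cast congrArg (Int.cast : ℤ → ℂ) ha
    have h3 : (x : ℂ) = A := by exact_mod_cast congrArg (Int.cast : ℤ → ℂ) hx
    have h4 : -(c : ℂ) = A * (b.val : ℤ) + B * p := by exact_mod_cast congrArg (Int.cast : ℤ → ℂ) hc
    have h5 : (y : ℂ) = C * (b.val : ℤ) + D * p := by exact_mod_cast congrArg (Int.cast : ℤ → ℂ) hy
    have hj : C * (ptFin p (b.val : ℤ) τ : ℂ) + D = (a * τ + y) / p := by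
      rw [coe_ptFin, h2, h5]; field_simp; ring
    have hτ : (τ : ℂ) * (C * (ptFin p (b.val : ℤ) τ : ℂ) + D) = A * (ptFin p (b.val : ℤ) τ : ℂ) + B := by
      rw [hj, coe_ptFin, ← h3]
      rw [← h3] at h4
      field_simp
      linear_combination hfix + h4
    have e1 := mf_e4.act h1 hτ
    have e2 := mf_e6.act h1 hτ
    rw [hj] at e1 e2
    rw [e1, e2]
    have hN5 : (((a : ℂ) * τ + y) / p) ^ 2 * (x - a * τ) ^ 2 = 1 := by
      rw [div_pow]; field_simp; linear_combination hN4
    linear_combination (((a : ℂ) * τ + y) / p) ^ 4 * e6 (ptFin p (b.val : ℤ) τ) * e4 (ptFin p (b.val : ℤ) τ) * hN5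

theorem Rd.hs {x y : ℂ} {α β : κ} (hx : Rd red x α) (hy : Rd red y β) (m : ℕ) :
    Rd red (hs m x y) (hs m α β) := by
  obtain ⟨h1, rfl⟩ := hx
  obtain ⟨h2, rfl⟩ := hy
  have e : Birch.hs m x y = ((Birch.hs m (⟨x, h1⟩ : V) ⟨y, h2⟩ : V) : ℂ) :=
    (map_hs V.subtype m (⟨x, h1⟩ : V) ⟨y, h2⟩).symm
  rw [e, ← map_hs]
  exact Rd.coe _

theorem Place.rd_hasse_aux (hP : Place p red) (hp5 : 5 ≤ p) {m : ℕ} (hm : 2 * m + 1 = p) {τ : ℍ} {s : ℂ}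
    (hs0 : s ≠ 0) {A B : κ} (hA : Rd red (s ^ 4 * e4 τ) A) (hB : Rd red (s ^ 6 * e6 τ) B)
    (hA0 : A ≠ 0) (hB0 : B ≠ 0)
    {x c a y : ℤ} (hdet : x * y + a * c = p)
    (hfix : (a : ℂ) * (τ : ℂ) ^ 2 + (y - x) * τ + c = 0) {ν : κ} (hν : Rd red ((x : ℂ) - a * τ) ν) (hν0 : ν ≠ 0) :
    (ν ^ 2) ^ p * B ^ (p - 1) = hs m (-3 * A) (2 * B) ^ 2 * A ^ (p - 1) := by
  have h1 : MF (p - 1) (hf m) := by rw [← hm]; exact mf_hf m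
  have h2 : s ^ (p - 1) * hf m τ = hs m (-3 * (s ^ 4 * e4 τ)) (2 * (s ^ 6 * e6 τ)) := by
    rw [show p - 1 = 2 * m by omega, hf, ← hs_mul_pow_pow m hs0]
    congr 1 <;> ring
  have h3 : Rd red (s ^ (p - 1) * hf m τ) (hs m (-3 * A) (2 * B)) := by
    rw [h2]
    exact ((Rd.natCast 3).neg.mul hA |> fun h => by simpa using h : Rd red (-3 * (s ^ 4 * e4 τ)) (-3 * A)).hs
      ((Rd.natCast 2).mul hB |> fun h => by simpa using h) m
  have h4 : (hs m (-3 : κ) 2) ^ 2 = 1 := hP.hs_cusp_sq hp5 hm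
  have h5 := red_hf (red := red) m
  rw [hP.red_hf_eq hp5 hm] at h5
  have h6 := hP.norm_rel hp5 h1 (qRep_hf m) h5 (by rw [← map_pow, h4, map_one]) (hν.pow 2).mem hA.mem hB.mem
  rw [nm_eq_zero hdet hfix, mul_zero, zero_sub, mem_kerMod] at h6
  have h7 := ((((hν.pow 2).pow (p + 1)).mul ((hA.mul hB).pow (p + 1))).sub
    ((((hν.pow 2).mul (h3.pow 2)).mul (hB.pow 2)).mul (hA.pow (2 * p)))).neg
  have h8 := h6.unique h7
  have hp1 := hp.out.one_le
  have h9 : ν ^ 2 * A ^ (p + 1) * B ^ 2 * ((ν ^ 2) ^ p * B ^ (p - 1)) =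
      ν ^ 2 * A ^ (p + 1) * B ^ 2 * (hs m (-3 * A) (2 * B) ^ 2 * A ^ (p - 1)) := by
    obtain ⟨k, hk⟩ := Nat.exists_eq_add_of_le' hp1
    have : p - 1 = k := by omega
    rw [this]
    rw [hk] at h8 ⊢
    linear_combination h8
  exact mul_left_cancel₀ (by positivity) h9

/-- Norm relation for `-p e6 e4_γ - e6_γ e4`, divided by `-p`, in terms of a lift `h` of the Hasse
invariant. -/
theorem Place.norm_rel_neg (hP : Place p red) (hp5 : 5 ≤ p) {h : ℍ → ℂ} (hh : MF (p - 1) h)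
    {ch : PowerSeries ℂ} (hch : QRep 1 h ch) {gh : PowerSeries κ} (hgh : Red red ch gh)
    (hgh1 : gh ^ 2 = 1) {τ : ℍ} {s : ℂ} (h4 : s ^ 4 * e4 τ ∈ V) (h6 : s ^ 6 * e6 τ ∈ V) :
    s ^ (10 * (p + 1)) * ((-(p : ℂ))⁻¹ * nm p 4 6 (fun τ => (-(p : ℂ)) * e6 τ) e4 e4 e6 τ) +
      (s ^ (p - 1) * h τ) ^ 2 * (s ^ 6 * e6 τ) ^ 2 * (s ^ 4 * e4 τ) ^ (2 * p) ∈ kerMod red := by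
  have := hP.charP
  have hp0 := hp.out.ne_zero
  have hpC : (-(p : ℂ)) ≠ 0 := neg_ne_zero.mpr (p_ne p)
  have hodd : Odd p := hp.out.odd_of_ne_two (by omega)
  obtain ⟨c, hc, hc'⟩ := exists_nm_exp (p := p) (mf_e6.smul (-(p : ℂ))) mf_e4 mf_e4 mf_e6 rfl
    (by norm_num) (qRep_e6.smul (-(p : ℂ))) qRep_e4 qRep_e4 qRep_e6
  have r4 := Red.map_int (red := red) c4
  have r6 := Red.map_int (red := red) c6
  have f4 : Fr p hp0 (c4.map (Int.castRingHom κ)) := Fr.map_int p hp0 c4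
  have f6 : Fr p hp0 (c6.map (Int.castRingHom κ)) := Fr.map_int p hp0 c6
  set F4 := c4.map (Int.castRingHom κ)
  set F6 := c6.map (Int.castRingHom κ)
  have rp : Rd red (-(p : ℂ)) 0 := by
    have := (Rd.natCast (red := red) p).neg
    rwa [CharP.cast_eq_zero κ p, neg_zero] at this
  have hra : Red red (PowerSeries.C (-(p : ℂ))⁻¹ * c) (-(F6 ^ 2 * F4 ^ (2 * p))) := by
    have h1 : Red red ((PowerSeries.C (-(p : ℂ))⁻¹ * c).expand p hp0)
        ((-(F6 ^ 2 * F4 ^ (2 * p))).expand p hp0) := by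
      rw [map_mul, hc', nmExp, ← mul_assoc, PowerSeries.expand_C]
      have e1 : ∀ u v : PowerSeries ℂ, PowerSeries.C (-(p : ℂ))⁻¹ *
          (PowerSeries.C (-(p : ℂ)) * u - PowerSeries.C ((p : ℂ) ^ (6 - 4)) * v) =
          u - PowerSeries.C (-(p : ℂ)) * v := by
        intro u v
        rw [mul_sub, ← mul_assoc, ← mul_assoc, ← map_mul, ← map_mul, inv_mul_cancel₀ hpC, map_one,
          one_mul, show (-(p : ℂ))⁻¹ * (p : ℂ) ^ (6 - 4) = -(p : ℂ) by
            have := p_ne p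
            field_simp]
      have e2 : (-(F6 ^ 2 * F4 ^ (2 * p))).expand p hp0 =
          (F6.expand p hp0 * (F4.expand p hp0).expand p hp0 - PowerSeries.C (0 : κ) *
            (F4.expand p hp0 * (F6.expand p hp0).expand p hp0)) *
          ∏ b : ZMod p, ((PowerSeries.C (0 : κ) * F6).expand p hp0 * F4.rescale 1 -
            F4.expand p hp0 * F6.rescale 1) := by
        rw [Finset.prod_const, Finset.card_univ, ZMod.card, PowerSeries.rescale_one, ← f4, ← f6]
        simp only [map_zero, zero_mul, sub_zero, zero_sub, RingHom.id_apply, hodd.neg_pow]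
        rw [mul_pow, map_pow, map_neg, map_mul, map_pow, map_pow, ← f4, ← f6]
        ring
      rw [e2, map_mul, PowerSeries.expand_C, mul_assoc (PowerSeries.C (-(p : ℂ))), e1]
      refine Red.mul ?_ (Red.prod _ fun b _ => ?_)
      · exact ((r6.expand hp0).mul ((r4.expand hp0).expand hp0)).sub
          ((Red.C rp).mul ((r4.expand hp0).mul ((r6.expand hp0).expand hp0)))
      · have := ((((Red.C rp).mul r6).expand hp0).mul (Red.rescale (hP.rd_zeta (b.val : ℤ)) r4)).sub
          ((r4.expand hp0).mul (Red.rescale (hP.rd_zeta (b.val : ℤ)) r6))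
        rwa [map_mul (PowerSeries.expand p hp0) (PowerSeries.C (-(p : ℂ))), PowerSeries.expand_C] at this
    refine Red.of_coeff fun n => ?_
    have := h1.coeff (p * n)
    rwa [PowerSeries.coeff_expand_mul, PowerSeries.coeff_expand_mul] at this
  have hM := (MF.nm (p := p) (mf_e6.smul (-(p : ℂ))) mf_e4 mf_e4 mf_e6 rfl (by norm_num)).smul
    (-(p : ℂ))⁻¹
  have hM2 := ((hh.pow 2).mul (mf_e6.pow 2)).mul (mf_e4.pow (2 * p))
  have e1 : (p - 1) * 2 + 6 * 2 + 4 * (2 * p) = 10 * (p + 1) := by omega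
  rw [e1] at hM2
  have hD := hM.add hM2
  have hDq := (hc.smul (-(p : ℂ))⁻¹).add (((hch.pow 2).mul (qRep_e6.pow 2)).mul (qRep_e4.pow (2 * p)))
  have hred := hra.add (((hgh.pow 2).mul (r6.pow 2)).mul (r4.pow (2 * p)))
  have hk := Red.coeffIn_ker (by
    convert hred using 1
    rw [hgh1]
    ring)
  have hgen := hD.gen (hP.mem_1728 hp5) (kerMod red) hDq (fun n _ => hk n)
  have := hgen.eval (hP.mem_1728 hp5) h4 h6
  convert this using 1
  have e2 : s ^ (10 * (p + 1)) = s ^ ((p - 1) * 2) * s ^ (6 * 2) * s ^ (4 * (2 * p)) := by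
    rw [← pow_add, ← pow_add, e1]
  rw [mul_add (s ^ (10 * (p + 1)))]
  congr 1
  rw [mul_pow, mul_pow, mul_pow, ← pow_mul, ← pow_mul, ← pow_mul, e2]; ring

theorem Place.rd_hasse_aux_zero (hP : Place p red) (hp5 : 5 ≤ p) {m : ℕ} (hm : 2 * m + 1 = p) {τ : ℍ}
    {s : ℂ} (hs0 : s ≠ 0) {A B : κ} (hA : Rd red (s ^ 4 * e4 τ) A) (hB : Rd red (s ^ 6 * e6 τ) B)
    (hA0 : A ≠ 0) (hB0 : B ≠ 0) {x c a y : ℤ} (hdet : x * y + a * c = p)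
    (hfix : (a : ℂ) * (τ : ℂ) ^ 2 + (y - x) * τ + c = 0) (ht : x + y = 0) :
    hs m (-3 * A) (2 * B) = 0 := by
  have h1 : MF (p - 1) (hf m) := by rw [← hm]; exact mf_hf m
  have h2 : s ^ (p - 1) * hf m τ = hs m (-3 * (s ^ 4 * e4 τ)) (2 * (s ^ 6 * e6 τ)) := by
    rw [show p - 1 = 2 * m by omega, hf, ← hs_mul_pow_pow m hs0]
    congr 1 <;> ring
  have h3 : Rd red (s ^ (p - 1) * hf m τ) (hs m (-3 * A) (2 * B)) := by
    rw [h2]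
    exact ((Rd.natCast 3).neg.mul hA |> fun h => by simpa using h : Rd red (-3 * (s ^ 4 * e4 τ)) (-3 * A)).hs
      ((Rd.natCast 2).mul hB |> fun h => by simpa using h) m
  have h4 : (hs m (-3 : κ) 2) ^ 2 = 1 := hP.hs_cusp_sq hp5 hm
  have h5 := red_hf (red := red) m
  rw [hP.red_hf_eq hp5 hm] at h5
  have h6 := hP.norm_rel_neg hp5 h1 (qRep_hf m) h5 (by rw [← map_pow, h4, map_one]) hA.mem hB.mem
  have hdC : (x : ℂ) * y + a * c = p := by exact_mod_cast congrArg (Int.cast : ℤ → ℂ) hdet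
  have hy : (y : ℂ) = -x := by
    have : ((x + y : ℤ) : ℂ) = 0 := by rw [ht]; simp
    push_cast at this
    linear_combination this
  have hν : ((x : ℂ) - a * τ) ^ 2 = -(p : ℂ) := by
    rw [hy] at hdC hfix
    linear_combination a * hfix - hdC
  have h0 := nm_eq_zero hdet hfix
  rw [hν] at h0
  rw [h0, mul_zero, mul_zero, zero_add, mem_kerMod] at h6
  have h8 := h6.unique (((h3.pow 2).mul (hB.pow 2)).mul (hA.pow (2 * p)))
  by_contra hne
  exact absurd h8.symm (by positivity)

theorem Place.rd_hasse (hP : Place p red) (hp5 : 5 ≤ p) {m : ℕ} (hm : 2 * m + 1 = p) {τ : ℍ} {s : ℂ}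
    (hs0 : s ≠ 0) {A B : κ} (hA : Rd red (s ^ 4 * e4 τ) A) (hB : Rd red (s ^ 6 * e6 τ) B)
    (hA0 : A ≠ 0) (hB0 : B ≠ 0)
    {x c a y : ℤ} (hdet : x * y + a * c = p)
    (hfix : (a : ℂ) * (τ : ℂ) ^ 2 + (y - x) * τ + c = 0) (ht : x + y = 0 ∨ ¬ (p : ℤ) ∣ x + y) :
    ((x + y : ℤ) : κ) ^ 2 * B ^ (p - 1) = hs m (-3 * A) (2 * B) ^ 2 * A ^ (p - 1) := by
  rcases ht with ht | ht
  · rw [ht, hP.rd_hasse_aux_zero hp5 hm hs0 hA hB hA0 hB0 hdet hfix ht]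
    simp
  have hchar := hP.charP
  have hdC : (x : ℂ) * y + a * c = p := by exact_mod_cast congrArg (Int.cast : ℤ → ℂ) hdet
  have hN : ((a : ℂ) * τ + y) * (x - a * τ) = p := by
    linear_combination hdC - a * hfix
  have ht0 : ((x + y : ℤ) : κ) ≠ 0 := by
    rwa [Ne, CharP.intCast_eq_zero_iff κ p]
  have htp : ((x + y : ℤ) : κ) ^ p = ((x + y : ℤ) : κ) := by
    rw [← map_intCast (ZMod.castHom (dvd_refl p) κ), ← map_pow, ZMod.pow_card]
  have int : ∀ z : ℂ, z ^ 2 - (x + y : ℤ) * z + (p : ℤ) = 0 → z ∈ V := by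
    intro z hz
    refine hP.mem_of_monic (f := Polynomial.X ^ 2 + (Polynomial.C (-((x + y : ℤ) : V)) * Polynomial.X + Polynomial.C ((p:ℤ) : V))) ?_ ?_
    · apply Polynomial.monic_X_pow_add
      refine (Polynomial.degree_linear_le).trans_lt (by norm_num)
    · simp at hz ⊢
      linear_combination hz
  have hν := int ((x : ℂ) - a * τ) (by push_cast; linear_combination -hN)
  have hμ := int ((a : ℂ) * τ + y) (by push_cast; linear_combination -hN)
  obtain ⟨ν, hν⟩ := Rd.exists_of_mem (red := red) hν
  obtain ⟨μ, hμ⟩ := Rd.exists_of_mem (red := red) hμ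
  have hsum : ν + μ = ((x + y : ℤ) : κ) := by
    refine (hν.add hμ).unique ?_
    have := Rd.intCast (red := red) (x + y)
    convert this using 1
    push_cast; ring
  have hprod : μ * ν = 0 := by
    have h1 := Rd.natCast (red := red) p
    rw [CharP.cast_eq_zero κ p] at h1
    rw [← hN] at h1
    exact (hμ.mul hν).unique h1
  rcases mul_eq_zero.mp hprod with h | h
  · have hν' : ν = ((x + y : ℤ) : κ) := by rw [← hsum, h, add_zero]
    rw [← hP.rd_hasse_aux hp5 hm hs0 hA hB hA0 hB0 hdet hfix hν (by rw [hν']; exact ht0), hν', ← pow_mul,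
      mul_comm 2 p, pow_mul, htp]
  · have hμ' : μ = ((x + y : ℤ) : κ) := by rw [← hsum, h, zero_add]
    have hμ2 : Rd red ((y : ℂ) - (-a : ℤ) * τ) μ := by convert hμ using 1; push_cast; ring
    rw [← hP.rd_hasse_aux hp5 hm hs0 hA hB hA0 hB0 (x := y) (y := x) (a := -a) (c := -c) (by linarith)
      (by push_cast; linear_combination -hfix) hμ2 (by rw [hμ']; exact ht0), hμ', ← pow_mul,
      mul_comm 2 p, pow_mul, htp]

/-- The residue of the trace of a fixing matrix is the point count up to sign. -/
theorem Place.ap_sq_eq [CharP κ p] (hP : Place p red) (hp5 : 5 ≤ p) {τ : ℍ} {s : ℂ}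
    (hs12 : s ^ 12 * dl τ = 1) {e : ZMod p} (he : e ≠ 0) (he' : 4 * e + 27 ≠ 0)
    (hr : Rd red ((s ^ 4 * e4 τ) ^ 3) (ZMod.castHom (dvd_refl p) κ (1728 * (4 * e) / (4 * e + 27))))
    {x c a y : ℤ} (hdet : x * y + a * c = p)
    (hfix : (a : ℂ) * (τ : ℂ) ^ 2 + (y - x) * τ + c = 0) (ht : x + y = 0 ∨ ¬ (p : ℤ) ∣ x + y) :
    (ap e e : ZMod p) ^ 2 = ((x + y : ℤ) : ZMod p) ^ 2 := by
  obtain ⟨m, hm⟩ : ∃ m, 2 * m + 1 = p := by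
    obtain ⟨m, hm⟩ := hp.out.odd_of_ne_two (by omega)
    exact ⟨m, hm.symm⟩
  have hs0 : s ≠ 0 := by rintro rfl; simp at hs12
  have smul : ∀ n : ℕ, n ∣ 12 ^ 3 → (n : ZMod p) ≠ 0 := by
    intro n hn h0
    rw [ZMod.natCast_eq_zero_iff] at h0
    exact not_dvd_1728 hp5 (h0.trans hn)
  have h2 : (2 : ZMod p) ≠ 0 := by simpa using smul 2 (by norm_num)
  have h3 : (3 : ZMod p) ≠ 0 := by simpa using smul 3 (by norm_num)
  set φ : ZMod p →+* κ := ZMod.castHom (dvd_refl p) κ with hφ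
  set j : ZMod p := 1728 * (4 * e) / (4 * e + 27) with hj
  have h1728 : (1728 : ZMod p) = 2 ^ 6 * 3 ^ 3 := by norm_num
  have h27 : (27 : ZMod p) = 3 ^ 3 := by norm_num
  have h4' : (4 : ZMod p) = 2 ^ 2 := by norm_num
  have hj0 : j ≠ 0 := by
    rw [hj, h1728, h4']
    rw [h4'] at he'
    positivity
  have hj1 : j - 1728 = -(1728 * 27 / (4 * e + 27)) := by
    rw [hj]; field_simp; ring
  have hj2 : j - 1728 ≠ 0 := by
    rw [hj1, neg_ne_zero, h1728, h27]
    rw [h27] at he'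
    positivity
  have mem_of_pow : ∀ {z : ℂ} {n : ℕ} (_ : 0 < n) (hz : z ^ n ∈ V), z ∈ V := by
    intro z n hn hz
    refine hP.mem_of_monic (f := Polynomial.X ^ n - Polynomial.C ⟨z ^ n, hz⟩) ?_ ?_
    · exact Polynomial.monic_X_pow_sub_C _ hn.ne'
    · simp
  have hB3 : (s ^ 6 * e6 τ) ^ 2 = (s ^ 4 * e4 τ) ^ 3 - (1728 : ℕ) := by
    push_cast
    linear_combination s ^ 12 * dl_eq τ - 1728 * hs12
  obtain ⟨A, hA⟩ := Rd.exists_of_mem (red := red) (mem_of_pow (by norm_num) hr.mem)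
  have hrB := hr.sub (Rd.natCast 1728)
  rw [← hB3] at hrB
  obtain ⟨B, hB⟩ := Rd.exists_of_mem (red := red) (mem_of_pow (by norm_num) hrB.mem)
  have eA : A ^ 3 = φ j := (hA.pow 3).unique hr
  have eB : B ^ 2 = φ (j - 1728) := by
    rw [(hB.pow 2).unique hrB, map_sub, map_ofNat]; norm_num
  have hA0 : A ≠ 0 := by
    rintro rfl
    rw [zero_pow (by norm_num), eq_comm, map_eq_zero] at eA
    exact hj0 eA
  have hB0 : B ≠ 0 := by
    rintro rfl
    rw [zero_pow (by norm_num), eq_comm, map_eq_zero] at eB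
    exact hj2 eB
  have key := hP.rd_hasse hp5 hm hs0 hA hB hA0 hB0 hdet hfix ht
  have k2 : (2 : κ) ≠ 0 := by rw [← map_ofNat φ 2, Ne, map_eq_zero]; exact h2
  have k3 : (3 : κ) ≠ 0 := by rw [← map_ofNat φ 3, Ne, map_eq_zero]; exact h3
  have hu : (2 * B) / (-3 * A) ≠ 0 := div_ne_zero (mul_ne_zero k2 hB0) (mul_ne_zero (neg_ne_zero.mpr k3) hA0)
  set u := (2 * B) / (-3 * A) with hu_def
  have hrel : φ e * (4 * B ^ 2) = -27 * A ^ 3 := by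
    rw [eA, eB, ← map_ofNat φ 4, ← map_ofNat φ 27, ← map_neg, ← map_mul, ← map_mul, ← map_mul]
    congr 1
    rw [hj1, hj]
    field_simp
  have hu3 : u * (-3 * A) = 2 * B := by
    rw [hu_def, div_mul_cancel₀ _ (mul_ne_zero (neg_ne_zero.mpr k3) hA0)]
  have e1 : -3 * A = u ^ 2 * φ e := by
    have h9 : (3 * A) ^ 2 ≠ 0 := pow_ne_zero 2 (mul_ne_zero k3 hA0)
    apply mul_left_cancel₀ h9
    linear_combination -hrel - φ e * hu3 * (u * (-3 * A) + 2 * B)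
  have e2 : 2 * B = u ^ 3 * φ e := by
    rw [← hu3, e1]; ring
  rw [e1, e2, hs_mul_pow m hu, mul_pow, ← pow_mul, mul_comm m 2, show 2 * m = p - 1 by omega, ← map_hs,
    ← ap_cast hp5 hm] at key
  have hfer : ∀ n : ZMod p, n ≠ 0 → (φ n) ^ (p - 1) = 1 := by
    intro n hn
    rw [← map_pow, ZMod.pow_card_sub_one_eq_one hn, map_one]
  have hu2 : u ^ (p - 1) * A ^ (p - 1) = B ^ (p - 1) := by
    have f2 := hfer 2 h2
    have f3 := hfer (-3) (neg_ne_zero.mpr h3)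
    rw [map_neg, map_ofNat] at f3
    rw [map_ofNat] at f2
    rw [hu_def, div_pow, mul_pow, mul_pow, f2, f3]
    field_simp
  have hBp : B ^ (p - 1) ≠ 0 := pow_ne_zero _ hB0
  apply φ.injective
  apply mul_right_cancel₀ hBp
  rw [map_pow, map_pow, map_intCast φ (x + y), key]
  linear_combination -φ (ap e e : ZMod p) ^ 2 * hu2

end
end Birch

end

section

open UpperHalfPlane ModularForm ModularGroup MatrixGroups Complex Manifold

set_option linter.unusedSectionVars false

namespace Birch

open Polynomial in
theorem count_roots_frobenius {p : ℕ} [Fact p.Prime] {κ : Type} [Field κ] [DecidableEq κ] [CharP κ p] (j : ZMod p) :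
    ((X ^ p - X : κ[X]) ^ 2).roots.count (ZMod.castHom (dvd_refl p) κ j) = 2 := by
  have hp : p.Prime := Fact.out
  have h0 : (X ^ p - X : κ[X]) ≠ 0 := FiniteField.X_pow_card_sub_X_ne_zero κ hp.one_lt
  rw [roots_pow, Multiset.count_nsmul, Multiset.count_eq_one_of_mem]
  · exact nodup_roots (galois_poly_separable p p dvd_rfl)
  · rw [mem_roots h0, IsRoot, eval_sub, eval_pow, eval_X, ← map_pow, ZMod.pow_card, sub_self]

open Polynomial in
/-- The polynomial whose reduction is `(X ^ p - X) ^ 2`. -/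
noncomputable def frobPoly {R : Type*} [CommRing R] (p : ℕ) (x : ℕ → R) : R[X] :=
  (X ^ p - X) ^ 2 - ∑ i ∈ Finset.range (2 * p + 1), C (x i) * X ^ i

open Polynomial in
theorem map_frobPoly {R S : Type*} [CommRing R] [CommRing S] (φ : R →+* S) (p : ℕ) (x : ℕ → R) :
    (frobPoly p x).map φ = frobPoly p (fun i => φ (x i)) := by
  simp [frobPoly, Polynomial.map_sum]

open Polynomial in
theorem frobPoly_coeff {R : Type*} [CommRing R] {p : ℕ} (hp : 2 ≤ p) (x : ℕ → R) :
    (frobPoly p x).natDegree ≤ 2 * p ∧ (frobPoly p x).coeff (2 * p) = 1 - x (2 * p) := by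
  nontriviality R
  have hm : (X ^ p - X : R[X]).Monic := monic_X_pow_sub (by
    rw [degree_X]; exact_mod_cast hp)
  have hd : (X ^ p - X : R[X]).natDegree = p := by
    rw [natDegree_sub_eq_left_of_natDegree_lt, natDegree_X_pow]
    rw [natDegree_X_pow, natDegree_X]; omega
  have hd2 : ((X ^ p - X : R[X]) ^ 2).natDegree = 2 * p := by
    rw [hm.natDegree_pow, hd]
  constructor
  · refine (natDegree_sub_le _ _).trans (max_le hd2.le (natDegree_sum_le_of_forall_le _ _ fun i hi => ?_))
    refine (natDegree_C_mul_X_pow_le _ _).trans ?_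
    rw [Finset.mem_range] at hi; omega
  · rw [frobPoly, coeff_sub, finsetSum_coeff, ← hd2, (hm.pow 2).coeff_natDegree, hd2]
    simp

section
variable {p : ℕ} [hp : Fact p.Prime] {V : Subring ℂ} {κ : Type} [Field κ] {red : V →+* κ}

open Polynomial Classical in
theorem Place.sum_rootMultiplicity [CharP κ p] (hP : Place p red) {x : ℕ → ℂ}
    (hx : ∀ i, Rd red (x i) 0) (j : ZMod p) :
    ∑ r ∈ (frobPoly p x).roots.toFinset.filter (fun r => Rd red r (ZMod.castHom (dvd_refl p) κ j)),
      (frobPoly p x).rootMultiplicity r = 2 := by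
  have hp2 := hp.out.two_le
  choose hxV hx0 using hx
  set y : ℕ → V := fun i => ⟨x i, hxV i⟩ with hy
  have e1 : (frobPoly p y).map V.subtype = frobPoly p x := map_frobPoly _ _ _
  have e2 : (frobPoly p y).map red = (X ^ p - X) ^ 2 := by
    rw [map_frobPoly]; simp [frobPoly, hy, hx0]
  obtain ⟨hdeg, hlc⟩ := frobPoly_coeff hp2 y
  obtain ⟨hdegx, hlcx⟩ := frobPoly_coeff hp2 x
  have hu : Rd red (1 - x (2 * p)) 1 := by
    have := Rd.one.sub (show Rd red (x (2 * p)) 0 from ⟨hxV _, hx0 _⟩)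
    rwa [sub_zero] at this
  have hu0 : (1 - x (2 * p)) ≠ 0 := by
    intro h
    rw [h] at hu
    exact zero_ne_one (Rd.zero.unique hu)
  have hui := hu.inv hP one_ne_zero
  have hdegx' : (frobPoly p x).natDegree = 2 * p :=
    natDegree_eq_of_le_of_coeff_ne_zero hdegx (by rw [hlcx]; exact hu0)
  have hlead : (frobPoly p x).leadingCoeff = 1 - x (2 * p) := by
    rw [leadingCoeff, hdegx', hlcx]
  have hne : frobPoly p x ≠ 0 := by
    intro h; rw [h, leadingCoeff_zero] at hlead; exact hu0 hlead.symm
  have hmon : (C (⟨_, hui.mem⟩ : V) * frobPoly p y).Monic := by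
    refine monic_of_natDegree_le_of_coeff_eq_one (2 * p) ((natDegree_C_mul_le _ _).trans hdeg) ?_
    rw [coeff_C_mul, hlc]
    apply Subtype.ext
    simp [hy]
    exact inv_mul_cancel₀ hu0
  have hmem : ∀ r ∈ (frobPoly p x).roots, r ∈ V := by
    intro r hr
    refine hP.mem_of_monic hmon ?_
    rw [mem_roots hne, IsRoot] at hr
    rw [Polynomial.map_mul, e1, eval_mul, hr, mul_zero]
  obtain ⟨S, hS⟩ : ∃ S : Multiset V, S.map (fun v : V => (v : ℂ)) = (frobPoly p x).roots :=
    ⟨(frobPoly p x).roots.pmap (fun r hr => (⟨r, hr⟩ : V)) hmem, by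
      rw [Multiset.map_pmap, Multiset.pmap_eq_map, Multiset.map_id']⟩
  have hfac : frobPoly p y = C (1 - y (2 * p)) * (S.map fun r => X - C r).prod := by
    apply Polynomial.map_injective V.subtype Subtype.val_injective
    rw [e1, Polynomial.map_mul, Polynomial.map_multiset_prod]
    conv_lhs => rw [(IsAlgClosed.splits (frobPoly p x)).eq_prod_roots, hlead, ← hS]
    simp [hy, Multiset.map_map]
  have hroots : S.map red = ((X ^ p - X : κ[X]) ^ 2).roots := by
    rw [← e2, hfac, Polynomial.map_mul, Polynomial.map_multiset_prod, Polynomial.map_C]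
    have : red (1 - y (2 * p)) = 1 := by rw [map_sub, map_one]; simp [hy, hx0]
    rw [this, C_1, one_mul, Multiset.map_map]
    have h2 : Multiset.map (Polynomial.map red ∘ fun r => X - C r) S = (S.map red).map (fun a => X - C a) := by
      rw [Multiset.map_map]; congr 1; ext1 a; simp
    rw [h2, roots_multiset_prod_X_sub_C]
  have hc := count_roots_frobenius (p := p) (κ := κ) j
  rw [← hroots, Multiset.count_map] at hc
  rw [← hc]
  have h3 : ∀ r, (frobPoly p x).rootMultiplicity r = (frobPoly p x).roots.count r := fun r =>
    (count_roots _).symm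
  simp_rw [h3]
  set Q : ℂ → Prop := fun r => Rd red r (ZMod.castHom (dvd_refl p) κ j) with hQ
  have h4 : ∑ r ∈ (frobPoly p x).roots.toFinset.filter Q, (frobPoly p x).roots.count r =
      ((frobPoly p x).roots.filter Q).card := by
    rw [← Multiset.toFinset_sum_count_eq, Multiset.toFinset_filter]
    refine Finset.sum_congr rfl fun r hr => ?_
    rw [Multiset.count_filter_of_pos (Finset.mem_filter.mp hr).2]
  rw [h4, ← hS, Multiset.filter_map, Multiset.card_map]
  congr 1
  refine Multiset.filter_congr fun v _ => ?_
  constructor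
  · rintro ⟨_, h⟩; exact h.symm
  · intro h; exact ⟨v.2, h.symm⟩

end

open Filter Topology in
/-- Comparison of vanishing orders. -/
theorem le_card_of_prod_eq {ι : Type*} [Fintype ι] (D : ι → ℂ → ℂ) (z₀ : ℂ)
    (hD : ∀ i, (D i z₀ ≠ 0 ∧ ContinuousAt (D i) z₀) ∨ (D i z₀ = 0 ∧ ∃ d ≠ 0, HasDerivAt (D i) d z₀))
    {u J : ℂ → ℂ} (hu : ContinuousAt u z₀) (hJ : DifferentiableAt ℂ J z₀) {m : ℕ}
    (h : ∀ᶠ z in 𝓝 z₀, ∏ i, D i z = u z * (J z - J z₀) ^ m) :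
    m ≤ (Finset.univ.filter fun i => D i z₀ = 0).card := by
  classical
  by_contra! hlt
  set k := (Finset.univ.filter fun i => D i z₀ = 0).card with hk
  obtain ⟨n, rfl⟩ := Nat.exists_eq_add_of_lt hlt
  set e : ι → ℕ := fun i => if D i z₀ = 0 then 1 else 0 with he
  have h1 : ∀ i, ∃ L ≠ 0, Tendsto (fun z => D i z / (z - z₀) ^ e i) (𝓝[≠] z₀) (𝓝 L) := by
    intro i
    rcases hD i with ⟨h0, hc⟩ | ⟨h0, d, hd0, hd⟩
    · refine ⟨D i z₀, h0, ?_⟩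
      simp only [he, if_neg h0, pow_zero, div_one]
      exact hc.tendsto.mono_left nhdsWithin_le_nhds
    · refine ⟨d, hd0, ?_⟩
      have := hasDerivAt_iff_tendsto_slope.mp hd
      refine this.congr fun z => ?_
      simp only [he, if_pos h0, pow_one, slope_def_field, h0, sub_zero]
  choose L hL0 hL using h1
  have h2 : Tendsto (fun z => ∏ i, D i z / (z - z₀) ^ e i) (𝓝[≠] z₀) (𝓝 (∏ i, L i)) :=
    tendsto_finsetProd _ fun i _ => hL i
  have hsum : ∑ i, e i = k := by
    rw [hk, Finset.card_filter]
  have h3 : Tendsto (fun z => u z * (((J z - J z₀) / (z - z₀)) ^ (k + n + 1) * (z - z₀) ^ (n + 1))) (𝓝[≠] z₀)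
      (𝓝 (u z₀ * ((deriv J z₀) ^ (k + n + 1) * (z₀ - z₀) ^ (n + 1)))) := by
    refine Tendsto.mul (hu.tendsto.mono_left nhdsWithin_le_nhds) (Tendsto.mul (Tendsto.pow ?_ _) ?_)
    · have := hasDerivAt_iff_tendsto_slope.mp hJ.hasDerivAt
      refine this.congr fun z => ?_
      rw [slope_def_field]
    · refine Tendsto.mono_left ?_ nhdsWithin_le_nhds
      exact (by fun_prop : Continuous fun z : ℂ => (z - z₀) ^ (n + 1)).tendsto z₀
  rw [sub_self, zero_pow (by omega), mul_zero, mul_zero] at h3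
  have h4 : (fun z => ∏ i, D i z / (z - z₀) ^ e i) =ᶠ[𝓝[≠] z₀]
      (fun z => u z * (((J z - J z₀) / (z - z₀)) ^ (k + n + 1) * (z - z₀) ^ (n + 1))) := by
    filter_upwards [h.filter_mono nhdsWithin_le_nhds, self_mem_nhdsWithin] with z hz hz0
    have hz1 : z - z₀ ≠ 0 := sub_ne_zero.mpr hz0
    rw [Finset.prod_div_distrib, hz, Finset.prod_pow_eq_pow_sum, hsum, div_pow]
    rw [show k + n + 1 = k + (n + 1) by ring, pow_add (z - z₀)]
    field_simp
  exact Finset.prod_ne_zero_iff.mpr (fun i _ => hL0 i) (tendsto_nhds_unique (h2.congr' h4) h3)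

end Birch

end

section

open UpperHalfPlane ModularForm ModularGroup MatrixGroups Complex Manifold

set_option linter.unusedSectionVars false

namespace Birch

/-- The modular invariant. -/
noncomputable def jf (τ : ℍ) : ℂ := e4 τ ^ 3 / dl τ

theorem jf_smul (g : SL(2, ℤ)) (τ : ℍ) : jf (g • τ) = jf τ := by
  have hdet : (g 0 0 : ℤ) * g 1 1 - g 0 1 * g 1 0 = 1 := by
    have := g.det_coe; rwa [Matrix.det_fin_two] at this
  have hτ : ((g • τ : ℍ) : ℂ) * ((g 1 0 : ℤ) * τ + (g 1 1 : ℤ)) = (g 0 0 : ℤ) * τ + (g 0 1 : ℤ) := by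
    rw [coe_specialLinearGroup_apply]
    have : ((g 1 0 : ℤ) : ℂ) * τ + (g 1 1 : ℤ) ≠ 0 := denom_ne_zero (g : GL (Fin 2) ℝ) τ
    simp only [algebraMap_int_eq, eq_intCast, ofReal_intCast]
    exact div_mul_cancel₀ _ this
  have hne : ((g 1 0 : ℤ) : ℂ) * τ + (g 1 1 : ℤ) ≠ 0 := denom_ne_zero (g : GL (Fin 2) ℝ) τ
  rw [jf, mf_e4.act hdet hτ, mf_dl.act hdet hτ, jf, mul_pow, ← pow_mul, mul_div_mul_left]
  exact pow_ne_zero _ hne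

theorem differentiableAt_ofComplex {f : ℍ → ℂ} (hf : MDiff f) (τ : ℍ) :
    DifferentiableAt ℂ (fun z => f (ofComplex z)) τ :=
  UpperHalfPlane.mdifferentiableAt_iff.mp (hf τ)

theorem mdiff_jf : MDiff jf := by
  intro τ
  rw [UpperHalfPlane.mdifferentiableAt_iff]
  exact ((differentiableAt_ofComplex mf_e4.holo τ).pow 3).div (differentiableAt_ofComplex mf_dl.holo τ)
    (by rw [ofComplex_apply]; exact dl_ne_zero τ)

theorem deriv_jf_ne_zero {τ : ℍ} (h4 : e4 τ ≠ 0) (h6 : e6 τ ≠ 0) :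
    deriv (fun z => jf (ofComplex z)) τ ≠ 0 := by
  have h1 := (differentiableAt_ofComplex mf_e4.holo τ).hasDerivAt
  have h2 := (differentiableAt_ofComplex mf_dl.holo τ).hasDerivAt
  have h := (h1.pow 3).div h2 (by rw [ofComplex_apply]; exact dl_ne_zero τ)
  have hd : deriv (fun z => jf (ofComplex z)) τ = _ := h.deriv
  rw [hd]
  have hr := ramanujan_e4.1 τ
  rw [DD, DD, Derivative.normalizedDerivOfComplex, Derivative.normalizedDerivOfComplex] at hr
  have hpi : (2 * Real.pi * Complex.I : ℂ) ≠ 0 := by simp [Real.pi_ne_zero]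
  have hr' : e4 τ * deriv (fun z => dl (ofComplex z)) τ - 3 * (dl τ * deriv (fun z => e4 (ofComplex z)) τ)
      = (2 * Real.pi * Complex.I) * (dl τ * e6 τ) := by
    rw [← hr]
    simp only [Function.comp_def]
    field_simp
  have hdl := dl_ne_zero τ
  refine div_ne_zero ?_ (pow_ne_zero _ (by simpa using hdl))
  have : e4 τ ^ 2 * ((2 * Real.pi * Complex.I) * (dl τ * e6 τ)) ≠ 0 :=
    mul_ne_zero (pow_ne_zero _ h4) (mul_ne_zero hpi (mul_ne_zero hdl h6))
  intro h0
  apply this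
  simp only [Pi.pow_apply, ofComplex_apply] at h0
  push_cast at h0
  linear_combination -h0 - e4 τ ^ 2 * hr'

section
variable {p : ℕ} [hp : Fact p.Prime]

/-- The coset relation between `(x, -c; a, y)` and a Hecke representative. -/
def Cos (p : ℕ) (δ : Option (ZMod p)) (x c a y : ℤ) : Prop :=
  match δ with
  | none => (x : ZMod p) = 0 ∧ (a : ZMod p) = 0
  | some b => ¬ ((x : ZMod p) = 0 ∧ (a : ZMod p) = 0) ∧ (-c : ZMod p) = b * x ∧ (y : ZMod p) = b * a

theorem Cos.unique {δ δ' : Option (ZMod p)} {x c a y : ℤ} (h : Cos p δ x c a y) (h' : Cos p δ' x c a y) :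
    δ = δ' := by
  match δ, δ' with
  | none, none => rfl
  | none, some b => exact absurd h h'.1
  | some b, none => exact absurd h' h.1
  | some b, some b' =>
    obtain ⟨h1, h2, h3⟩ := h
    obtain ⟨-, h2', h3'⟩ := h'
    have e1 : (b - b') * x = 0 := by linear_combination h2' - h2
    have e2 : (b - b') * a = 0 := by linear_combination h3' - h3
    congr 1
    by_contra hne
    have := sub_ne_zero.mpr hne
    exact h1 ⟨(mul_eq_zero.mp e1).resolve_left this, (mul_eq_zero.mp e2).resolve_left this⟩

theorem Cos.neg {δ : Option (ZMod p)} {x c a y : ℤ} (h : Cos p δ x c a y) :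
    Cos p δ (-x) (-c) (-a) (-y) := by
  match δ with
  | none => simpa [Cos] using h
  | some b =>
    obtain ⟨h1, h2, h3⟩ := h
    refine ⟨by simpa using h1, ?_, ?_⟩
    · push_cast; linear_combination -h2
    · push_cast; linear_combination -h3

theorem exists_smul_pt (g : SL(2, ℤ)) (δ : Option (ZMod p)) :
    ∃ x c a y : ℤ, x * y + a * c = p ∧ Cos p δ x c a y ∧
      ∀ τ : ℍ, (a : ℂ) * τ + y ≠ 0 ∧ ((g • pt δ τ : ℍ) : ℂ) = (x * τ - c) / (a * τ + y) := by
  have hdet : (g 0 0 : ℤ) * g 1 1 - g 0 1 * g 1 0 = 1 := by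
    have := g.det_coe; rwa [Matrix.det_fin_two] at this
  have hp0 : (p : ℂ) ≠ 0 := p_ne p
  match δ with
  | none =>
    refine ⟨g 0 0 * p, -g 0 1, g 1 0 * p, g 1 1, by linear_combination (p : ℤ) * hdet, ?_, fun τ => ?_⟩
    · simp [Cos]
    · have hne : ((g 1 0 : ℤ) : ℂ) * (ptInf p τ : ℍ) + (g 1 1 : ℤ) ≠ 0 :=
        denom_ne_zero (g : GL (Fin 2) ℝ) _
      rw [coe_ptInf] at hne
      refine ⟨by push_cast; rwa [mul_assoc], ?_⟩
      rw [coe_specialLinearGroup_apply, show pt (none : Option (ZMod p)) τ = ptInf p τ from rfl, coe_ptInf]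
      simp [mul_assoc]
  | some b =>
    refine ⟨g 0 0, -(g 0 0 * (b.val : ℤ) + g 0 1 * p), g 1 0, g 1 0 * (b.val : ℤ) + g 1 1 * p,
      by linear_combination (p : ℤ) * hdet, ?_, fun τ => ?_⟩
    · refine ⟨?_, by simp [mul_comm], by simp [mul_comm]⟩
      rintro ⟨h1, h2⟩
      have := congrArg (Int.cast : ℤ → ZMod p) hdet
      push_cast at this
      rw [h1, h2] at this
      simp at this
    · have hne : ((g 1 0 : ℤ) : ℂ) * (ptFin p (b.val : ℤ) τ : ℍ) + (g 1 1 : ℤ) ≠ 0 :=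
        denom_ne_zero (g : GL (Fin 2) ℝ) _
      rw [coe_ptFin] at hne
      have e : ((g 1 0 : ℤ) : ℂ) * τ + ((g 1 0 * (b.val : ℤ) + g 1 1 * p : ℤ) : ℂ) =
          (((g 1 0 : ℤ) : ℂ) * ((τ + (b.val : ℤ)) / p) + (g 1 1 : ℤ)) * p := by
        push_cast
        field_simp
        ring
      refine ⟨by rw [e]; exact mul_ne_zero hne hp0, ?_⟩
      rw [e, coe_specialLinearGroup_apply, show pt (some b) τ = ptFin p (b.val : ℤ) τ from rfl, coe_ptFin]
      simp only [algebraMap_int_eq, eq_intCast, ofReal_intCast]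
      rw [div_eq_div_iff hne (mul_ne_zero hne hp0)]
      push_cast
      field_simp
      ring

theorem pt_eq (δ : Option (ZMod p)) : ∃ φ : ℂ → ℂ, Differentiable ℂ φ ∧ ∀ τ : ℍ, (pt δ τ : ℂ) = φ τ := by
  match δ with
  | none => exact ⟨fun z => p * z, by fun_prop, fun τ => rfl⟩
  | some b => exact ⟨fun z => (z + (b.val : ℤ)) / p, by fun_prop, fun τ => rfl⟩

theorem mdiff_comp_pt {f : ℍ → ℂ} (hf : MDiff f) (δ : Option (ZMod p)) : MDiff (fun τ => f (pt δ τ)) := by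
  obtain ⟨φ, h1, h2⟩ := pt_eq δ
  exact mdiff_comp hf h1 h2

/-- A coincidence `j τ = j (δ τ)` comes from an integral matrix fixing `τ`. -/
theorem exists_matrix {τ : ℍ} {δ : Option (ZMod p)} (hj : jf τ = jf (pt δ τ)) :
    ∃ x c a y : ℤ, x * y + a * c = p ∧ Cos p δ x c a y ∧ (a : ℂ) * (τ : ℂ) ^ 2 + (y - x) * τ + c = 0 ∧
      a ≠ 0 ∧ (e4 τ ≠ 0 → e6 τ ≠ 0 → ∃ d ≠ 0,
        HasDerivAt (fun z : ℂ => jf (ofComplex z) - jf (pt δ (ofComplex z))) d τ) := by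
  have h := hj
  rw [jf, jf, div_eq_div_iff (dl_ne_zero _) (dl_ne_zero _)] at h
  obtain ⟨g, hg⟩ := exists_smul_eq_of_j h.symm
  obtain ⟨x, c, a, y, hdet, hcos, hW⟩ := exists_smul_pt g δ
  have hfix0 : (τ : ℂ) = (x * τ - c) / (a * τ + y) := by
    rw [← (hW τ).2, ← hg]
  have hfix : (a : ℂ) * (τ : ℂ) ^ 2 + (y - x) * τ + c = 0 := by
    rw [eq_div_iff (hW τ).1] at hfix0
    linear_combination hfix0
  have him : (τ : ℂ).im ≠ 0 := τ.im_ne_zero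
  have ha : a ≠ 0 := by
    rintro rfl
    have h1 := congrArg Complex.im hfix
    have h2 := congrArg Complex.re hfix
    simp at h1 h2
    have hyx : (y : ℝ) - x = 0 := by
      rcases h1 with h1 | h1
      · exact h1
      · exact absurd h1 him
    have hyx' : y = x := by exact_mod_cast sub_eq_zero.mp hyx
    subst hyx'
    have : (p : ℤ) = y * y := by linarith
    exact (Nat.prime_iff_prime_int.mp hp.out).irreducible.not_isSquare ⟨y, this⟩
  refine ⟨x, c, a, y, hdet, hcos, hfix, ha, fun h4 h6 => ?_⟩
  set J : ℂ → ℂ := fun z => jf (ofComplex z) with hJ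
  have hJ1 : HasDerivAt J (deriv J τ) τ := (differentiableAt_ofComplex mdiff_jf τ).hasDerivAt
  have hden := (hW τ).1
  have hWd : HasDerivAt (fun z : ℂ => (x * z - c) / (a * z + y)) (p / (a * τ + y) ^ 2) τ := by
    have h1 : HasDerivAt (fun z : ℂ => (x : ℂ) * z - c) x τ := by
      simpa using ((hasDerivAt_id (τ : ℂ)).const_mul (x : ℂ)).sub_const (c : ℂ)
    have h2 : HasDerivAt (fun z : ℂ => (a : ℂ) * z + y) a τ := by
      simpa using ((hasDerivAt_id (τ : ℂ)).const_mul (a : ℂ)).add_const (y : ℂ)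
    refine (h1.div h2 hden).congr_deriv ?_
    congr 1
    have : ((x * y + a * c : ℤ) : ℂ) = (p : ℤ) := by rw [hdet]
    push_cast at this
    linear_combination this
  have hJW : HasDerivAt (fun z => J ((x * z - c) / (a * z + y))) (deriv J τ * (p / (a * τ + y) ^ 2)) τ := by
    refine HasDerivAt.comp (τ : ℂ) (h₂ := J) ?_ hWd
    rw [← hfix0]; exact hJ1
  have hev : (fun z : ℂ => J ((x * z - c) / (a * z + y))) =ᶠ[nhds (τ : ℂ)]
      fun z => jf (pt δ (ofComplex z)) := by
    filter_upwards [isOpen_upperHalfPlaneSet.mem_nhds τ.im_pos] with z hz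
    have hz' : ((ofComplex z : ℍ) : ℂ) = z := by rw [ofComplex_apply_of_im_pos hz]
    rw [← jf_smul g (pt δ (ofComplex z)), hJ]
    simp only
    congr 1
    have := (hW (ofComplex z)).2
    rw [hz'] at this
    rw [← this, ofComplex_apply]
  refine ⟨_, ?_, hJ1.sub (hJW.congr_of_eventuallyEq hev.symm)⟩
  have hJ0 := deriv_jf_ne_zero h4 h6
  rw [show deriv J τ - deriv J τ * (p / (a * τ + y) ^ 2) = deriv J τ * (1 - p / (a * τ + y) ^ 2) by ring]
  refine mul_ne_zero hJ0 ?_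
  intro h0
  have h1 : (a * (τ : ℂ) + y) ^ 2 = p := by
    have : (p : ℂ) / (a * τ + y) ^ 2 = 1 := by linear_combination -h0
    rw [div_eq_one_iff_eq (pow_ne_zero _ hden)] at this
    exact this.symm
  have h2 : (a * (τ : ℂ) + y) * (2 * a * τ + y - x) = 0 := by
    have : ((x * y + a * c : ℤ) : ℂ) = (p : ℤ) := by rw [hdet]
    push_cast at this
    linear_combination h1 + a * hfix - this
  have h3 := (mul_eq_zero.mp h2).resolve_left hden
  have h4 := congrArg Complex.im h3
  simp at h4
  rcases h4 with h4 | h4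
  · exact ha h4
  · exact him h4

end
end Birch

end

section

open UpperHalfPlane ModularForm ModularGroup MatrixGroups Complex Manifold

set_option linter.unusedSectionVars false

namespace Birch

section
variable {p : ℕ} [hp : Fact p.Prime]

/-- The monic-degree identity satisfied by the coefficients of the modular polynomial. -/
def ModId (p : ℕ) [Fact p.Prime] (x : ℕ → ℂ) : Prop :=
  ∀ τ, nm p 12 12 (fun τ => e4 τ ^ 3) dl dl (fun τ => e4 τ ^ 3) τ =
    ∑ i ∈ Finset.range (2 * p + 1), x i * ((e4 τ ^ 3) ^ i * dl τ ^ (2 * p + 2 - i)) -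
      (e4 τ ^ 3 * dl τ ^ p - (e4 τ ^ 3) ^ p * dl τ) ^ 2

theorem ModId.prod_eq {x : ℕ → ℂ} (hx : ModId p x) (τ : ℍ) :
    ∏ δ : Option (ZMod p), (jf τ - jf (pt δ τ)) =
      -(dl τ ^ (2 * p + 2) / ∏ δ : Option (ZMod p), (dl τ * dl (pt δ τ))) * (frobPoly p x).eval (jf τ) := by
  have hdl := dl_ne_zero τ
  have hj : e4 τ ^ 3 = jf τ * dl τ := by rw [jf]; field_simp
  have h1 : nm p 12 12 (fun τ => e4 τ ^ 3) dl dl (fun τ => e4 τ ^ 3) τ =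
      ∏ δ : Option (ZMod p), ((dl τ * dl (pt δ τ)) * (jf τ - jf (pt δ τ))) := by
    rw [Fintype.prod_option, nm]
    have hh : ∀ δ : Option (ZMod p), (dl τ * dl (pt δ τ)) * (jf τ - jf (pt δ τ)) =
        e4 τ ^ 3 * dl (pt δ τ) - dl τ * e4 (pt δ τ) ^ 3 := by
      intro δ
      have := dl_ne_zero (pt δ τ)
      rw [jf, jf]; field_simp
    simp_rw [hh]
    simp [pt]
  have h2 := hx τ
  rw [h1, Finset.prod_mul_distrib, hj] at h2
  have h3 : ∏ δ : Option (ZMod p), (dl τ * dl (pt δ τ)) ≠ 0 :=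
    Finset.prod_ne_zero_iff.mpr fun δ _ => mul_ne_zero hdl (dl_ne_zero _)
  apply mul_left_cancel₀ h3
  rw [h2]
  have h4 : (frobPoly p x).eval (jf τ) = (jf τ ^ p - jf τ) ^ 2 -
      ∑ i ∈ Finset.range (2 * p + 1), x i * jf τ ^ i := by
    simp [frobPoly, Polynomial.eval_finsetSum]
  have h5 : ∑ i ∈ Finset.range (2 * p + 1), x i * ((jf τ * dl τ) ^ i * dl τ ^ (2 * p + 2 - i)) =
      dl τ ^ (2 * p + 2) * ∑ i ∈ Finset.range (2 * p + 1), x i * jf τ ^ i := by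
    rw [Finset.mul_sum]
    refine Finset.sum_congr rfl fun i hi => ?_
    rw [Finset.mem_range] at hi
    rw [show 2 * p + 2 = i + (2 * p + 2 - i) by omega, pow_add, mul_pow,
      show i + (2 * p + 2 - i) - i = 2 * p + 2 - i by omega]
    ring
  rw [h4, h5]
  field_simp
  ring

open Classical in
theorem ModId.rootMultiplicity_le {x : ℕ → ℂ} (hx : ModId p x) {τ : ℍ} (h4 : e4 τ ≠ 0) (h6 : e6 τ ≠ 0) :
    (frobPoly p x).rootMultiplicity (jf τ) ≤
      (Finset.univ.filter fun δ : Option (ZMod p) => jf τ = jf (pt δ τ)).card := by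
  obtain ⟨G, hG⟩ := Polynomial.pow_rootMultiplicity_dvd (frobPoly p x) (jf τ)
  set m := (frobPoly p x).rootMultiplicity (jf τ) with hm
  set J : ℂ → ℂ := fun z => jf (ofComplex z) with hJ
  set D : Option (ZMod p) → ℂ → ℂ := fun δ z => jf (ofComplex z) - jf (pt δ (ofComplex z)) with hD
  set E : ℂ → ℂ := fun z => dl (ofComplex z) with hE
  have hJd : DifferentiableAt ℂ J τ := differentiableAt_ofComplex mdiff_jf τ
  have hEd : DifferentiableAt ℂ E τ := differentiableAt_ofComplex mf_dl.holo τ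
  have hptd : ∀ δ : Option (ZMod p), DifferentiableAt ℂ (fun z => jf (pt δ (ofComplex z))) τ := fun δ =>
    differentiableAt_ofComplex (mdiff_comp_pt mdiff_jf δ) τ
  have hptE : ∀ δ : Option (ZMod p), DifferentiableAt ℂ (fun z => dl (pt δ (ofComplex z))) τ := fun δ =>
    differentiableAt_ofComplex (mdiff_comp_pt mf_dl.holo δ) τ
  have key := le_card_of_prod_eq D (τ : ℂ) (fun δ => ?_)
    (u := fun z => -(E z ^ (2 * p + 2) / ∏ δ : Option (ZMod p), (E z * dl (pt δ (ofComplex z)))) * G.eval (J z))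
    (J := J) (m := m) ?_ hJd ?_
  · refine key.trans (Finset.card_le_card fun δ hδ => ?_)
    simp only [Finset.mem_filter, Finset.mem_univ, true_and, hD, ofComplex_apply] at hδ ⊢
    exact sub_eq_zero.mp hδ
  · by_cases h0 : D δ τ = 0
    · right
      refine ⟨h0, ?_⟩
      simp only [hD, ofComplex_apply] at h0
      obtain ⟨_, _, _, _, -, -, -, -, h⟩ := exists_matrix (sub_eq_zero.mp h0)
      exact h h4 h6
    · left
      exact ⟨h0, (hJd.sub (hptd δ)).continuousAt⟩
  · refine ((hEd.continuousAt.pow _).div (tendsto_finsetProd _ fun δ _ =>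
      (hEd.mul (hptE δ)).continuousAt) ?_).neg.mul (G.continuous.continuousAt.comp hJd.continuousAt)
    exact Finset.prod_ne_zero_iff.mpr fun δ _ => mul_ne_zero (dl_ne_zero _) (dl_ne_zero _)
  · refine Filter.Eventually.of_forall fun z => ?_
    simp only [hD, hE, hJ, ofComplex_apply]
    rw [hx.prod_eq (ofComplex z), hG]
    simp
    ring

end
end Birch

end

section

open UpperHalfPlane ModularForm ModularGroup MatrixGroups Complex Manifold

set_option linter.unusedSectionVars false

namespace Birch

/-- Integral matrices `(x, -c; a, y)` of determinant `p` with a reduced fixed point. -/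
noncomputable def RR (p : ℕ) : Finset (ℤ × ℤ × ℤ) :=
  (Finset.Icc (-(p : ℤ)) p ×ˢ Finset.Icc (-(p : ℤ)) p ×ˢ Finset.Icc (-(p : ℤ)) p).filter fun g =>
    0 < g.1 ∧ g.1 ∣ p - g.2.1 * g.2.2 ∧ |g.2.1 - g.2.2| ≤ g.1 ∧ g.1 ^ 2 ≤ p - g.2.1 * g.2.2

/-- The fixed point relation. -/
def Fix (p : ℕ) (τ : ℍ) (g : ℤ × ℤ × ℤ) : Prop :=
  ∃ c : ℤ, g.2.1 * g.2.2 + g.1 * c = p ∧ (g.1 : ℂ) * (τ : ℂ) ^ 2 + (g.2.2 - g.2.1) * τ + c = 0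

theorem Fix.unique {p : ℕ} {τ τ' : ℍ} {g : ℤ × ℤ × ℤ} (ha : 0 < g.1) (h : Fix p τ g) (h' : Fix p τ' g) :
    τ = τ' := by
  obtain ⟨c, h1, h2⟩ := h
  obtain ⟨c', h1', h2'⟩ := h'
  have hc : c = c' := by
    have : g.1 * c = g.1 * c' := by linarith
    exact mul_left_cancel₀ ha.ne' this
  subst hc
  have h3 : ((τ : ℂ) - τ') * (g.1 * ((τ : ℂ) + τ') + (g.2.2 - g.2.1)) = 0 := by
    linear_combination h2 - h2'
  rcases mul_eq_zero.mp h3 with h4 | h4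
  · exact UpperHalfPlane.ext (sub_eq_zero.mp h4)
  · exfalso
    have h5 := congrArg Complex.im h4
    simp at h5
    have := τ.im_pos
    have := τ'.im_pos
    rcases h5 with h5 | h5
    · exact ha.ne' h5
    · linarith

theorem mem_RR {p : ℕ} (hp5 : 5 ≤ p) {τ : ℍ} (hτ : τ ∈ fd) {x c a y : ℤ} (ha : 0 < a)
    (hdet : x * y + a * c = p) (hfix : (a : ℂ) * (τ : ℂ) ^ 2 + (y - x) * τ + c = 0) :
    (a, x, y) ∈ RR p := by
  obtain ⟨h1, h2⟩ := hτ
  rw [Complex.normSq_apply] at h1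
  have hre := congrArg Complex.re hfix
  have him := congrArg Complex.im hfix
  simp [pow_two] at hre him
  have hy := τ.im_pos
  have haR : (0 : ℝ) < a := by exact_mod_cast ha
  rw [coe_re] at h1
  rw [coe_im] at h1
  have e1 : 2 * a * τ.re = x - y := by
    have : (2 * a * τ.re - (x - y)) * τ.im = 0 := by linear_combination him
    rcases mul_eq_zero.mp this with h | h
    · linarith
    · exact absurd h hy.ne'
  have e2 : (c : ℝ) = a * (τ.re * τ.re + τ.im * τ.im) := by
    linear_combination hre - e1 * τ.re
  have h3 : |(x : ℝ) - y| ≤ a := by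
    rw [← e1, abs_mul, abs_of_pos (by positivity : (0:ℝ) < 2 * a)]
    nlinarith
  have h3' : |x - y| ≤ a := by exact_mod_cast h3
  have h4 : a ≤ c := by
    have : (a : ℝ) ≤ c := by rw [e2]; nlinarith
    exact_mod_cast this
  have h5 : a ^ 2 ≤ p - x * y := by nlinarith
  have h6 : (x - y) ^ 2 ≤ a ^ 2 := by
    rw [← sq_abs]
    exact pow_le_pow_left₀ (abs_nonneg _) h3' 2
  have hp5' : (5 : ℤ) ≤ p := by exact_mod_cast hp5
  have h7 : (x + y) ^ 2 + 3 * a ^ 2 ≤ 4 * p := by nlinarith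
  have h8 : (2 * x) ^ 2 ≤ (2 * p) ^ 2 := by nlinarith [sq_nonneg (x + y - (x - y)), sq_nonneg (x + y + (x - y))]
  have h9 : (2 * y) ^ 2 ≤ (2 * p) ^ 2 := by nlinarith [sq_nonneg (x + y - (x - y)), sq_nonneg (x + y + (x - y))]
  have h10 : a ^ 2 ≤ (p : ℤ) ^ 2 := by nlinarith [sq_nonneg (x + y)]
  have h8' := abs_le_of_sq_le_sq' h8 (by linarith)
  have h9' := abs_le_of_sq_le_sq' h9 (by linarith)
  have h10' := abs_le_of_sq_le_sq' h10 (by linarith)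
  simp only [RR, Finset.mem_filter, Finset.mem_product, Finset.mem_Icc]
  refine ⟨⟨⟨by linarith, by linarith⟩, ⟨by linarith, by linarith⟩, by linarith, by linarith⟩, ha, ⟨c, by linarith⟩, h3', h5⟩

theorem trace_sq_le {p : ℕ} {g : ℤ × ℤ × ℤ} (hg : g ∈ RR p) :
    (g.2.1 + g.2.2) ^ 2 ≤ 4 * p := by
  simp only [RR, Finset.mem_filter] at hg
  obtain ⟨-, h0, -, h1, h2⟩ := hg
  have h6 : (g.2.1 - g.2.2) ^ 2 ≤ g.1 ^ 2 := by
    rw [← sq_abs]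
    exact pow_le_pow_left₀ (abs_nonneg _) h1 2
  nlinarith [sq_nonneg g.1]

section
variable {p : ℕ} [hp : Fact p.Prime]

open Classical in
theorem rootMultiplicity_le_card (hp5 : 5 ≤ p) {x : ℕ → ℂ} (hx : ModId p x) {r : ℂ} (h0 : r ≠ 0)
    (h1 : r ≠ 1728) :
    (frobPoly p x).rootMultiplicity r ≤ ((RR p).filter fun g => ∃ τ, Fix p τ g ∧ jf τ = r).card := by
  obtain ⟨τ, hτ, hr⟩ : ∃ τ : ℍ, τ ∈ fd ∧ jf τ = r := by
    obtain ⟨τ, h⟩ := exists_j_eq r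
    obtain ⟨g, hg⟩ := exists_smul_mem_fd τ
    refine ⟨g • τ, hg, ?_⟩
    rw [jf_smul, jf, h, mul_div_cancel_right₀ _ (dl_ne_zero τ)]
  have hdl := dl_ne_zero τ
  have h4 : e4 τ ≠ 0 := by
    intro h; apply h0; rw [← hr, jf, h]; simp
  have h6 : e6 τ ≠ 0 := by
    intro h; apply h1; rw [← hr, jf]
    have := dl_eq τ
    rw [h] at this
    field_simp
    linear_combination -this
  subst hr
  refine (hx.rootMultiplicity_le h4 h6).trans ?_
  have hM : ∀ δ : Option (ZMod p), ∃ x c a y : ℤ, jf τ = jf (pt δ τ) →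
      x * y + a * c = p ∧ Cos p δ x c a y ∧ (a : ℂ) * (τ : ℂ) ^ 2 + (y - x) * τ + c = 0 ∧ 0 < a := by
    intro δ
    by_cases hδ : jf τ = jf (pt δ τ)
    · obtain ⟨x, c, a, y, hdet, hcos, hfix, ha, -⟩ := exists_matrix hδ
      rcases lt_or_gt_of_ne ha with ha | ha
      · refine ⟨-x, -c, -a, -y, fun _ => ⟨by linarith, hcos.neg, ?_, by linarith⟩⟩
        push_cast
        linear_combination -hfix
      · exact ⟨x, c, a, y, fun _ => ⟨hdet, hcos, hfix, ha⟩⟩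
    · exact ⟨0, 0, 0, 0, fun h => absurd h hδ⟩
  choose X C A Y hXY using hM
  refine Finset.card_le_card_of_injOn (fun δ => (A δ, X δ, Y δ)) ?_ ?_
  · intro δ hδ
    simp only [Finset.coe_filter, Finset.mem_univ, true_and, Set.mem_ofPred_eq] at hδ
    obtain ⟨h1, h2, h3, h4⟩ := hXY δ hδ
    simp only [Finset.coe_filter, Set.mem_ofPred_eq]
    exact ⟨mem_RR hp5 hτ h4 h1 h3, τ, ⟨C δ, h1, h3⟩, rfl⟩
  · intro δ hδ δ' hδ' heq
    simp only [Finset.coe_filter, Finset.mem_univ, true_and, Set.mem_ofPred_eq] at hδ hδ'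
    obtain ⟨h1, h2, h3, h4⟩ := hXY δ hδ
    obtain ⟨h1', h2', h3', h4'⟩ := hXY δ' hδ'
    simp only [Prod.mk.injEq] at heq
    obtain ⟨ea, ex, ey⟩ := heq
    rw [← ea, ← ex, ← ey] at h1' h2'
    have hc : C δ = C δ' := by
      have : A δ * C δ = A δ * C δ' := by linarith
      exact mul_left_cancel₀ h4.ne' this
    rw [← hc] at h2'
    exact h2.unique h2'

open Classical in
theorem two_mul_sum_le (hp5 : 5 ≤ p) {f : ZMod p → ℝ} (hf : ∀ z, 0 ≤ f z) :
    2 * ∑ e ∈ Finset.univ.filter (fun e : ZMod p => e ≠ 0 ∧ 4 * e + 27 ≠ 0), f ((ap e e : ZMod p) ^ 2) ≤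
      ∑ g ∈ RR p, f (((g.2.1 + g.2.2 : ℤ) : ZMod p) ^ 2) := by
  obtain ⟨V, κ, _, red, hP⟩ := exists_place p hp.out
  have := hP.charP
  obtain ⟨x, hx0, hx⟩ := hP.modular_poly hp5
  have hx : ModId p x := hx
  set φ : ZMod p →+* κ := ZMod.castHom (dvd_refl p) κ with hφ
  set j0 : ZMod p → ZMod p := fun e => 1728 * (4 * e) / (4 * e + 27) with hj0
  have smul : ∀ n : ℕ, n ∣ 12 ^ 3 → (n : ZMod p) ≠ 0 := by
    intro n hn h0
    rw [ZMod.natCast_eq_zero_iff] at h0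
    exact not_dvd_1728 hp5 (h0.trans hn)
  have h2 : (2 : ZMod p) ≠ 0 := by simpa using smul 2 (by norm_num)
  have h3 : (3 : ZMod p) ≠ 0 := by simpa using smul 3 (by norm_num)
  have h1728 : (1728 : ZMod p) = 2 ^ 6 * 3 ^ 3 := by norm_num
  have h27 : (27 : ZMod p) = 3 ^ 3 := by norm_num
  have h4' : (4 : ZMod p) = 2 ^ 2 := by norm_num
  have hj1 : ∀ e : ZMod p, e ≠ 0 → 4 * e + 27 ≠ 0 → j0 e ≠ 0 := by
    intro e he he'
    simp only [hj0]
    rw [h4'] at he' ⊢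
    rw [h1728]
    positivity
  have hj2 : ∀ e : ZMod p, 4 * e + 27 ≠ 0 → 1728 - j0 e = 1728 * 27 / (4 * e + 27) := by
    intro e he'
    simp only [hj0]
    field_simp
    ring
  have hj3 : ∀ e : ZMod p, 4 * e + 27 ≠ 0 → j0 e ≠ 1728 := by
    intro e he' h
    have := hj2 e he'
    rw [h, sub_self, eq_comm, h1728, h27] at this
    rw [h27] at he'
    revert this
    positivity
  have hjinj : ∀ e e' : ZMod p, 4 * e + 27 ≠ 0 → 4 * e' + 27 ≠ 0 → j0 e = j0 e' → e = e' := by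
    intro e e' he he' h
    have k1 := hj2 e he
    rw [h, hj2 e' he', div_eq_div_iff he' he] at k1
    have k2 : (1728 * 27 * 4 : ZMod p) ≠ 0 := by rw [h1728, h27, h4']; positivity
    apply mul_left_cancel₀ k2
    linear_combination k1
  set S := Finset.univ.filter (fun e : ZMod p => e ≠ 0 ∧ 4 * e + 27 ≠ 0) with hS
  set T : ZMod p → Finset (ℤ × ℤ × ℤ) := fun e => (RR p).filter fun g => ∃ τ, Fix p τ g ∧ Rd red (jf τ) (φ (j0 e)) with hT
  set w : ℤ × ℤ × ℤ → ℝ := fun g => f (((g.2.1 + g.2.2 : ℤ) : ZMod p) ^ 2) with hw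
  have hw0 : ∀ g, 0 ≤ w g := fun g => hf _
  have hpos : ∀ g ∈ RR p, 0 < g.1 := fun g hg => by
    simp only [RR, Finset.mem_filter] at hg
    exact hg.2.1
  have hcard : ∀ e ∈ S, 2 ≤ (T e).card := by
    intro e he
    simp only [hS, Finset.mem_filter, Finset.mem_univ, true_and] at he
    have hsum := hP.sum_rootMultiplicity hx0 (j0 e)
    set Q := (frobPoly p x).roots.toFinset.filter (fun r => Rd red r (φ (j0 e))) with hQ
    rw [← hsum]
    have : ∑ r ∈ Q, (frobPoly p x).rootMultiplicity r ≤
        ∑ r ∈ Q, ((RR p).filter fun g => ∃ τ, Fix p τ g ∧ jf τ = r).card := by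
      refine Finset.sum_le_sum fun r hr => rootMultiplicity_le_card hp5 hx ?_ ?_
      · rintro rfl
        have h0 := (Rd.zero (red := red)).unique (Finset.mem_filter.mp hr).2
        rw [eq_comm, map_eq_zero] at h0
        exact hj1 e he.1 he.2 h0
      · rintro rfl
        have h0 := (Rd.natCast (red := red) 1728).unique (Finset.mem_filter.mp hr).2
        rw [← map_natCast φ] at h0
        exact hj3 e he.2 (by exact_mod_cast (φ.injective h0).symm)
    refine this.trans ?_
    rw [← Finset.card_biUnion]
    · refine Finset.card_le_card fun g hg => ?_
      simp only [Finset.mem_biUnion, Finset.mem_filter, hT] at hg ⊢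
      obtain ⟨r, hr, hg, τ, hτ, rfl⟩ := hg
      exact ⟨hg, τ, hτ, (Finset.mem_filter.mp hr).2⟩
    · intro r _ r' _ hne
      rw [Function.onFun, Finset.disjoint_left]
      intro g hg hg'
      simp only [Finset.mem_filter] at hg hg'
      obtain ⟨hg, τ, hτ, rfl⟩ := hg
      obtain ⟨-, τ', hτ', rfl⟩ := hg'
      exact hne (by rw [hτ.unique (hpos g hg) hτ'])
  have hval : ∀ e ∈ S, ∀ g ∈ T e, f ((ap e e : ZMod p) ^ 2) ≤ w g := by
    intro e he g hg
    simp only [hS, hT, Finset.mem_filter, Finset.mem_univ, true_and] at he hg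
    obtain ⟨hg, τ, ⟨c, hdet, hfix⟩, hr⟩ := hg
    have hpt : g.2.1 + g.2.2 = 0 ∨ ¬ (p : ℤ) ∣ g.2.1 + g.2.2 := by
      refine or_iff_not_imp_left.mpr fun ht hd => ?_
      have k1 := trace_sq_le hg
      have k2 := Int.le_of_dvd (abs_pos.mpr ht) ((dvd_abs _ _).mpr hd)
      have hp5' : (5 : ℤ) ≤ p := by exact_mod_cast hp5
      rw [← sq_abs] at k1
      nlinarith
    obtain ⟨s, hs⟩ := IsAlgClosed.exists_pow_nat_eq (dl τ)⁻¹ (n := 12) (by norm_num)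
    have hs12 : s ^ 12 * dl τ = 1 := by rw [hs, inv_mul_cancel₀ (dl_ne_zero τ)]
    have hj : (s ^ 4 * e4 τ) ^ 3 = jf τ := by
      rw [jf, mul_pow, ← pow_mul, hs]; field_simp
    rw [← hj] at hr
    simp only [hw]
    rw [hP.ap_sq_eq hp5 hs12 he.1 he.2 hr hdet hfix hpt]
  have hdisj : (S : Set (ZMod p)).PairwiseDisjoint T := by
    intro e he e' he' hne
    rw [Function.onFun, Finset.disjoint_left]
    intro g hg hg'
    simp only [hS, hT, Finset.coe_filter, Finset.mem_univ, true_and, Set.mem_ofPred_eq, Finset.mem_filter] at he he' hg hg'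
    obtain ⟨hg, τ, hτ, hr⟩ := hg
    obtain ⟨-, τ', hτ', hr'⟩ := hg'
    rw [← hτ.unique (hpos g hg) hτ'] at hr'
    exact hne (hjinj e e' he.2 he'.2 (φ.injective (hr.unique hr')))
  calc 2 * ∑ e ∈ S, f ((ap e e : ZMod p) ^ 2) = ∑ e ∈ S, 2 * f ((ap e e : ZMod p) ^ 2) := Finset.mul_sum ..
    _ ≤ ∑ e ∈ S, ∑ g ∈ T e, w g := by
        refine Finset.sum_le_sum fun e he => ?_
        calc 2 * f ((ap e e : ZMod p) ^ 2) ≤ (T e).card * f ((ap e e : ZMod p) ^ 2) :=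
              mul_le_mul_of_nonneg_right (by exact_mod_cast hcard e he) (hf _)
          _ ≤ ∑ g ∈ T e, w g := by
              rw [← nsmul_eq_mul]
              exact Finset.card_nsmul_le_sum _ _ _ (hval e he)
    _ = ∑ g ∈ S.biUnion T, w g := (Finset.sum_biUnion hdisj).symm
    _ ≤ ∑ g ∈ RR p, w g := by
        refine Finset.sum_le_sum_of_subset_of_nonneg ?_ fun g _ _ => hw0 g
        intro g hg
        simp only [Finset.mem_biUnion, hT, Finset.mem_filter] at hg
        obtain ⟨_, _, hg, _⟩ := hg
        exact hg

end
end Birch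

end

section

namespace Birch

theorem exists_succ_pow_le (k : ℕ) : ∃ c : ℝ, 1 ≤ c ∧ ∀ e : ℕ, ((e : ℝ) + 1) ^ k ≤ c * 2 ^ e := by
  have h := tendsto_pow_const_div_const_pow_of_one_lt k (show (1 : ℝ) < 2 by norm_num)
  obtain ⟨M, hM⟩ := h.bddAbove_range
  refine ⟨max 1 (M * 2), le_max_left _ _, fun e => ?_⟩
  have h1 : ((e + 1 : ℕ) : ℝ) ^ k / 2 ^ (e + 1) ≤ M := hM ⟨e + 1, rfl⟩
  rw [div_le_iff₀ (by positivity)] at h1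
  push_cast at h1
  calc ((e : ℝ) + 1) ^ k ≤ M * 2 ^ (e + 1) := h1
    _ = M * 2 * 2 ^ e := by ring
    _ ≤ _ := mul_le_mul_of_nonneg_right (le_max_right _ _) (by positivity)

/-- The divisor bound. -/
theorem exists_card_divisors_pow_le (k : ℕ) :
    ∃ C : ℝ, 0 < C ∧ ∀ n : ℕ, n ≠ 0 → (n.divisors.card : ℝ) ^ k ≤ C * n := by
  obtain ⟨c, hc1, hc⟩ := exists_succ_pow_le k
  refine ⟨c ^ 2 ^ k, by positivity, fun n hn => ?_⟩
  have hn' : (n : ℝ) = ∏ q ∈ n.primeFactors, (q : ℝ) ^ n.factorization q := by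
    conv_lhs => rw [← Nat.prod_factorization_pow_eq_self hn]
    rw [Finsupp.prod, Nat.support_factorization]
    push_cast; rfl
  rw [Nat.card_divisors hn, hn']
  push_cast
  rw [← Finset.prod_pow]
  have h1 : ∀ q ∈ n.primeFactors, ((n.factorization q : ℝ) + 1) ^ k ≤
      (if q < 2 ^ k then c else 1) * (q : ℝ) ^ n.factorization q := by
    intro q hq
    have hq2 := (Nat.prime_of_mem_primeFactors hq).two_le
    split_ifs with h
    · refine (hc _).trans ?_
      gcongr
      exact_mod_cast hq2
    · rw [one_mul]
      have h2 : ((n.factorization q : ℝ) + 1) ≤ 2 ^ n.factorization q := by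
        exact_mod_cast Nat.lt_two_pow_self
      calc ((n.factorization q : ℝ) + 1) ^ k ≤ (2 ^ n.factorization q) ^ k := by gcongr
        _ = ((2 : ℝ) ^ k) ^ n.factorization q := by rw [← pow_mul, ← pow_mul, mul_comm]
        _ ≤ (q : ℝ) ^ n.factorization q := by
            gcongr
            exact_mod_cast not_lt.mp h
  refine (Finset.prod_le_prod (fun q _ => by positivity) h1).trans ?_
  rw [Finset.prod_mul_distrib]
  refine mul_le_mul_of_nonneg_right ?_ (by positivity)
  rw [Finset.prod_ite, Finset.prod_const_one, mul_one, Finset.prod_const]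
  refine pow_le_pow_right₀ hc1 ?_
  calc _ ≤ (Finset.range (2 ^ k)).card := Finset.card_le_card fun q hq => by
        rw [Finset.mem_filter] at hq
        exact Finset.mem_range.mpr hq.2
    _ = _ := Finset.card_range _

theorem le_card_divisors_mul_totient (n : ℕ) : n ≤ n.divisors.card * n.totient := by
  rcases Nat.eq_zero_or_pos n with rfl | hn
  · simp
  calc n = ∑ d ∈ n.divisors, d.totient := (Nat.sum_totient n).symm
    _ ≤ ∑ _d ∈ n.divisors, n.totient := Finset.sum_le_sum fun d hd =>
        Nat.le_of_dvd (Nat.totient_pos.mpr hn) (Nat.totient_dvd_of_dvd (Nat.dvd_of_mem_divisors hd))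
    _ = _ := by rw [Finset.sum_const, smul_eq_mul]

section
variable {N : ℕ} [NeZero N]

/-- The Kloosterman sum. -/
noncomputable def kl (u v : ZMod N) : ℂ := ∑ w : (ZMod N)ˣ, ZMod.stdAddChar (u * (w : ZMod N) + v * ((w⁻¹ : (ZMod N)ˣ) : ZMod N))

theorem kl_twist (s : (ZMod N)ˣ) (u v : ZMod N) : kl (u * (s : ZMod N)) (v * ((s⁻¹ : (ZMod N)ˣ) : ZMod N)) = kl u v := by
  rw [kl, kl]
  refine Fintype.sum_equiv (Equiv.mulLeft s) _ _ fun w => ?_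
  simp only [Equiv.coe_mulLeft, Units.val_mul, mul_inv]
  ring_nf

theorem kl_comm (u v : ZMod N) : kl u v = kl v u := by
  rw [kl, kl]
  refine Fintype.sum_equiv (Equiv.inv _) _ _ fun w => ?_
  simp [add_comm]

open Classical in
/-- The number of solutions of `m * w = 0`. -/
noncomputable def ann (m : ZMod N) : ℕ := (Finset.univ.filter fun w : ZMod N => m * w = 0).card

open Classical in
theorem card_mul_eq_le (m c : ZMod N) : (Finset.univ.filter fun w : ZMod N => m * w = c).card ≤ ann m := by
  by_cases h : ∃ w, m * w = c
  · obtain ⟨w, hw⟩ := h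
    refine Finset.card_le_card_of_injOn (fun z => z - w) (fun z hz => ?_) (fun z _ z' _ h => by simpa using h)
    simp only [Finset.coe_filter, Finset.mem_univ, true_and, Set.mem_ofPred_eq] at hz ⊢
    rw [mul_sub, hz, hw, sub_self]
  · rw [Finset.filter_false_of_mem]
    · simp
    · intro w _ hw; exact h ⟨w, hw⟩

open Classical in
theorem ann_mul_le (m n : ZMod N) : ann (m * n) ≤ ann m * ann n := by
  rw [ann, ann]
  have := Finset.card_eq_sum_card_fiberwise (f := fun w : ZMod N => n * w)
    (s := Finset.univ.filter fun w : ZMod N => m * n * w = 0)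
    (t := Finset.univ.filter fun w : ZMod N => m * w = 0) (fun w hw => by
      simp only [Finset.coe_filter, Finset.mem_univ, true_and, Set.mem_ofPred_eq] at hw ⊢
      rw [← mul_assoc]; exact hw)
  rw [this, ← smul_eq_mul]
  refine Finset.sum_le_card_nsmul _ _ _ fun c _ => ?_
  refine (Finset.card_le_card ?_).trans (card_mul_eq_le n c)
  intro w hw
  simp only [Finset.mem_filter, Finset.mem_univ, true_and] at hw ⊢
  exact hw.2

theorem ann_natCast_le {m : ℕ} (hm : 0 < m) : ann (m : ZMod N) ≤ m := by
  classical
  rw [ann]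
  have := IsAddCyclic.card_nsmul_eq_zero_le (α := ZMod N) hm
  simpa [nsmul_eq_mul] using this

theorem ann_neg (m : ZMod N) : ann (-m) = ann m := by
  simp [ann]

theorem ann_intCast_le {u : ℤ} (hu : u ≠ 0) : ann (u : ZMod N) ≤ u.natAbs := by
  have h := ann_natCast_le (N := N) (Int.natAbs_pos.mpr hu)
  rcases Int.natAbs_eq u with h1 | h1
  · rwa [show (u : ZMod N) = ((u.natAbs : ℕ) : ZMod N) by conv_lhs => rw [h1, Int.cast_natCast]]
  · rwa [show (u : ZMod N) = -((u.natAbs : ℕ) : ZMod N) by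
      conv_lhs => rw [h1, Int.cast_neg, Int.cast_natCast], ann_neg]

theorem ann_unit_mul (s : (ZMod N)ˣ) (m : ZMod N) : ann ((s : ZMod N) * m) = ann m := by
  simp [ann, mul_assoc]

theorem ann_le_gcd (A : ZMod N) : ann A ≤ A.val.gcd N := by
  classical
  refine le_trans (Finset.card_le_card ?_) (ann_natCast_le (N := N)
    (Nat.gcd_pos_of_pos_right _ (NeZero.pos N)))
  intro w hw
  simp only [Finset.mem_filter, Finset.mem_univ, true_and] at hw ⊢
  have h := congrArg (Int.cast : ℤ → ZMod N) (Nat.gcd_eq_gcd_ab A.val N)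
  push_cast at h
  rw [h]
  simp only [ZMod.natCast_zmod_val, ZMod.natCast_self]
  linear_combination (A.val.gcdA N : ZMod N) * hw

theorem sum_ann_le : ∑ A : ZMod N, ann A ≤ N * N.divisors.card := by
  have h1 : ∑ A : ZMod N, ann A ≤ ∑ A : ZMod N, ∑ d ∈ N.divisors, if d ∣ A.val then d else 0 := by
    refine Finset.sum_le_sum fun A _ => (ann_le_gcd A).trans ?_
    have hm : A.val.gcd N ∈ N.divisors := Nat.mem_divisors.mpr ⟨Nat.gcd_dvd_right _ _, NeZero.ne N⟩
    refine le_trans ?_ (Finset.single_le_sum (fun _ _ => Nat.zero_le _) hm)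
    rw [if_pos (Nat.gcd_dvd_left _ _)]
  refine h1.trans ?_
  rw [Finset.sum_comm, mul_comm, ← smul_eq_mul]
  refine Finset.sum_le_card_nsmul _ _ _ fun d hd => ?_
  have hdN := Nat.dvd_of_mem_divisors hd
  obtain ⟨m, hm⟩ := hdN
  have hd0 : 0 < d := Nat.pos_of_mem_divisors hd
  rw [← Finset.sum_filter, Finset.sum_const, smul_eq_mul]
  have : (Finset.univ.filter fun A : ZMod N => d ∣ A.val).card ≤ (Finset.range m).card := by
    refine Finset.card_le_card_of_injOn (fun A => A.val / d) (fun A hA => ?_) (fun A hA B hB h => ?_)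
    · simp only [Finset.coe_range, Set.mem_Iio]
      rw [Nat.div_lt_iff_lt_mul hd0, mul_comm, ← hm]
      exact A.val_lt
    · simp only [Finset.coe_filter, Finset.mem_univ, true_and, Set.mem_ofPred_eq] at hA hB
      apply ZMod.val_injective
      rw [← Nat.div_mul_cancel hA, ← Nat.div_mul_cancel hB]
      exact congrArg (· * d) h
  rw [Finset.card_range] at this
  calc _ ≤ m * d := Nat.mul_le_mul_right _ this
    _ = N := by rw [hm, mul_comm]

open Classical in
theorem sum_norm_sq_eq {ι : Type*} [Fintype ι] (s t : ι → ZMod N) :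
    ∑ u : ZMod N, ∑ v : ZMod N, ‖∑ i, ZMod.stdAddChar (u * s i + v * t i)‖ ^ 2 =
      (N : ℝ) ^ 2 * (Finset.univ.filter fun ij : ι × ι => s ij.1 = s ij.2 ∧ t ij.1 = t ij.2).card := by
  have h1 : ∀ u v : ZMod N, ((‖∑ i, ZMod.stdAddChar (u * s i + v * t i)‖ ^ 2 : ℝ) : ℂ) =
      ∑ ij : ι × ι, ZMod.stdAddChar (u * (s ij.1 - s ij.2)) * ZMod.stdAddChar (v * (t ij.1 - t ij.2)) := by
    intro u v
    rw [Complex.ofReal_pow, ← Complex.mul_conj', map_sum, Finset.sum_mul_sum, Fintype.sum_prod_type]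
    refine Finset.sum_congr rfl fun i _ => Finset.sum_congr rfl fun j _ => ?_
    rw [← AddChar.map_neg_eq_conj, ← AddChar.map_add_eq_mul, ← AddChar.map_add_eq_mul]
    congr 1; ring
  apply Complex.ofReal_injective
  push_cast
  simp_rw [← Complex.ofReal_pow, h1]
  simp_rw [Finset.sum_comm (s := (Finset.univ : Finset (ZMod N))) (t := (Finset.univ : Finset (ι × ι)))]
  simp_rw [← Finset.sum_mul_sum]
  have h2 : ∀ b : ZMod N, ∑ u : ZMod N, ZMod.stdAddChar (u * b) = if b = 0 then (N : ℂ) else 0 := by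
    intro b
    have := AddChar.sum_mulShift b (ZMod.isPrimitive_stdAddChar N)
    rw [this]; simp
  simp_rw [h2]
  rw [Finset.card_filter]
  push_cast
  rw [Finset.mul_sum]
  refine Finset.sum_congr rfl fun ij _ => ?_
  simp only [sub_eq_zero]
  split_ifs <;> simp_all [pow_two]

open Classical in
theorem card_quad_le : (Finset.univ.filter fun w : ((ZMod N)ˣ × (ZMod N)ˣ) × ((ZMod N)ˣ × (ZMod N)ˣ) =>
    (w.1.1 : ZMod N) + w.1.2 = w.2.1 + w.2.2 ∧ ((w.1.1⁻¹ : (ZMod N)ˣ) : ZMod N) + ((w.1.2⁻¹ : (ZMod N)ˣ) : ZMod N) =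
      ((w.2.1⁻¹ : (ZMod N)ˣ) : ZMod N) + ((w.2.2⁻¹ : (ZMod N)ˣ) : ZMod N)).card ≤ 2 * (N * N.divisors.card) ^ 2 := by
  have h1 : (Finset.univ.filter fun w : ((ZMod N)ˣ × (ZMod N)ˣ) × ((ZMod N)ˣ × (ZMod N)ˣ) =>
    (w.1.1 : ZMod N) + w.1.2 = w.2.1 + w.2.2 ∧ ((w.1.1⁻¹ : (ZMod N)ˣ) : ZMod N) + ((w.1.2⁻¹ : (ZMod N)ˣ) : ZMod N) =
      ((w.2.1⁻¹ : (ZMod N)ˣ) : ZMod N) + ((w.2.2⁻¹ : (ZMod N)ˣ) : ZMod N)).card ≤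
      (Finset.univ.filter fun z : (ZMod N × ZMod N) × ZMod N =>
        (z.1.1 * z.1.2 * 2) * z.2 = - (z.1.1 * z.1.2 * (z.1.1 + z.1.2))).card := by
    refine Finset.card_le_card_of_injOn
      (fun w => (((w.1.1 : ZMod N) - w.2.1, (w.1.2 : ZMod N) - w.2.1), (w.2.1 : ZMod N))) ?_ ?_
    · rintro ⟨⟨w1, w2⟩, ⟨w3, w4⟩⟩ hw
      simp only [Finset.coe_filter, Finset.mem_univ, true_and, Set.mem_ofPred_eq] at hw ⊢
      obtain ⟨e1, e2⟩ := hw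
      have i1 := w1.mul_inv
      have i2 := w2.mul_inv
      have i3 := w3.mul_inv
      have i4 := w4.mul_inv
      have e3 : ((w1 : ZMod N) + w2) * (w3 * w4) = (w3 + w4) * (w1 * w2) := by
        linear_combination (w1 : ZMod N) * w2 * w3 * w4 * e2 - (w2 : ZMod N) * w3 * w4 * i1 - (w1 : ZMod N) * w3 * w4 * i2 +
          (w1 : ZMod N) * w2 * w4 * i3 + (w1 : ZMod N) * w2 * w3 * i4
      have e4 : (w4 : ZMod N) = w1 + w2 - w3 := by linear_combination -e1
      rw [e4] at e3
      linear_combination -e3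
    · rintro ⟨⟨w1, w2⟩, ⟨w3, w4⟩⟩ hw ⟨⟨w1', w2'⟩, ⟨w3', w4'⟩⟩ hw' heq
      simp only [Finset.coe_filter, Finset.mem_univ, true_and, Set.mem_ofPred_eq] at hw hw'
      simp only [Prod.mk.injEq] at heq ⊢
      obtain ⟨⟨q1, q2⟩, q3⟩ := heq
      rw [q3] at q1 q2
      have r1 : (w1 : ZMod N) = w1' := by linear_combination q1
      have r2 : (w2 : ZMod N) = w2' := by linear_combination q2
      have r4 : (w4 : ZMod N) = w4' := by linear_combination hw'.1 - hw.1 + r1 + r2 - q3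
      exact ⟨⟨Units.ext r1, Units.ext r2⟩, Units.ext q3, Units.ext r4⟩
  refine h1.trans ?_
  have h2 : (Finset.univ.filter fun z : (ZMod N × ZMod N) × ZMod N =>
        (z.1.1 * z.1.2 * 2) * z.2 = - (z.1.1 * z.1.2 * (z.1.1 + z.1.2))).card =
      ∑ z : ZMod N × ZMod N, (Finset.univ.filter fun w : ZMod N =>
        (z.1 * z.2 * 2) * w = - (z.1 * z.2 * (z.1 + z.2))).card := by
    simp_rw [Finset.card_filter]
    rw [Fintype.sum_prod_type]
  rw [h2]
  calc _ ≤ ∑ z : ZMod N × ZMod N, ann z.1 * ann z.2 * 2 := by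
        refine Finset.sum_le_sum fun z _ => (card_mul_eq_le _ _).trans ((ann_mul_le _ _).trans ?_)
        have := ann_natCast_le (N := N) (m := 2) (by norm_num)
        exact Nat.mul_le_mul (ann_mul_le _ _) (by exact_mod_cast this)
    _ = (∑ A : ZMod N, ann A) * (∑ A : ZMod N, ann A) * 2 := by
        rw [Finset.sum_mul_sum, ← Finset.sum_mul, Fintype.sum_prod_type]
    _ ≤ (N * N.divisors.card) * (N * N.divisors.card) * 2 := by
        gcongr <;> exact sum_ann_le
    _ = _ := by ring

theorem sum_kl_le : ∑ u : ZMod N, ∑ v : ZMod N, ‖kl u v‖ ^ 4 ≤ 2 * (N : ℝ) ^ 4 * (N.divisors.card : ℝ) ^ 2 := by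
  classical
  have h1 := sum_norm_sq_eq (N := N) (ι := (ZMod N)ˣ × (ZMod N)ˣ) (fun w => (w.1 : ZMod N) + w.2)
    (fun w => ((w.1⁻¹ : (ZMod N)ˣ) : ZMod N) + ((w.2⁻¹ : (ZMod N)ˣ) : ZMod N))
  have h2 : ∀ u v : ZMod N, ‖kl u v‖ ^ 4 = ‖∑ w : (ZMod N)ˣ × (ZMod N)ˣ,
      ZMod.stdAddChar (u * ((w.1 : ZMod N) + (w.2 : ZMod N)) + v * (((w.1⁻¹ : (ZMod N)ˣ) : ZMod N) + ((w.2⁻¹ : (ZMod N)ˣ) : ZMod N)))‖ ^ 2 := by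
    intro u v
    have : (∑ w : (ZMod N)ˣ × (ZMod N)ˣ, ZMod.stdAddChar (u * ((w.1 : ZMod N) + (w.2 : ZMod N)) +
        v * (((w.1⁻¹ : (ZMod N)ˣ) : ZMod N) + ((w.2⁻¹ : (ZMod N)ˣ) : ZMod N)))) = kl u v * kl u v := by
      rw [kl, Finset.sum_mul_sum, Fintype.sum_prod_type]
      refine Finset.sum_congr rfl fun i _ => Finset.sum_congr rfl fun j _ => ?_
      rw [← AddChar.map_add_eq_mul]
      congr 1; ring
    rw [this, norm_mul]; ring
  simp_rw [h2]
  rw [h1]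
  have h3 : ((Finset.univ.filter fun w : ((ZMod N)ˣ × (ZMod N)ˣ) × ((ZMod N)ˣ × (ZMod N)ˣ) =>
    (w.1.1 : ZMod N) + w.1.2 = w.2.1 + w.2.2 ∧ ((w.1.1⁻¹ : (ZMod N)ˣ) : ZMod N) + ((w.1.2⁻¹ : (ZMod N)ˣ) : ZMod N) =
      ((w.2.1⁻¹ : (ZMod N)ˣ) : ZMod N) + ((w.2.2⁻¹ : (ZMod N)ˣ) : ZMod N)).card : ℝ) ≤ 2 * (N * N.divisors.card : ℝ) ^ 2 := by
    exact_mod_cast card_quad_le (N := N)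
  calc _ ≤ (N : ℝ) ^ 2 * (2 * (N * N.divisors.card : ℝ) ^ 2) := mul_le_mul_of_nonneg_left h3 (by positivity)
    _ = _ := by ring

theorem totient_mul_norm_kl_le (u v : ZMod N) :
    (N.totient : ℝ) * ‖kl u v‖ ^ 4 ≤ ann u * (2 * (N : ℝ) ^ 4 * (N.divisors.card : ℝ) ^ 2) := by
  classical
  have h1 : (N.totient : ℝ) * ‖kl u v‖ ^ 4 = ∑ s : (ZMod N)ˣ, ‖kl (u * (s : ZMod N)) (v * ((s⁻¹ : (ZMod N)ˣ) : ZMod N))‖ ^ 4 := by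
    simp_rw [kl_twist]
    rw [Finset.sum_const, Finset.card_univ, ZMod.card_units_eq_totient, nsmul_eq_mul]
  rw [h1]
  have h2 : ∑ s : (ZMod N)ˣ, ‖kl (u * (s : ZMod N)) (v * ((s⁻¹ : (ZMod N)ˣ) : ZMod N))‖ ^ 4 =
      ∑ z : ZMod N × ZMod N, ∑ s ∈ Finset.univ.filter (fun s : (ZMod N)ˣ => (u * (s : ZMod N), v * ((s⁻¹ : (ZMod N)ˣ) : ZMod N)) = z), ‖kl z.1 z.2‖ ^ 4 := by
    rw [← Finset.sum_fiberwise (Finset.univ : Finset (ZMod N)ˣ)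
      (fun s => (u * (s : ZMod N), v * ((s⁻¹ : (ZMod N)ˣ) : ZMod N)))]
    refine Finset.sum_congr rfl fun z _ => Finset.sum_congr rfl fun s hs => ?_
    rw [← (Finset.mem_filter.mp hs).2]
  rw [h2]
  calc _ ≤ ∑ z : ZMod N × ZMod N, (ann u : ℝ) * ‖kl z.1 z.2‖ ^ 4 := by
        refine Finset.sum_le_sum fun z _ => ?_
        rw [Finset.sum_const, nsmul_eq_mul]
        refine mul_le_mul_of_nonneg_right ?_ (by positivity)
        norm_cast
        refine le_trans ?_ (card_mul_eq_le u z.1)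
        refine Finset.card_le_card_of_injOn (fun s : (ZMod N)ˣ => (s : ZMod N)) (fun s hs => ?_)
          (fun s _ s' _ h => Units.ext h)
        simp only [Finset.coe_filter, Finset.mem_univ, true_and, Set.mem_ofPred_eq] at hs ⊢
        rw [← hs]
    _ = (ann u : ℝ) * ∑ u : ZMod N, ∑ v : ZMod N, ‖kl u v‖ ^ 4 := by
        rw [← Finset.mul_sum, Fintype.sum_prod_type]
    _ ≤ _ := mul_le_mul_of_nonneg_left sum_kl_le (by positivity)

end

/-- Kloosterman sums with a small coefficient are small. -/
theorem exists_norm_kl_le (U : ℕ) {ε : ℝ} (hε : 0 < ε) : ∃ N₀ : ℕ, ∀ N : ℕ, N₀ ≤ N → ∀ [NeZero N], ∀ u v : ZMod N,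
    ann u ≤ U → ‖kl u v‖ ≤ ε * N.totient := by
  obtain ⟨C, hC0, hC⟩ := exists_card_divisors_pow_le 14
  obtain ⟨N₀, hN₀⟩ := exists_nat_ge (C * (2 * U / ε ^ 4) ^ 2)
  refine ⟨N₀, fun N hN _ u v hu => ?_⟩
  have hN0 := NeZero.ne N
  have h1 := totient_mul_norm_kl_le u v
  set τ : ℝ := (N.divisors.card : ℝ) with hτ
  set φ : ℝ := (N.totient : ℝ) with hφ
  have hφ0 : 0 < φ := by
    rw [hφ]; exact_mod_cast Nat.totient_pos.mpr (NeZero.pos N)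
  have hN1 : (0 : ℝ) < N := by exact_mod_cast NeZero.pos N
  have hτ0 : 0 ≤ τ := by positivity
  have h2 : (N : ℝ) ≤ τ * φ := by
    rw [hτ, hφ]
    exact_mod_cast le_card_divisors_mul_totient N
  have h3 : 2 * U * τ ^ 7 ≤ ε ^ 4 * N := by
    have h4 : (2 * U / ε ^ 4 * τ ^ 7) ^ 2 ≤ (N : ℝ) ^ 2 := by
      calc (2 * U / ε ^ 4 * τ ^ 7) ^ 2 = (2 * U / ε ^ 4) ^ 2 * τ ^ 14 := by ring
        _ ≤ (2 * U / ε ^ 4) ^ 2 * (C * N) := by gcongr; exact hC N hN0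
        _ = C * (2 * U / ε ^ 4) ^ 2 * N := by ring
        _ ≤ N * N := by
            gcongr
            exact hN₀.trans (by exact_mod_cast hN)
        _ = _ := by ring
    have h5 := abs_le_of_sq_le_sq' h4 hN1.le
    have h6 := h5.2
    rw [div_mul_eq_mul_div, div_le_iff₀ (by positivity)] at h6
    linarith
  have h4 : φ * ‖kl u v‖ ^ 4 ≤ φ * (ε * φ) ^ 4 := by
    refine h1.trans ?_
    have hτ1 : 0 < τ := by
      rw [hτ]; exact_mod_cast Finset.card_pos.mpr ⟨1, Nat.one_mem_divisors.mpr hN0⟩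
    have : τ ^ 5 * (ann u * (2 * (N : ℝ) ^ 4 * τ ^ 2)) ≤ τ ^ 5 * (φ * (ε * φ) ^ 4) := by
      calc τ ^ 5 * (ann u * (2 * (N : ℝ) ^ 4 * τ ^ 2)) ≤ τ ^ 5 * (U * (2 * (N : ℝ) ^ 4 * τ ^ 2)) := by
            gcongr
        _ = 2 * U * τ ^ 7 * N ^ 4 := by ring
        _ ≤ ε ^ 4 * N * N ^ 4 := by gcongr
        _ = ε ^ 4 * N ^ 5 := by ring
        _ ≤ ε ^ 4 * (τ * φ) ^ 5 := by gcongr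
        _ = _ := by ring
    exact le_of_mul_le_mul_left this (by positivity)
  have h5 := le_of_mul_le_mul_left h4 hφ0
  exact le_of_pow_le_pow_left₀ (by norm_num) (by positivity) h5

end Birch

end

section

namespace Birch

open MeasureTheory

theorem exists_finsupp_of_mem_fourierSubalgebra {Q : C(UnitAddCircle, ℂ)}
    (hQ : Q ∈ (fourierSubalgebra : StarSubalgebra ℂ C(UnitAddCircle, ℂ))) :
    ∃ s : ℤ →₀ ℂ, ∀ x, Q x = s.sum fun n z => z * fourier n x := by
  have h : Q ∈ Submodule.span ℂ (Set.range (@fourier (1 : ℝ))) := by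
    rw [← fourierSubalgebra_coe]; exact hQ
  obtain ⟨s, hs⟩ := (Finsupp.mem_span_range_iff_exists_finsupp).mp h
  refine ⟨s, fun x => ?_⟩
  rw [← hs, Finsupp.sum, Finsupp.sum, ContinuousMap.coe_sum, Finset.sum_apply]
  rfl

theorem volume_real_univ_unitAddCircle : (volume : Measure UnitAddCircle).real Set.univ = 1 := by
  rw [Measure.real, UnitAddCircle.measure_univ, ENNReal.toReal_one]

theorem integral_fourier_of_ne_zero {n : ℤ} (hn : n ≠ 0) :
    ∫ x : UnitAddCircle, fourier n x = 0 :=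
  integral_eq_zero_of_add_right_eq_neg (fourier_add_half_inv_index hn one_pos)

theorem integral_trig (s : ℤ →₀ ℂ) :
    ∫ x : UnitAddCircle, (s.sum fun n z => z * fourier n x) = s 0 := by
  simp only [Finsupp.sum]
  rw [integral_finsetSum]
  · simp only [integral_const_mul]
    rw [Finset.sum_eq_single 0]
    · simp [volume_real_univ_unitAddCircle]
    · intro n _ hn
      rw [integral_fourier_of_ne_zero hn, mul_zero]
    · intro h; simp [Finsupp.notMem_support_iff.mp h]
  · intro n _
    exact ((fourier n).continuous.const_mul _ |>.integrable_of_hasCompactSupport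
      (HasCompactSupport.of_compactSpace _))

theorem exists_trig_majorant (r : ℝ) (hr : 0 ≤ r) (c : UnitAddCircle) {ε : ℝ} (hε : 0 < ε) :
    ∃ (s : ℤ →₀ ℂ) (W : UnitAddCircle → ℝ),
      (∀ x, (W x : ℂ) = s.sum fun n z => z * fourier n x) ∧ (∀ x, 0 ≤ W x) ∧
      (∀ x ∈ Metric.closedBall c r, 1 ≤ W x) ∧ ‖s 0‖ ≤ 2 * r + ε := by
  set E := Metric.closedBall c r with hE
  have hvol : (volume : Measure UnitAddCircle).real E ≤ 2 * r := by
    rw [hE, Measure.real, AddCircle.volume_closedBall]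
    refine ENNReal.toReal_le_of_le_ofReal (by positivity) (ENNReal.ofReal_le_ofReal ?_)
    exact min_le_right _ _
  obtain ⟨δ, hδ, hδ'⟩ : ∃ δ : ℝ, ∃ h : 0 < δ,
      ∫ x : UnitAddCircle, (thickenedIndicator h E x : ℝ) ≤ 2 * r + ε / 4 := by
    have h1 : ∀ n : ℕ, (0 : ℝ) < 1 / ((n : ℝ) + 1) := fun n => by positivity
    have := tendsto_integral_thickenedIndicator_of_isClosed (volume : Measure UnitAddCircle)
      (Metric.isClosed_closedBall : IsClosed E) h1 tendsto_one_div_add_atTop_nhds_zero_nat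
    obtain ⟨n, hn⟩ := (this.eventually_lt_const (u := 2 * r + ε / 4)
      (by linarith)).exists
    exact ⟨_, h1 n, hn.le⟩
  set G : C(UnitAddCircle, ℂ) := ⟨fun x => (((thickenedIndicator hδ E x : NNReal) : ℝ) + ε / 4 : ℝ), by
    refine Complex.continuous_ofReal.comp (Continuous.add ?_ continuous_const)
    exact NNReal.continuous_coe.comp (thickenedIndicator hδ E).continuous⟩ with hG
  have hmem : G ∈ (fourierSubalgebra : StarSubalgebra ℂ C(UnitAddCircle, ℂ)).topologicalClosure := by
    rw [fourierSubalgebra_closure_eq_top]; trivial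
  obtain ⟨Q, hQ, hQG⟩ := Metric.mem_closure_iff.mp hmem (ε / 4) (by positivity)
  obtain ⟨s, hs⟩ := exists_finsupp_of_mem_fourierSubalgebra
    (StarSubalgebra.smul_mem _ (add_mem hQ (star_mem hQ)) (1 / 2 : ℂ))
  have hs' : ∀ x, ((Q x).re : ℂ) = s.sum fun n z => z * fourier n x := by
    intro x
    rw [← hs x]
    simp only [ContinuousMap.smul_apply, ContinuousMap.add_apply, ContinuousMap.star_apply,
      smul_eq_mul, Complex.re_eq_add_conj]
    rw [RCLike.star_def]; ring
  have hd : ∀ x, |((thickenedIndicator hδ E x : NNReal) : ℝ) + ε / 4 - (Q x).re| < ε / 4 := by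
    intro x
    have h1 := (ContinuousMap.dist_apply_le_dist x).trans_lt hQG
    rw [Complex.dist_eq] at h1
    refine lt_of_le_of_lt ?_ h1
    have h2 := Complex.abs_re_le_norm (G x - Q x)
    rwa [Complex.sub_re, hG] at h2
  have hc : Continuous fun x => (Q x).re := Complex.continuous_re.comp Q.continuous
  refine ⟨s, fun x => (Q x).re, hs', fun x => ?_, fun x hx => ?_, ?_⟩
  · have := abs_lt.mp (hd x)
    have h2 : (0 : ℝ) ≤ thickenedIndicator hδ E x := NNReal.coe_nonneg _
    linarith
  · have := abs_lt.mp (hd x)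
    rw [thickenedIndicator_one hδ E hx] at this
    push_cast at this
    linarith
  · have h1 : s 0 = ((∫ x, (Q x).re : ℝ) : ℂ) := by
      rw [← integral_trig, ← integral_complex_ofReal]
      exact integral_congr_ae (.of_forall fun x => (hs' x).symm)
    have h_int : Integrable (fun x : UnitAddCircle => ((thickenedIndicator hδ E x : NNReal) : ℝ)) :=
      (NNReal.continuous_coe.comp (thickenedIndicator hδ E).continuous).integrable_of_hasCompactSupport
        (HasCompactSupport.of_compactSpace _)
    have h2 : (∫ x, (Q x).re) ≤ ∫ x : UnitAddCircle,
        (((thickenedIndicator hδ E x : NNReal) : ℝ) + ε / 2) := by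
      refine integral_mono (hc.integrable_of_hasCompactSupport
        (HasCompactSupport.of_compactSpace _)) (h_int.add (integrable_const _)) fun x => ?_
      have := abs_lt.mp (hd x)
      show (Q x).re ≤ _
      linarith
    have h3 : 0 ≤ ∫ x, (Q x).re := by
      refine integral_nonneg fun x => ?_
      have := abs_lt.mp (hd x)
      have h2 : (0 : ℝ) ≤ thickenedIndicator hδ E x := NNReal.coe_nonneg _
      show 0 ≤ (Q x).re
      linarith
    rw [integral_add h_int (integrable_const _)] at h2
    rw [h1, Complex.norm_real, Real.norm_of_nonneg h3]
    simp only [integral_const, volume_real_univ_unitAddCircle, one_smul] at h2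
    linarith

theorem stdAddChar_intCast_mul {N : ℕ} [NeZero N] (n : ℤ) (w : ZMod N) :
    ZMod.stdAddChar ((n : ZMod N) * w) = fourier n (ZMod.toAddCircle w) := by
  rw [fourier_apply, ← map_zsmul, zsmul_eq_mul]
  rfl

open Classical in
theorem exists_box_count {r : ℝ} (hr : 0 ≤ r) (c₁ c₂ : UnitAddCircle) {ε : ℝ} (hε : 0 < ε) :
    ∃ N₀ : ℕ, ∀ N, N₀ ≤ N → ∀ [NeZero N], ∀ v : (ZMod N)ˣ,
      ((Finset.univ.filter fun w : (ZMod N)ˣ =>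
        ZMod.toAddCircle (w : ZMod N) ∈ Metric.closedBall c₁ r ∧
        ZMod.toAddCircle ((v : ZMod N) * ((w⁻¹ : (ZMod N)ˣ) : ZMod N)) ∈ Metric.closedBall c₂ r).card : ℝ)
      ≤ ((2 * r + ε) ^ 2 + ε) * N.totient := by
  obtain ⟨s, W, hW, hW0, hW1, hs⟩ := exists_trig_majorant r hr c₁ hε
  obtain ⟨s', W', hW', hW0', hW1', hs'⟩ := exists_trig_majorant r hr c₂ hε
  set U : ℕ := (s.support ∪ s'.support).sup Int.natAbs with hU
  set L : ℝ := ∑ m ∈ s.support, ∑ n ∈ s'.support, ‖s m‖ * ‖s' n‖ with hL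
  have hL0 : 0 ≤ L := by positivity
  obtain ⟨N₀, hN₀⟩ := exists_norm_kl_le U (ε := ε / (L + 1)) (by positivity)
  refine ⟨N₀, fun N hN _ v => ?_⟩
  have hφ : (0 : ℝ) ≤ N.totient := by positivity
  have hkl : ∀ m ∈ s.support, ∀ n ∈ s'.support, ‖kl (m : ZMod N) ((n : ZMod N) * v)‖ ≤
      ε / (L + 1) * N.totient + if m = 0 ∧ n = 0 then (N.totient : ℝ) else 0 := by
    intro m hm n hn
    have hm' : m.natAbs ≤ U := Finset.le_sup (f := Int.natAbs) (Finset.mem_union_left _ hm)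
    have hn' : n.natAbs ≤ U := Finset.le_sup (f := Int.natAbs) (Finset.mem_union_right _ hn)
    by_cases hm0 : m = 0
    · by_cases hn0 : n = 0
      · rw [if_pos ⟨hm0, hn0⟩, hm0, hn0]
        have : ‖kl ((0 : ℤ) : ZMod N) (((0 : ℤ) : ZMod N) * v)‖ ≤ N.totient := by
          rw [kl]
          refine (norm_sum_le _ _).trans ?_
          simp [ZMod.card_units_eq_totient]
        exact le_add_of_nonneg_of_le (by positivity) this
      · rw [if_neg (by tauto), add_zero, kl_comm]
        refine hN₀ N hN _ _ ?_
        rw [mul_comm, ann_unit_mul]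
        exact (ann_intCast_le hn0).trans hn'
    · rw [if_neg (by tauto), add_zero]
      exact hN₀ N hN _ _ ((ann_intCast_le hm0).trans hm')
  have h1 : ((Finset.univ.filter fun w : (ZMod N)ˣ =>
        ZMod.toAddCircle (w : ZMod N) ∈ Metric.closedBall c₁ r ∧
        ZMod.toAddCircle ((v : ZMod N) * ((w⁻¹ : (ZMod N)ˣ) : ZMod N)) ∈ Metric.closedBall c₂ r).card : ℝ)
      ≤ ∑ w : (ZMod N)ˣ, W (ZMod.toAddCircle (w : ZMod N)) *
        W' (ZMod.toAddCircle ((v : ZMod N) * ((w⁻¹ : (ZMod N)ˣ) : ZMod N))) := by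
    rw [Finset.card_filter, Nat.cast_sum]
    refine Finset.sum_le_sum fun w _ => ?_
    split_ifs with h
    · have := one_le_mul_of_one_le_of_one_le (hW1 _ h.1) (hW1' _ h.2)
      simpa using this
    · simpa using mul_nonneg (hW0 _) (hW0' _)
  have h2 : ((∑ w : (ZMod N)ˣ, W (ZMod.toAddCircle (w : ZMod N)) *
        W' (ZMod.toAddCircle ((v : ZMod N) * ((w⁻¹ : (ZMod N)ˣ) : ZMod N))) : ℝ) : ℂ) =
      ∑ m ∈ s.support, ∑ n ∈ s'.support, s m * s' n * kl (m : ZMod N) ((n : ZMod N) * v) := by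
    push_cast
    simp only [hW, hW', Finsupp.sum, kl, Finset.mul_sum, Finset.sum_mul]
    rw [Finset.sum_comm]
    rw [Finset.sum_congr rfl fun n _ => Finset.sum_comm]
    rw [Finset.sum_comm]
    refine Finset.sum_congr rfl fun m _ => Finset.sum_congr rfl fun n _ =>
      Finset.sum_congr rfl fun w _ => ?_
    rw [AddChar.map_add_eq_mul, mul_assoc (n : ZMod N), stdAddChar_intCast_mul,
      stdAddChar_intCast_mul]
    ring
  have h3 : (∑ w : (ZMod N)ˣ, W (ZMod.toAddCircle (w : ZMod N)) *
        W' (ZMod.toAddCircle ((v : ZMod N) * ((w⁻¹ : (ZMod N)ˣ) : ZMod N)))) ≤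
      ∑ m ∈ s.support, ∑ n ∈ s'.support, ‖s m‖ * ‖s' n‖ *
        (ε / (L + 1) * N.totient + if m = 0 ∧ n = 0 then (N.totient : ℝ) else 0) := by
    refine (Real.le_norm_self _).trans ?_
    rw [← Complex.norm_real, h2]
    refine (norm_sum_le _ _).trans (Finset.sum_le_sum fun m hm => ?_)
    refine (norm_sum_le _ _).trans (Finset.sum_le_sum fun n hn => ?_)
    rw [norm_mul, norm_mul]
    exact mul_le_mul_of_nonneg_left (hkl m hm n hn) (by positivity)
  refine h1.trans (h3.trans ?_)
  simp only [mul_add, Finset.sum_add_distrib, ← Finset.sum_mul]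
  have h4 : L * (ε / (L + 1) * N.totient) ≤ ε * N.totient := by
    have : L * (ε / (L + 1)) ≤ ε := by
      rw [mul_div_assoc', div_le_iff₀ (by positivity)]
      nlinarith
    calc _ = L * (ε / (L + 1)) * N.totient := by ring
      _ ≤ _ := by gcongr
  have h5 : ∑ m ∈ s.support, ∑ n ∈ s'.support, ‖s m‖ * ‖s' n‖ *
      (if m = 0 ∧ n = 0 then (N.totient : ℝ) else 0) ≤ ‖s 0‖ * ‖s' 0‖ * N.totient := by
    calc _ = ∑ m ∈ s.support, ∑ n ∈ s'.support, (if m = 0 then ‖s m‖ else 0) *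
          (if n = 0 then ‖s' n‖ else 0) * N.totient := by
          refine Finset.sum_congr rfl fun m _ => Finset.sum_congr rfl fun n _ => ?_
          by_cases hm : m = 0 <;> by_cases hn : n = 0 <;> simp [hm, hn]
      _ = (∑ m ∈ s.support, (if m = 0 then ‖s m‖ else 0)) *
          (∑ n ∈ s'.support, (if n = 0 then ‖s' n‖ else 0)) * N.totient := by
          rw [Finset.sum_mul_sum]; simp only [Finset.sum_mul]
      _ ≤ _ := by
          rw [Finset.sum_ite_eq', Finset.sum_ite_eq']
          gcongr <;> split_ifs <;> simp
  have h6 : ‖s 0‖ * ‖s' 0‖ * N.totient ≤ (2 * r + ε) ^ 2 * N.totient := by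
    rw [sq]; gcongr
  have h7 : (((2 * r + ε) ^ 2 + ε) * N.totient : ℝ) =
    (2 * r + ε) ^ 2 * N.totient + ε * N.totient := by ring
  rw [h7, ← hL]
  linarith

end Birch

end

section

namespace Birch


theorem tsum_moebius_div_sq : ∑' n : ℕ, (ArithmeticFunction.moebius n : ℝ) / (n : ℝ) ^ 2 = 6 / Real.pi ^ 2 := by
  have h2 : 1 < (2 : ℂ).re := by norm_num
  have h := LSeries_one_mul_Lseries_moebius h2
  rw [LSeries_one_eq_riemannZeta h2, riemannZeta_two] at h
  have h3 : LSeries (fun n => ((ArithmeticFunction.moebius n : ℤ) : ℂ)) 2 =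
      ((∑' n : ℕ, (ArithmeticFunction.moebius n : ℝ) / (n : ℝ) ^ 2 : ℝ) : ℂ) := by
    rw [LSeries, Complex.ofReal_tsum]
    refine tsum_congr fun n => ?_
    rcases eq_or_ne n 0 with rfl | hn
    · simp
    · rw [LSeries.term_of_ne_zero hn]
      push_cast
      norm_num
  rw [h3] at h
  have h4 : Real.pi ^ 2 / 6 *
      (∑' n : ℕ, (ArithmeticFunction.moebius n : ℝ) / (n : ℝ) ^ 2) = 1 := by
    exact_mod_cast h
  have := Real.pi_ne_zero
  field_simp
  linarith

theorem sum_Ioc_totient (A : ℕ) : ∑ a ∈ Finset.Ioc 0 A, (a.totient : ℝ) =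
    ∑ d ∈ Finset.Ioc 0 A, (ArithmeticFunction.moebius d : ℝ) *
      (((A / d : ℕ) : ℝ) * (((A / d : ℕ) : ℝ) + 1) / 2) := by
  have h1 : ∀ n > 0, ∑ x ∈ n.divisorsAntidiagonal,
      (ArithmeticFunction.moebius x.1 : ℝ) * (x.2 : ℝ) = (n.totient : ℝ) := by
    rw [← ArithmeticFunction.sum_eq_iff_sum_mul_moebius_eq (f := fun n => (n.totient : ℝ))
      (g := fun n => (n : ℝ))]
    intro n _
    exact_mod_cast n.sum_totient
  have h2 := ArithmeticFunction.sum_Ioc_mul_eq_sum_sum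
    ((ArithmeticFunction.moebius : ArithmeticFunction ℤ) : ArithmeticFunction ℝ)
    ((ArithmeticFunction.id : ArithmeticFunction ℕ) : ArithmeticFunction ℝ) A
  have h3 : ∀ q : ℕ, ∑ m ∈ Finset.Ioc 0 q, (m : ℝ) = (q : ℝ) * ((q : ℝ) + 1) / 2 := by
    intro q
    induction q with
    | zero => simp
    | succ q ih => rw [Finset.sum_Ioc_succ_top (Nat.zero_le q), ih]; push_cast; ring
  have h4 : ∀ n ∈ Finset.Ioc 0 A, (((ArithmeticFunction.moebius : ArithmeticFunction ℤ) :
      ArithmeticFunction ℝ) * ((ArithmeticFunction.id : ArithmeticFunction ℕ) :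
      ArithmeticFunction ℝ)) n = (n.totient : ℝ) := by
    intro n hn
    rw [← h1 n (Finset.mem_Ioc.mp hn).1, ArithmeticFunction.mul_apply]
    simp
  rw [Finset.sum_congr rfl h4] at h2
  rw [h2]
  refine Finset.sum_congr rfl fun d _ => ?_
  rw [← h3]
  simp

theorem tendsto_sum_totient : Filter.Tendsto
    (fun A : ℕ => (∑ a ∈ Finset.Ioc 0 A, (a.totient : ℝ)) / (A : ℝ) ^ 2) Filter.atTop
    (nhds (3 / Real.pi ^ 2)) := by
  have key : Filter.Tendsto (fun A : ℕ => ∑' d : ℕ, (ArithmeticFunction.moebius d : ℝ) *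
      (((A / d : ℕ) : ℝ) * (((A / d : ℕ) : ℝ) + 1) / 2) / (A : ℝ) ^ 2) Filter.atTop
      (nhds (∑' d : ℕ, (ArithmeticFunction.moebius d : ℝ) / (d : ℝ) ^ 2 / 2)) := by
    refine tendsto_tsum_of_dominated_convergence (bound := fun d : ℕ => 1 / (d : ℝ) ^ 2)
      (Real.summable_one_div_nat_pow.mpr one_lt_two) (fun d => ?_) ?_
    · have h1 : Filter.Tendsto (fun A : ℕ => ((A / d : ℕ) : ℝ) / A) Filter.atTop
          (nhds (1 / (d : ℝ))) := by
        have := (tendsto_nat_floor_mul_div_atTop (R := ℝ) (a := 1 / d) (by positivity)).comp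
          tendsto_natCast_atTop_atTop
        refine this.congr fun A => ?_
        simp only [Function.comp]
        rw [one_div_mul_eq_div, Nat.floor_div_natCast, Nat.floor_natCast]
      have h2 := ((h1.mul (h1.add (tendsto_const_div_atTop_nhds_zero_nat (1 : ℝ)))).const_mul
        (ArithmeticFunction.moebius d : ℝ)).div_const 2
      refine (h2.congr' ?_).trans (le_of_eq ?_)
      · filter_upwards [Filter.eventually_gt_atTop 0] with A hA
        have : (A : ℝ) ≠ 0 := by positivity
        field_simp
      · congr 1; ring
    · filter_upwards with A d
      rcases eq_or_ne d 0 with rfl | hd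
      · simp
      rcases eq_or_ne A 0 with rfl | hA
      · simp
      have hA' : (0 : ℝ) < A := by positivity
      have hd' : (0 : ℝ) < d := by positivity
      have h1 : |(ArithmeticFunction.moebius d : ℝ)| ≤ 1 := by
        exact_mod_cast ArithmeticFunction.abs_moebius_le_one
      have h2 : ((A / d : ℕ) : ℝ) ≤ A / d := Nat.cast_div_le
      have h3 : ((A / d : ℕ) : ℝ) ≤ ((A / d : ℕ) : ℝ) ^ 2 := by
        exact_mod_cast Nat.le_self_pow two_ne_zero (A / d)
      have h4 : ((A / d : ℕ) : ℝ) ^ 2 ≤ (A / d) ^ 2 := by gcongr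
      have h0 : (0 : ℝ) ≤ ((A / d : ℕ) : ℝ) := by positivity
      rw [Real.norm_eq_abs, abs_div, abs_mul, abs_of_nonneg (by positivity : (0 : ℝ) ≤ (A : ℝ) ^ 2),
        abs_of_nonneg (by positivity : (0 : ℝ) ≤ ((A / d : ℕ) : ℝ) * (((A / d : ℕ) : ℝ) + 1) / 2),
        div_le_iff₀ (by positivity)]
      calc _ ≤ 1 * (((A / d : ℕ) : ℝ) * (((A / d : ℕ) : ℝ) + 1) / 2) := by gcongr
        _ ≤ (A / d) ^ 2 := by nlinarith
        _ = _ := by ring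
  rw [tsum_div_const, tsum_moebius_div_sq] at key
  rw [show 3 / Real.pi ^ 2 = 6 / Real.pi ^ 2 / 2 by ring]
  refine key.congr fun A => ?_
  rw [tsum_eq_sum (s := Finset.Ioc 0 A), sum_Ioc_totient, Finset.sum_div]
  intro d hd
  rcases eq_or_ne d 0 with rfl | hd0
  · simp
  · have : A / d = 0 := Nat.div_eq_of_lt (by
      by_contra h
      exact hd (Finset.mem_Ioc.mpr ⟨Nat.pos_of_ne_zero hd0, not_lt.mp h⟩))
    simp [this]

end Birch

end

section

namespace Birch

theorem coe_mem_closedBall_of_abs_le {x c r : ℝ} (h : |x - c| ≤ r) :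
    (x : UnitAddCircle) ∈ Metric.closedBall (c : UnitAddCircle) r := by
  rw [Metric.mem_closedBall, dist_eq_norm, ← AddCircle.coe_sub]
  refine le_trans ?_ h
  exact QuotientAddGroup.norm_mk_le_norm

theorem abs_sub_le_of_ceil_eq {K : ℕ} (hK : 0 < K) {x : ℝ} {j : ℤ} (h : ⌈(K : ℝ) * x⌉ = j) :
    |x - (2 * j - 1) / (2 * K)| ≤ 1 / (2 * K) := by
  rw [Int.ceil_eq_iff] at h
  have hK' : (0 : ℝ) < K := by exact_mod_cast hK
  have : x - (2 * j - 1) / (2 * K) = (2 * (K * x) - (2 * j - 1)) / (2 * K) := by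
    field_simp
  rw [this, abs_div, abs_of_pos (by positivity : (0 : ℝ) < 2 * K)]
  gcongr
  rw [abs_le]; constructor <;> linarith [h.1, h.2]

theorem eq_of_ceil_eq {K a : ℕ} (hK : 0 < K) [NeZero a] {x x' : ℤ}
    (h : ⌈(K : ℝ) * (x / a)⌉ = ⌈(K : ℝ) * (x' / a)⌉) (hx : (x : ZMod a) = x') : x = x' := by
  have ha : (0 : ℝ) < a := by exact_mod_cast Nat.pos_of_ne_zero (NeZero.ne a)
  have hK1 : (1 : ℝ) ≤ K := by exact_mod_cast hK
  have h1 := Int.ceil_eq_iff.mp h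
  have h2 := Int.ceil_eq_iff.mp (rfl : ⌈(K : ℝ) * (x' / a)⌉ = _)
  have h3 : |(K : ℝ) * (x / a) - K * (x' / a)| < 1 := by
    rw [abs_lt]; constructor <;> linarith [h1.1, h1.2, h2.1, h2.2]
  have h4 : |(x : ℝ) - x'| < a := by
    have : (K : ℝ) * (x / a) - K * (x' / a) = K * ((x - x') / a) := by ring
    rw [this, abs_mul, abs_div, abs_of_pos ha, abs_of_pos (by linarith)] at h3
    have h5 : |(x : ℝ) - x'| / a ≤ K * (|(x : ℝ) - x'| / a) := le_mul_of_one_le_left (by positivity) hK1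
    have h6 := h5.trans_lt h3
    rwa [div_lt_one ha] at h6
  have h5 : |x - x'| < a := by exact_mod_cast h4
  have h6 : (a : ℤ) ∣ x - x' := by
    rw [← ZMod.intCast_zmod_eq_zero_iff_dvd]; push_cast; rw [hx, sub_self]
  have := Int.eq_zero_of_abs_lt_dvd h6 h5
  linarith

open Classical in
theorem card_cell_fiber_le {K a p : ℕ} (hK : 0 < K) [NeZero a] (hap : p.Coprime a) (j k : ℤ)
    (S : Finset (ℤ × ℤ)) (hS : ∀ z ∈ S, (a : ℤ) ∣ p - z.1 * z.2 ∧
      ⌈(K : ℝ) * (z.1 / a)⌉ = j ∧ ⌈(K : ℝ) * (z.2 / a)⌉ = k) :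
    S.card ≤ (Finset.univ.filter fun w : (ZMod a)ˣ =>
        ZMod.toAddCircle (w : ZMod a) ∈
          Metric.closedBall (((2 * j - 1) / (2 * K) : ℝ) : UnitAddCircle) (1 / (2 * K)) ∧
        ZMod.toAddCircle ((ZMod.unitOfCoprime p hap : ZMod a) * ((w⁻¹ : (ZMod a)ˣ) : ZMod a)) ∈
          Metric.closedBall (((2 * k - 1) / (2 * K) : ℝ) : UnitAddCircle) (1 / (2 * K))).card := by
  have hxy : ∀ z ∈ S, (z.1 : ZMod a) * z.2 = (ZMod.unitOfCoprime p hap : ZMod a) := by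
    intro z hz
    have h1 := (ZMod.intCast_zmod_eq_zero_iff_dvd _ a).mpr (hS z hz).1
    push_cast at h1
    rw [ZMod.coe_unitOfCoprime]
    linear_combination -h1
  have hu : ∀ z ∈ S, IsUnit (z.1 : ZMod a) := fun z hz =>
    isUnit_of_mul_isUnit_left (hxy z hz ▸ (ZMod.unitOfCoprime p hap).isUnit)
  have hy : ∀ z (hz : z ∈ S), (ZMod.unitOfCoprime p hap : ZMod a) *
      (((hu z hz).unit⁻¹ : (ZMod a)ˣ) : ZMod a) = z.2 := by
    intro z hz
    rw [← hxy z hz, mul_comm (z.1 : ZMod a), mul_assoc]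
    have : (z.1 : ZMod a) * (((hu z hz).unit⁻¹ : (ZMod a)ˣ) : ZMod a) = 1 := (hu z hz).mul_val_inv
    rw [this, mul_one]
  refine Finset.card_le_card_of_injOn
    (fun z => if h : IsUnit (z.1 : ZMod a) then h.unit else 1) (fun z hz => ?_) ?_
  · simp only [dif_pos (hu z hz)]
    rw [Finset.mem_coe, Finset.mem_filter]
    refine ⟨Finset.mem_univ _, ?_, ?_⟩
    · rw [IsUnit.unit_spec, ZMod.toAddCircle_intCast]
      exact coe_mem_closedBall_of_abs_le (abs_sub_le_of_ceil_eq hK (hS z hz).2.1)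
    · rw [hy z hz, ZMod.toAddCircle_intCast]
      exact coe_mem_closedBall_of_abs_le (abs_sub_le_of_ceil_eq hK (hS z hz).2.2)
  · intro z hz z' hz' h
    have hz1 : z ∈ S := hz
    have hz2 : z' ∈ S := hz'
    simp only [dif_pos (hu z hz1), dif_pos (hu z' hz2)] at h
    have h1 : (z.1 : ZMod a) = z'.1 := by
      have := congrArg (Units.val) h
      simpa only [IsUnit.unit_spec] using this
    have h2 : (z.2 : ZMod a) = z'.2 := by
      rw [← hy z hz1, ← hy z' hz2, h]
    exact Prod.ext (eq_of_ceil_eq hK ((hS z hz1).2.1.trans (hS z' hz2).2.1.symm) h1)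
      (eq_of_ceil_eq hK ((hS z hz1).2.2.trans (hS z' hz2).2.2.symm) h2)

theorem tendsto_sum_totient_floor {c : ℝ} (hc : 0 ≤ c) : Filter.Tendsto
    (fun P : ℝ => (∑ a ∈ Finset.Ioc 0 ⌊c * P⌋₊, (a.totient : ℝ)) / P ^ 2) Filter.atTop
    (nhds (3 / Real.pi ^ 2 * c ^ 2)) := by
  rcases hc.eq_or_lt with rfl | hc0
  · simp
  have h1 : Filter.Tendsto (fun P : ℝ => ⌊c * P⌋₊) Filter.atTop Filter.atTop :=
    tendsto_nat_floor_atTop.comp (Filter.tendsto_id.const_mul_atTop hc0)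
  have h2 := (tendsto_sum_totient.comp h1).mul ((tendsto_nat_floor_mul_div_atTop hc).pow 2)
  refine h2.congr' ?_
  filter_upwards [h1.eventually_gt_atTop 0, Filter.eventually_gt_atTop 0] with P hP hP0
  simp only [Function.comp]
  have : (⌊c * P⌋₊ : ℝ) ≠ 0 := by exact_mod_cast hP.ne'
  field_simp

theorem tendsto_sqrt_natCast : Filter.Tendsto (fun p : ℕ => √(p : ℝ)) Filter.atTop Filter.atTop :=
  Real.tendsto_sqrt_atTop.comp tendsto_natCast_atTop_atTop

theorem exists_cell_count {K : ℕ} (hK : 0 < K) {i : ℤ} (hi : 2 ≤ i) (j k : ℤ) {ε : ℝ} (hε : 0 < ε) :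
    ∃ p₀ : ℕ, ∀ p, p₀ ≤ p → p.Prime → ∀ S : Finset (ℤ × ℤ × ℤ),
      (∀ g ∈ S, 0 < g.1 ∧ g.1 < p ∧ g.1 ∣ p - g.2.1 * g.2.2 ∧ ⌈(K : ℝ) * (g.1 / √(p : ℝ))⌉ = i ∧
        ⌈(K : ℝ) * (g.2.1 / g.1)⌉ = j ∧ ⌈(K : ℝ) * (g.2.2 / g.1)⌉ = k) →
      (S.card : ℝ) ≤ p * (3 / Real.pi ^ 2 * (((i : ℝ) / K) ^ 2 - (((i : ℝ) - 1) / K) ^ 2) / K ^ 2 + ε) := by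
  have hK' : (0 : ℝ) < K := by exact_mod_cast hK
  have hi' : (2 : ℝ) ≤ i := by exact_mod_cast hi
  set c₁ : ℝ := ((i : ℝ) - 1) / K with hc₁
  set c₂ : ℝ := (i : ℝ) / K with hc₂
  have hc₁0 : 0 < c₁ := div_pos (by linarith) hK'
  have hc₂0 : 0 < c₂ := div_pos (by linarith) hK'
  have hc : c₁ ≤ c₂ := by rw [hc₁, hc₂]; gcongr; linarith
  set L : ℝ := 3 / Real.pi ^ 2 * c₂ ^ 2 - 3 / Real.pi ^ 2 * c₁ ^ 2 with hL
  obtain ⟨η, hη0, hη⟩ : ∃ η : ℝ, 0 < η ∧ ((2 * (1 / (2 * K)) + η) ^ 2 + η) * (L + η) < L / K ^ 2 + ε := by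
    have h1 : Continuous fun η : ℝ => ((2 * (1 / (2 * (K : ℝ))) + η) ^ 2 + η) * (L + η) := by fun_prop
    have h2 : ((2 * (1 / (2 * (K : ℝ))) + 0) ^ 2 + 0) * (L + 0) < L / K ^ 2 + ε := by
      have : ((2 * (1 / (2 * (K : ℝ))) + 0) ^ 2 + 0) * (L + 0) = L / K ^ 2 := by field_simp; ring
      linarith
    have h3 := (h1.tendsto 0).eventually_lt_const h2
    obtain ⟨η, h4, h5⟩ := ((h3.filter_mono nhdsWithin_le_nhds).and
      (self_mem_nhdsWithin : Set.Ioi (0 : ℝ) ∈ nhdsWithin 0 (Set.Ioi 0))).exists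
    exact ⟨η, h5, h4⟩
  obtain ⟨N₀, hN₀⟩ := exists_box_count (r := 1 / (2 * (K : ℝ))) (by positivity)
    (((2 * j - 1) / (2 * K) : ℝ) : UnitAddCircle) (((2 * k - 1) / (2 * K) : ℝ) : UnitAddCircle) hη0
  have hT := (((tendsto_sum_totient_floor hc₂0.le).sub (tendsto_sum_totient_floor hc₁0.le)).comp
    tendsto_sqrt_natCast).eventually_lt_const (show L < L + η by linarith)
  have hN : ∀ᶠ p : ℕ in Filter.atTop, (N₀ : ℝ) ≤ c₁ * √(p : ℝ) :=
    (tendsto_sqrt_natCast.const_mul_atTop hc₁0).eventually_ge_atTop _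
  obtain ⟨p₀, hp₀⟩ := Filter.eventually_atTop.mp (hT.and hN)
  refine ⟨p₀, fun p hp hpp S hS => ?_⟩
  obtain ⟨h1, h2⟩ := hp₀ p hp
  have hp0 : (0 : ℝ) < p := by exact_mod_cast hpp.pos
  have hP : 0 < √(p : ℝ) := Real.sqrt_pos.mpr hp0
  have hPP : √(p : ℝ) ^ 2 = p := Real.sq_sqrt hp0.le
  set P := √(p : ℝ) with hPdef
  simp only [Function.comp, ← hPdef] at h1
  rw [← sub_div, hPP, div_lt_iff₀ hp0] at h1
  set A₁ := ⌊c₁ * P⌋₊ with hA₁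
  set A₂ := ⌊c₂ * P⌋₊ with hA₂
  have hA : A₁ ≤ A₂ := Nat.floor_le_floor (by gcongr)
  have hT' : ∑ a ∈ Finset.Ioc A₁ A₂, (a.totient : ℝ) ≤ (L + η) * p := by
    rw [← Finset.sum_Ioc_consecutive _ (Nat.zero_le _) hA] at h1
    linarith
  have hmap : ∀ g ∈ S, g.1.toNat ∈ Finset.Ioc A₁ A₂ := by
    intro g hg
    obtain ⟨h3, -, -, h4, -⟩ := hS g hg
    rw [Int.ceil_eq_iff] at h4
    have h5 : ((g.1.toNat : ℕ) : ℝ) = g.1 := by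
      rw [← Int.cast_natCast, Int.toNat_of_nonneg h3.le]
    rw [Finset.mem_Ioc, hA₁, hA₂, Nat.floor_lt (by positivity), Nat.le_floor_iff (by positivity), h5,
      hc₁, hc₂]
    constructor
    · have := h4.1
      rw [mul_div_assoc', lt_div_iff₀ hP] at this
      rw [div_mul_eq_mul_div, div_lt_iff₀ hK']; linarith
    · have := h4.2
      rw [mul_div_assoc', div_le_iff₀ hP] at this
      rw [div_mul_eq_mul_div, le_div_iff₀ hK']; linarith
  have hC0 : 0 ≤ (2 * (1 / (2 * (K : ℝ))) + η) ^ 2 + η := by positivity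
  have hfib : ∀ a ∈ Finset.Ioc A₁ A₂, (((S.filter fun g => g.1.toNat = a).card : ℕ) : ℝ) ≤
      ((2 * (1 / (2 * (K : ℝ))) + η) ^ 2 + η) * (a.totient : ℝ) := by
    intro a ha
    rw [Finset.mem_Ioc] at ha
    rcases (S.filter fun g => g.1.toNat = a).eq_empty_or_nonempty with h0 | ⟨g₀, hg₀⟩
    · rw [h0]; simp only [Finset.card_empty, Nat.cast_zero]; positivity
    have hg₁ := Finset.mem_filter.mp hg₀
    have ha0 : NeZero a := ⟨by omega⟩
    have hap' : a < p := by
      have := (hS g₀ hg₁.1).2.1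
      have := hg₁.2
      have := (hS g₀ hg₁.1).1
      omega
    have hap : p.Coprime a := (Nat.coprime_of_lt_prime ha0.ne hap' hpp)
    have ha1 : N₀ ≤ a := by
      have h3 : c₁ * P < a := (Nat.floor_lt (by positivity)).mp ha.1
      exact_mod_cast (h2.trans h3.le)
    have h3 := hN₀ a ha1 (ZMod.unitOfCoprime p hap)
    refine le_trans ?_ h3
    norm_cast
    have hfst : ∀ g ∈ S.filter (fun g => g.1.toNat = a), g.1 = a := by
      intro g hg
      have hg' := Finset.mem_filter.mp hg
      have := (hS g hg'.1).1
      omega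
    have h4 : ((S.filter fun g => g.1.toNat = a).image Prod.snd).card =
        (S.filter fun g => g.1.toNat = a).card := by
      refine Finset.card_image_of_injOn fun g hg g' hg' h => ?_
      exact Prod.ext ((hfst g hg).trans (hfst g' hg').symm) h
    rw [← h4]
    have h5 := card_cell_fiber_le hK hap j k ((S.filter fun g => g.1.toNat = a).image Prod.snd) ?_
    · convert h5 using 2
    · intro z hz
      obtain ⟨g, hg, rfl⟩ := Finset.mem_image.mp hz
      have h6 := hfst g hg
      obtain ⟨-, -, h7, -, h8, h9⟩ := hS g (Finset.mem_filter.mp hg).1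
      rw [h6] at h7 h8 h9
      exact ⟨h7, by exact_mod_cast h8, by exact_mod_cast h9⟩
  rw [Finset.card_eq_sum_card_fiberwise hmap, Nat.cast_sum]
  calc _ ≤ ∑ a ∈ Finset.Ioc A₁ A₂, ((2 * (1 / (2 * (K : ℝ))) + η) ^ 2 + η) * (a.totient : ℝ) :=
        Finset.sum_le_sum hfib
    _ = ((2 * (1 / (2 * (K : ℝ))) + η) ^ 2 + η) * ∑ a ∈ Finset.Ioc A₁ A₂, (a.totient : ℝ) := by
        rw [Finset.mul_sum]
    _ ≤ ((2 * (1 / (2 * (K : ℝ))) + η) ^ 2 + η) * ((L + η) * p) := by gcongr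
    _ ≤ (L / K ^ 2 + ε) * p := by rw [← mul_assoc]; gcongr
    _ = _ := by rw [hL]; ring

end Birch

end

section

namespace Birch

open MeasureTheory

noncomputable def gridCell (K : ℕ) (v : ℝ × ℝ × ℝ) : ℤ × ℤ × ℤ :=
  (⌈(K : ℝ) * v.1⌉, ⌈(K : ℝ) * v.2.1⌉, ⌈(K : ℝ) * v.2.2⌉)

theorem measurable_gridCell (K : ℕ) : Measurable (gridCell K) := by
  unfold gridCell
  fun_prop

noncomputable def cellSup (H : ℝ × ℝ × ℝ → ℝ) (K : ℕ) (c : ℤ × ℤ × ℤ) : ℝ :=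
  sSup (H '' {w | gridCell K w = c})

noncomputable def cellSlice (K : ℕ) (n : ℤ) : Set ℝ := Set.Ioc (((n : ℝ) - 1) / K) ((n : ℝ) / K)

theorem mem_cellSlice {K : ℕ} (hK : 0 < K) {n : ℤ} {x : ℝ} : x ∈ cellSlice K n ↔ ⌈(K : ℝ) * x⌉ = n := by
  have hK' : (0 : ℝ) < K := by exact_mod_cast hK
  rw [cellSlice, Set.mem_Ioc, Int.ceil_eq_iff, div_lt_iff₀ hK', le_div_iff₀ hK', mul_comm x]

noncomputable def cellWeight (K : ℕ) (c : ℤ × ℤ × ℤ) (v : ℝ × ℝ × ℝ) : ℝ :=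
  (cellSlice K c.1).indicator (fun x => x) v.1 *
    ((cellSlice K c.2.1).indicator (fun _ => 1) v.2.1 * (cellSlice K c.2.2).indicator (fun _ => 1) v.2.2)

theorem cellWeight_eq {K : ℕ} (hK : 0 < K) (c : ℤ × ℤ × ℤ) (v : ℝ × ℝ × ℝ) :
    cellWeight K c v = if gridCell K v = c then v.1 else 0 := by
  classical
  rw [cellWeight]
  simp only [Set.indicator_apply, mem_cellSlice hK, gridCell, Prod.ext_iff]
  split_ifs <;> simp_all

theorem integrable_indicator_cellSlice (K : ℕ) (n : ℤ) :
    Integrable ((cellSlice K n).indicator (fun _ => (1 : ℝ))) := by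
  rw [cellSlice, integrable_indicator_iff measurableSet_Ioc]
  exact integrableOn_const (by simp)

theorem integrable_indicator_id_cellSlice (K : ℕ) (n : ℤ) :
    Integrable ((cellSlice K n).indicator (fun x : ℝ => x)) := by
  rw [cellSlice, integrable_indicator_iff measurableSet_Ioc]
  exact (continuous_id.integrableOn_Icc).mono_set Set.Ioc_subset_Icc_self

theorem integral_indicator_cellSlice (K : ℕ) (n : ℤ) :
    ∫ x, (cellSlice K n).indicator (fun _ => (1 : ℝ)) x = 1 / K := by
  rw [cellSlice, integral_indicator measurableSet_Ioc, ← intervalIntegral.integral_of_le (by gcongr; linarith)]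
  simp; ring

theorem integral_indicator_id_cellSlice (K : ℕ) (n : ℤ) :
    ∫ x, (cellSlice K n).indicator (fun x : ℝ => x) x =
      (((n : ℝ) / K) ^ 2 - (((n : ℝ) - 1) / K) ^ 2) / 2 := by
  rw [cellSlice, integral_indicator measurableSet_Ioc, ← intervalIntegral.integral_of_le (by gcongr; linarith),
    integral_id]

theorem integrable_cellWeight (K : ℕ) (c : ℤ × ℤ × ℤ) : Integrable (cellWeight K c) :=
  (integrable_indicator_id_cellSlice K c.1).mul_prod
    ((integrable_indicator_cellSlice K c.2.1).mul_prod (integrable_indicator_cellSlice K c.2.2))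

theorem integral_cellWeight (K : ℕ) (c : ℤ × ℤ × ℤ) : ∫ v, cellWeight K c v =
    (((c.1 : ℝ) / K) ^ 2 - (((c.1 : ℝ) - 1) / K) ^ 2) / 2 / K ^ 2 := by
  have h1 := integral_prod_mul (μ := (volume : Measure ℝ)) (ν := (volume : Measure (ℝ × ℝ)))
    ((cellSlice K c.1).indicator (fun x : ℝ => x))
    (fun z : ℝ × ℝ => (cellSlice K c.2.1).indicator (fun _ => (1 : ℝ)) z.1 *
      (cellSlice K c.2.2).indicator (fun _ => (1 : ℝ)) z.2)
  have h2 := integral_prod_mul (μ := (volume : Measure ℝ)) (ν := (volume : Measure ℝ))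
    ((cellSlice K c.2.1).indicator (fun _ => (1 : ℝ))) ((cellSlice K c.2.2).indicator (fun _ => (1 : ℝ)))
  refine h1.trans ?_
  refine (congrArg _ h2).trans ?_
  rw [integral_indicator_cellSlice, integral_indicator_cellSlice, integral_indicator_id_cellSlice]
  ring

theorem abs_sub_le_of_ceil {K : ℕ} (hK : 0 < K) {x y : ℝ} (h : ⌈(K : ℝ) * x⌉ = ⌈(K : ℝ) * y⌉) :
    |x - y| ≤ 1 / K := by
  have hK' : (0 : ℝ) < K := by exact_mod_cast hK
  have h1 := Int.ceil_eq_iff.mp h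
  have h2 := Int.ceil_eq_iff.mp (rfl : ⌈(K : ℝ) * y⌉ = _)
  have h3 : |(K : ℝ) * (x - y)| ≤ 1 := by
    rw [abs_le]; constructor <;> linarith [h1.1, h1.2, h2.1, h2.2]
  rw [abs_mul, abs_of_pos hK'] at h3
  rwa [le_div_iff₀ hK', mul_comm]

theorem dist_le_of_gridCell_eq {K : ℕ} (hK : 0 < K) {v w : ℝ × ℝ × ℝ} (h : gridCell K w = gridCell K v) :
    dist w v ≤ 1 / K := by
  simp only [gridCell, Prod.ext_iff] at h
  rw [Prod.dist_eq, Prod.dist_eq, max_le_iff, max_le_iff]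
  exact ⟨abs_sub_le_of_ceil hK h.1, abs_sub_le_of_ceil hK h.2.1, abs_sub_le_of_ceil hK h.2.2⟩

section

variable {Ω : Set (ℝ × ℝ × ℝ)} {g : ℝ × ℝ × ℝ → ℝ} {M : ℝ}

theorem bddAbove_cell {H : ℝ × ℝ × ℝ → ℝ} (hM : ∀ v, H v ≤ M) (K : ℕ) (c : ℤ × ℤ × ℤ) :
    BddAbove (H '' {w | gridCell K w = c}) :=
  ⟨M, by rintro _ ⟨w, -, rfl⟩; exact hM w⟩

theorem le_cellSup {H : ℝ × ℝ × ℝ → ℝ} (hM : ∀ v, H v ≤ M) (K : ℕ) (v : ℝ × ℝ × ℝ) :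
    H v ≤ cellSup H K (gridCell K v) :=
  le_csSup (bddAbove_cell hM K _) ⟨v, rfl, rfl⟩

theorem cellSup_nonneg {H : ℝ × ℝ × ℝ → ℝ} (h0 : ∀ v, 0 ≤ H v) (K : ℕ) (c : ℤ × ℤ × ℤ) :
    0 ≤ cellSup H K c :=
  Real.sSup_nonneg (by rintro _ ⟨w, -, rfl⟩; exact h0 w)

theorem exists_of_cellSup_ne_zero {H : ℝ × ℝ × ℝ → ℝ} (h0 : ∀ v, 0 ≤ H v) {K : ℕ} {c : ℤ × ℤ × ℤ}
    (h : cellSup H K c ≠ 0) : ∃ w, H w ≠ 0 ∧ gridCell K w = c := by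
  by_contra! hcon
  refine h (le_antisymm (Real.sSup_nonpos ?_) (cellSup_nonneg h0 K c))
  rintro _ ⟨w, hw, rfl⟩
  by_contra hne
  exact hcon w (fun h => hne h.le) hw

theorem tendsto_cellSup (hΩ : IsClosed Ω) (hg : Continuous g) (hg0 : ∀ v, 0 ≤ g v)
    (hM : ∀ v, Ω.indicator g v ≤ M) (v : ℝ × ℝ × ℝ) :
    Filter.Tendsto (fun K : ℕ => cellSup (Ω.indicator g) K (gridCell K v)) Filter.atTop
      (nhds (Ω.indicator g v)) := by
  have h0 : ∀ v, 0 ≤ Ω.indicator g v := fun v => Set.indicator_nonneg (fun v _ => hg0 v) v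
  rw [tendsto_order]
  refine ⟨fun y hy => .of_forall fun K => hy.trans_le (le_cellSup hM K v), fun y hy => ?_⟩
  obtain ⟨z, hz1, hz2⟩ := exists_between hy
  have h1 : ∀ᶠ w in nhds v, Ω.indicator g w < z := by
    by_cases hv : v ∈ Ω
    · rw [Set.indicator_of_mem hv] at hz1
      filter_upwards [(hg.tendsto v).eventually_lt_const hz1] with w hw
      exact (Set.indicator_le_self' (fun w _ => hg0 w) w).trans_lt hw
    · filter_upwards [hΩ.isOpen_compl.mem_nhds hv] with w hw
      rw [Set.indicator_of_notMem hw]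
      exact (h0 v).trans_lt hz1
  obtain ⟨ρ, hρ, h2⟩ := Metric.eventually_nhds_iff.mp h1
  filter_upwards [(tendsto_const_div_atTop_nhds_zero_nat (1 : ℝ)).eventually_lt_const hρ,
    Filter.eventually_gt_atTop 0] with K hK hK0
  refine lt_of_le_of_lt (csSup_le ⟨_, v, rfl, rfl⟩ ?_) hz2
  rintro _ ⟨w, hw, rfl⟩
  exact (h2 ((dist_le_of_gridCell_eq hK0 hw).trans_lt hK)).le

theorem tendsto_integral_cellSup (hΩ : IsCompact Ω) (hg : Continuous g) (hg0 : ∀ v, 0 ≤ g v)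
    (hM : ∀ v, Ω.indicator g v ≤ M) :
    Filter.Tendsto (fun K : ℕ => ∫ v, v.1 * cellSup (Ω.indicator g) K (gridCell K v)) Filter.atTop
      (nhds (∫ v, v.1 * Ω.indicator g v)) := by
  have h0 : ∀ v, 0 ≤ Ω.indicator g v := fun v => Set.indicator_nonneg (fun v _ => hg0 v) v
  have hM0 : 0 ≤ M := (h0 0).trans (hM 0)
  obtain ⟨B, hB⟩ := hΩ.isBounded.subset_closedBall 0
  refine tendsto_integral_filter_of_dominated_convergence
    ((Metric.closedBall (0 : ℝ × ℝ × ℝ) (B + 1)).indicator fun _ => (B + 1) * M) ?_ ?_ ?_ ?_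
  · refine .of_forall fun K => (measurable_fst.mul ?_).aestronglyMeasurable
    exact (Measurable.of_discrete (f := cellSup (Ω.indicator g) K)).comp (measurable_gridCell K)
  · filter_upwards [Filter.eventually_gt_atTop 0] with K hK
    refine .of_forall fun v => ?_
    by_cases h : cellSup (Ω.indicator g) K (gridCell K v) = 0
    · rw [h, mul_zero, norm_zero]
      refine Set.indicator_nonneg (fun v hv => ?_) v
      have : 0 ≤ B + 1 := Metric.nonempty_closedBall.mp ⟨v, hv⟩
      positivity
    · obtain ⟨w, hw, hwv⟩ := exists_of_cellSup_ne_zero h0 h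
      have hwΩ : w ∈ Ω := Set.mem_of_indicator_ne_zero hw
      have h1 := hB hwΩ
      have h2 := dist_le_of_gridCell_eq hK hwv
      have hK1 : (1 : ℝ) / K ≤ 1 := by
        rw [div_le_one (by positivity)]; exact_mod_cast hK
      have h3 : dist v 0 ≤ B + 1 := by
        have := dist_triangle_left v 0 w
        rw [Metric.mem_closedBall] at h1
        linarith
      rw [Set.indicator_of_mem (Metric.mem_closedBall.mpr h3), norm_mul,
        Real.norm_of_nonneg (cellSup_nonneg h0 K _)]
      rw [dist_zero_right] at h3
      refine mul_le_mul ((norm_fst_le v).trans h3) ?_ (cellSup_nonneg h0 K _)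
        ((norm_nonneg _).trans h3)
      refine csSup_le ⟨_, v, rfl, rfl⟩ ?_
      rintro _ ⟨w, -, rfl⟩
      exact hM w
  · rw [integrable_indicator_iff Metric.isClosed_closedBall.measurableSet]
    exact integrableOn_const (isCompact_closedBall _ _).measure_ne_top
  · exact .of_forall fun v => (tendsto_cellSup hΩ.isClosed hg hg0 hM v).const_mul v.1

theorem exists_sum_indicator_le (hΩ : IsCompact Ω) (hg : Continuous g) (hg0 : ∀ v, 0 ≤ g v)
    {δ : ℝ} (hδ : 0 < δ) (hΩδ : ∀ v ∈ Ω, δ ≤ v.1) {ε : ℝ} (hε : 0 < ε) :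
    ∃ p₀ : ℕ, ∀ p, p₀ ≤ p → p.Prime → ∀ S : Finset (ℤ × ℤ × ℤ),
      (∀ γ ∈ S, 0 < γ.1 ∧ γ.1 < p ∧ γ.1 ∣ p - γ.2.1 * γ.2.2) →
      ∑ γ ∈ S, Ω.indicator g ((γ.1 : ℝ) / √(p : ℝ), (γ.2.1 : ℝ) / γ.1, (γ.2.2 : ℝ) / γ.1) ≤
        p * (6 / Real.pi ^ 2 * (∫ v, v.1 * Ω.indicator g v) + ε) := by
  classical
  obtain ⟨B, hB⟩ := hΩ.isBounded.subset_closedBall 0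
  obtain ⟨M, hM'⟩ := (hΩ.bddAbove_image hg.continuousOn)
  have h0 : ∀ v, 0 ≤ Ω.indicator g v := fun v => Set.indicator_nonneg (fun v _ => hg0 v) v
  have hM : ∀ v, Ω.indicator g v ≤ max M 0 := by
    intro v
    by_cases hv : v ∈ Ω
    · rw [Set.indicator_of_mem hv]
      exact (hM' ⟨v, hv, rfl⟩).trans (le_max_left _ _)
    · rw [Set.indicator_of_notMem hv]; exact le_max_right _ _
  set H := Ω.indicator g with hH
  have hlim := ((tendsto_integral_cellSup hΩ hg hg0 hM).const_mul
    (6 / Real.pi ^ 2)).eventually_lt_const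
    (show 6 / Real.pi ^ 2 * (∫ v, v.1 * H v) < 6 / Real.pi ^ 2 * (∫ v, v.1 * H v) + ε / 2 by linarith)
  obtain ⟨K, hKlim, hKδ, hK⟩ := (hlim.and (((tendsto_natCast_atTop_atTop (R := ℝ)).atTop_mul_const
    hδ).eventually_gt_atTop 1 |>.and (Filter.eventually_gt_atTop 0))).exists
  set R : ℤ := ⌈(K : ℝ) * B⌉ with hR
  set C : Finset (ℤ × ℤ × ℤ) := Finset.Icc (-R) R ×ˢ Finset.Icc (-R) R ×ˢ Finset.Icc (-R) R with hC
  have hK' : (0 : ℝ) < K := by exact_mod_cast hK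
  have hbd : ∀ x : ℝ, |x| ≤ B → ⌈(K : ℝ) * x⌉ ∈ Finset.Icc (-R) R := by
    intro x hx
    rw [abs_le] at hx
    rw [Finset.mem_Icc]
    constructor
    · have h1 : (K : ℝ) * (-B) ≤ K * x := by gcongr; exact hx.1
      have h2 : (K : ℝ) * B ≤ R := Int.le_ceil _
      refine Int.ceil_mono (b := (K : ℝ) * x) (a := ((-R : ℤ) : ℝ)) ?_ |>.trans' (by rw [Int.ceil_intCast])
      push_cast; linarith
    · exact Int.ceil_mono (by gcongr; exact hx.2)
  have hsupp : ∀ c, cellSup H K c ≠ 0 → c ∈ C ∧ 2 ≤ c.1 := by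
    intro c hc
    obtain ⟨w, hw, rfl⟩ := exists_of_cellSup_ne_zero h0 hc
    have hwΩ : w ∈ Ω := Set.mem_of_indicator_ne_zero hw
    have h1 := hB hwΩ
    rw [mem_closedBall_zero_iff, Prod.norm_def, Prod.norm_def, max_le_iff, max_le_iff] at h1
    refine ⟨?_, ?_⟩
    · rw [hC, Finset.mem_product, Finset.mem_product]
      exact ⟨hbd _ h1.1, hbd _ h1.2.1, hbd _ h1.2.2⟩
    · have h2 : (1 : ℝ) < K * w.1 := hKδ.trans_le (by gcongr; exact hΩδ w hwΩ)
      have h3 : (1 : ℤ) < ⌈(K : ℝ) * w.1⌉ := Int.lt_ceil.mpr (by exact_mod_cast h2)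
      exact h3
  set s : ℝ := ∑ c ∈ C, cellSup H K c with hs
  have hs0 : 0 ≤ s := Finset.sum_nonneg fun c _ => cellSup_nonneg h0 K c
  have hcount : ∀ c : ℤ × ℤ × ℤ, ∃ p₀ : ℕ, 2 ≤ c.1 → ∀ p, p₀ ≤ p → p.Prime →
      ∀ S : Finset (ℤ × ℤ × ℤ),
      (∀ γ ∈ S, 0 < γ.1 ∧ γ.1 < p ∧ γ.1 ∣ p - γ.2.1 * γ.2.2 ∧
        ⌈(K : ℝ) * (γ.1 / √(p : ℝ))⌉ = c.1 ∧
        ⌈(K : ℝ) * (γ.2.1 / γ.1)⌉ = c.2.1 ∧ ⌈(K : ℝ) * (γ.2.2 / γ.1)⌉ = c.2.2) →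
      (S.card : ℝ) ≤ p * (3 / Real.pi ^ 2 *
        (((c.1 : ℝ) / K) ^ 2 - (((c.1 : ℝ) - 1) / K) ^ 2) / K ^ 2 + ε / 2 / (s + 1)) := by
    intro c
    by_cases hc : 2 ≤ c.1
    · obtain ⟨p₀, hp₀⟩ := exists_cell_count hK hc c.2.1 c.2.2 (ε := ε / 2 / (s + 1)) (by positivity)
      exact ⟨p₀, fun _ => hp₀⟩
    · exact ⟨0, fun h => absurd h hc⟩
  choose q hq using hcount
  refine ⟨C.sup q, fun p hp hpp S hS => ?_⟩
  set pt : ℤ × ℤ × ℤ → ℝ × ℝ × ℝ := fun γ =>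
    ((γ.1 : ℝ) / √(p : ℝ), (γ.2.1 : ℝ) / γ.1, (γ.2.2 : ℝ) / γ.1) with hpt
  have hcell : ∀ c ∈ C, cellSup H K c * ((S.filter fun γ => gridCell K (pt γ) = c).card : ℝ) ≤
      p * (6 / Real.pi ^ 2 * (cellSup H K c * ∫ v, cellWeight K c v) +
        cellSup H K c * (ε / 2 / (s + 1))) := by
    intro c hc
    by_cases h : cellSup H K c = 0
    · simp [h]
    · have h1 := hq c (hsupp c h).2 p ((Finset.le_sup hc).trans hp) hpp
        (S.filter fun γ => gridCell K (pt γ) = c) (fun γ hγ => by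
          obtain ⟨h2, h3⟩ := Finset.mem_filter.mp hγ
          obtain ⟨h4, h5, h6⟩ := hS γ h2
          refine ⟨h4, h5, h6, ?_, ?_, ?_⟩
          · rw [← h3]; rfl
          · rw [← h3]; rfl
          · rw [← h3]; rfl)
      rw [integral_cellWeight]
      refine (mul_le_mul_of_nonneg_left h1 (cellSup_nonneg h0 K c)).trans (le_of_eq ?_)
      ring
  have h_int : ∫ v, v.1 * cellSup H K (gridCell K v) = ∑ c ∈ C, cellSup H K c * ∫ v, cellWeight K c v := by
    simp only [← integral_const_mul]
    rw [← integral_finsetSum C fun c _ => (integrable_cellWeight K c).const_mul _]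
    refine integral_congr_ae (.of_forall fun v => ?_)
    simp only [cellWeight_eq hK, mul_ite, mul_zero]
    rw [Finset.sum_ite_eq]
    split_ifs with h
    · ring
    · have : cellSup H K (gridCell K v) = 0 := by
        by_contra hne
        exact h (hsupp _ hne).1
      rw [this, mul_zero]
  calc ∑ γ ∈ S, H (pt γ) ≤ ∑ γ ∈ S, cellSup H K (gridCell K (pt γ)) :=
        Finset.sum_le_sum fun γ _ => le_cellSup hM K _
    _ = ∑ γ ∈ S, ∑ c ∈ C, if gridCell K (pt γ) = c then cellSup H K c else 0 := by
        refine Finset.sum_congr rfl fun γ _ => ?_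
        rw [Finset.sum_ite_eq]
        split_ifs with h
        · rfl
        · by_contra hne
          exact h (hsupp _ hne).1
    _ = ∑ c ∈ C, cellSup H K c * ((S.filter fun γ => gridCell K (pt γ) = c).card : ℝ) := by
        rw [Finset.sum_comm]
        refine Finset.sum_congr rfl fun c _ => ?_
        rw [← Finset.sum_filter, Finset.sum_const, nsmul_eq_mul, mul_comm]
    _ ≤ ∑ c ∈ C, p * (6 / Real.pi ^ 2 * (cellSup H K c * ∫ v, cellWeight K c v) +
        cellSup H K c * (ε / 2 / (s + 1))) := Finset.sum_le_sum hcell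
    _ = p * (6 / Real.pi ^ 2 * (∫ v, v.1 * cellSup H K (gridCell K v)) + s * (ε / 2 / (s + 1))) := by
        rw [← Finset.mul_sum, Finset.sum_add_distrib, ← Finset.mul_sum, ← Finset.sum_mul, h_int]
    _ ≤ _ := by
        have h1 : s * (ε / 2 / (s + 1)) ≤ ε / 2 := by
          rw [mul_div_assoc', div_le_iff₀ (by positivity)]
          nlinarith
        rw [← hH] at hKlim
        exact mul_le_mul_of_nonneg_left (by linarith) (by positivity)

end

end Birch

end

section

namespace Birch

open MeasureTheory

theorem lintegral_comp_mul_add {c : ℝ} (hc : 0 < c) (b : ℝ) {h : ℝ → ENNReal} (hh : Measurable h) :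
    ∫⁻ x, h (c * x + b) = ENNReal.ofReal c⁻¹ * ∫⁻ x, h x := by
  have h1 : ∫⁻ x, h (c * x + b) = ∫⁻ x, h (x + b) ∂(Measure.map (c * ·) volume) := by
    exact (lintegral_map (hh.comp (measurable_add_const b)) (measurable_const_mul c)).symm
  rw [h1, Real.map_volume_mul_left hc.ne', lintegral_smul_measure, abs_of_pos (inv_pos.mpr hc),
    lintegral_add_right_eq_self h b]
  rfl

theorem integral_inv_sqrt_four_sub_sq : ∫ x in (-1 : ℝ)..1, (√(4 - x ^ 2))⁻¹ = Real.pi / 3 := by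
  have hpos : ∀ x ∈ Set.uIcc (-1 : ℝ) 1, 0 < 4 - x ^ 2 := by
    intro x hx
    rw [Set.uIcc_of_le (by norm_num), Set.mem_Icc] at hx
    nlinarith [hx.1, hx.2]
  have hd : ∀ x ∈ Set.uIcc (-1 : ℝ) 1, HasDerivAt (fun x => Real.arcsin (x / 2)) (√(4 - x ^ 2))⁻¹ x := by
    intro x hx
    have hx' := hx
    rw [Set.uIcc_of_le (by norm_num), Set.mem_Icc] at hx'
    have h1 := (Real.hasDerivAt_arcsin (x := x / 2) (by linarith [hx'.1]) (by linarith [hx'.2])).comp x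
      ((hasDerivAt_id x).div_const 2)
    refine h1.congr_deriv ?_
    have h2 : √(4 - x ^ 2) = 2 * √(1 - (x / 2) ^ 2) := by
      rw [show 4 - x ^ 2 = 2 ^ 2 * (1 - (x / 2) ^ 2) by ring, Real.sqrt_mul (by norm_num),
        Real.sqrt_sq (by norm_num)]
    rw [h2]
    field_simp
  rw [intervalIntegral.integral_eq_sub_of_hasDerivAt hd]
  · have h1 : Real.arcsin (1 / 2) = Real.pi / 6 := by
      rw [← Real.sin_pi_div_six]
      exact Real.arcsin_sin (by linarith [Real.pi_pos]) (by linarith [Real.pi_pos])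
    rw [neg_div, Real.arcsin_neg, h1]
    ring
  · refine ContinuousOn.intervalIntegrable (ContinuousOn.inv₀ (by fun_prop) fun x hx => ?_)
    exact (Real.sqrt_pos.mpr (hpos x hx)).ne'

def region (δ : ℝ) : Set (ℝ × ℝ × ℝ) :=
  {v | δ ≤ v.1 ∧ v.1 ≤ 2 ∧ |v.2.1 - v.2.2| ≤ 1 ∧ v.1 ^ 2 * (1 + v.2.1 * v.2.2) ≤ 1}

theorem isClosed_region (δ : ℝ) : IsClosed (region δ) := by
  have h1 : IsClosed {v : ℝ × ℝ × ℝ | δ ≤ v.1} := isClosed_le (by fun_prop) (by fun_prop)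
  have h2 : IsClosed {v : ℝ × ℝ × ℝ | v.1 ≤ 2} := isClosed_le (by fun_prop) (by fun_prop)
  have h3 : IsClosed {v : ℝ × ℝ × ℝ | |v.2.1 - v.2.2| ≤ 1} := isClosed_le (by fun_prop) (by fun_prop)
  have h4 : IsClosed {v : ℝ × ℝ × ℝ | v.1 ^ 2 * (1 + v.2.1 * v.2.2) ≤ 1} :=
    isClosed_le (by fun_prop) (by fun_prop)
  exact h1.inter (h2.inter (h3.inter h4))

theorem isCompact_region {δ : ℝ} (hδ : 0 < δ) : IsCompact (region δ) := by
  refine Metric.isCompact_of_isClosed_isBounded (isClosed_region δ) ?_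
  refine (Metric.isBounded_iff_subset_closedBall 0).mpr ⟨2 + 1 / δ, fun v hv => ?_⟩
  obtain ⟨h1, h2, h3, h4⟩ := hv
  have hδ' : 0 < 1 / δ := by positivity
  have hv0 : 0 < v.1 := hδ.trans_le h1
  have h5 : v.2.1 * v.2.2 ≤ (1 / δ) ^ 2 := by
    have h6 : 1 + v.2.1 * v.2.2 ≤ 1 / v.1 ^ 2 := by
      rw [le_div_iff₀ (by positivity)]; linarith
    have h7 : 1 / v.1 ^ 2 ≤ 1 / δ ^ 2 := by gcongr
    rw [one_div_pow]; linarith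
  have key : ∀ x y : ℝ, x * y ≤ (1 / δ) ^ 2 → |x - y| ≤ 1 → |x| ≤ 2 + 1 / δ := by
    intro x y hxy hd
    by_contra! hcon
    have h6 : |x| ^ 2 = x * y + x * (x - y) := by rw [sq_abs]; ring
    have h7 : x * (x - y) ≤ |x| * 1 := (le_abs_self _).trans (by rw [abs_mul]; gcongr)
    nlinarith
  rw [mem_closedBall_zero_iff, Prod.norm_def, Prod.norm_def, max_le_iff, max_le_iff]
  refine ⟨?_, key _ _ h5 h3, key _ v.2.1 (by linarith) (by rw [abs_sub_comm]; exact h3)⟩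
  rw [Real.norm_eq_abs, abs_of_pos hv0]; linarith

open Classical in
noncomputable def kernelRegion (f : ℝ → ℝ) (δ α S T : ℝ) : ENNReal :=
  if δ ≤ α ∧ α ≤ 2 ∧ |S| ≤ 1 ∧ α ^ 2 * (4 - S ^ 2) + T ^ 2 ≤ 4 then ENNReal.ofReal (f T) else 0

theorem measurable_kernelRegion {f : ℝ → ℝ} (hf : Continuous f) (δ : ℝ) :
    Measurable fun v : ℝ × ℝ × ℝ => kernelRegion f δ v.1 v.2.1 v.2.2 := by
  unfold kernelRegion
  refine Measurable.ite ?_ (by fun_prop) measurable_const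
  have h1 : MeasurableSet {v : ℝ × ℝ × ℝ | δ ≤ v.1} := measurableSet_le (by fun_prop) (by fun_prop)
  have h2 : MeasurableSet {v : ℝ × ℝ × ℝ | v.1 ≤ 2} := measurableSet_le (by fun_prop) (by fun_prop)
  have h3 : MeasurableSet {v : ℝ × ℝ × ℝ | |v.2.1| ≤ 1} :=
    measurableSet_le (by fun_prop) (by fun_prop)
  have h4 : MeasurableSet {v : ℝ × ℝ × ℝ | v.1 ^ 2 * (4 - v.2.1 ^ 2) + v.2.2 ^ 2 ≤ 4} :=
    measurableSet_le (by fun_prop) (by fun_prop)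
  exact h1.inter (h2.inter (h3.inter h4))

theorem lintegral_kernelRegion_le {f : ℝ → ℝ} {δ : ℝ} (hδ : 0 < δ) (S T : ℝ) :
    ∫⁻ α, kernelRegion f δ α S T ≤
      (Set.Ioc (-1) 1).indicator (fun S => ENNReal.ofReal (√(4 - S ^ 2))⁻¹) S *
        (Set.Ioc (-2) 2).indicator (fun T => ENNReal.ofReal (f T * √(4 - T ^ 2))) T ∨ S = -1 ∨ T = -2 := by
  by_cases hS1 : S = -1
  · exact Or.inr (Or.inl hS1)
  by_cases hT2 : T = -2
  · exact Or.inr (Or.inr hT2)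
  left
  by_cases hS : |S| ≤ 1
  · by_cases hT : |T| ≤ 2
    · rw [abs_le] at hS hT
      rw [Set.indicator_of_mem (show S ∈ Set.Ioc (-1 : ℝ) 1 from ⟨lt_of_le_of_ne hS.1 (Ne.symm hS1), hS.2⟩),
        Set.indicator_of_mem (show T ∈ Set.Ioc (-2 : ℝ) 2 from ⟨lt_of_le_of_ne hT.1 (Ne.symm hT2), hT.2⟩)]
      have hSp : 0 < 4 - S ^ 2 := by nlinarith
      have hTp : 0 ≤ 4 - T ^ 2 := by nlinarith
      calc ∫⁻ α, kernelRegion f δ α S T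
          ≤ ∫⁻ α, (Set.Icc 0 (√(4 - T ^ 2) * (√(4 - S ^ 2))⁻¹)).indicator
              (fun _ => ENNReal.ofReal (f T)) α := by
            refine lintegral_mono fun α => ?_
            unfold kernelRegion
            split_ifs with h
            · rw [Set.indicator_of_mem]
              have hα : 0 ≤ α := hδ.le.trans h.1
              refine ⟨hα, ?_⟩
              rw [← div_eq_mul_inv, le_div_iff₀ (Real.sqrt_pos.mpr hSp)]
              refine Real.le_sqrt_of_sq_le ?_
              rw [mul_pow, Real.sq_sqrt hSp.le]
              linarith [h.2.2.2]
            · exact zero_le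
        _ = ENNReal.ofReal (f T) * ENNReal.ofReal (√(4 - T ^ 2) * (√(4 - S ^ 2))⁻¹) := by
            rw [lintegral_indicator_const measurableSet_Icc, Real.volume_Icc, sub_zero]
        _ = _ := by
            rw [ENNReal.ofReal_mul (by positivity), ENNReal.ofReal_mul' (by positivity)]
            ring
    · have h0 : ∀ α, kernelRegion f δ α S T = 0 := by
        intro α
        unfold kernelRegion
        rw [if_neg]
        rintro ⟨-, -, h3, h4⟩
        rw [abs_le] at h3
        apply hT
        have h5 : 0 ≤ α ^ 2 * (4 - S ^ 2) := mul_nonneg (sq_nonneg _) (by nlinarith)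
        exact abs_le_of_sq_le_sq (by linarith) (by norm_num)
      simp [h0]
  · have h0 : ∀ α, kernelRegion f δ α S T = 0 := by
      intro α
      unfold kernelRegion
      rw [if_neg]
      tauto
    simp [h0]

theorem lintegral_lintegral_lintegral_kernelRegion_le {f : ℝ → ℝ} (hf : Continuous f)
    (hf0 : ∀ x, 0 ≤ f x) {δ : ℝ} (hδ : 0 < δ) :
    ∫⁻ α, ∫⁻ S, ∫⁻ T, kernelRegion f δ α S T ≤
      ENNReal.ofReal (Real.pi / 3 * ∫ T in (-2 : ℝ)..2, f T * √(4 - T ^ 2)) := by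
  have hm := measurable_kernelRegion hf δ
  have h1 : ∫⁻ α, ∫⁻ S, ∫⁻ T, kernelRegion f δ α S T
      = ∫⁻ S, ∫⁻ T, ∫⁻ α, kernelRegion f δ α S T := by
    rw [lintegral_lintegral_swap]
    · refine lintegral_congr fun S => ?_
      rw [lintegral_lintegral_swap]
      have h2 : Measurable fun w : ℝ × ℝ => kernelRegion f δ w.1 S w.2 :=
        hm.comp (by fun_prop : Measurable fun w : ℝ × ℝ => (w.1, S, w.2))
      exact h2.aemeasurable
    · have h2 : Measurable fun w : (ℝ × ℝ) × ℝ => kernelRegion f δ w.1.1 w.1.2 w.2 :=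
        hm.comp (by fun_prop : Measurable fun w : (ℝ × ℝ) × ℝ => (w.1.1, w.1.2, w.2))
      exact h2.lintegral_prod_right'.aemeasurable
  rw [h1]
  have hI1 : ∫⁻ S, (Set.Ioc (-1) 1).indicator (fun S : ℝ => ENNReal.ofReal (√(4 - S ^ 2))⁻¹) S
      = ENNReal.ofReal (Real.pi / 3) := by
    rw [lintegral_indicator measurableSet_Ioc, ← integral_inv_sqrt_four_sub_sq,
      intervalIntegral.integral_of_le (by norm_num), ofReal_integral_eq_lintegral_ofReal]
    · refine (ContinuousOn.integrableOn_Icc (ContinuousOn.inv₀ (by fun_prop) fun x hx => ?_)).mono_set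
        Set.Ioc_subset_Icc_self
      rw [Set.mem_Icc] at hx
      exact (Real.sqrt_pos.mpr (by nlinarith)).ne'
    · exact Filter.Eventually.of_forall fun x => by positivity
  have hI2 : ∫⁻ T, (Set.Ioc (-2) 2).indicator (fun T => ENNReal.ofReal (f T * √(4 - T ^ 2))) T
      = ENNReal.ofReal (∫ T in (-2 : ℝ)..2, f T * √(4 - T ^ 2)) := by
    rw [lintegral_indicator measurableSet_Ioc,
      intervalIntegral.integral_of_le (by norm_num), ofReal_integral_eq_lintegral_ofReal]
    · exact (Continuous.integrableOn_Icc (by fun_prop)).mono_set Set.Ioc_subset_Icc_self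
    · exact Filter.Eventually.of_forall fun x => mul_nonneg (hf0 x) (Real.sqrt_nonneg _)
  rw [ENNReal.ofReal_mul (by positivity), ← hI1, ← hI2]
  have hae : ∀ a : ℝ, ∀ᵐ x : ℝ, x ≠ a := fun a => by simp [ae_iff]
  have hm1 : Measurable ((Set.Ioc (-1) 1).indicator (fun S : ℝ => ENNReal.ofReal (√(4 - S ^ 2))⁻¹)) :=
    Measurable.indicator (by fun_prop) measurableSet_Ioc
  have hm2 : Measurable ((Set.Ioc (-2) 2).indicator (fun T : ℝ => ENNReal.ofReal (f T * √(4 - T ^ 2)))) :=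
    Measurable.indicator (by fun_prop) measurableSet_Ioc
  rw [← lintegral_mul_const _ hm1]
  refine lintegral_mono_ae ?_
  filter_upwards [hae (-1)] with S hS
  rw [← lintegral_const_mul _ hm2]
  refine lintegral_mono_ae ?_
  filter_upwards [hae (-2)] with T hT
  rcases lintegral_kernelRegion_le (f := f) hδ S T with h | h | h
  · exact h
  · exact absurd h hS
  · exact absurd h hT

theorem lintegral_region_slice {f : ℝ → ℝ} (hf : Continuous f) {δ : ℝ} (hδ : 0 < δ) (α : ℝ) :
    ∫⁻ ξ, ∫⁻ η, (region δ).indicator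
        (fun v => ENNReal.ofReal (v.1 * f (v.1 * (v.2.1 + v.2.2)))) (α, ξ, η) =
      ENNReal.ofReal (1 / 2) * ∫⁻ S, ∫⁻ T, kernelRegion f δ α S T := by
  have hm := measurable_kernelRegion hf δ
  by_cases hα : δ ≤ α
  · have hα0 : 0 < α := hδ.trans_le hα
    have h1 : ∀ ξ S : ℝ, (region δ).indicator
        (fun v => ENNReal.ofReal (v.1 * f (v.1 * (v.2.1 + v.2.2)))) (α, ξ, ξ + S) =
        ENNReal.ofReal α * kernelRegion f δ α S (2 * α * ξ + α * S) := by
      intro ξ S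
      unfold kernelRegion
      by_cases h : (α, ξ, ξ + S) ∈ region δ
      · rw [Set.indicator_of_mem h, if_pos, ENNReal.ofReal_mul hα0.le]
        · congr 3
          simp only
          ring
        · obtain ⟨h1, h2, h3, h4⟩ := h
          refine ⟨h1, h2, ?_, ?_⟩
          · rw [abs_sub_comm] at h3; simpa using h3
          · simp only at h4; nlinarith
      · rw [Set.indicator_of_notMem h, if_neg, mul_zero]
        rintro ⟨h1, h2, h3, h4⟩
        refine h ⟨h1, h2, ?_, ?_⟩
        · rw [abs_sub_comm]; simpa using h3
        · simp only; nlinarith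
    have hm2 : Measurable fun w : ℝ × ℝ => kernelRegion f δ α w.2 (2 * α * w.1 + α * w.2) :=
      hm.comp (by fun_prop : Measurable fun w : ℝ × ℝ => (α, w.2, 2 * α * w.1 + α * w.2))
    have hm3 : Measurable fun w : ℝ × ℝ => kernelRegion f δ α w.1 w.2 :=
      hm.comp (by fun_prop : Measurable fun w : ℝ × ℝ => (α, w.1, w.2))
    calc ∫⁻ ξ, ∫⁻ η, (region δ).indicator
          (fun v => ENNReal.ofReal (v.1 * f (v.1 * (v.2.1 + v.2.2)))) (α, ξ, η)
        = ∫⁻ ξ, ∫⁻ S, ENNReal.ofReal α * kernelRegion f δ α S (2 * α * ξ + α * S) := by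
          refine lintegral_congr fun ξ => ?_
          rw [← lintegral_add_left_eq_self _ ξ]
          exact lintegral_congr fun S => h1 ξ S
      _ = ∫⁻ S, ∫⁻ ξ, ENNReal.ofReal α * kernelRegion f δ α S (2 * α * ξ + α * S) :=
          lintegral_lintegral_swap (hm2.const_mul _).aemeasurable
      _ = ∫⁻ S, ENNReal.ofReal (1 / 2) * ∫⁻ T, kernelRegion f δ α S T := by
          refine lintegral_congr fun S => ?_
          have hmS : Measurable fun T => kernelRegion f δ α S T :=
            hm.comp (by fun_prop : Measurable fun T : ℝ => (α, S, T))
          rw [lintegral_comp_mul_add (by positivity : 0 < 2 * α) (α * S)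
            (h := fun T => ENNReal.ofReal α * kernelRegion f δ α S T) (hmS.const_mul _),
            lintegral_const_mul _ hmS, ← mul_assoc, ← ENNReal.ofReal_mul (by positivity)]
          congr 2
          field_simp
      _ = _ := lintegral_const_mul _ hm3.lintegral_prod_right'
  · have h1 : ∀ ξ η : ℝ, (region δ).indicator
        (fun v => ENNReal.ofReal (v.1 * f (v.1 * (v.2.1 + v.2.2)))) (α, ξ, η) = 0 :=
      fun ξ η => Set.indicator_of_notMem (fun h => hα h.1) _
    have h2 : ∀ S T, kernelRegion f δ α S T = 0 := fun S T => by
      unfold kernelRegion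
      exact if_neg fun h => hα h.1
    simp [h1, h2]

theorem integral_region_le {f : ℝ → ℝ} (hf : Continuous f) (hf0 : ∀ x, 0 ≤ f x) {δ : ℝ} (hδ : 0 < δ) :
    ∫ v : ℝ × ℝ × ℝ, v.1 * (region δ).indicator (fun v => f (v.1 * (v.2.1 + v.2.2))) v ≤
      Real.pi / 6 * ∫ T in (-2 : ℝ)..2, f T * √(4 - T ^ 2) := by
  have hind : ∀ v : ℝ × ℝ × ℝ, v.1 * (region δ).indicator (fun v => f (v.1 * (v.2.1 + v.2.2))) v =
      (region δ).indicator (fun v => v.1 * f (v.1 * (v.2.1 + v.2.2))) v := fun v => by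
    by_cases h : v ∈ region δ
    · rw [Set.indicator_of_mem h, Set.indicator_of_mem h]
    · rw [Set.indicator_of_notMem h, Set.indicator_of_notMem h, mul_zero]
  have hmr := (isClosed_region δ).measurableSet
  have hI0 : 0 ≤ ∫ T in (-2 : ℝ)..2, f T * √(4 - T ^ 2) :=
    intervalIntegral.integral_nonneg (by norm_num) fun x _ => mul_nonneg (hf0 x) (Real.sqrt_nonneg _)
  simp_rw [hind]
  rw [integral_eq_lintegral_of_nonneg_ae]
  · refine ENNReal.toReal_le_of_le_ofReal (by positivity) ?_
    have hofr : ∀ v : ℝ × ℝ × ℝ,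
        ENNReal.ofReal ((region δ).indicator (fun v => v.1 * f (v.1 * (v.2.1 + v.2.2))) v) =
        (region δ).indicator (fun v => ENNReal.ofReal (v.1 * f (v.1 * (v.2.1 + v.2.2)))) v := fun v => by
      by_cases h : v ∈ region δ
      · rw [Set.indicator_of_mem h, Set.indicator_of_mem h]
      · rw [Set.indicator_of_notMem h, Set.indicator_of_notMem h, ENNReal.ofReal_zero]
    simp_rw [hofr]
    have hm : Measurable ((region δ).indicator
        (fun v => ENNReal.ofReal (v.1 * f (v.1 * (v.2.1 + v.2.2))))) :=
      Measurable.indicator (by fun_prop) hmr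
    rw [Measure.volume_eq_prod, lintegral_prod _ hm.aemeasurable]
    have h1 : ∀ α : ℝ, ∫⁻ w : ℝ × ℝ, (region δ).indicator
        (fun v => ENNReal.ofReal (v.1 * f (v.1 * (v.2.1 + v.2.2)))) (α, w) =
        ENNReal.ofReal (1 / 2) * ∫⁻ S, ∫⁻ T, kernelRegion f δ α S T := fun α => by
      rw [← lintegral_region_slice hf hδ α, Measure.volume_eq_prod, lintegral_prod]
      exact (hm.comp (by fun_prop : Measurable fun w : ℝ × ℝ => (α, w))).aemeasurable
    simp_rw [h1]
    rw [lintegral_const_mul]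
    · refine (mul_le_mul_right (lintegral_lintegral_lintegral_kernelRegion_le hf hf0 hδ) _).trans ?_
      rw [← ENNReal.ofReal_mul (by norm_num)]
      refine ENNReal.ofReal_le_ofReal (le_of_eq ?_)
      ring
    · have hk := measurable_kernelRegion hf δ
      have h2 : Measurable fun w : (ℝ × ℝ) × ℝ => kernelRegion f δ w.1.1 w.1.2 w.2 :=
        hk.comp (by fun_prop : Measurable fun w : (ℝ × ℝ) × ℝ => (w.1.1, w.1.2, w.2))
      exact h2.lintegral_prod_right'.lintegral_prod_right'
  · exact Filter.Eventually.of_forall fun v => Set.indicator_nonneg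
      (fun v hv => mul_nonneg (hδ.le.trans hv.1) (hf0 _)) v
  · exact (Measurable.indicator (by fun_prop) hmr).aestronglyMeasurable

end Birch

end

section

namespace Birch

open MeasureTheory

theorem three_mul_fst_sq_le {p : ℕ} {g : ℤ × ℤ × ℤ} (hg : g ∈ RR p) : 3 * g.1 ^ 2 ≤ 4 * p := by
  simp only [RR, Finset.mem_filter] at hg
  obtain ⟨-, h1, -, h3, h4⟩ := hg
  rw [abs_le] at h3
  nlinarith [sq_nonneg (g.2.1 + g.2.2)]

theorem fst_lt_of_mem_RR {p : ℕ} (hp5 : 5 ≤ p) {g : ℤ × ℤ × ℤ} (hg : g ∈ RR p) : g.1 < p := by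
  have h := three_mul_fst_sq_le hg
  by_contra! hcon
  have hp : (5 : ℤ) ≤ p := by exact_mod_cast hp5
  nlinarith

theorem isCoprime_of_mem_RR {p : ℕ} (hp : p.Prime) (hp5 : 5 ≤ p) {g : ℤ × ℤ × ℤ} (hg : g ∈ RR p) :
    IsCoprime g.1 g.2.1 := by
  have hlt := fst_lt_of_mem_RR hp5 hg
  simp only [RR, Finset.mem_filter] at hg
  obtain ⟨-, h1, h2, -, -⟩ := hg
  rw [Int.isCoprime_iff_gcd_eq_one]
  have hd1 : ((Int.gcd g.1 g.2.1 : ℕ) : ℤ) ∣ g.1 := Int.gcd_dvd_left ..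
  have hd2 : ((Int.gcd g.1 g.2.1 : ℕ) : ℤ) ∣ g.2.1 := Int.gcd_dvd_right ..
  have hd3 : ((Int.gcd g.1 g.2.1 : ℕ) : ℤ) ∣ p := by
    have := (hd1.trans h2).add (hd2.mul_right g.2.2)
    simpa using this
  rcases (Nat.dvd_prime hp).mp (Int.natCast_dvd_natCast.mp hd3) with h | h
  · exact h
  · have := Int.le_of_dvd h1 hd1
    omega

theorem card_RR_filter_lt_le {p : ℕ} (hp : p.Prime) (hp5 : 5 ≤ p) {δ : ℝ} (hδ : 0 < δ) (hδ1 : δ ≤ 1) :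
    (((RR p).filter fun g => (g.1 : ℝ) < δ * √(p : ℝ)).card : ℝ) ≤ 12 * δ * p := by
  classical
  have hP1 : 1 ≤ √(p : ℝ) := Real.one_le_sqrt.mpr (by exact_mod_cast hp.one_le)
  have hPsq : √(p : ℝ) ^ 2 = p := Real.sq_sqrt (by positivity)
  set P := √(p : ℝ)
  have hcard := Finset.card_le_card_of_injOn
    (s := (RR p).filter fun g => (g.1 : ℝ) < δ * P)
    (t := (Finset.Ioc (0 : ℤ) ⌊δ * P⌋) ×ˢ (Finset.Icc (-⌊3 / 2 * P⌋) ⌊3 / 2 * P⌋) ×ˢ Finset.Ico (0 : ℤ) 3)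
    (fun g => (g.1, g.2.1, (g.2.2 - g.2.1 + g.1) / g.1)) ?_ ?_
  · rw [Finset.card_product, Finset.card_product, Int.card_Ioc, Int.card_Icc, Int.card_Ico] at hcard
    have hA0 : 0 ≤ ⌊δ * P⌋ := Int.floor_nonneg.mpr (by positivity)
    have hB0 : 0 ≤ ⌊3 / 2 * P⌋ := Int.floor_nonneg.mpr (by positivity)
    have hA : (((⌊δ * P⌋ - 0).toNat : ℕ) : ℝ) ≤ δ * P := by
      rw [sub_zero, ← Int.cast_natCast, Int.toNat_of_nonneg hA0]
      exact Int.floor_le _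
    have hB : (((⌊3 / 2 * P⌋ + 1 - -⌊3 / 2 * P⌋).toNat : ℕ) : ℝ) ≤ 4 * P := by
      rw [← Int.cast_natCast, Int.toNat_of_nonneg (by omega)]
      push_cast
      linarith [Int.floor_le (3 / 2 * P)]
    calc _ ≤ (((⌊δ * P⌋ - 0).toNat * ((⌊3 / 2 * P⌋ + 1 - -⌊3 / 2 * P⌋).toNat * (3 - 0 : ℤ).toNat) : ℕ) : ℝ) := by
          exact_mod_cast hcard
      _ ≤ (δ * P) * ((4 * P) * 3) := by
          push_cast
          gcongr
      _ = 12 * δ * P ^ 2 := by ring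
      _ = _ := by rw [hPsq]
  · intro g hg
    rw [Finset.mem_coe, Finset.mem_filter] at hg
    obtain ⟨hg, hlt⟩ := hg
    have htr := trace_sq_le hg
    have hg' := hg
    simp only [RR, Finset.mem_filter] at hg'
    obtain ⟨-, h1, -, h3, -⟩ := hg'
    have h3' := abs_le.mp h3
    have htr' : |(g.2.1 + g.2.2 : ℝ)| ≤ 2 * P := by
      refine abs_le_of_sq_le_sq ?_ (by positivity)
      rw [mul_pow, hPsq]
      have : (((g.2.1 + g.2.2) ^ 2 : ℤ) : ℝ) ≤ ((4 * p : ℤ) : ℝ) := by exact_mod_cast htr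
      push_cast at this
      linarith
    rw [abs_le] at htr'
    have h4 : -(g.1 : ℝ) ≤ g.2.1 - g.2.2 := by exact_mod_cast h3'.1
    have h5 : (g.2.1 - g.2.2 : ℝ) ≤ g.1 := by exact_mod_cast h3'.2
    have h6 : δ * P ≤ P := by nlinarith
    simp only [Finset.mem_coe, Finset.mem_product, Finset.mem_Ioc, Finset.mem_Icc, Finset.mem_Ico]
    refine ⟨⟨h1, Int.le_floor.mpr hlt.le⟩, ⟨?_, Int.le_floor.mpr (by linarith)⟩, ?_, ?_⟩
    · rw [neg_le]
      refine Int.le_floor.mpr ?_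
      push_cast
      linarith
    · exact Int.ediv_nonneg (by linarith) h1.le
    · exact Int.ediv_lt_of_lt_mul h1 (by linarith)
  · intro g hg g' hg' heq
    rw [Finset.mem_coe, Finset.mem_filter] at hg hg'
    have hc := isCoprime_of_mem_RR hp hp5 hg.1
    have hg1 := hg.1
    have hg1' := hg'.1
    simp only [RR, Finset.mem_filter] at hg1 hg1'
    obtain ⟨-, h1, h2, -, -⟩ := hg1
    obtain ⟨-, -, h2', -, -⟩ := hg1'
    obtain ⟨a, x, y⟩ := g
    obtain ⟨a', x', y'⟩ := g'
    simp only [Prod.mk.injEq] at heq h1 h2 h2' hc ⊢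
    obtain ⟨rfl, rfl, hq⟩ := heq
    refine ⟨rfl, rfl, ?_⟩
    have hdvd : a ∣ y' - y := by
      refine hc.dvd_of_dvd_mul_left ?_
      have := h2.sub h2'
      convert this using 1
      ring
    obtain ⟨k, hk⟩ := hdvd
    have e1 := Int.emod_nonneg (y - x + a) h1.ne'
    have e2 := Int.emod_lt_of_pos (y - x + a) h1
    have e3 := Int.emod_nonneg (y' - x + a) h1.ne'
    have e4 := Int.emod_lt_of_pos (y' - x + a) h1
    have e5 := Int.mul_ediv_add_emod (y - x + a) a
    have e6 := Int.mul_ediv_add_emod (y' - x + a) a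
    rw [hq] at e5
    have e7 : a * k < a * 1 := by linarith
    have e8 : a * (-1) < a * k := by linarith
    have e9 := lt_of_mul_lt_mul_left e7 h1.le
    have e10 := lt_of_mul_lt_mul_left e8 h1.le
    have : k = 0 := by omega
    rw [this] at hk
    linarith

theorem exists_sum_RR_le {f : ℝ → ℝ} (hf : Continuous f) (hf0 : ∀ x, 0 ≤ f x) {ε : ℝ} (hε : 0 < ε) :
    ∃ p₀ : ℕ, ∀ p, p₀ ≤ p → p.Prime →
      ∑ g ∈ RR p, f (((g.2.1 + g.2.2 : ℤ) : ℝ) / √(p : ℝ)) ≤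
        p * (1 / Real.pi * (∫ T in (-2 : ℝ)..2, f T * √(4 - T ^ 2)) + ε) := by
  classical
  obtain ⟨M, hM⟩ := (isCompact_Icc (a := (-2 : ℝ)) (b := 2)).exists_bound_of_continuousOn hf.continuousOn
  have hM0 : 0 ≤ M := (norm_nonneg _).trans (hM 0 (by norm_num))
  set δ : ℝ := min 1 (ε / (24 * (M + 1))) with hδdef
  have hδ : 0 < δ := lt_min one_pos (by positivity)
  have hδ1 : δ ≤ 1 := min_le_left ..
  have hδM : 12 * δ * M ≤ ε / 2 := by
    have h1 : δ ≤ ε / (24 * (M + 1)) := min_le_right ..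
    rw [le_div_iff₀ (by positivity)] at h1
    nlinarith
  obtain ⟨p₀, hp₀⟩ := exists_sum_indicator_le (g := fun v : ℝ × ℝ × ℝ => f (v.1 * (v.2.1 + v.2.2)))
    (isCompact_region hδ) (by fun_prop) (fun v => hf0 _) hδ (fun v hv => hv.1) (half_pos hε)
  refine ⟨max p₀ 5, fun p hp hpp => ?_⟩
  have hp5 : 5 ≤ p := (le_max_right ..).trans hp
  have hP0 : 0 < √(p : ℝ) := Real.sqrt_pos.mpr (by exact_mod_cast hpp.pos)
  have hPsq : √(p : ℝ) ^ 2 = p := Real.sq_sqrt (by positivity)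
  have hmain := hp₀ p ((le_max_left ..).trans hp) hpp
    ((RR p).filter fun g => ¬ (g.1 : ℝ) < δ * √(p : ℝ)) (by
      intro g hg
      have hg1 := (Finset.mem_filter.mp hg).1
      have hlt := fst_lt_of_mem_RR hp5 hg1
      simp only [RR, Finset.mem_filter] at hg1
      exact ⟨hg1.2.1, hlt, hg1.2.2.1⟩)
  have hle : ∑ g ∈ (RR p).filter (fun g => ¬ (g.1 : ℝ) < δ * √(p : ℝ)),
      f (((g.2.1 + g.2.2 : ℤ) : ℝ) / √(p : ℝ)) ≤
      p * (1 / Real.pi * (∫ T in (-2 : ℝ)..2, f T * √(4 - T ^ 2)) + ε / 2) := by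
    calc _ = ∑ γ ∈ (RR p).filter (fun g => ¬ (g.1 : ℝ) < δ * √(p : ℝ)),
          (region δ).indicator (fun v => f (v.1 * (v.2.1 + v.2.2)))
            ((γ.1 : ℝ) / √(p : ℝ), (γ.2.1 : ℝ) / γ.1, (γ.2.2 : ℝ) / γ.1) := by
          refine Finset.sum_congr rfl fun g hg => ?_
          obtain ⟨hg, hge⟩ := Finset.mem_filter.mp hg
          have h3a := three_mul_fst_sq_le hg
          simp only [RR, Finset.mem_filter] at hg
          obtain ⟨-, h1, -, h3, h4⟩ := hg
          have h1' : (0 : ℝ) < g.1 := by exact_mod_cast h1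
          have h3' : |(g.2.1 : ℝ) - g.2.2| ≤ g.1 := by exact_mod_cast h3
          have h4' : (g.1 : ℝ) ^ 2 ≤ p - g.2.1 * g.2.2 := by exact_mod_cast h4
          have h3a' : 3 * (g.1 : ℝ) ^ 2 ≤ 4 * p := by exact_mod_cast h3a
          rw [Set.indicator_of_mem]
          · congr 1
            push_cast
            field_simp
          · refine ⟨?_, ?_, ?_, ?_⟩
            · simp only
              rw [le_div_iff₀ hP0]
              exact not_lt.mp hge
            · simp only
              rw [div_le_iff₀ hP0]
              refine le_of_sq_le_sq ?_ (by positivity)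
              rw [mul_pow, hPsq]
              linarith
            · simp only
              rw [← sub_div, abs_div, abs_of_pos h1', div_le_one h1']
              exact h3'
            · simp only
              rw [div_pow, hPsq]
              have hp0 : (0 : ℝ) < p := by exact_mod_cast hpp.pos
              rw [show (g.1 : ℝ) ^ 2 / p * (1 + g.2.1 / g.1 * (g.2.2 / g.1)) =
                (g.1 ^ 2 + g.2.1 * g.2.2) / p by field_simp, div_le_one hp0]
              linarith
      _ ≤ _ := hmain
      _ ≤ _ := by
          refine mul_le_mul_of_nonneg_left (add_le_add_left ?_ _) (by positivity)
          refine (mul_le_mul_of_nonneg_left (integral_region_le hf hf0 hδ) (by positivity)).trans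
            (le_of_eq ?_)
          rw [← mul_assoc]
          congr 1
          field_simp
  have hsmall : ∑ g ∈ (RR p).filter (fun g => (g.1 : ℝ) < δ * √(p : ℝ)),
      f (((g.2.1 + g.2.2 : ℤ) : ℝ) / √(p : ℝ)) ≤ p * (ε / 2) := by
    calc _ ≤ ∑ g ∈ (RR p).filter (fun g => (g.1 : ℝ) < δ * √(p : ℝ)), M := by
          refine Finset.sum_le_sum fun g hg => ?_
          refine (Real.le_norm_self _).trans (hM _ ?_)
          have htr := trace_sq_le (Finset.mem_filter.mp hg).1
          have : (((g.2.1 + g.2.2) ^ 2 : ℤ) : ℝ) ≤ ((4 * p : ℤ) : ℝ) := by exact_mod_cast htr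
          rw [Set.mem_Icc, ← abs_le, abs_div, abs_of_pos hP0, div_le_iff₀ hP0]
          refine abs_le_of_sq_le_sq ?_ (by positivity)
          rw [mul_pow, hPsq]
          push_cast at this ⊢
          linarith
      _ ≤ (12 * δ * p) * M := by
          rw [Finset.sum_const, nsmul_eq_mul]
          gcongr
          exact card_RR_filter_lt_le hpp hp5 hδ hδ1
      _ = p * (12 * δ * M) := by ring
      _ ≤ _ := by gcongr
  rw [← Finset.sum_filter_add_sum_filter_not (RR p) (fun g => (g.1 : ℝ) < δ * √(p : ℝ))]
  linarith

end Birch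

end

section

namespace Birch

theorem integral_sqrt_four_sub_sq : ∫ T in (-2 : ℝ)..2, √(4 - T ^ 2) = 2 * Real.pi := by
  have h := intervalIntegral.integral_comp_mul_left (a := -1) (b := 1) (fun T : ℝ => √(4 - T ^ 2))
    (c := 2) (by norm_num)
  have h1 : ∀ x : ℝ, √(4 - (2 * x) ^ 2) = 2 * √(1 - x ^ 2) := by
    intro x
    rw [show 4 - (2 * x) ^ 2 = 2 ^ 2 * (1 - x ^ 2) by ring, Real.sqrt_mul (by norm_num),
      Real.sqrt_sq (by norm_num)]
  simp only [h1] at h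
  rw [intervalIntegral.integral_const_mul, integral_sqrt_one_sub_sq] at h
  norm_num at h
  linarith

theorem hasDerivAt_pow_mul_sqrt (n : ℕ) {x : ℝ} (hx : x ∈ Set.Ioo (-2 : ℝ) 2) :
    HasDerivAt (fun x : ℝ => x ^ (2 * n + 1) * ((4 - x ^ 2) * √(4 - x ^ 2)))
      (4 * (2 * n + 1) * (x ^ (2 * n) * √(4 - x ^ 2)) -
        (2 * n + 4) * (x ^ (2 * (n + 1)) * √(4 - x ^ 2))) x := by
  have hpos : 0 < 4 - x ^ 2 := by nlinarith [hx.1, hx.2]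
  have h1 : HasDerivAt (fun x : ℝ => 4 - x ^ 2) (-(2 * x)) x := by
    simpa using (hasDerivAt_pow 2 x).const_sub 4
  have h2 := (hasDerivAt_pow (2 * n + 1) x).mul (h1.mul (h1.sqrt hpos.ne'))
  refine h2.congr_deriv ?_
  have hs := Real.sqrt_pos.mpr hpos
  have hsq := Real.sq_sqrt hpos.le
  simp only [Pi.mul_apply]
  push_cast
  rw [show (4 - x ^ 2) * (-(2 * x) / (2 * √(4 - x ^ 2))) =
    -x * √(4 - x ^ 2) by
      field_simp
      linear_combination x * hsq]
  ring

theorem integral_pow_mul_sqrt (n : ℕ) :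
    ∫ T in (-2 : ℝ)..2, T ^ (2 * n) * √(4 - T ^ 2) = 2 * Real.pi * catalan n := by
  induction n with
  | zero => simp [integral_sqrt_four_sub_sq]
  | succ n ih =>
    have hc : ∀ k : ℕ, Continuous fun x : ℝ => x ^ k * √(4 - x ^ 2) := fun k => by fun_prop
    have hi : ∀ k : ℕ, IntervalIntegrable (fun x : ℝ => x ^ k * √(4 - x ^ 2)) MeasureTheory.volume
      (-2) 2 := fun k => (hc k).intervalIntegrable _ _
    have h := intervalIntegral.integral_eq_sub_of_hasDerivAt_of_le (a := -2) (b := 2) (by norm_num)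
      (by fun_prop) (fun x hx => hasDerivAt_pow_mul_sqrt n hx)
      (((hi (2 * n)).const_mul _).sub ((hi (2 * (n + 1))).const_mul _))
    rw [intervalIntegral.integral_sub ((hi (2 * n)).const_mul _) ((hi (2 * (n + 1))).const_mul _),
      intervalIntegral.integral_const_mul, intervalIntegral.integral_const_mul, ih] at h
    norm_num at h
    have c1 : ((n : ℝ) + 1) * catalan n = n.centralBinom := by
      exact_mod_cast succ_mul_catalan_eq_centralBinom n
    have c2 : ((n : ℝ) + 2) * catalan (n + 1) = (n + 1).centralBinom := by
      have := succ_mul_catalan_eq_centralBinom (n + 1)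
      exact_mod_cast this
    have c3 : ((n : ℝ) + 1) * (n + 1).centralBinom = 2 * (2 * n + 1) * n.centralBinom := by
      exact_mod_cast Nat.succ_mul_centralBinom_succ n
    have h0 : ((n : ℝ) + 1) * (2 * n + 4) ≠ 0 := by positivity
    apply mul_left_cancel₀ h0
    linear_combination (-(n : ℝ) - 1) * h + 8 * Real.pi * (2 * n + 1) * c1 -
      4 * Real.pi * (n + 1) * c2 - 4 * Real.pi * c3

theorem catalan_eq_factorial (d : ℕ) :
    (catalan d : ℝ) = ((2 * d).factorial : ℝ) / ((d.factorial : ℝ) * ((d + 1).factorial : ℝ)) := by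
  have h1 : ((d : ℝ) + 1) * catalan d = d.centralBinom := by
    exact_mod_cast succ_mul_catalan_eq_centralBinom d
  have h2 := Nat.choose_mul_factorial_mul_factorial (show d ≤ 2 * d by omega)
  rw [← Nat.centralBinom_eq_two_mul_choose, show 2 * d - d = d by omega] at h2
  have h3 : (d.centralBinom : ℝ) * d.factorial * d.factorial = (2 * d).factorial := by
    exact_mod_cast h2
  rw [eq_div_iff (by positivity), Nat.factorial_succ]
  push_cast
  rw [← h3, ← h1]
  ring

section
variable {p : ℕ} [hp : Fact p.Prime]

open Classical in
/-- The parameters `e` for which `y² = x³ + e x + e` is smooth with nonzero coefficients. -/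
noncomputable def EE (p : ℕ) [hp : Fact p.Prime] : Finset (ZMod p) :=
  Finset.univ.filter fun e : ZMod p => e ≠ 0 ∧ 4 * e + 27 ≠ 0

theorem four_ne_zero' (hp5 : 5 ≤ p) : (4 : ZMod p) ≠ 0 := by
  intro h
  have : ((4 : ℕ) : ZMod p) = 0 := by exact_mod_cast h
  rw [ZMod.natCast_eq_zero_iff] at this
  have := Nat.le_of_dvd (by norm_num) this
  omega

theorem card_EE (hp5 : 5 ≤ p) : (p : ℝ) - 2 ≤ (EE p).card ∧ ((EE p).card : ℝ) ≤ p := by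
  classical
  have h1 : (EE p).card ≤ p := by
    have := Finset.card_le_univ (EE p)
    rwa [ZMod.card] at this
  have h2 : (Finset.univ : Finset (ZMod p)) ⊆ EE p ∪ {0, -27 / 4} := by
    intro e _
    simp only [EE, Finset.mem_union, Finset.mem_filter, Finset.mem_univ, true_and,
      Finset.mem_insert, Finset.mem_singleton]
    by_cases h0 : e = 0
    · exact Or.inr (Or.inl h0)
    by_cases h4 : 4 * e + 27 = 0
    · refine Or.inr (Or.inr ?_)
      rw [eq_div_iff (four_ne_zero' hp5)]
      linear_combination h4
    · exact Or.inl ⟨h0, h4⟩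
  have h3 := (Finset.card_le_card h2).trans (Finset.card_union_le _ _)
  rw [Finset.card_univ, ZMod.card] at h3
  have h4 : ({0, -27 / 4} : Finset (ZMod p)).card ≤ 2 := Finset.card_le_two
  have h5 : p ≤ (EE p).card + 2 := by omega
  constructor
  · have : (p : ℝ) ≤ (EE p).card + 2 := by exact_mod_cast h5
    linarith
  · exact_mod_cast h1

/-- `t` represents the reductions of the traces by integers in the Hasse interval. -/
def Lift (p : ℕ) [hp : Fact p.Prime] (t : ZMod p → ℤ) : Prop :=
  ∀ e ∈ EE p, t e ^ 2 ≤ 4 * p ∧ (ap e e : ZMod p) ^ 2 = (t e : ZMod p) ^ 2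

theorem exists_lift (hp5 : 5 ≤ p) : ∃ t, Lift p t := by
  classical
  have h := two_mul_sum_le (p := p) hp5
    (f := fun z => if ∃ t : ℤ, t ^ 2 ≤ 4 * p ∧ z = (t : ZMod p) ^ 2 then 0 else 1)
    (fun z => by split_ifs <;> norm_num)
  have h0 : ∑ g ∈ RR p, (if ∃ t : ℤ, t ^ 2 ≤ 4 * p ∧
      ((g.2.1 + g.2.2 : ℤ) : ZMod p) ^ 2 = (t : ZMod p) ^ 2 then (0 : ℝ) else 1) = 0 :=
    Finset.sum_eq_zero fun g hg => if_pos ⟨_, trace_sq_le hg, rfl⟩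
  rw [h0] at h
  have hex : ∀ e ∈ EE p, ∃ t : ℤ, t ^ 2 ≤ 4 * p ∧ (ap e e : ZMod p) ^ 2 = (t : ZMod p) ^ 2 := by
    intro e he
    by_contra hcon
    have h1 : (1 : ℝ) ≤ ∑ e ∈ Finset.univ.filter (fun e : ZMod p => e ≠ 0 ∧ 4 * e + 27 ≠ 0),
        (if ∃ t : ℤ, t ^ 2 ≤ 4 * p ∧ (ap e e : ZMod p) ^ 2 = (t : ZMod p) ^ 2 then (0 : ℝ) else 1) := by
      refine le_trans (le_of_eq (if_neg hcon).symm) (Finset.single_le_sum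
        (f := fun e => (if ∃ t : ℤ, t ^ 2 ≤ 4 * p ∧ (ap e e : ZMod p) ^ 2 = (t : ZMod p) ^ 2
          then (0 : ℝ) else 1)) (fun i _ => ?_) ?_)
      · split_ifs <;> norm_num
      · simpa [EE] using he
    linarith
  choose! t ht using hex
  exact ⟨t, ht⟩

theorem sq_eq_or_le {t : ℤ} (ht : t ^ 2 ≤ 4 * p) {a : ℤ} (ha : (a : ZMod p) ^ 2 = (t : ZMod p) ^ 2)
    (hp16 : 16 ≤ p) : a ^ 2 = t ^ 2 ∨ (p : ℤ) ^ 2 ≤ 4 * a ^ 2 := by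
  have key : ∀ b : ℤ, b ^ 2 ≤ 4 * p → ((a - b : ℤ) : ZMod p) = 0 → a ^ 2 = b ^ 2 ∨ (p : ℤ) ^ 2 ≤ 4 * a ^ 2 := by
    intro b hb h0
    rw [ZMod.intCast_zmod_eq_zero_iff_dvd] at h0
    by_cases hab : a - b = 0
    · left; rw [sub_eq_zero.mp hab]
    right
    have h1 := Int.le_of_dvd (abs_pos.mpr hab) ((dvd_abs _ _).mpr h0)
    have hp' : (16 : ℤ) ≤ p := by exact_mod_cast hp16
    have h2 : |b| * 2 ≤ p := by
      refine abs_le_of_sq_le_sq' (a := |b| * 2) ?_ (by positivity) |>.2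
      rw [mul_pow, sq_abs]
      nlinarith
    have h3 : |a - b| ≤ |a| + |b| := abs_sub _ _
    have h4 : (p : ℤ) ≤ 2 * |a| := by linarith
    calc (p : ℤ) ^ 2 ≤ (2 * |a|) ^ 2 := pow_le_pow_left₀ (by positivity) h4 2
      _ = 4 * a ^ 2 := by rw [mul_pow, sq_abs]; ring
  rcases sq_eq_sq_iff_eq_or_eq_neg.mp ha with h | h
  · exact key t ht (by push_cast; rw [h, sub_self])
  · have := key (-t) (by rw [neg_sq]; exact ht) (by push_cast; rw [h]; ring)
    rwa [neg_sq] at this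

theorem two_mul_sum_lift_le (hp17 : 17 ≤ p) {t : ZMod p → ℤ} (ht : Lift p t) {g : ℝ → ℝ}
    (hg : ∀ v, 0 ≤ g v) :
    2 * ∑ e ∈ EE p, g ((t e : ℝ) ^ 2 / p) ≤
      ∑ x ∈ RR p, g ((((x.2.1 + x.2.2 : ℤ) : ℝ) / √(p : ℝ)) ^ 2) := by
  classical
  set P : ZMod p → Prop := fun z => ∃ s : ℤ, s ^ 2 ≤ 4 * p ∧ z = (s : ZMod p) ^ 2 with hP
  set f : ZMod p → ℝ := fun z => if h : P z then g ((h.choose : ℝ) ^ 2 / p) else 0 with hf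
  have hval : ∀ s : ℤ, s ^ 2 ≤ 4 * p → f ((s : ZMod p) ^ 2) = g ((s : ℝ) ^ 2 / p) := by
    intro s hs
    have hPz : P ((s : ZMod p) ^ 2) := ⟨s, hs, rfl⟩
    simp only [hf, dif_pos hPz]
    obtain ⟨h1, h2⟩ := hPz.choose_spec
    have hp' : (17 : ℤ) ≤ p := by exact_mod_cast hp17
    rcases sq_eq_or_le hs h2.symm (by omega) with h | h
    · have : (hPz.choose : ℝ) ^ 2 = (s : ℝ) ^ 2 := by exact_mod_cast h
      rw [this]
    · nlinarith
  have h := two_mul_sum_le (p := p) (by omega) (f := f) (fun z => by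
    simp only [hf]; split_ifs
    · exact hg _
    · exact le_rfl)
  calc 2 * ∑ e ∈ EE p, g ((t e : ℝ) ^ 2 / p)
      = 2 * ∑ e ∈ EE p, f ((ap e e : ZMod p) ^ 2) := by
        congr 1
        refine Finset.sum_congr rfl fun e he => ?_
        rw [(ht e he).2, hval _ (ht e he).1]
    _ ≤ ∑ x ∈ RR p, f (((x.2.1 + x.2.2 : ℤ) : ZMod p) ^ 2) := h
    _ = _ := by
        refine Finset.sum_congr rfl fun x hx => ?_
        rw [hval _ (trace_sq_le hx), div_pow, Real.sq_sqrt (by positivity)]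

end

theorem exists_sum_lift_le {g : ℝ → ℝ} (hg : Continuous g) (hg0 : ∀ v, 0 ≤ g v) {ε : ℝ} (hε : 0 < ε) :
    ∃ p₀ : ℕ, ∀ p, p₀ ≤ p → ∀ [Fact p.Prime], ∀ t, Lift p t →
      ∑ e ∈ EE p, g ((t e : ℝ) ^ 2 / p) ≤
        p * (1 / (2 * Real.pi) * (∫ T in (-2 : ℝ)..2, g (T ^ 2) * √(4 - T ^ 2)) + ε) := by
  obtain ⟨p₀, hp₀⟩ := exists_sum_RR_le (f := fun T => g (T ^ 2)) (by fun_prop) (fun _ => hg0 _) hε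
  refine ⟨max p₀ 17, fun p hpp hp t ht => ?_⟩
  have h1 := two_mul_sum_lift_le (le_of_max_le_right hpp) ht hg0
  have h2 := hp₀ p (le_of_max_le_left hpp) hp.out
  have h3 : 1 / Real.pi * (∫ T in (-2 : ℝ)..2, g (T ^ 2) * √(4 - T ^ 2)) =
      2 * (1 / (2 * Real.pi) * (∫ T in (-2 : ℝ)..2, g (T ^ 2) * √(4 - T ^ 2))) := by
    field_simp
  rw [h3] at h2
  have h4 : 0 ≤ (p : ℝ) * ε := by positivity
  nlinarith

theorem exists_abs_sum_lift_sub_le (n : ℕ) {ε : ℝ} (hε : 0 < ε) :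
    ∃ p₀ : ℕ, ∀ p, p₀ ≤ p → ∀ [Fact p.Prime], ∀ t, Lift p t →
      |∑ e ∈ EE p, ((t e : ℝ) ^ 2 / p) ^ n - p * catalan n| ≤ p * ε := by
  obtain ⟨p₁, h₁⟩ := exists_sum_lift_le (g := fun v => |v| ^ n) (by fun_prop) (fun v => by positivity)
    hε
  obtain ⟨p₂, h₂⟩ := exists_sum_lift_le (g := fun v => |4 ^ n - v ^ n|) (by fun_prop)
    (fun v => by positivity) (half_pos hε)
  obtain ⟨p₃, h₃⟩ := exists_nat_ge (4 * 4 ^ n / ε)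
  have hi : ∀ k : ℕ, IntervalIntegrable (fun x : ℝ => x ^ k * √(4 - x ^ 2)) MeasureTheory.volume
      (-2) 2 := fun k => (by fun_prop : Continuous fun x : ℝ => x ^ k * √(4 - x ^ 2)).intervalIntegrable _ _
  have hi0 : IntervalIntegrable (fun x : ℝ => √(4 - x ^ 2)) MeasureTheory.volume (-2) 2 :=
    (by fun_prop : Continuous fun x : ℝ => √(4 - x ^ 2)).intervalIntegrable _ _
  have I1 : ∫ T in (-2 : ℝ)..2, |T ^ 2| ^ n * √(4 - T ^ 2) = 2 * Real.pi * catalan n := by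
    rw [← integral_pow_mul_sqrt]
    refine intervalIntegral.integral_congr fun T _ => ?_
    rw [abs_of_nonneg (sq_nonneg T), ← pow_mul]
  have I2 : ∫ T in (-2 : ℝ)..2, |4 ^ n - (T ^ 2) ^ n| * √(4 - T ^ 2) =
      2 * Real.pi * (4 ^ n - catalan n) := by
    rw [mul_sub, ← integral_pow_mul_sqrt, ← integral_sqrt_four_sub_sq, mul_comm _ ((4 : ℝ) ^ n),
      ← intervalIntegral.integral_const_mul, ← intervalIntegral.integral_sub (hi0.const_mul _) (hi _)]
    refine intervalIntegral.integral_congr fun T hT => ?_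
    rw [Set.uIcc_of_le (by norm_num)] at hT
    have : (T ^ 2) ^ n ≤ 4 ^ n := pow_le_pow_left₀ (sq_nonneg T) (by nlinarith [hT.1, hT.2]) n
    rw [abs_of_nonneg (by linarith), sub_mul, ← pow_mul]
  refine ⟨max (max p₁ p₂) (max p₃ 5), fun p hpp hp t ht => ?_⟩
  simp only [max_le_iff] at hpp
  obtain ⟨⟨k1, k2⟩, k3, k5⟩ := hpp
  have hp0 : (0 : ℝ) < p := by exact_mod_cast hp.out.pos
  have hpi := Real.pi_pos
  have a1 := h₁ p k1 t ht
  have a2 := h₂ p k2 t ht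
  rw [I1, ← mul_assoc, one_div, inv_mul_cancel₀ (by positivity), one_mul] at a1
  rw [I2, ← mul_assoc, one_div, inv_mul_cancel₀ (by positivity), one_mul] at a2
  have b1 : ∑ e ∈ EE p, |(t e : ℝ) ^ 2 / p| ^ n = ∑ e ∈ EE p, ((t e : ℝ) ^ 2 / p) ^ n :=
    Finset.sum_congr rfl fun e _ => by rw [abs_of_nonneg (by positivity)]
  have b2 : ∑ e ∈ EE p, |(4 : ℝ) ^ n - ((t e : ℝ) ^ 2 / p) ^ n| =
      (EE p).card * (4 : ℝ) ^ n - ∑ e ∈ EE p, ((t e : ℝ) ^ 2 / p) ^ n := by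
    rw [← nsmul_eq_mul, ← Finset.sum_const, ← Finset.sum_sub_distrib]
    refine Finset.sum_congr rfl fun e he => ?_
    have h1 : ((t e ^ 2 : ℤ) : ℝ) ≤ ((4 * p : ℤ) : ℝ) := by exact_mod_cast (ht e he).1
    push_cast at h1
    have : ((t e : ℝ) ^ 2 / p) ^ n ≤ 4 ^ n :=
      pow_le_pow_left₀ (by positivity) ((div_le_iff₀ hp0).mpr h1) n
    rw [abs_of_nonneg (by linarith)]
  rw [b1] at a1
  rw [b2] at a2
  have c1 := (card_EE k5).1
  have c2 : 4 * (4 : ℝ) ^ n ≤ p * ε := by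
    have : (p₃ : ℝ) ≤ p := by exact_mod_cast k3
    have := h₃.trans this
    rwa [div_le_iff₀ hε] at this
  have c3 : ((p : ℝ) - 2) * 4 ^ n ≤ (EE p).card * 4 ^ n := by gcongr
  rw [abs_le]
  constructor
  · linarith
  · linarith

end Birch

end

section

namespace Birch

theorem exists_ap_sq_eq : ∃ p₀ : ℕ, ∀ p, p₀ ≤ p → ∀ [Fact p.Prime], ∀ t, Lift p t →
    ∀ e ∈ EE p, ap e e ^ 2 = t e ^ 2 := by
  obtain ⟨p₀, h₀⟩ := exists_abs_sum_lift_sub_le 1 (show (0 : ℝ) < 1 / 8 by norm_num)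
  refine ⟨max p₀ 33, fun p hpp hp t ht e he => ?_⟩
  simp only [max_le_iff] at hpp
  obtain ⟨k0, k1⟩ := hpp
  have hp33 : (33 : ℤ) ≤ p := by exact_mod_cast k1
  have hp33' : (33 : ℝ) ≤ p := by exact_mod_cast k1
  have alt : ∀ e ∈ EE p, ap e e ^ 2 = t e ^ 2 ∨ (p : ℤ) ^ 2 ≤ 4 * ap e e ^ 2 := fun e he =>
    sq_eq_or_le (ht e he).1 (ht e he).2 (by omega)
  by_contra hne
  have hbig := (alt e he).resolve_left hne
  have hle : ∀ e ∈ EE p, 0 ≤ ap e e ^ 2 - t e ^ 2 := by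
    intro e he
    rcases alt e he with h | h
    · rw [h, sub_self]
    · nlinarith [(ht e he).1]
  have h1 := Finset.single_le_sum hle he
  rw [Finset.sum_sub_distrib] at h1
  have h2 : ∑ e ∈ EE p, ap e e ^ 2 ≤ (p : ℤ) ^ 2 := by
    classical
    have a1 : ∑ e ∈ EE p, ap e e ^ 2 ≤ ∑ c ∈ Finset.univ.erase (0 : ZMod p), ap c c ^ 2 := by
      refine Finset.sum_le_sum_of_subset_of_nonneg (fun c hc => ?_) fun _ _ _ => sq_nonneg _
      simp only [EE, Finset.mem_filter] at hc
      exact Finset.mem_erase.mpr ⟨hc.2.1, Finset.mem_univ _⟩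
    have a2 := sum_pairs (p := p) (fun α β => (ap α β : ℝ) ^ 2) (fun u hu α β => by
      exact_mod_cast ap_twist_sq (by omega) hu α β)
    have a3 : ∑ α ∈ Finset.univ.erase (0 : ZMod p), ∑ β ∈ Finset.univ.erase (0 : ZMod p), ap α β ^ 2 ≤
        ∑ α : ZMod p, ∑ β : ZMod p, ap α β ^ 2 := by
      refine (Finset.sum_le_sum fun α _ => ?_).trans (Finset.sum_le_sum_of_subset_of_nonneg
        (Finset.erase_subset _ _) fun α _ _ => Finset.sum_nonneg fun _ _ => sq_nonneg _)
      exact Finset.sum_le_sum_of_subset_of_nonneg (Finset.erase_subset _ _) fun _ _ _ => sq_nonneg _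
    have a2' : ∑ α ∈ Finset.univ.erase (0 : ZMod p), ∑ β ∈ Finset.univ.erase (0 : ZMod p), ap α β ^ 2 =
        ((p : ℤ) - 1) * ∑ c ∈ Finset.univ.erase (0 : ZMod p), ap c c ^ 2 := by exact_mod_cast a2
    rw [a2', sum_ap_sq (by omega)] at a3
    have a4 : ((p : ℤ) - 1) * ∑ c ∈ Finset.univ.erase (0 : ZMod p), ap c c ^ 2 ≤ ((p : ℤ) - 1) * p ^ 2 := by
      linarith
    exact a1.trans (le_of_mul_le_mul_left a4 (by linarith))
  have h3 := (abs_le.mp (h₀ p k0 t ht)).1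
  simp only [pow_one, catalan_one, Nat.cast_one, mul_one] at h3
  rw [← Finset.sum_div, neg_le_sub_iff_le_add, ← sub_le_iff_le_add] at h3
  have hp0 : (0 : ℝ) < p := by linarith
  have h4 : (p : ℝ) ^ 2 * (7 / 8) ≤ ∑ e ∈ EE p, (t e : ℝ) ^ 2 := by
    have : (p : ℝ) * (7 / 8) ≤ (∑ e ∈ EE p, (t e : ℝ) ^ 2) / p := by linarith
    rw [le_div_iff₀ hp0] at this
    linarith
  have h5 : (7 : ℤ) * p ^ 2 ≤ 8 * ∑ e ∈ EE p, t e ^ 2 := by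
    have : (7 : ℝ) * p ^ 2 ≤ 8 * ∑ e ∈ EE p, (t e : ℝ) ^ 2 := by linarith
    exact_mod_cast this
  have h6 := (ht e he).1
  nlinarith

theorem exists_abs_sum_ap_sub_le (d : ℕ) {ε : ℝ} (hε : 0 < ε) :
    ∃ p₀ : ℕ, ∀ p, p₀ ≤ p → ∀ [Fact p.Prime],
      |∑ e ∈ EE p, ((ap e e : ℝ) ^ 2 / p) ^ d - p * catalan d| ≤ p * ε := by
  obtain ⟨p₁, h₁⟩ := exists_abs_sum_lift_sub_le d hε
  obtain ⟨p₂, h₂⟩ := exists_ap_sq_eq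
  refine ⟨max p₁ (max p₂ 5), fun p hpp hp => ?_⟩
  simp only [max_le_iff] at hpp
  obtain ⟨k1, k2, k5⟩ := hpp
  obtain ⟨t, ht⟩ := exists_lift (p := p) k5
  have h := h₁ p k1 t ht
  have e1 : ∑ e ∈ EE p, ((ap e e : ℝ) ^ 2 / p) ^ d = ∑ e ∈ EE p, ((t e : ℝ) ^ 2 / p) ^ d := by
    refine Finset.sum_congr rfl fun e he => ?_
    have : (ap e e : ℝ) ^ 2 = (t e : ℝ) ^ 2 := by exact_mod_cast h₂ p k2 t ht e he
    rw [this]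
  rwa [e1]

section
variable {p : ℕ} [hp : Fact p.Prime]

open Classical in
/-- The even power of the trace at smooth pairs, extended by zero. -/
noncomputable def apw (p : ℕ) [hp : Fact p.Prime] (d : ℕ) (α β : ZMod p) : ℝ :=
  if 4 * α ^ 3 + 27 * β ^ 2 ≠ 0 then (ap α β : ℝ) ^ (2 * d) else 0

theorem apw_twist (hp5 : 5 ≤ p) (d : ℕ) {u : ZMod p} (hu : u ≠ 0) (α β : ZMod p) :
    apw p d (u ^ 2 * α) (u ^ 3 * β) = apw p d α β := by
  have h1 : 4 * (u ^ 2 * α) ^ 3 + 27 * (u ^ 3 * β) ^ 2 = u ^ 6 * (4 * α ^ 3 + 27 * β ^ 2) := by ring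
  have h2 : (ap (u ^ 2 * α) (u ^ 3 * β) : ℝ) ^ 2 = (ap α β : ℝ) ^ 2 := by
    exact_mod_cast ap_twist_sq hp5 hu α β
  simp only [apw, h1, mul_ne_zero_iff, ne_eq, pow_ne_zero 6 hu, not_false_eq_true, true_and, pow_mul, h2]

theorem apw_nonneg (d : ℕ) (α β : ZMod p) : 0 ≤ apw p d α β := by
  rw [apw]
  split_ifs
  · rw [pow_mul]; positivity
  · exact le_rfl

theorem apw_le {d : ℕ} {α β : ZMod p} (h : 4 * α ^ 3 + 27 * β ^ 2 ≠ 0 → ap α β ^ 2 ≤ 12 * (p : ℤ)) :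
    apw p d α β ≤ (12 * (p : ℝ)) ^ d := by
  rw [apw]
  split_ifs with h0
  · have : (ap α β : ℝ) ^ 2 ≤ 12 * p := by exact_mod_cast h h0
    rw [pow_mul]
    exact pow_le_pow_left₀ (sq_nonneg _) this d
  · positivity

theorem sum_apw_diag (d : ℕ) :
    ∑ c ∈ Finset.univ.erase (0 : ZMod p), apw p d c c = ∑ e ∈ EE p, (ap e e : ℝ) ^ (2 * d) := by
  classical
  rw [EE, ← Finset.filter_filter, Finset.sum_filter]
  have h1 : (Finset.univ.filter fun e : ZMod p => e ≠ 0) = Finset.univ.erase 0 := by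
    ext e; simp
  rw [h1]
  refine Finset.sum_congr rfl fun c hc => ?_
  have hc0 := (Finset.mem_erase.mp hc).1
  have h2 : 4 * c ^ 3 + 27 * c ^ 2 = c ^ 2 * (4 * c + 27) := by ring
  simp only [apw, h2, mul_ne_zero_iff, ne_eq, pow_ne_zero 2 hc0, not_false_eq_true, true_and]

theorem sum_apw_bounds (hp5 : 5 ≤ p) (d : ℕ) :
    ((p : ℝ) - 1) * ∑ e ∈ EE p, (ap e e : ℝ) ^ (2 * d) ≤ ∑ α : ZMod p, ∑ β : ZMod p, apw p d α β ∧
    ∑ α : ZMod p, ∑ β : ZMod p, apw p d α β ≤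
      ((p : ℝ) - 1) * ∑ e ∈ EE p, (ap e e : ℝ) ^ (2 * d) + 2 * p * (12 * (p : ℝ)) ^ d := by
  classical
  have h1 := sum_pairs (p := p) (apw p d) (fun u hu α β => apw_twist hp5 d hu α β)
  rw [sum_apw_diag] at h1
  have hz : ∑ β : ZMod p, apw p d 0 β ≤ p * (12 * (p : ℝ)) ^ d := by
    have := Finset.sum_le_card_nsmul Finset.univ (fun β : ZMod p => apw p d 0 β) ((12 * (p : ℝ)) ^ d)
      fun β _ => apw_le fun h => ap_zero_left_sq_le hp5 (by rintro rfl; simp at h)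
    rwa [Finset.card_univ, ZMod.card, nsmul_eq_mul] at this
  have hz' : ∑ α ∈ Finset.univ.erase (0 : ZMod p), apw p d α 0 ≤ p * (12 * (p : ℝ)) ^ d := by
    have := Finset.sum_le_card_nsmul Finset.univ (fun α : ZMod p => apw p d α 0) ((12 * (p : ℝ)) ^ d)
      fun α _ => apw_le fun h => ap_zero_right_sq_le hp5 (by rintro rfl; simp at h)
    rw [Finset.card_univ, ZMod.card, nsmul_eq_mul] at this
    exact (Finset.sum_le_sum_of_subset_of_nonneg (Finset.erase_subset _ _)
      fun _ _ _ => apw_nonneg _ _ _).trans this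
  have hz0 : 0 ≤ ∑ β : ZMod p, apw p d 0 β := Finset.sum_nonneg fun _ _ => apw_nonneg _ _ _
  have hz0' : 0 ≤ ∑ α ∈ Finset.univ.erase (0 : ZMod p), apw p d α 0 :=
    Finset.sum_nonneg fun _ _ => apw_nonneg _ _ _
  have h2 : ∑ α : ZMod p, ∑ β : ZMod p, apw p d α β = ∑ β : ZMod p, apw p d 0 β +
      (∑ α ∈ Finset.univ.erase (0 : ZMod p), apw p d α 0 +
        ∑ α ∈ Finset.univ.erase (0 : ZMod p), ∑ β ∈ Finset.univ.erase (0 : ZMod p), apw p d α β) := by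
    rw [← Finset.add_sum_erase _ _ (Finset.mem_univ (0 : ZMod p)), ← Finset.sum_add_distrib]
    congr 1
    refine Finset.sum_congr rfl fun α _ => ?_
    rw [← Finset.add_sum_erase _ _ (Finset.mem_univ (0 : ZMod p))]
  rw [h1] at h2
  constructor <;> linarith

theorem sum_range_eq (f : ZMod p → ℝ) : ∑ a ∈ Finset.range p, f (a : ZMod p) = ∑ α : ZMod p, f α := by
  refine Finset.sum_bij (fun a _ => (a : ZMod p)) (fun _ _ => Finset.mem_univ _) ?_ ?_ fun _ _ => rfl
  · intro a ha b hb h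
    rw [ZMod.natCast_eq_natCast_iff'] at h
    rwa [Nat.mod_eq_of_lt (Finset.mem_range.mp ha), Nat.mod_eq_of_lt (Finset.mem_range.mp hb)] at h
  · intro α _
    exact ⟨α.val, Finset.mem_range.mpr α.val_lt, by rw [ZMod.natCast_val, ZMod.cast_id]⟩

end

theorem exists_abs_moment_sub_le (d : ℕ) {ε : ℝ} (hε : 0 < ε) :
    ∃ p₀ : ℕ, ∀ p, p₀ ≤ p → ∀ [Fact p.Prime],
      |(1 / (((p : ℝ) ^ 2 - (p : ℝ)) * (p : ℝ) ^ d)) * (∑ α : ZMod p, ∑ β : ZMod p, apw p d α β) -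
        catalan d| ≤ ε := by
  obtain ⟨p₁, h₁⟩ := exists_abs_sum_ap_sub_le d (half_pos hε)
  obtain ⟨p₂, h₂⟩ := exists_nat_ge (4 * 12 ^ d / ε + 1)
  refine ⟨max p₁ (max p₂ 5), fun p hpp hp => ?_⟩
  simp only [max_le_iff] at hpp
  obtain ⟨k1, k2, k5⟩ := hpp
  have h5 : (5 : ℝ) ≤ p := by exact_mod_cast k5
  have hp0 : (0 : ℝ) < p := by linarith
  have hp1 : (0 : ℝ) < p - 1 := by linarith
  have h := h₁ p k1
  obtain ⟨b1, b2⟩ := sum_apw_bounds k5 d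
  have e1 : ∑ e ∈ EE p, (ap e e : ℝ) ^ (2 * d) = (p : ℝ) ^ d * ∑ e ∈ EE p, ((ap e e : ℝ) ^ 2 / p) ^ d := by
    rw [Finset.mul_sum]
    refine Finset.sum_congr rfl fun e _ => ?_
    rw [div_pow, pow_mul]
    field_simp
  rw [e1] at b1 b2
  set T := ∑ e ∈ EE p, ((ap e e : ℝ) ^ 2 / p) ^ d
  set S := ∑ α : ZMod p, ∑ β : ZMod p, apw p d α β
  have h12 : 2 * (12 : ℝ) ^ d ≤ (p - 1) * (ε / 2) := by
    have : (p₂ : ℝ) ≤ p := by exact_mod_cast k2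
    have : 4 * 12 ^ d / ε ≤ (p : ℝ) - 1 := by linarith
    rw [div_le_iff₀ hε] at this
    linarith
  have hq : (0 : ℝ) < ((p : ℝ) ^ 2 - p) * p ^ d := by
    have : (p : ℝ) ^ 2 - p = p * (p - 1) := by ring
    rw [this]
    positivity
  obtain ⟨h3, h4⟩ := abs_le.mp h
  have m1 := mul_le_mul_of_nonneg_left h3 (by positivity : 0 ≤ ((p : ℝ) - 1) * p ^ d)
  have m2 := mul_le_mul_of_nonneg_left h4 (by positivity : 0 ≤ ((p : ℝ) - 1) * p ^ d)
  have m3 := mul_le_mul_of_nonneg_left h12 (by positivity : 0 ≤ (p : ℝ) * p ^ d)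
  have m4 : 0 ≤ ((p : ℝ) ^ 2 - p) * p ^ d * (ε / 2) := by positivity
  rw [mul_pow] at b2
  rw [one_div_mul_eq_div, abs_le, neg_le_sub_iff_le_add, sub_le_iff_le_add, div_le_iff₀ hq,
    ← sub_le_iff_le_add, le_div_iff₀ hq]
  constructor <;> nlinarith

end Birch

end

/-- For every positive integer `d`, the normalized moment
`(1/((p² - p)·p^d)) · Σ a_p(A,B)^(2d)`, the sum ranging over all pairs
`(A,B) ∈ (ℤ/pℤ)²` with `4A³ + 27B² ≠ 0`, tends to the Catalan number
`(2d)!/(d!·(d+1)!)` as `p` tends to infinity through the primes.  Here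
`a_p(A,B) = p - #{(x,y) ∈ (ℤ/pℤ)² : y² = x³ + Ax + B}`. -/
theorem birch_moments_limit (d : ℕ) (hd : 0 < d) :
    Filter.Tendsto
      (fun p : ℕ =>
        (1 / (((p : ℝ) ^ 2 - (p : ℝ)) * (p : ℝ) ^ d)) *
          ∑ AB ∈ (Finset.range p ×ˢ Finset.range p).filter
              (fun AB : ℕ × ℕ =>
                4 * (AB.1 : ZMod p) ^ 3 + 27 * (AB.2 : ZMod p) ^ 2 ≠ 0),
            (((p : ℤ) -
              (Nat.card {xy : ZMod p × ZMod p //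
                xy.2 ^ 2 = xy.1 ^ 3 + (AB.1 : ZMod p) * xy.1 + (AB.2 : ZMod p)} : ℤ)
              : ℝ)) ^ (2 * d))
      (Filter.atTop ⊓ Filter.principal {p : ℕ | p.Prime})
      (nhds (((2 * d).factorial : ℝ) / ((d.factorial : ℝ) * ((d + 1).factorial : ℝ)))) := by
  rw [← Birch.catalan_eq_factorial, Metric.tendsto_nhds]
  intro ε hε
  obtain ⟨p₀, h₀⟩ := Birch.exists_abs_moment_sub_le d (half_pos hε)
  rw [Filter.eventually_inf_principal]
  filter_upwards [Filter.eventually_ge_atTop p₀] with p hp hprime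
  have : Fact p.Prime := ⟨hprime⟩
  have h := h₀ p hp
  rw [Real.dist_eq]
  refine lt_of_le_of_lt (le_of_eq ?_) (lt_of_le_of_lt h (half_lt_self hε))
  congr 3
  rw [Finset.sum_filter, Finset.sum_product,
    ← Birch.sum_range_eq (fun α => ∑ β : ZMod p, Birch.apw p d α β)]
  refine Finset.sum_congr rfl fun a _ => ?_
  rw [← Birch.sum_range_eq (fun β => Birch.apw p d (a : ZMod p) β)]
  refine Finset.sum_congr rfl fun b _ => ?_
  simp only [Birch.apw, Birch.ap]
  split_ifs
  · push_cast
    rfl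
  · rfl
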